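/- Let n ≥ 2 and p ≥ p_n. For every ε > 0 there exists a constant C = C(ε, n, p) > 0 such that for every 0 < δ < 1 and every finite direction-separated family 𝕋 of δ-tubes in ℝⁿ, one has ‖Σ_{T∈𝕋} χ_T‖_{L^p(ℝⁿ)} ≤ C · δ^{−(n−1−n/p)−ε} · (Σ_{T∈𝕋} |T|)^{1/p}. -/

import Mathlib

open MeasureTheory Metric InnerProductGeometry
open scoped RealInnerProductSpace ENNReal NNReal

noncomputable section

/-- Euclidean space ℝⁿ. -/
abbrev Esp (n : ℕ) : Type := EuclideanSpace ℝ (Fin n)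

/-- The δ-tube with centre `a` and unit direction `v`. -/
def tube (n : ℕ) (δ : ℝ) (a v : Esp n) : Set (Esp n) :=
  {x | |⟪x - a, v⟫| ≤ 1 / 2 ∧ ‖(x - a) - ⟪x - a, v⟫ • v‖ ≤ δ}

section

/-! ### The Borsuk–Ulam theorem via mod 2 cochains on lists of points -/

namespace BorsukUlam

variable {X : Type*}

/-- Simplicial coboundary modulo two of a cochain on lists of vertices. -/
def cobd : (List X → ZMod 2) → List X → ZMod 2
  | _, [] => 0
  | φ, x :: l => φ l + cobd (fun l' => φ (x :: l')) l

@[simp] lemma cobd_nil (φ : List X → ZMod 2) : cobd φ [] = 0 := rfl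

@[simp] lemma cobd_cons (φ : List X → ZMod 2) (x : X) (l : List X) :
    cobd φ (x :: l) = φ l + cobd (fun l' => φ (x :: l')) l := rfl

lemma cobd_add (φ ψ : List X → ZMod 2) (l : List X) :
    cobd (fun l' => φ l' + ψ l') l = cobd φ l + cobd ψ l := by
  induction l generalizing φ ψ with
  | nil => simp
  | cons x l ih => simp only [cobd_cons, ih]; ring

lemma cobd_cobd (φ : List X → ZMod 2) (l : List X) : cobd (cobd φ) l = 0 := by
  induction l generalizing φ with
  | nil => simp
  | cons x l ih =>
    simp only [cobd_cons, cobd_add, ih, add_zero]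
    exact CharTwo.add_self_eq_zero _

lemma cobd_mul_left (a : ZMod 2) (φ : List X → ZMod 2) (l : List X) :
    cobd (fun l' => a * φ l') l = a * cobd φ l := by
  induction l generalizing φ with
  | nil => simp
  | cons x l ih => simp only [cobd_cons, ih]; ring

lemma cobd_eq_zero {φ : List X → ZMod 2} {l : List X}
    (h : ∀ l', l'.Sublist l → l'.length + 1 = l.length → φ l' = 0) : cobd φ l = 0 := by
  induction l generalizing φ with
  | nil => simp
  | cons x l ih =>
    rw [cobd_cons, h l (List.sublist_cons_self x l) rfl, zero_add]
    refine ih fun l' hl hlen => h _ (List.cons_sublist_cons.2 hl) (by simp [hlen])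

lemma cobd_congr {φ ψ : List X → ZMod 2} {l : List X}
    (h : ∀ l', l'.length + 1 = l.length → φ l' = ψ l') : cobd φ l = cobd ψ l := by
  have h0 : cobd (fun l' => φ l' + ψ l') l = 0 :=
    cobd_eq_zero fun l' _ hlen => by rw [h l' hlen]; exact CharTwo.add_self_eq_zero _
  rw [cobd_add] at h0
  exact CharTwo.add_eq_zero.1 h0

lemma cobd_map (ν : X → X) (φ : List X → ZMod 2) (l : List X) :
    cobd (fun l' => φ (l'.map ν)) l = cobd φ (l.map ν) := by
  induction l generalizing φ with
  | nil => simp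
  | cons x l ih =>
    simp only [cobd_cons, List.map_cons]
    rw [← ih]

/-- Pull-back of cochains under barycentric subdivision, with barycentre map `b`. -/
def subdiv (b : List X → X) : ℕ → (List X → ZMod 2) → List X → ZMod 2
  | 0, φ, l => φ l
  | k + 1, φ, l => cobd (fun l' => subdiv b k (fun l'' => φ (b l :: l'')) l') l

lemma subdiv_add (b : List X → X) (k : ℕ) (φ ψ : List X → ZMod 2) (l : List X) :
    subdiv b k (fun l' => φ l' + ψ l') l = subdiv b k φ l + subdiv b k ψ l := by
  induction k generalizing φ ψ l with
  | zero => rfl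
  | succ k ih => simp only [subdiv, ih, cobd_add]

lemma subdiv_cobd (b : List X → X) (k : ℕ) (φ : List X → ZMod 2) (l : List X)
    (hl : l.length = k + 1) : subdiv b (k + 1) (cobd φ) l = cobd (subdiv b k φ) l := by
  induction k generalizing φ l with
  | zero =>
    obtain ⟨x, rfl⟩ := List.length_eq_one_iff.1 hl
    simp [subdiv]
  | succ k ih =>
    rw [subdiv]
    simp only [cobd_cons, subdiv_add, cobd_add]
    have : cobd (fun l' => subdiv b (k + 1) (cobd fun l'_1 => φ (b l :: l'_1)) l') l
        = cobd (cobd (subdiv b k fun l'_1 => φ (b l :: l'_1))) l :=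
      cobd_congr fun l' hlen => ih _ l' (by omega)
    rw [this, cobd_cobd, add_zero]

lemma subdiv_map (b : List X → X) (ν : X → X) (hb : ∀ l, b (l.map ν) = ν (b l)) (k : ℕ)
    (φ : List X → ZMod 2) (l : List X) :
    subdiv b k (fun l' => φ (l'.map ν)) l = subdiv b k φ (l.map ν) := by
  induction k generalizing φ l with
  | zero => rfl
  | succ k ih =>
    simp only [subdiv, List.map_cons]
    rw [← cobd_map, hb]
    congr 1
    funext l'
    exact ih (fun l'' => φ (ν (b l) :: l'')) l'

/-- Pairing with the fundamental chain of the upper hemisphere of the cross-polytope. -/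
def hemi (ν : X → X) (e : ℕ → X) : ℕ → (List X → ZMod 2) → ZMod 2
  | 0, φ => φ [e 0]
  | i + 1, φ => hemi ν e i (fun l => φ (e (i + 1) :: l)) +
      hemi ν e i (fun l => φ (e (i + 1) :: l.map ν))

lemma hemi_add (ν : X → X) (e : ℕ → X) (i : ℕ) (φ ψ : List X → ZMod 2) :
    hemi ν e i (fun l => φ l + ψ l) = hemi ν e i φ + hemi ν e i ψ := by
  induction i generalizing φ ψ with
  | zero => rfl
  | succ i ih => simp only [hemi, ih]; ring

lemma hemi_eq_zero (ν : X → X) (e : ℕ → X) (hν : Function.Involutive ν) (i : ℕ)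
    {φ : List X → ZMod 2}
    (h : ∀ l : List X, l.length = i + 1 →
      (∃ σ : ℕ → Prop, ∀ x ∈ l, ∃ j ≤ i, (σ j ∧ x = e j) ∨ (¬ σ j ∧ x = ν (e j))) → φ l = 0) :
    hemi ν e i φ = 0 := by
  induction i generalizing φ with
  | zero =>
    exact h _ rfl ⟨fun _ => True, fun x hx => ⟨0, le_rfl, by simpa using hx⟩⟩
  | succ i ih =>
    rw [hemi, ih, ih, add_zero]
    · rintro l hl ⟨σ, hσ⟩
      refine h _ (by simp [hl]) ⟨fun j => j = i + 1 ∨ (j ≠ i + 1 ∧ ¬ σ j), fun x hx => ?_⟩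
      rcases List.mem_cons.1 hx with rfl | hx
      · exact ⟨i + 1, le_rfl, by simp⟩
      · obtain ⟨y, hy, rfl⟩ := List.mem_map.1 hx
        obtain ⟨j, hj, hj'⟩ := hσ y hy
        refine ⟨j, by omega, ?_⟩
        have : j ≠ i + 1 := by omega
        rcases hj' with ⟨h1, rfl⟩ | ⟨h1, rfl⟩
        · right; simp [this, h1]
        · left; simp [this, h1, hν (e j)]
    · rintro l hl ⟨σ, hσ⟩
      refine h _ (by simp [hl]) ⟨fun j => j = i + 1 ∨ (j ≠ i + 1 ∧ σ j), fun x hx => ?_⟩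
      rcases List.mem_cons.1 hx with rfl | hx
      · exact ⟨i + 1, le_rfl, by simp⟩
      · obtain ⟨j, hj, hj'⟩ := hσ x hx
        refine ⟨j, by omega, ?_⟩
        have : j ≠ i + 1 := by omega
        simpa [this] using hj'

lemma hemi_congr (ν : X → X) (e : ℕ → X) (i : ℕ) {φ ψ : List X → ZMod 2}
    (h : ∀ l : List X, l.length = i + 1 → φ l = ψ l) : hemi ν e i φ = hemi ν e i ψ := by
  induction i generalizing φ ψ with
  | zero => exact h _ rfl
  | succ i ih =>
    exact congrArg₂ (· + ·) (ih fun l hl => h _ (by simp [hl])) (ih fun l hl => h _ (by simp [hl]))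

lemma hemi_cobd (ν : X → X) (hν : Function.Involutive ν) (e : ℕ → X) (i : ℕ)
    (φ : List X → ZMod 2) :
    hemi ν e (i + 1) (cobd φ) = hemi ν e i φ + hemi ν e i (fun l => φ (l.map ν)) := by
  induction i generalizing φ with
  | zero =>
    simp only [hemi, cobd_cons, List.map_cons, List.map_nil, cobd_nil, add_zero]
    linear_combination CharTwo.add_self_eq_zero (φ [e 1])
  | succ i ih =>
    rw [hemi]
    simp only [cobd_cons, hemi_add]
    rw [ih]
    have h1 : hemi ν e (i + 1) (fun l => cobd (fun l' => φ (e (i + 1 + 1) :: l')) (l.map ν))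
        = hemi ν e (i + 1) (cobd fun l => φ (e (i + 1 + 1) :: l.map ν)) := by
      congr 1
      funext l
      rw [← cobd_map ν (fun l' => φ (e (i + 1 + 1) :: l'))]
    rw [h1, ih]
    have h2 : ∀ l : List X, (l.map ν).map ν = l := fun l => by
      rw [List.map_map, hν.comp_self, List.map_id]
    simp only [h2]
    linear_combination
      CharTwo.add_self_eq_zero (hemi ν e i fun l => φ (e (i + 1 + 1) :: l)) +
      CharTwo.add_self_eq_zero (hemi ν e i fun l => φ (e (i + 1 + 1) :: l.map ν))

/-- Cup product of the coboundaries of a list of `0`-cochains. -/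
def cupCobd : List (X → ZMod 2) → List X → ZMod 2
  | [], [_] => 1
  | s :: ss, x :: y :: l => (s x + s y) * cupCobd ss (y :: l)
  | _, _ => 0

/-- Cup product of a `0`-cochain with a product of coboundaries. -/
def cupHead (s : X → ZMod 2) (ss : List (X → ZMod 2)) (l : List X) : ZMod 2 :=
  (l.head?.elim 0 s) * cupCobd ss l

lemma cobd_cupHead_of_cocycle (s : X → ZMod 2) (ss : List (X → ZMod 2)) (l : List X)
    (hl : l.length = ss.length + 2) (hc : cobd (cupCobd ss) l = 0) :
    cobd (cupHead s ss) l = cupCobd (s :: ss) l := by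
  match l, hl with
  | x :: y :: l, hl =>
    rw [cobd_cons] at hc ⊢
    have h1 : cobd (fun l' => cupHead s ss (x :: l')) (y :: l)
        = s x * cobd (fun l' => cupCobd ss (x :: l')) (y :: l) := by
      rw [← cobd_mul_left]; rfl
    rw [h1, ← CharTwo.add_eq_zero.1 hc]
    simp only [cupHead, cupCobd, List.head?_cons, Option.elim]
    ring

lemma cobd_cupCobd (ss : List (X → ZMod 2)) (l : List X) (hl : l.length = ss.length + 2) :
    cobd (cupCobd ss) l = 0 := by
  induction ss generalizing l with
  | nil =>
    match l, hl with
    | [x, y], _ => simp [cupCobd]; exact CharTwo.add_self_eq_zero _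
  | cons s ss ih =>
    have : cobd (cupCobd (s :: ss)) l = cobd (cobd (cupHead s ss)) l :=
      cobd_congr fun l' hlen => by
        have hl' : l'.length = ss.length + 2 := by simp at hl; omega
        exact (cobd_cupHead_of_cocycle s ss l' hl' (ih l' hl')).symm
    rw [this, cobd_cobd]

lemma cobd_cupHead (s : X → ZMod 2) (ss : List (X → ZMod 2)) (l : List X)
    (hl : l.length = ss.length + 2) : cobd (cupHead s ss) l = cupCobd (s :: ss) l :=
  cobd_cupHead_of_cocycle s ss l hl (cobd_cupCobd ss l hl)

lemma cupCobd_eq_zero {ss : List (X → ZMod 2)} {l : List X}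
    (h : ∃ s ∈ ss, ∀ x ∈ l, ∀ y ∈ l, s x = s y) : cupCobd ss l = 0 := by
  induction ss generalizing l with
  | nil => simp at h
  | cons s ss ih =>
    match l with
    | [] => rfl
    | [x] => rfl
    | x :: y :: l =>
      obtain ⟨s', hs', hc⟩ := h
      rw [cupCobd]
      rcases List.mem_cons.1 hs' with rfl | hs'
      · rw [hc x (by simp) y (by simp), CharTwo.add_self_eq_zero, zero_mul]
      · rw [ih ⟨s', hs', fun x hx y hy => hc x (List.mem_cons_of_mem _ hx) y
          (List.mem_cons_of_mem _ hy)⟩, mul_zero]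

lemma cupCobd_map (ν : X → X) (G : X → Prop) (ss : List (X → ZMod 2))
    (hs : ∀ s ∈ ss, ∀ x, G x → s x + s (ν x) = 1) (l : List X) (hG : ∀ x ∈ l, G x) :
    cupCobd ss (l.map ν) = cupCobd ss l := by
  induction ss generalizing l with
  | nil => rcases l with _ | ⟨x, _ | ⟨y, l⟩⟩ <;> rfl
  | cons s ss ih =>
    rcases l with _ | ⟨x, _ | ⟨y, l⟩⟩
    · rfl
    · rfl
    · have hx := hs s (by simp) x (hG x (by simp))
      have hy := hs s (by simp) y (hG y (by simp))
      have h := ih (fun s' h' => hs s' (List.mem_cons_of_mem _ h')) (y :: l)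
        (fun z hz => hG z (List.mem_cons_of_mem _ hz))
      simp only [List.map_cons, cupCobd] at h ⊢
      rw [h]
      have e : s (ν x) + s (ν y) = s x + s y := by
        linear_combination hx + hy - CharTwo.add_self_eq_zero (s x)
          - CharTwo.add_self_eq_zero (s y) + CharTwo.add_self_eq_zero (1 : ZMod 2)
      rw [e]

/-- Pairing with the `K`-fold subdivided fundamental chain of the hemisphere. -/
def hemiSub (ν : X → X) (e : ℕ → X) (b : List X → X) (K i : ℕ) (φ : List X → ZMod 2) : ZMod 2 :=
  hemi ν e i ((subdiv b (i + 1))^[K] φ)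

lemma subdiv_iterate_add (b : List X → X) (k K : ℕ) (φ ψ : List X → ZMod 2) :
    (subdiv b k)^[K] (fun l => φ l + ψ l) =
      fun l => (subdiv b k)^[K] φ l + (subdiv b k)^[K] ψ l := by
  induction K generalizing φ ψ with
  | zero => rfl
  | succ K ih =>
    simp only [Function.iterate_succ, Function.comp]
    rw [← ih]
    congr 1
    funext l
    exact subdiv_add b k φ ψ l

lemma hemiSub_add (ν : X → X) (e : ℕ → X) (b : List X → X) (K i : ℕ) (φ ψ : List X → ZMod 2) :
    hemiSub ν e b K i (fun l => φ l + ψ l) = hemiSub ν e b K i φ + hemiSub ν e b K i ψ := by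
  rw [hemiSub, subdiv_iterate_add, hemi_add]; rfl

lemma subdiv_congr (b : List X → X) (k : ℕ) {φ ψ : List X → ZMod 2}
    (h : ∀ l : List X, l.length = k → φ l = ψ l) (l : List X) (hl : l.length = k) :
    subdiv b k φ l = subdiv b k ψ l := by
  induction k generalizing φ ψ l with
  | zero => exact h l hl
  | succ k ih =>
    refine cobd_congr fun l' hl' => ih (fun l'' hl'' => h _ (by simp [hl''])) l' (by omega)

lemma subdiv_iterate_congr (b : List X → X) (k K : ℕ) {φ ψ : List X → ZMod 2}
    (h : ∀ l : List X, l.length = k → φ l = ψ l) (l : List X) (hl : l.length = k) :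
    (subdiv b k)^[K] φ l = (subdiv b k)^[K] ψ l := by
  induction K generalizing φ ψ with
  | zero => exact h l hl
  | succ K ih =>
    exact ih fun l' hl' => subdiv_congr b k h l' hl'

lemma hemiSub_congr (ν : X → X) (e : ℕ → X) (b : List X → X) (K i : ℕ) {φ ψ : List X → ZMod 2}
    (h : ∀ l : List X, l.length = i + 1 → φ l = ψ l) :
    hemiSub ν e b K i φ = hemiSub ν e b K i ψ :=
  hemi_congr ν e i fun l hl => subdiv_iterate_congr b _ K h l hl

lemma subdiv_iterate_cobd (b : List X → X) (k K : ℕ) (φ : List X → ZMod 2) (l : List X)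
    (hl : l.length = k + 1) :
    (subdiv b (k + 1))^[K] (cobd φ) l = cobd ((subdiv b k)^[K] φ) l := by
  induction K generalizing φ with
  | zero => rfl
  | succ K ih =>
    rw [Function.iterate_succ_apply, Function.iterate_succ_apply, ← ih]
    exact subdiv_iterate_congr b _ K (fun l' hl' => subdiv_cobd b k φ l' hl') l hl

lemma subdiv_iterate_map (b : List X → X) (ν : X → X) (hb : ∀ l, b (l.map ν) = ν (b l)) (k K : ℕ)
    (φ : List X → ZMod 2) :
    (subdiv b k)^[K] (fun l' => φ (l'.map ν)) = fun l => (subdiv b k)^[K] φ (l.map ν) := by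
  induction K generalizing φ with
  | zero => rfl
  | succ K ih =>
    rw [Function.iterate_succ_apply, Function.iterate_succ_apply, ← ih]
    congr 1
    funext l
    exact subdiv_map b ν hb k φ l

lemma hemiSub_cobd (ν : X → X) (hν : Function.Involutive ν) (e : ℕ → X) (b : List X → X)
    (hb : ∀ l, b (l.map ν) = ν (b l)) (K i : ℕ) (φ : List X → ZMod 2) :
    hemiSub ν e b K (i + 1) (cobd φ) =
      hemiSub ν e b K i φ + hemiSub ν e b K i (fun l => φ (l.map ν)) := by
  rw [hemiSub, hemi_congr ν e (i + 1) (fun l hl => subdiv_iterate_cobd b (i + 1) K φ l hl),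
    hemi_cobd ν hν]
  simp only [hemiSub, subdiv_iterate_map b ν hb]

/-- The combinatorial heart: a product of coboundaries of odd sign functions is detected by the
hemisphere chain. -/
lemma hemiSub_cupCobd (ν : X → X) (hν : Function.Involutive ν) (e : ℕ → X) (b : List X → X)
    (hb : ∀ l, b (l.map ν) = ν (b l)) (K : ℕ) (G : X → Prop)
    {n : ℕ} (hG : ∀ i ≤ n, ∀ φ, (∀ l : List X, l.length = i + 1 → (∀ x ∈ l, G x) → φ l = 0) →
      hemiSub ν e b K i φ = 0)
    (ss : List (X → ZMod 2)) (hn : ss.length ≤ n) (hs : ∀ s ∈ ss, ∀ x, G x → s x + s (ν x) = 1) :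
    hemiSub ν e b K ss.length (cupCobd ss) = 1 := by
  induction ss with
  | nil =>
    clear hG hs
    have key : ∀ x, (subdiv b 1)^[K] (cupCobd []) [x] = 1 := by
      induction K with
      | zero => intro x; rfl
      | succ K ih =>
        intro x
        rw [Function.iterate_succ_apply, subdiv_iterate_congr b 1 K (ψ := cupCobd []) _ _ rfl]
        · exact ih x
        · intro l hl
          obtain ⟨y, rfl⟩ := List.length_eq_one_iff.1 hl
          simp [subdiv, cupCobd]
    exact key _
  | cons s ss ih =>
    have h1 : hemiSub ν e b K (ss.length + 1) (cupCobd (s :: ss)) =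
        hemiSub ν e b K (ss.length + 1) (cobd (cupHead s ss)) :=
      hemiSub_congr ν e b K _ fun l hl => (cobd_cupHead s ss l (by omega)).symm
    rw [List.length_cons, h1, hemiSub_cobd ν hν e b hb, ← hemiSub_add,
      ← ih (by simp at hn; omega) fun s' h' => hs s' (List.mem_cons_of_mem _ h')]
    refine CharTwo.add_eq_zero.1 ?_
    rw [← hemiSub_add]
    refine hG _ (by simp at hn; omega) _ fun l hl hGl => ?_
    have h2 := cupCobd_map ν G ss (fun s' h' => hs s' (List.mem_cons_of_mem _ h')) l hGl
    rcases l with _ | ⟨x, l⟩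
    · simp at hl
    · have hx := hs s (by simp) x (hGl x (by simp))
      simp only [cupHead, List.map_cons, List.head?_cons, Option.elim] at h2 ⊢
      rw [h2]
      linear_combination (cupCobd ss (x :: l)) * hx +
        CharTwo.add_self_eq_zero (cupCobd ss (x :: l))


section Geometry

variable {E : Type*} [NormedAddCommGroup E] [NormedSpace ℝ E]

/-- The barycentre of a list of points. -/
noncomputable def bary (l : List E) : E := (l.length : ℝ)⁻¹ • l.sum

lemma bary_map_neg (l : List E) : bary (l.map fun x => -x) = -bary l := by
  simp only [bary, List.length_map]
  rw [← smul_neg]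
  congr 1
  induction l with
  | nil => simp
  | cons x l ih => simp only [List.map_cons, List.sum_cons, ih]; abel

lemma bary_mem {K : Set E} (hK : Convex ℝ K) {l : List E} (hl : l ≠ []) (h : ∀ x ∈ l, x ∈ K) :
    bary l ∈ K := by
  have hlen : 0 < l.length := List.length_pos_iff.2 hl
  have h1 : bary l = ∑ i : Fin l.length, (l.length : ℝ)⁻¹ • l.get i := by
    rw [← Finset.smul_sum, bary]
    congr 1
    conv_lhs => rw [← List.ofFn_get l]
    rw [List.sum_ofFn]
  rw [h1]
  refine hK.sum_mem (fun _ _ => by positivity) ?_ fun i _ => h _ (List.get_mem l i)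
  simp [hlen.ne']

lemma norm_bary_sub_le {l : List E} {d : ℝ} {y : E} (hy : y ∈ l)
    (hd : ∀ x ∈ l, ‖x - y‖ ≤ d) : ‖bary l - y‖ ≤ (((l.length : ℝ) - 1) / l.length) * d := by
  classical
  have hlen : 0 < l.length := List.length_pos_of_mem hy
  have hlen' : (0 : ℝ) < l.length := by exact_mod_cast hlen
  obtain ⟨i₀, hi₀⟩ := List.get_of_mem hy
  have h1 : bary l - y = (l.length : ℝ)⁻¹ • ∑ i : Fin l.length, (l.get i - y) := by
    rw [Finset.sum_sub_distrib, smul_sub, bary]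
    congr 1
    · congr 1
      conv_lhs => rw [← List.ofFn_get l]
      rw [List.sum_ofFn]
    · simp only [Finset.sum_const, Finset.card_univ, Fintype.card_fin]
      rw [← Nat.cast_smul_eq_nsmul ℝ, smul_smul, inv_mul_cancel₀ hlen'.ne', one_smul]
  rw [h1, norm_smul, norm_inv, Real.norm_natCast, div_mul_eq_mul_div, div_eq_inv_mul]
  refine mul_le_mul_of_nonneg_left ?_ (by positivity)
  rw [← Finset.sum_erase_add _ _ (Finset.mem_univ i₀), hi₀, sub_self, add_zero]
  refine (norm_sum_le _ _).trans ?_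
  refine (Finset.sum_le_card_nsmul _ _ d fun i _ => hd _ (List.get_mem l i)).trans ?_
  rw [Finset.card_erase_of_mem (Finset.mem_univ _), nsmul_eq_mul]
  simp only [Finset.card_univ, Fintype.card_fin]
  rw [Nat.cast_sub (by omega)]
  simp

lemma norm_bary_sub_le_of_mem_convexHull {l : List E} {d : ℝ} {y : E}
    (hy : y ∈ convexHull ℝ {x | x ∈ l}) (hd : ∀ x ∈ l, ∀ y ∈ l, ‖x - y‖ ≤ d) :
    ‖bary l - y‖ ≤ (((l.length : ℝ) - 1) / l.length) * d := by
  have h : {x | x ∈ l} ⊆ Metric.closedBall (bary l) ((((l.length : ℝ) - 1) / l.length) * d) := by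
    intro x hx
    rw [mem_closedBall_iff_norm, norm_sub_rev]
    exact norm_bary_sub_le hx fun z hz => hd z hz x hx
  have := convexHull_min h (convex_closedBall _ _) hy
  rwa [mem_closedBall_iff_norm, norm_sub_rev] at this

lemma subdiv_bary_eq_zero {N : ℕ} {d : ℝ} (hd0 : 0 ≤ d) (k : ℕ) (hk : k ≤ N + 1)
    {φ : List E → ZMod 2} {l : List E} (hl : l.length = k) (hd : ∀ x ∈ l, ∀ y ∈ l, ‖x - y‖ ≤ d)
    (h : ∀ l' : List E, l'.length = k → (∀ x ∈ l', x ∈ convexHull ℝ {x | x ∈ l}) →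
      (∀ x ∈ l', ∀ y ∈ l', ‖x - y‖ ≤ (N : ℝ) / (N + 1) * d) → φ l' = 0) :
    subdiv bary k φ l = 0 := by
  induction k generalizing φ l with
  | zero =>
    have : l = [] := List.length_eq_zero_iff.1 hl
    subst this
    exact h [] rfl (by simp) (by simp)
  | succ k ih =>
    refine cobd_eq_zero fun l' hsub hlen => ?_
    refine ih (by omega) (by omega)
      (fun x hx y hy => hd x (hsub.subset hx) y (hsub.subset hy)) ?_
    intro l'' hl'' hconv hsmall
    have hmono : convexHull ℝ {x | x ∈ l'} ⊆ convexHull ℝ {x | x ∈ l} :=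
      convexHull_mono fun x hx => hsub.subset hx
    have hne : l ≠ [] := by rintro rfl; simp at hl
    have hb : ∀ y ∈ convexHull ℝ {x | x ∈ l}, ‖bary l - y‖ ≤ (N : ℝ) / (N + 1) * d := by
      intro y hy
      refine (norm_bary_sub_le_of_mem_convexHull hy hd).trans ?_
      refine mul_le_mul_of_nonneg_right ?_ hd0
      rw [hl]
      push_cast
      have hkN : (k : ℝ) ≤ N := by exact_mod_cast (by omega : k ≤ N)
      rw [add_sub_cancel_right, div_le_div_iff₀ (by positivity) (by positivity)]
      nlinarith
    refine h _ (by simp [hl'']) ?_ ?_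
    · intro x hx
      rcases List.mem_cons.1 hx with rfl | hx
      · exact bary_mem (convex_convexHull ℝ _) hne fun x hx => subset_convexHull ℝ _ hx
      · exact hmono (hconv x hx)
    · intro x hx y hy
      rcases List.mem_cons.1 hx with rfl | hx
      · rcases List.mem_cons.1 hy with rfl | hy
        · rw [sub_self, norm_zero]; positivity
        · exact hb y (hmono (hconv y hy))
      · rcases List.mem_cons.1 hy with rfl | hy
        · rw [norm_sub_rev]; exact hb x (hmono (hconv x hx))
        · exact hsmall x hx y hy

lemma subdiv_bary_iterate_eq_zero {N : ℕ} {d : ℝ} (hd0 : 0 ≤ d) {K : ℕ} {k : ℕ} (hk : k ≤ N + 1)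
    {S : Set E} (hS : Convex ℝ S)
    {φ : List E → ZMod 2} {l : List E} (hl : l.length = k) (hd : ∀ x ∈ l, ∀ y ∈ l, ‖x - y‖ ≤ d)
    (hlS : ∀ x ∈ l, x ∈ S)
    (h : ∀ l' : List E, l'.length = k → (∀ x ∈ l', x ∈ S) →
      (∀ x ∈ l', ∀ y ∈ l', ‖x - y‖ ≤ ((N : ℝ) / (N + 1)) ^ K * d) → φ l' = 0) :
    (subdiv bary k)^[K] φ l = 0 := by
  induction K generalizing φ l d with
  | zero => exact h l hl hlS (by simpa using hd)
  | succ K ih =>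
    rw [Function.iterate_succ_apply']
    refine subdiv_bary_eq_zero hd0 k hk hl hd fun l' hl' hconv hsmall => ?_
    refine ih (d := (N : ℝ) / (N + 1) * d) (by positivity) hl' hsmall
      (fun x hx => convexHull_min hlS hS (hconv x hx)) ?_
    intro l'' h1 h2 h3
    refine h l'' h1 h2 fun x hx y hy => (h3 x hx y hy).trans (le_of_eq ?_)
    ring

/-- The face of the cross-polytope with sign pattern `σ`. -/
def signFace (N : ℕ) (σ : Fin (N + 1) → ℝ) : Set (Fin (N + 1) → ℝ) :=
  {x | (∀ i, 0 ≤ σ i * x i) ∧ ∑ i, σ i * x i = 1}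

lemma convex_signFace (N : ℕ) (σ : Fin (N + 1) → ℝ) : Convex ℝ (signFace N σ) := by
  rintro x ⟨hx, hx1⟩ y ⟨hy, hy1⟩ a b ha hb hab
  refine ⟨fun i => ?_, ?_⟩
  · have := add_nonneg (mul_nonneg ha (hx i)) (mul_nonneg hb (hy i))
    simp only [Pi.add_apply, Pi.smul_apply, smul_eq_mul]
    linarith
  · have : ∑ i, σ i * (a • x + b • y) i = a * ∑ i, σ i * x i + b * ∑ i, σ i * y i := by
      rw [Finset.mul_sum, Finset.mul_sum, ← Finset.sum_add_distrib]
      refine Finset.sum_congr rfl fun i _ => ?_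
      simp only [Pi.add_apply, Pi.smul_apply, smul_eq_mul]
      ring
    rw [this, hx1, hy1]
    linarith

lemma ne_zero_of_mem_signFace {N : ℕ} {σ : Fin (N + 1) → ℝ} {x : Fin (N + 1) → ℝ}
    (hx : x ∈ signFace N σ) : x ≠ 0 := by
  rintro rfl
  simpa [signFace] using hx.2

/-- Vertices of the cross-polytope. -/
noncomputable def vertex (N : ℕ) (i : ℕ) : Fin (N + 1) → ℝ := fun j => if (j : ℕ) = i then 1 else 0

lemma hemiSub_vertex_eq_zero {N K i : ℕ} (hi : i ≤ N) {φ : List (Fin (N + 1) → ℝ) → ZMod 2}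
    (h : ∀ l : List (Fin (N + 1) → ℝ), l.length = i + 1 →
      (∃ σ : Fin (N + 1) → ℝ, (∀ j, |σ j| = 1) ∧ ∀ x ∈ l, x ∈ signFace N σ) →
      (∀ x ∈ l, ∀ y ∈ l, ‖x - y‖ ≤ ((N : ℝ) / (N + 1)) ^ K * 2) → φ l = 0) :
    hemiSub (fun x => -x) (vertex N) bary K i φ = 0 := by
  classical
  refine hemi_eq_zero _ _ neg_involutive i fun l hl ⟨σ, hσ⟩ => ?_
  set τ : Fin (N + 1) → ℝ := fun j => if σ j then 1 else -1 with hτ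
  have hnorm : ∀ j ≤ N, ‖vertex N j‖ ≤ 1 := fun j _ => by
    refine (pi_norm_le_iff_of_nonneg zero_le_one).2 fun m => ?_
    simp only [vertex]
    split_ifs <;> simp
  have hnorm' : ∀ x ∈ l, ‖x‖ ≤ 1 := fun x hx => by
    obtain ⟨j, hj, ⟨_, rfl⟩ | ⟨_, rfl⟩⟩ := hσ x hx
    · exact hnorm j (hj.trans hi)
    · rw [norm_neg]; exact hnorm j (hj.trans hi)
  have hmem : ∀ x ∈ l, x ∈ signFace N τ := fun x hx => by
    obtain ⟨j, hj, hj'⟩ := hσ x hx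
    have hjN : j < N + 1 := by omega
    have key : ∀ m : Fin (N + 1), τ m * x m = if m = ⟨j, hjN⟩ then 1 else 0 := by
      intro m
      by_cases hm : (m : ℕ) = j
      · have hm' : m = ⟨j, hjN⟩ := Fin.ext hm
        rcases hj' with ⟨h1, rfl⟩ | ⟨h1, rfl⟩
        · simp [hτ, hm', vertex, h1]
        · simp [hτ, hm', vertex, h1]
      · have hm' : m ≠ ⟨j, hjN⟩ := fun h => hm (by rw [h])
        rcases hj' with ⟨h1, rfl⟩ | ⟨h1, rfl⟩
        · simp [hm', vertex, hm]
        · simp [hm', vertex, hm]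
    refine ⟨fun m => ?_, ?_⟩
    · rw [key]; split_ifs <;> norm_num
    · simp [key]
  refine subdiv_bary_iterate_eq_zero (N := N) (d := 2) (by norm_num) (by omega)
    (convex_signFace N τ) hl (fun x hx y hy => ?_) hmem fun l' h1 h2 h3 => ?_
  · exact (norm_sub_le x y).trans (by linarith [hnorm' x hx, hnorm' y hy])
  · exact h l' h1 ⟨τ, fun j => by simp only [hτ]; split_ifs <;> simp, h2⟩ h3

end Geometry

/-- There is an odd choice of sign on nonzero vectors. -/
lemma exists_odd_sign (N : ℕ) : ∃ s : (Fin N → ℝ) → Prop, ∀ x, x ≠ 0 → (s (-x) ↔ ¬ s x) := by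
  refine ⟨fun x => 0 < toLex x, fun x hx => ?_⟩
  have h0 : toLex x ≠ 0 := fun h => hx (by simpa using h)
  have h1 : toLex (-x) = -toLex x := rfl
  change 0 < toLex (-x) ↔ ¬ 0 < toLex x
  rw [h1, Left.neg_pos_iff]
  exact ⟨fun h => lt_asymm h, fun h => (lt_or_gt_of_ne h0).resolve_right h⟩

/-- **Borsuk–Ulam**: an odd continuous map from `ℝ^(N+1) ∖ {0}` to `ℝ^N` has a zero. -/
theorem exists_zero_of_odd (N : ℕ) (f : (Fin (N + 1) → ℝ) → Fin N → ℝ)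
    (hf : ContinuousOn f {0}ᶜ) (hodd : ∀ x, x ≠ 0 → f (-x) = -f x) :
    ∃ x, x ≠ 0 ∧ f x = 0 := by
  classical
  by_contra! hne
  obtain ⟨sgn, hsgn⟩ := exists_odd_sign (N + 1)
  set S : Set (Fin (N + 1) → ℝ) := {x | ∑ i, |x i| = 1} with hS
  have hS0 : S ⊆ {0}ᶜ := by
    rintro x hx rfl
    simp [hS] at hx
  have hcpt : IsCompact S := by
    refine Metric.isCompact_of_isClosed_isBounded
      (isClosed_eq (by fun_prop) continuous_const) ?_
    refine (Metric.isBounded_closedBall (x := 0) (r := 1)).subset fun x hx => ?_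
    rw [mem_closedBall_zero_iff, pi_norm_le_iff_of_nonneg zero_le_one]
    intro i
    rw [Real.norm_eq_abs, ← (show ∑ i, |x i| = 1 from hx)]
    exact Finset.single_le_sum (f := fun i => |x i|) (fun i _ => abs_nonneg _) (Finset.mem_univ i)
  have hfS : ContinuousOn f S := hf.mono hS0
  obtain ⟨c, hc0, hc⟩ : ∃ c > 0, ∀ x ∈ S, c ≤ ‖f x‖ := by
    by_cases hSe : S.Nonempty
    · obtain ⟨x, hx, hmin⟩ := hcpt.exists_isMinOn hSe hfS.norm
      exact ⟨‖f x‖, norm_pos_iff.2 (hne x (hS0 hx)), fun y hy => hmin hy⟩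
    · exact ⟨1, one_pos, fun x hx => (hSe ⟨x, hx⟩).elim⟩
  obtain ⟨ρ, hρ0, hρ⟩ := Metric.uniformContinuousOn_iff.1
    (hcpt.uniformContinuousOn_of_continuous hfS) c hc0
  obtain ⟨K, hK⟩ := exists_pow_lt_of_lt_one (show 0 < ρ / 2 by positivity)
    (show (N : ℝ) / (N + 1) < 1 by rw [div_lt_one (by positivity)]; linarith)
  set e : Fin N → (Fin (N + 1) → ℝ) → ZMod 2 :=
    fun j x => if 0 < f x j ∨ (f x j = 0 ∧ sgn x) then 1 else 0 with he
  have hodd' : ∀ j x, x ≠ 0 → e j x + e j (-x) = 1 := by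
    intro j x hx
    have h1 : f (-x) j = - f x j := by rw [hodd x hx]; rfl
    have h2 := hsgn x hx
    simp only [he, h1, h2]
    rcases lt_trichotomy (f x j) 0 with h | h | h
    · simp [h, h.ne, h.not_gt]
    · by_cases hs : sgn x <;> simp [h, hs]
    · simp [h, h.ne', h.not_gt]
  have hface : ∀ (σ x : Fin (N + 1) → ℝ), (∀ j, |σ j| = 1) → x ∈ signFace N σ → x ∈ S := by
    intro σ x hσ hx
    rw [hS, Set.mem_ofPred_eq, ← hx.2]
    refine Finset.sum_congr rfl fun i _ => ?_
    rw [← abs_of_nonneg (hx.1 i), abs_mul, hσ, one_mul]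
  have hmain := hemiSub_cupCobd (fun x : Fin (N + 1) → ℝ => -x) neg_involutive (vertex N) bary
    bary_map_neg K (fun x => x ≠ 0) (n := N)
    (fun i hi φ hφ => hemiSub_vertex_eq_zero hi fun l hl ⟨σ, _, hl'⟩ _ =>
      hφ l hl fun x hx => ne_zero_of_mem_signFace (hl' x hx))
    (List.ofFn e) (by simp) (fun s hs x hx => by
      obtain ⟨j, rfl⟩ := (List.mem_ofFn' _ _).1 hs
      exact hodd' j x hx)
  rw [List.length_ofFn, hemiSub_vertex_eq_zero le_rfl] at hmain
  · exact zero_ne_one hmain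
  intro l hl ⟨σ, hσ, hlσ⟩ hsmall
  obtain ⟨x₀, hx₀⟩ : ∃ x, x ∈ l := List.exists_mem_of_length_pos (by omega)
  have hclose : ∀ x ∈ l, ∀ y ∈ l, ‖f x - f y‖ < c := fun x hx y hy => by
    rw [← dist_eq_norm]
    refine hρ x (hface σ x hσ (hlσ x hx)) y (hface σ y hσ (hlσ y hy)) ?_
    rw [dist_eq_norm]
    exact (hsmall x hx y hy).trans_lt (by linarith)
  obtain ⟨j, hj⟩ : ∃ j, c ≤ |f x₀ j| := by
    by_contra! h
    exact absurd ((pi_norm_lt_iff hc0).2 h) (not_lt.2 (hc x₀ (hface σ x₀ hσ (hlσ x₀ hx₀))))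
  refine cupCobd_eq_zero ⟨e j, (List.mem_ofFn' _ _).2 ⟨j, rfl⟩, ?_⟩
  have hconst : ∀ x ∈ l, e j x = e j x₀ := fun x hx => by
    have h1 : |f x j - f x₀ j| < c := (norm_le_pi_norm (f x - f x₀) j).trans_lt (hclose x hx x₀ hx₀)
    rw [abs_lt] at h1
    rcases le_abs'.1 hj with h | h
    · have h2 : f x j < 0 := by linarith
      have h3 : f x₀ j < 0 := by linarith
      simp [he, h2.ne, h2.not_gt, h3.ne, h3.not_gt]
    · have h2 : 0 < f x j := by linarith
      have h3 : 0 < f x₀ j := by linarith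
      simp [he, h2, h3]
  intro x hx y hy
  rw [hconst x hx, hconst y hy]

end BorsukUlam

end

section

open MeasureTheory

/-! ### Polynomial partitioning -/

namespace PolyPartition

/-- The zero set of a nonzero polynomial has measure zero. -/
lemma volume_zeroSet_eq_zero {n : ℕ} {P : MvPolynomial (Fin n) ℝ} (hP : P ≠ 0) :
    volume {x : Fin n → ℝ | MvPolynomial.eval x P = 0} = 0 := by
  induction n with
  | zero =>
    have : {x : Fin 0 → ℝ | MvPolynomial.eval x P = 0} = ∅ := by
      ext x
      simp only [Set.mem_ofPred_eq, Set.mem_empty_iff_false, iff_false]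
      intro h
      apply hP
      rw [MvPolynomial.eq_C_of_isEmpty P] at h ⊢
      rw [MvPolynomial.eval_C] at h
      rw [h, map_zero]
    rw [this, measure_empty]
  | succ n ih =>
    set Q := MvPolynomial.finSuccEquiv ℝ n P with hQ
    have hQ0 : Q ≠ 0 := by
      rw [hQ]; exact (map_ne_zero_iff _ (MvPolynomial.finSuccEquiv ℝ n).injective).2 hP
    have hlead := ih (Polynomial.leadingCoeff_ne_zero.2 hQ0)
    have hmp := volume_preserving_piFinSuccAbove (fun _ : Fin (n + 1) => ℝ) 0
    set e := MeasurableEquiv.piFinSuccAbove (fun _ : Fin (n + 1) => ℝ) 0 with he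
    set S : Set (Fin (n + 1) → ℝ) := {x | MvPolynomial.eval x P = 0} with hS
    have hSm : MeasurableSet S :=
      (MvPolynomial.continuous_eval P).measurable (measurableSet_singleton 0)
    have hpre : S = e ⁻¹' (e.symm ⁻¹' S) := by
      ext x; simp
    rw [hpre, hmp.measure_preimage_equiv, Measure.volume_eq_prod,
      Measure.prod_apply_symm (e.symm.measurable hSm)]
    rw [lintegral_eq_zero_iff (measurable_measure_prodMk_right (e.symm.measurable hSm))]
    have hae : ∀ᵐ y : Fin n → ℝ, MvPolynomial.eval y Q.leadingCoeff ≠ 0 := by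
      rw [ae_iff]; simpa using hlead
    filter_upwards [hae] with y hy
    have hsub : (fun x => (x, y)) ⁻¹' (e.symm ⁻¹' S) ⊆
        {x : ℝ | x ∈ (Polynomial.map (MvPolynomial.eval y) Q).roots} := by
      intro x hx
      have h1 : e.symm (x, y) = Fin.cons x y := by
        simp [he, MeasurableEquiv.piFinSuccAbove]; rfl
      have h2 : MvPolynomial.eval (Fin.cons x y : Fin (n + 1) → ℝ) P = 0 := by
        rw [← h1]; exact hx
      rw [MvPolynomial.eval_eq_eval_mv_eval'] at h2
      refine (Polynomial.mem_roots ?_).2 h2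
      intro h0
      apply hy
      have := congrArg (fun p => Polynomial.coeff p Q.natDegree) h0
      simpa [Polynomial.coeff_map] using this
    refine measure_mono_null hsub (Set.Finite.measure_zero ?_ _)
    refine (Polynomial.map (MvPolynomial.eval y) Q).roots.toFinset.finite_toSet.subset ?_
    intro x hx
    rw [Finset.mem_coe, Multiset.mem_toFinset]
    exact hx

/-- Ham sandwich theorem in parametrised form. -/
lemma exists_bisecting {n N : ℕ} (Φ : (Fin (N + 1) → ℝ) →ₗ[ℝ] MvPolynomial (Fin n) ℝ)
    (hΦ : Function.Injective Φ) (μ : Fin N → Measure (Fin n → ℝ)) [∀ j, IsFiniteMeasure (μ j)]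
    (hμ : ∀ j, μ j ≪ volume) :
    ∃ c, c ≠ 0 ∧ ∀ j, μ j {x | 0 < MvPolynomial.eval x (Φ c)} =
      μ j {x | MvPolynomial.eval x (Φ c) < 0} := by
  set g : (Fin (N + 1) → ℝ) → (Fin n → ℝ) → ℝ := fun c x => MvPolynomial.eval x (Φ c) with hg
  have hgx : ∀ c, Continuous (g c) := fun c => MvPolynomial.continuous_eval _
  have hgc : ∀ x, Continuous fun c => g c x := fun x => by
    have : (fun c => g c x) = ((MvPolynomial.aeval x).toLinearMap ∘ₗ Φ : _ →ₗ[ℝ] ℝ) := by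
      ext c
      simp [hg, MvPolynomial.aeval_eq_eval]
    rw [this]
    exact LinearMap.continuous_of_finiteDimensional _
  have hmeas : ∀ c, Measurable fun x => (SignType.sign (g c x) : ℝ) := fun c => by
    have : (fun x => (SignType.sign (g c x) : ℝ)) =
        fun x => if 0 < g c x then 1 else if g c x < 0 then -1 else 0 := by
      funext x
      rw [sign_apply]
      split_ifs <;> simp
    rw [this]
    exact Measurable.ite ((isOpen_lt continuous_const (hgx c)).measurableSet) measurable_const
      (Measurable.ite ((isOpen_lt (hgx c) continuous_const).measurableSet) measurable_const
        measurable_const)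
  have hbd : ∀ c x, ‖(SignType.sign (g c x) : ℝ)‖ ≤ 1 := fun c x => by
    rcases lt_trichotomy (g c x) 0 with h | h | h
    · simp [sign_neg h]
    · simp [h]
    · simp [sign_pos h]
  obtain ⟨c, hc, h0⟩ := BorsukUlam.exists_zero_of_odd N
    (fun c j => ∫ x, (SignType.sign (g c x) : ℝ) ∂(μ j)) (by
      rw [continuousOn_pi]
      intro j c hc
      refine (continuousAt_of_dominated (bound := fun _ => 1)
        (Filter.Eventually.of_forall fun c' => (hmeas c').aestronglyMeasurable)
        (Filter.Eventually.of_forall fun c' => Filter.Eventually.of_forall (hbd c'))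
        (integrable_const _) ?_).continuousWithinAt
      have hne : Φ c ≠ 0 := (map_ne_zero_iff _ hΦ).2 hc
      have hae : ∀ᵐ x ∂(volume : Measure (Fin n → ℝ)), g c x ≠ 0 := by
        rw [ae_iff]; simpa [hg] using volume_zeroSet_eq_zero hne
      filter_upwards [(hμ j).ae_le hae] with x hx
      have h1 : ContinuousAt (fun c => SignType.sign (g c x)) c :=
        ContinuousAt.comp (f := fun c => g c x) (continuousAt_sign_of_ne_zero hx)
          (hgc x).continuousAt
      exact (continuous_of_discreteTopology (f := fun s : SignType =>
          (s : ℝ))).continuousAt.comp h1)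
    (by
      intro c _
      funext j
      rw [Pi.neg_apply, ← integral_neg]
      congr 1
      funext x
      simp [hg, Left.sign_neg])
  refine ⟨c, hc, fun j => ?_⟩
  have hj : ∫ x, (SignType.sign (g c x) : ℝ) ∂(μ j) = 0 := congrFun h0 j
  have hmp : MeasurableSet {x | 0 < g c x} := (isOpen_lt continuous_const (hgx c)).measurableSet
  have hmn : MeasurableSet {x | g c x < 0} := (isOpen_lt (hgx c) continuous_const).measurableSet
  have hdec : (fun x => (SignType.sign (g c x) : ℝ)) =
      fun x => Set.indicator {x | 0 < g c x} (fun _ => (1 : ℝ)) x -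
        Set.indicator {x | g c x < 0} (fun _ => (1 : ℝ)) x := by
    funext x
    rcases lt_trichotomy (g c x) 0 with h | h | h
    · simp [h, sign_neg h, h.not_gt]
    · simp [h]
    · simp [h, sign_pos h, h.not_gt]
  rw [hdec, integral_sub ((integrable_const _).indicator hmp)
    ((integrable_const _).indicator hmn), integral_indicator hmp, integral_indicator hmn] at hj
  simp only [integral_const, smul_eq_mul, mul_one, measureReal_restrict_apply_univ] at hj
  have := sub_eq_zero.1 hj
  rw [measureReal_def, measureReal_def,
    ENNReal.toReal_eq_toReal_iff' (measure_ne_top _ _) (measure_ne_top _ _)] at this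
  exact this

/-- Ham sandwich with polynomials of controlled degree in the variables `J`. -/
lemma exists_polynomial_bisecting {n e : ℕ} {J : Finset (Fin n)} {ι : Type*} [Fintype ι]
    (hcard : Fintype.card ι < (e + 1) ^ J.card)
    (μ : ι → Measure (Fin n → ℝ)) [∀ j, IsFiniteMeasure (μ j)] (hμ : ∀ j, μ j ≪ volume) :
    ∃ P : MvPolynomial (Fin n) ℝ, P ≠ 0 ∧ P.vars ⊆ J ∧ P.totalDegree ≤ J.card * e ∧
      ∀ j, μ j {x | 0 < MvPolynomial.eval x P} = μ j {x | MvPolynomial.eval x P < 0} := by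
  classical
  set N := Fintype.card ι
  have hcard' : Fintype.card (Fin (N + 1)) ≤ Fintype.card (J → Fin (e + 1)) := by
    simp only [Fintype.card_fin, Fintype.card_fun, Fintype.card_coe]
    omega
  obtain ⟨emb⟩ := Function.Embedding.nonempty_of_card_le hcard'
  set ex : Fin (N + 1) → (Fin n →₀ ℕ) := fun i =>
    Finsupp.onFinset J (fun j => if h : j ∈ J then (emb i ⟨j, h⟩ : ℕ) else 0)
      (fun j hj => by by_contra h; simp [h] at hj) with hex
  have hexinj : Function.Injective ex := by
    intro i i' h
    apply emb.injective
    funext ⟨j, hj⟩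
    have := DFunLike.congr_fun h j
    simp only [hex, Finsupp.onFinset_apply, hj, dif_pos] at this
    exact Fin.ext this
  set Φ : (Fin (N + 1) → ℝ) →ₗ[ℝ] MvPolynomial (Fin n) ℝ :=
    Fintype.linearCombination ℝ (fun i => MvPolynomial.monomial (ex i) (1 : ℝ)) with hΦ
  have hΦc : ∀ c, Φ c = ∑ i, MvPolynomial.monomial (ex i) (c i) := fun c => by
    simp [hΦ, Fintype.linearCombination_apply, MvPolynomial.smul_monomial]
  have hinj : Function.Injective Φ := by
    intro c c' h
    funext i
    have := congrArg (MvPolynomial.coeff (ex i)) h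
    simpa [hΦc, MvPolynomial.coeff_sum, MvPolynomial.coeff_monomial, hexinj.eq_iff] using this
  obtain ⟨c, hc, hbis⟩ := exists_bisecting Φ hinj (fun j => μ ((Fintype.equivFin ι).symm j))
    (fun j => hμ _)
  refine ⟨Φ c, (map_ne_zero_iff _ hinj).2 hc, ?_, ?_, fun j => ?_⟩
  · rw [hΦc]
    refine (MvPolynomial.vars_sum_subset _ _).trans ?_
    intro j hj
    obtain ⟨i, _, hi⟩ := Finset.mem_biUnion.1 hj
    by_cases h0 : c i = 0
    · simp [h0] at hi
    · rw [MvPolynomial.vars_monomial h0] at hi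
      exact Finsupp.support_onFinset_subset hi
  · rw [hΦc]
    refine MvPolynomial.totalDegree_finsetSum_le fun i _ => ?_
    refine (MvPolynomial.totalDegree_monomial_le _ _).trans ?_
    rw [Finsupp.sum_of_support_subset _ Finsupp.support_onFinset_subset _ (by simp)]
    refine (Finset.sum_le_card_nsmul _ _ e fun j hj => ?_).trans (by simp)
    simp only [Finsupp.onFinset_apply, hj, dif_pos]
    exact Nat.lt_succ_iff.1 (emb i ⟨j, hj⟩).2
  · have := hbis (Fintype.equivFin ι j)
    simpa using this

/-- The sign cell of a family of polynomials. -/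
def signCell {n t : ℕ} (P : Fin t → MvPolynomial (Fin n) ℝ) (σ : Fin t → Bool) :
    Set (Fin n → ℝ) :=
  {x | ∀ i, if σ i then 0 < MvPolynomial.eval x (P i) else MvPolynomial.eval x (P i) < 0}

lemma measurableSet_signCell {n t : ℕ} (P : Fin t → MvPolynomial (Fin n) ℝ) (σ : Fin t → Bool) :
    MeasurableSet (signCell P σ) := by
  rw [signCell, Set.ofPred_forall]
  refine MeasurableSet.iInter fun i => ?_
  cases σ i
  · simpa using (isOpen_lt (MvPolynomial.continuous_eval (P i)) continuous_const).measurableSet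
  · simpa using (isOpen_lt continuous_const (MvPolynomial.continuous_eval (P i))).measurableSet

lemma exists_partition_aux {n : ℕ} (J : Finset (Fin n)) (hJ : J.Nonempty)
    (μ : Measure (Fin n → ℝ)) [IsFiniteMeasure μ] (hμ : μ ≪ volume) (t : ℕ) :
    ∃ P : Fin t → MvPolynomial (Fin n) ℝ, (∀ i, P i ≠ 0) ∧ (∀ i, (P i).vars ⊆ J) ∧
      (∀ i, (P i).totalDegree ≤ J.card * 2 ^ ((i : ℕ) / J.card + 1)) ∧
      ∀ σ : Fin t → Bool, 2 ^ t * μ (signCell P σ) ≤ μ Set.univ := by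
  induction t with
  | zero =>
    exact ⟨Fin.elim0, fun i => i.elim0, fun i => i.elim0, fun i => i.elim0, fun σ => by
      simpa using measure_mono (Set.subset_univ _)⟩
  | succ t ih =>
    obtain ⟨P, h0, hv, hd, hc⟩ := ih
    have hm : 0 < J.card := hJ.card_pos
    have hcard : Fintype.card (Fin t → Bool) < ((2 ^ (t / J.card + 1) - 1) + 1) ^ J.card := by
      rw [Nat.sub_add_cancel Nat.one_le_two_pow]
      simp only [Fintype.card_fun, Fintype.card_bool, Fintype.card_fin]
      rw [← pow_mul]
      refine Nat.pow_lt_pow_right (by norm_num) ?_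
      have := Nat.div_add_mod t J.card
      have h2 := Nat.mod_lt t hm
      nlinarith
    obtain ⟨Q, hQ0, hQv, hQd, hQ⟩ := exists_polynomial_bisecting hcard
      (fun σ => μ.restrict (signCell P σ))
      (fun σ => (Measure.absolutelyContinuous_of_le Measure.restrict_le_self).trans hμ)
    refine ⟨Fin.snoc P Q, fun i => ?_, fun i => ?_, fun i => ?_, fun σ => ?_⟩
    · refine Fin.lastCases ?_ (fun i => ?_) i <;> simp [hQ0, h0]
    · refine Fin.lastCases ?_ (fun i => ?_) i
      · simpa using hQv
      · simpa using hv i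
    · refine Fin.lastCases ?_ (fun i => ?_) i
      · simpa using hQd.trans (Nat.mul_le_mul_left _ (Nat.sub_le _ _))
      · simpa using hd i
    · have hmp : MeasurableSet {x | 0 < MvPolynomial.eval x Q} :=
        (isOpen_lt continuous_const (MvPolynomial.continuous_eval Q)).measurableSet
      have hmn : MeasurableSet {x | MvPolynomial.eval x Q < 0} :=
        (isOpen_lt (MvPolynomial.continuous_eval Q) continuous_const).measurableSet
      set τ : Fin t → Bool := fun i => σ i.castSucc
      have heq := hQ τ
      rw [Measure.restrict_apply hmp, Measure.restrict_apply hmn] at heq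
      have hsum : μ ({x | 0 < MvPolynomial.eval x Q} ∩ signCell P τ) +
          μ ({x | MvPolynomial.eval x Q < 0} ∩ signCell P τ) ≤ μ (signCell P τ) := by
        rw [← measure_union _ (hmn.inter (measurableSet_signCell P τ))]
        · exact measure_mono (Set.union_subset Set.inter_subset_right Set.inter_subset_right)
        · rw [Set.disjoint_left]
          rintro x ⟨h1, _⟩ ⟨h2, _⟩
          exact lt_asymm (show 0 < MvPolynomial.eval x Q from h1) h2
      have hcell : μ (signCell (Fin.snoc P Q : Fin (t + 1) → MvPolynomial (Fin n) ℝ) σ) * 2 ≤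
          μ (signCell P τ) := by
        refine le_trans ?_ hsum
        rw [mul_two]
        cases hσ : σ (Fin.last t)
        · rw [heq]
          refine add_le_add ?_ ?_ <;>
          · refine measure_mono fun x hx => ⟨?_, fun i => ?_⟩
            · simpa [hσ] using hx (Fin.last t)
            · simpa using hx i.castSucc
        · rw [← heq]
          refine add_le_add ?_ ?_ <;>
          · refine measure_mono fun x hx => ⟨?_, fun i => ?_⟩
            · simpa [hσ] using hx (Fin.last t)
            · simpa using hx i.castSucc
      calc _ = 2 ^ t * (μ (signCell (Fin.snoc P Q : Fin (t + 1) → MvPolynomial (Fin n) ℝ) σ) * 2) :=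
            by rw [pow_succ]; ring
        _ ≤ 2 ^ t * μ (signCell P τ) := by gcongr
        _ ≤ _ := hc τ

/-- **Polynomial partitioning**: `2 ^ (b * |J|)` sign cells of equal mass, cut out by polynomials
in the variables `J` whose product has degree `O(2 ^ b)`. -/
theorem exists_partition {n : ℕ} (J : Finset (Fin n)) (hJ : J.Nonempty)
    (μ : Measure (Fin n → ℝ)) [IsFiniteMeasure μ] (hμ : μ ≪ volume) (b : ℕ) :
    ∃ (t : ℕ) (P : Fin t → MvPolynomial (Fin n) ℝ), (∀ i, P i ≠ 0) ∧ (∏ i, P i).vars ⊆ J ∧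
      (∏ i, P i).totalDegree ≤ 2 * J.card ^ 2 * 2 ^ b ∧
      ∀ σ : Fin t → Bool, (2 ^ b) ^ J.card * μ (signCell P σ) ≤ μ Set.univ := by
  obtain ⟨P, h0, hv, hd, hc⟩ := exists_partition_aux J hJ μ hμ (b * J.card)
  refine ⟨_, P, h0, ?_, ?_, fun σ => by rw [← pow_mul]; exact hc σ⟩
  · refine (MvPolynomial.vars_prod _).trans fun j hj => ?_
    obtain ⟨i, _, hi⟩ := Finset.mem_biUnion.1 hj
    exact hv i hi
  · refine (MvPolynomial.totalDegree_finsetProd _ _).trans ?_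
    refine (Finset.sum_le_sum fun i _ => hd i).trans ?_
    rw [Fin.sum_univ_eq_sum_range (fun i => J.card * 2 ^ (i / J.card + 1))]
    have hm : 0 < J.card := hJ.card_pos
    clear hc hd hv h0 P
    induction b with
    | zero => simp
    | succ b ih =>
      rw [add_mul, one_mul, Finset.sum_range_add]
      have : ∀ x ∈ Finset.range J.card, J.card * 2 ^ ((b * J.card + x) / J.card + 1) =
          J.card * 2 ^ (b + 1) := by
        intro x hx
        rw [mul_comm b, Nat.mul_add_div hm, Nat.div_eq_of_lt (Finset.mem_range.1 hx), add_zero]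
      rw [Finset.sum_congr rfl this, Finset.sum_const, Finset.card_range, smul_eq_mul]
      calc _ ≤ 2 * J.card ^ 2 * 2 ^ b + J.card * (J.card * 2 ^ (b + 1)) := by gcongr
        _ = _ := by ring

end PolyPartition

end

section

open MeasureTheory

/-! ### Calculus of multivariate polynomials -/

namespace PolyCalc

open MvPolynomial

section General

variable {σ : Type*}

lemma vars_pderiv_subset (i : σ) (P : MvPolynomial σ ℝ) : (pderiv i P).vars ⊆ P.vars := by
  classical
  intro j hj
  obtain ⟨m, hm, hmj⟩ := (mem_vars_iff_mem_support j).1 hj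
  rw [mem_support_iff, coeff_pderiv] at hm
  refine (mem_vars_iff_mem_support j).2 ⟨m + Finsupp.single i 1, mem_support_iff.2
      (left_ne_zero_of_mul hm), ?_⟩
  rw [Finsupp.mem_support_iff] at hmj ⊢
  simp only [Finsupp.coe_add, Pi.add_apply]
  omega

lemma totalDegree_pderiv_le (i : σ) (P : MvPolynomial σ ℝ) :
    (pderiv i P).totalDegree ≤ P.totalDegree - 1 := by
  classical
  refine Finset.sup_le fun m hm => ?_
  rw [mem_support_iff, coeff_pderiv] at hm
  have h := le_totalDegree (mem_support_iff.2 (left_ne_zero_of_mul hm))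
  rw [Finsupp.sum_add_index' (by simp) (by simp), Finsupp.sum_single_index rfl] at h
  omega

variable [Fintype σ]

lemma hasStrictFDerivAt_eval (P : MvPolynomial σ ℝ) (x : σ → ℝ) :
    HasStrictFDerivAt (fun y : σ → ℝ => eval y P)
      (∑ i, eval x (pderiv i P) • (ContinuousLinearMap.proj i : (σ → ℝ) →L[ℝ] ℝ)) x := by
  classical
  induction P using MvPolynomial.induction_on with
  | C a =>
    simpa using hasStrictFDerivAt_const (𝕜 := ℝ) a x
  | add p q hp hq =>
    have := hp.add hq
    have hf : (fun y : σ → ℝ => eval y (p + q)) =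
        (fun y => eval y p) + fun y => eval y q := by funext y; simp
    rw [hf]
    refine this.congr_fderiv ?_
    simp [add_smul, Finset.sum_add_distrib]
  | mul_X p j hp =>
    have := hp.mul ((ContinuousLinearMap.proj j : (σ → ℝ) →L[ℝ] ℝ).hasStrictFDerivAt (x := x))
    have hf : (fun y : σ → ℝ => eval y (p * X j)) = (fun y => eval y p) *
        (ContinuousLinearMap.proj j : (σ → ℝ) →L[ℝ] ℝ) := by funext y; simp
    rw [hf]
    refine this.congr_fderiv ?_
    · ext v
      simp only [pderiv_mul, pderiv_X, map_add, map_mul, eval_X, add_smul, Finset.sum_add_distrib,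
        add_apply, sum_apply, smul_apply,
        ContinuousLinearMap.proj_apply, smul_eq_mul, Finset.smul_sum]
      rw [add_comm]
      congr 1
      · exact Finset.sum_congr rfl fun i _ => by ring
      · rw [Finset.sum_eq_single j]
        · simp
        · intro b _ hb; simp [hb.symm]
        · simp

lemma hasFDerivAt_eval (P : MvPolynomial σ ℝ) (x : σ → ℝ) :
    HasFDerivAt (fun y : σ → ℝ => eval y P)
      (∑ i, eval x (pderiv i P) • (ContinuousLinearMap.proj i : (σ → ℝ) →L[ℝ] ℝ)) x :=
  (hasStrictFDerivAt_eval P x).hasFDerivAt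

/-- Mean value inequality along a segment. -/
lemma abs_eval_sub_le {P : MvPolynomial σ ℝ} {x y : σ → ℝ} {C : ℝ}
    (h : ∀ w ∈ segment ℝ x y, ∑ i, |eval w (pderiv i P)| ≤ C) :
    |eval y P - eval x P| ≤ C * ‖y - x‖ := by
  have := (convex_segment x y).norm_image_sub_le_of_norm_hasFDerivWithin_le (𝕜 := ℝ)
    (f := fun z => eval z P) (C := C)
    (fun w _ => (hasFDerivAt_eval P w).hasFDerivWithinAt) (fun w hw => ?_)
    (left_mem_segment ℝ x y) (right_mem_segment ℝ x y)
  · simpa using this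
  · refine le_trans ?_ (h w hw)
    refine (norm_sum_le _ _).trans (Finset.sum_le_sum fun i _ => ?_)
    rw [norm_smul, Real.norm_eq_abs]
    refine mul_le_of_le_one_right (abs_nonneg _) ?_
    refine ContinuousLinearMap.opNorm_le_bound _ zero_le_one fun v => ?_
    rw [one_mul]
    exact norm_le_pi_norm v i

/-- Restriction of a polynomial to the line `x + t • w`. -/
noncomputable def lineRes (P : MvPolynomial σ ℝ) (x w : σ → ℝ) : Polynomial ℝ :=
  aeval (fun j => Polynomial.C (x j) + Polynomial.C (w j) * Polynomial.X) P

lemma eval_lineRes (P : MvPolynomial σ ℝ) (x w : σ → ℝ) (t : ℝ) :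
    (lineRes P x w).eval t = eval (x + t • w) P := by
  have h : (Polynomial.aeval t).comp
      (aeval (R := ℝ) (fun j => Polynomial.C (x j) + Polynomial.C (w j) * Polynomial.X))
      = aeval (x + t • w) := by
    ext j
    simp only [AlgHom.comp_apply, aeval_X, map_add, map_mul, Polynomial.aeval_X,
      Polynomial.aeval_C, Pi.add_apply, Pi.smul_apply, smul_eq_mul, Algebra.algebraMap_self,
      RingHom.id_apply]
    ring
  have := DFunLike.congr_fun h P
  rw [AlgHom.comp_apply, Polynomial.coe_aeval_eq_eval] at this
  rw [lineRes, this, aeval_eq_eval]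

lemma natDegree_lineRes_le (P : MvPolynomial σ ℝ) (x w : σ → ℝ) :
    (lineRes P x w).natDegree ≤ P.totalDegree := by
  rw [lineRes, aeval_def, eval₂_eq]
  refine Polynomial.natDegree_sum_le_of_forall_le _ _ fun m hm => ?_
  refine (Polynomial.natDegree_mul_le).trans ?_
  rw [show (algebraMap ℝ (Polynomial ℝ)) (coeff m P) = Polynomial.C (coeff m P) from rfl,
    Polynomial.natDegree_C, zero_add]
  refine (Polynomial.natDegree_prod_le _ _).trans ?_
  refine le_trans (Finset.sum_le_sum fun j _ => ?_) (le_totalDegree hm)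
  refine (Polynomial.natDegree_pow_le).trans ?_
  refine (Nat.mul_le_mul_left _ ?_).trans (mul_one _).le
  exact (Polynomial.natDegree_add_le _ _).trans
    (by simpa using (Polynomial.natDegree_C_mul_le
        (w j) Polynomial.X).trans Polynomial.natDegree_X_le)

lemma derivative_lineRes (P : MvPolynomial σ ℝ) (x w : σ → ℝ) :
    Polynomial.derivative (lineRes P x w) =
      ∑ j, Polynomial.C (w j) * lineRes (pderiv j P) x w := by
  refine Polynomial.funext fun t => ?_
  have h1 := (lineRes P x w).hasDerivAt t
  have h2 : HasDerivAt (fun s : ℝ => eval (x + s • w) P)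
      ((∑ i, eval (x + t • w) (pderiv i P) • (ContinuousLinearMap.proj i : (σ → ℝ) →L[ℝ] ℝ)) w)
      t := by
    refine HasFDerivAt.comp_hasDerivAt (f := fun s : ℝ => x + s • w) t
      (hasFDerivAt_eval P (x + t • w)) ?_
    simpa using ((hasDerivAt_id t).smul_const w).const_add x
  simp only [← eval_lineRes] at h2
  rw [h1.unique h2]
  simp [Polynomial.eval_finsetSum, eval_lineRes, mul_comm]

end General

/-- Iterated partial derivative along a list of variables. -/
noncomputable def iterD {n : ℕ} (L : List (Fin n)) (P : MvPolynomial (Fin n) ℝ) :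
    MvPolynomial (Fin n) ℝ :=
  L.foldr (fun l Q => pderiv l Q) P

section

variable {n : ℕ}

@[simp] lemma iterD_nil (P : MvPolynomial (Fin n) ℝ) : iterD [] P = P := rfl

@[simp] lemma iterD_cons (l : Fin n) (L : List (Fin n)) (P : MvPolynomial (Fin n) ℝ) :
    iterD (l :: L) P = pderiv l (iterD L P) := rfl

lemma iterD_append (L L' : List (Fin n)) (P : MvPolynomial (Fin n) ℝ) :
    iterD (L ++ L') P = iterD L (iterD L' P) := by
  simp [iterD]

lemma vars_iterD_subset (L : List (Fin n)) (P : MvPolynomial (Fin n) ℝ) :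
    (iterD L P).vars ⊆ P.vars := by
  induction L with
  | nil => exact subset_rfl
  | cons l L ih => exact (vars_pderiv_subset l _).trans ih

lemma totalDegree_iterD_le (L : List (Fin n)) (P : MvPolynomial (Fin n) ℝ) :
    (iterD L P).totalDegree ≤ P.totalDegree - L.length := by
  induction L with
  | nil => simp
  | cons l L ih =>
    rw [iterD_cons]
    refine (totalDegree_pderiv_le l _).trans ?_
    simp only [List.length_cons]
    omega

lemma iterD_eq_zero {L : List (Fin n)} {P : MvPolynomial (Fin n) ℝ}
    (h : P.totalDegree < L.length) : iterD L P = 0 := by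
  cases L with
  | nil => simp at h
  | cons l L =>
    have h1 := totalDegree_iterD_le L P
    simp only [List.length_cons] at h
    have h2 : (iterD L P).totalDegree = 0 := by omega
    rw [iterD_cons, totalDegree_eq_zero_iff_eq_C.1 h2, pderiv_C]

/-- Quantitative Taylor estimate. -/
lemma taylor_estimate {J : Finset (Fin n)} {s B : ℝ} (hs : 0 < s) {y z : Fin n → ℝ}
    (hz : n * ‖z - y‖ / s ≤ 1 / 2) {R : MvPolynomial (Fin n) ℝ} (hR : R.vars ⊆ J)
    (h : ∀ L : List (Fin n), (∀ l ∈ L, l ∈ J) → s ^ L.length * |eval y (iterD L R)| ≤ B) :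
    |eval z R - eval y R| ≤ 2 * (n * ‖z - y‖ / s) * B := by
  obtain ⟨N, hN⟩ : ∃ N, R.totalDegree ≤ N := ⟨_, le_rfl⟩
  have hB : 0 ≤ B := le_trans (by simp) (h [] (by simp))
  induction N generalizing R B z with
  | zero =>
    have h0 : R.totalDegree = 0 := by omega
    rw [totalDegree_eq_zero_iff_eq_C.1 h0]
    simp only [eval_C, sub_self, abs_zero]
    positivity
  | succ N ih =>
    have key : ∀ w ∈ segment ℝ y z, ∑ i, |eval w (pderiv i R)| ≤ n * (2 * (B / s)) := by
      intro w hw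
      have hw1 : ‖w - y‖ ≤ ‖z - y‖ := by
        have := (convex_closedBall y ‖z - y‖).segment_subset
          (Metric.mem_closedBall_self (norm_nonneg _))
          (by rw [mem_closedBall_iff_norm]) hw
        rwa [mem_closedBall_iff_norm] at this
      have hw2 : n * ‖w - y‖ / s ≤ 1 / 2 := le_trans (by gcongr) hz
      refine (Finset.sum_le_card_nsmul _ _ (2 * (B / s)) fun i _ => ?_).trans (by simp)
      by_cases hi : i ∈ R.vars
      · have hiJ := hR hi
        have hb : ∀ L : List (Fin n), (∀ l ∈ L, l ∈ J) →
            s ^ L.length * |eval y (iterD L (pderiv i R))| ≤ B / s := by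
          intro L hL
          have := h (L ++ [i]) (by
            intro l hl
            rcases List.mem_append.1 hl with hl | hl
            · exact hL l hl
            · rw [List.mem_singleton.1 hl]; exact hiJ)
          rw [iterD_append, List.length_append, List.length_singleton, pow_succ] at this
          rw [le_div_iff₀ hs]
          simpa [mul_comm, mul_left_comm, mul_assoc] using this
        have h1 := ih hw2 ((vars_pderiv_subset i R).trans hR) hb
          ((totalDegree_pderiv_le i R).trans (by omega)) (by positivity)
        have h2 := hb [] (by simp)
        simp only [List.length_nil, pow_zero, one_mul, iterD_nil] at h2
        have h3 : 2 * (n * ‖w - y‖ / s) * (B / s) ≤ 2 * (1 / 2) * (B / s) := by gcongr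
        have h4 := abs_sub_abs_le_abs_sub (eval w (pderiv i R)) (eval y (pderiv i R))
        linarith
      · rw [pderiv_eq_zero_of_notMem_vars hi, map_zero, abs_zero]; positivity
    refine (abs_eval_sub_le key).trans (le_of_eq ?_)
    field_simp

/-- The region where the derivative `∂_l Q` dominates all (rescaled) derivatives of `Q`. -/
def Reg (s B : ℝ) (J : Finset (Fin n)) (l : Fin n) (Q : MvPolynomial (Fin n) ℝ) :
    Set (Fin n → ℝ) :=
  {y | eval y (pderiv l Q) ≠ 0 ∧ ∀ L : List (Fin n), (∀ l ∈ L, l ∈ J) →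
    s ^ L.length * |eval y (iterD L Q)| ≤ B * (s * |eval y (pderiv l Q)|)}

lemma Reg.abs_iterD_sub_le {s B : ℝ} (hs : 0 < s) {J : Finset (Fin n)} {l : Fin n}
    {Q : MvPolynomial (Fin n) ℝ} (hQ : Q.vars ⊆ J) {y z : Fin n → ℝ} (hy : y ∈ Reg s B J l Q)
    (hz : n * ‖z - y‖ / s ≤ 1 / 2) {L : List (Fin n)} (hL : ∀ l ∈ L, l ∈ J) :
    s ^ L.length * |eval z (iterD L Q) - eval y (iterD L Q)| ≤
      2 * (n * ‖z - y‖ / s) * (B * (s * |eval y (pderiv l Q)|)) := by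
  have hpos : 0 < s ^ L.length := pow_pos hs _
  have := taylor_estimate (J := J) (B := B * (s * |eval y (pderiv l Q)|) / s ^ L.length) hs hz
    ((vars_iterD_subset L Q).trans hQ) (fun L' hL' => by
      rw [← iterD_append, le_div_iff₀ hpos]
      have h2 := hy.2 (L' ++ L) (fun l hl => (List.mem_append.1 hl).elim (hL' l) (hL l))
      rw [List.length_append, pow_add] at h2
      linarith)
  calc _ ≤ s ^ L.length * (2 * (n * ‖z - y‖ / s) *
        (B * (s * |eval y (pderiv l Q)|) / s ^ L.length)) := by gcongr
    _ = _ := by field_simp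

lemma Reg.abs_pderiv_sub_le {s B : ℝ} (hs : 0 < s) {J : Finset (Fin n)} {l : Fin n}
    {Q : MvPolynomial (Fin n) ℝ} (hQ : Q.vars ⊆ J) {y z : Fin n → ℝ} (hy : y ∈ Reg s B J l Q)
    (hz : n * ‖z - y‖ / s ≤ 1 / 2) (l' : Fin n) :
    |eval z (pderiv l' Q) - eval y (pderiv l' Q)| ≤
      2 * (n * ‖z - y‖ / s) * (B * |eval y (pderiv l Q)|) := by
  by_cases hl' : l' ∈ J
  · have := Reg.abs_iterD_sub_le hs hQ hy hz (L := [l']) (by simpa using hl')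
    simp only [List.length_singleton, pow_one, iterD_cons, iterD_nil] at this
    refine le_of_mul_le_mul_left (this.trans (le_of_eq ?_)) hs
    ring
  · have hB : 0 ≤ B * (s * |eval y (pderiv l Q)|) := le_trans (by simp) (hy.2 [] (by simp))
    have hB' : 0 ≤ B * |eval y (pderiv l Q)| := by
      have : s * (B * |eval y (pderiv l Q)|) = B * (s * |eval y (pderiv l Q)|) := by ring
      exact nonneg_of_mul_nonneg_right (this ▸ hB) hs
    rw [pderiv_eq_zero_of_notMem_vars (fun h => hl' (hQ h))]
    simp only [map_zero, sub_zero, abs_zero]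
    positivity

/-- Regular regions are stable under small displacements, with a worse constant. -/
lemma Reg.fatten {s B : ℝ} (hs : 0 < s) (hB : 1 ≤ B) {J : Finset (Fin n)} {l : Fin n}
    {Q : MvPolynomial (Fin n) ℝ} (hQ : Q.vars ⊆ J) {y z : Fin n → ℝ} (hy : y ∈ Reg s B J l Q)
    (hz : n * ‖z - y‖ / s ≤ 1 / (8 * B)) :
    z ∈ Reg s (4 * B) J l Q ∧ |eval y (pderiv l Q)| ≤ 4 / 3 * |eval z (pderiv l Q)| ∧
      |eval z (pderiv l Q)| ≤ 4 / 3 * |eval y (pderiv l Q)| := by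
  have hz2 : n * ‖z - y‖ / s ≤ 1 / 2 :=
    hz.trans (one_div_le_one_div_of_le (by norm_num) (by linarith))
  have hBpos : 0 < B := by linarith
  have h0 : 0 < |eval y (pderiv l Q)| := abs_pos.2 hy.1
  set A := |eval y (pderiv l Q)| with hA
  have h1 := Reg.abs_pderiv_sub_le hs hQ hy hz2 l
  have h2 : 2 * (n * ‖z - y‖ / s) * (B * A) ≤ 2 * (1 / (8 * B)) * (B * A) := by gcongr
  have h3 : 2 * (1 / (8 * B)) * (B * A) = A / 4 := by field_simp; norm_num
  have h4 := abs_sub_abs_le_abs_sub (eval z (pderiv l Q)) (eval y (pderiv l Q))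
  have h5 := abs_sub_abs_le_abs_sub (eval y (pderiv l Q)) (eval z (pderiv l Q))
  rw [abs_sub_comm (eval y (pderiv l Q))] at h5
  have h6 : A ≤ 4 / 3 * |eval z (pderiv l Q)| := by linarith
  refine ⟨⟨abs_pos.1 (by linarith), fun L hL => ?_⟩, h6, by linarith⟩
  have h7 := Reg.abs_iterD_sub_le hs hQ hy hz2 hL
  have h8 := hy.2 L hL
  have h9 : 2 * (n * ‖z - y‖ / s) * (B * (s * A)) ≤ 2 * (1 / 2) * (B * (s * A)) := by gcongr
  have h10 : s ^ L.length * |eval z (iterD L Q)| ≤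
      s ^ L.length * |eval z (iterD L Q) - eval y (iterD L Q)| +
        s ^ L.length * |eval y (iterD L Q)| := by
    rw [← mul_add]
    gcongr
    linarith [abs_sub_abs_le_abs_sub (eval z (iterD L Q)) (eval y (iterD L Q))]
  calc _ ≤ 2 * (B * (s * A)) := by linarith
    _ ≤ 2 * (B * (s * (4 / 3 * |eval z (pderiv l Q)|))) := by gcongr
    _ ≤ _ := by
      have : 0 ≤ B * (s * |eval z (pderiv l Q)|) := by positivity
      linarith

/-- Near the zero set of `P`, some derivative of `P` is regular. -/
lemma exists_mem_Reg {J : Finset (Fin n)} {s : ℝ} (hs : 0 < s) {P : MvPolynomial (Fin n) ℝ}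
    (hP : P ≠ 0) (hv : P.vars ⊆ J) {y z : Fin n → ℝ} (hz : n * ‖z - y‖ / s ≤ 1 / 4)
    (h0 : eval z P = 0) :
    ∃ (L : List (Fin n)) (l : Fin n), L.length ≤ P.totalDegree ∧ (∀ l ∈ L, l ∈ J) ∧ l ∈ J ∧
      y ∈ Reg s 1 J l (iterD L P) := by
  classical
  set 𝓛 : Set (List (Fin n)) := {L | L.length ≤ P.totalDegree ∧ ∀ l ∈ L, l ∈ J} with h𝓛
  have hfin : 𝓛.Finite := (List.finite_length_le (Fin n) P.totalDegree).subset fun L hL => hL.1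
  have hne : 𝓛.Nonempty := ⟨[], by simp [h𝓛]⟩
  obtain ⟨M, hM, hmax⟩ := Set.exists_max_image 𝓛
    (fun L => s ^ L.length * |eval y (iterD L P)|) hfin hne
  set A := s ^ M.length * |eval y (iterD M P)| with hA
  have hall : ∀ L : List (Fin n), (∀ l ∈ L, l ∈ J) → s ^ L.length * |eval y (iterD L P)| ≤ A := by
    intro L hL
    by_cases hlen : L.length ≤ P.totalDegree
    · exact hmax L ⟨hlen, hL⟩
    · rw [iterD_eq_zero (not_le.1 hlen), map_zero, abs_zero, mul_zero]; positivity
  have hApos : 0 < A := by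
    by_contra hA0
    apply hP
    have hz : ∀ L : List (Fin n), (∀ l ∈ L, l ∈ J) → eval y (iterD L P) = 0 := by
      intro L hL
      have h1 : s ^ L.length * |eval y (iterD L P)| ≤ 0 := (hall L hL).trans (not_lt.1 hA0)
      have h2 : 0 < s ^ L.length := pow_pos hs _
      exact abs_eq_zero.1 (le_antisymm (by nlinarith) (abs_nonneg _))
    refine MvPolynomial.funext fun w => ?_
    have h3 : 0 < 2 * (n * ‖w - y‖) + 1 := by positivity
    have := taylor_estimate (J := J) (B := 0) (s := 2 * (n * ‖w - y‖) + 1) (y := y) (z := w)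
      h3 (by rw [div_le_iff₀ h3]; linarith) hv (fun L hL => by simp [hz L hL])
    simp only [mul_zero, abs_nonpos_iff] at this
    have h4 := hz [] (by simp)
    simp only [iterD_nil] at h4
    rw [map_zero]
    linarith
  have hMne : M ≠ [] := by
    rintro rfl
    have h1 := taylor_estimate (z := z) hs (by linarith) hv hall
    simp only [List.length_nil, pow_zero, one_mul, iterD_nil] at hA
    rw [h0, zero_sub, abs_neg, ← hA] at h1
    have h2 : 2 * (n * ‖z - y‖ / s) * A ≤ 2 * (1 / 4) * A := by gcongr
    linarith
  obtain ⟨l, L, rfl⟩ := List.exists_cons_of_ne_nil hMne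
  have hmemJ := hM.2
  refine ⟨L, l, ?_, fun l' h' => hmemJ l' (List.mem_cons_of_mem _ h'), hmemJ l (by simp), ?_, ?_⟩
  · have := hM.1
    simp only [List.length_cons] at this
    omega
  · intro h
    rw [iterD_cons, h, abs_zero, mul_zero] at hA
    exact hApos.ne' hA
  · intro L' hL'
    have h1 := hall (L' ++ L) (fun l' h' => (List.mem_append.1 h').elim (hL' l')
      (fun h' => hmemJ l' (List.mem_cons_of_mem _ h')))
    rw [hA, iterD_append, List.length_append, pow_add, List.length_cons, pow_succ] at h1
    have h2 : 0 < s ^ L.length := pow_pos hs _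
    refine le_of_mul_le_mul_left ?_ h2
    rw [iterD_cons] at h1
    linarith

end

end PolyCalc

end

section

open MeasureTheory

namespace PolyCalc

open MvPolynomial

/-- The set where a univariate polynomial is small compared with its derivative is covered by
few short intervals. -/
lemma exists_centers_of_abs_eval_le (q : Polynomial ℝ) {N : ℕ} (hN : q.natDegree ≤ N) {c : ℝ}
    (hc : 0 ≤ c) : ∃ R : Finset ℝ, R.card ≤ N ∧ ∀ t, q.derivative.eval t ≠ 0 →
      |q.eval t| ≤ c * |q.derivative.eval t| → ∃ r ∈ R, |t - r| ≤ N * c := by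
  classical
  by_cases hq : q = 0
  · exact ⟨∅, by simp, fun t h => by simp [hq] at h⟩
  set Q : Polynomial ℂ := q.map (algebraMap ℝ ℂ) with hQ
  have hsplit : Q.Splits := IsAlgClosed.splits Q
  have hcard : Multiset.card Q.roots ≤ N := by
    refine (Polynomial.card_roots' Q).trans ?_
    rw [hQ, Polynomial.natDegree_map]; exact hN
  have hev : ∀ (f : Polynomial ℝ) (t : ℝ),
      (f.map (algebraMap ℝ ℂ)).eval (t : ℂ) = ((f.eval t : ℝ) : ℂ) := fun f t => by
    rw [Polynomial.eval_map_algebraMap]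
    exact Polynomial.aeval_algebraMap_apply_eq_algebraMap_eval t f
  refine ⟨(Q.roots.map Complex.re).toFinset,
    (Multiset.toFinset_card_le _).trans (by simpa using hcard), fun t h0 h1 => ?_⟩
  by_contra! hcon
  have hfar : ∀ z ∈ Q.roots, N * c < ‖(t : ℂ) - z‖ := by
    intro z hz
    have := hcon z.re (Multiset.mem_toFinset.2 (Multiset.mem_map_of_mem _ hz))
    refine this.trans_le ?_
    have := Complex.abs_re_le_norm ((t : ℂ) - z)
    simpa using this
  have hne : q.eval t ≠ 0 := by
    intro h
    have hz : (t : ℂ) ∈ Q.roots := by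
      rw [Polynomial.mem_roots (Polynomial.map_ne_zero hq), Polynomial.IsRoot, hev, h]; simp
    have := hfar _ hz
    rw [sub_self, norm_zero] at this
    exact absurd this (not_lt.2 (by positivity))
  have hne' : Q.eval (t : ℂ) ≠ 0 := by rw [hev]; exact_mod_cast hne
  have key := hsplit.eval_derivative_div_eval_of_ne_zero hne'
  rw [hQ, Polynomial.derivative_map, hev, hev, ← hQ] at key
  have hnorm : |q.derivative.eval t| / |q.eval t| =
      ‖(Q.roots.map fun z => 1 / ((t : ℂ) - z)).sum‖ := by
    rw [← key]; simp
  have hroots : Q.roots ≠ 0 := by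
    intro h
    rw [h] at hnorm
    simp [hne, h0] at hnorm
  have hNpos : 0 < N := lt_of_lt_of_le (Multiset.card_pos.2 hroots) hcard
  have hcpos : 0 < c := by
    rcases hc.eq_or_lt with rfl | h
    · rw [zero_mul] at h1
      exact absurd (abs_nonpos_iff.1 h1) hne
    · exact h
  have hNc : 0 < N * c := by positivity
  have hlt : ‖(Q.roots.map fun z => 1 / ((t : ℂ) - z)).sum‖ <
      (Q.roots.map fun _ => 1 / (N * c)).sum := by
    refine lt_of_le_of_lt (norm_multiset_sum_le _) ?_
    rw [Multiset.map_map]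
    refine Multiset.sum_lt_sum_of_nonempty hroots fun z hz => ?_
    simp only [Function.comp, norm_div, norm_one]
    exact one_div_lt_one_div_of_lt hNc (hfar z hz)
  rw [Multiset.map_const', Multiset.sum_replicate, nsmul_eq_mul, ← hnorm] at hlt
  have h2 : |q.derivative.eval t| / |q.eval t| < 1 / c := by
    refine hlt.trans_le ?_
    calc (Multiset.card Q.roots : ℝ) * (1 / (N * c)) ≤ N * (1 / (N * c)) := by gcongr
      _ = 1 / c := by field_simp
  rw [div_lt_div_iff₀ (abs_pos.2 hne) hcpos] at h2
  linarith

variable {n : ℕ}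

/-- A tower of hypersurfaces: a list of pairs `(Q, l)` where each successive polynomial only
involves the variables `J` that remain after removing the variables `l` of the previous ones. -/
def IsTower (N : ℕ) : List (MvPolynomial (Fin n) ℝ × Fin n) → Finset (Fin n) → Prop
  | [], J => J = Finset.univ
  | e :: τ, J => ∃ J', IsTower N τ J' ∧ e.2 ∈ J' ∧ J = J'.erase e.2 ∧ e.1.vars ⊆ J' ∧
      e.1.totalDegree ≤ N

lemma IsTower.card {N : ℕ} {τ : List (MvPolynomial (Fin n) ℝ × Fin n)} {J : Finset (Fin n)}
    (h : IsTower N τ J) : J.card + τ.length = n := by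
  induction τ generalizing J with
  | nil => rw [IsTower] at h; simp [h]
  | cons e τ ih =>
    obtain ⟨J', h1, h2, rfl, -, -⟩ := h
    have := ih h1
    have := Finset.card_pos.2 ⟨_, h2⟩
    rw [Finset.card_erase_of_mem h2, List.length_cons]
    omega

lemma IsTower.totalDegree_le {N : ℕ} {τ : List (MvPolynomial (Fin n) ℝ × Fin n)}
    {J : Finset (Fin n)} (h : IsTower N τ J) : ∀ e ∈ τ, e.1.totalDegree ≤ N := by
  induction τ generalizing J with
  | nil => simp
  | cons e τ ih =>
    obtain ⟨J', h1, -, -, -, h2⟩ := h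
    intro e' he'
    rcases List.mem_cons.1 he' with rfl | he'
    · exact h2
    · exact ih h1 e' he'

/-- The neighbourhood of a tower of hypersurfaces. -/
def towerSet (c : ℝ) (τ : List (MvPolynomial (Fin n) ℝ × Fin n)) : Set (Fin n → ℝ) :=
  {x | ∀ e ∈ τ, |eval x e.1| < c * |eval x (pderiv e.2 e.1)|}

lemma eval_update_of_notMem {x : Fin n → ℝ} {l : Fin n} {P : MvPolynomial (Fin n) ℝ}
    (h : l ∉ P.vars) (t : ℝ) : eval (Function.update x l t) P = eval x P :=
  eval₂Hom_congr' rfl (fun i hi _ => Function.update_of_ne (by rintro rfl; exact h hi) _ _) rfl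

lemma measurable_eval (P : MvPolynomial (Fin n) ℝ) : Measurable fun x : Fin n → ℝ => eval x P :=
  (MvPolynomial.continuous_eval P).measurable

lemma measurableSet_towerSet (c : ℝ) (τ : List (MvPolynomial (Fin n) ℝ × Fin n)) :
    MeasurableSet (towerSet c τ) := by
  have : towerSet c τ = ⋂ e ∈ {e | e ∈ τ}, {x | |eval x e.1| < c * |eval x (pderiv e.2 e.1)|} := by
    ext x; simp [towerSet]
  rw [this]
  refine MeasurableSet.biInter (List.finite_toSet τ).countable fun e _ => ?_
  exact measurableSet_lt ((measurable_eval _).abs) (((measurable_eval _).abs).const_mul c)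

lemma volume_fiber_le {N : ℕ} {c : ℝ} (hc : 0 ≤ c) {Q : MvPolynomial (Fin n) ℝ}
    (hQ : Q.totalDegree ≤ N) (l : Fin n) (x : Fin n → ℝ) :
    volume {t : ℝ | |eval (Function.update x l t) Q| <
      c * |eval (Function.update x l t) (pderiv l Q)|} ≤ ENNReal.ofReal (2 * N ^ 2 * c) := by
  classical
  set x0 := Function.update x l 0
  have hup : ∀ t, x0 + t • Pi.single l (1 : ℝ) = Function.update x l t := by
    intro t; ext j
    by_cases hj : j = l
    · subst hj; simp [x0]
    · simp [x0, hj]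
  obtain ⟨R, hR, h⟩ := exists_centers_of_abs_eval_le (lineRes Q x0 (Pi.single l 1))
    ((natDegree_lineRes_le Q _ _).trans hQ) hc
  have hder : Polynomial.derivative (lineRes Q x0 (Pi.single l 1)) =
      lineRes (pderiv l Q) x0 (Pi.single l 1) := by
    rw [derivative_lineRes, Finset.sum_eq_single l]
    · simp
    · intro b _ hb; simp [hb]
    · simp
  simp only [hder, eval_lineRes, hup] at h
  have hsub : {t : ℝ | |eval (Function.update x l t) Q| <
      c * |eval (Function.update x l t) (pderiv l Q)|} ⊆
      ⋃ r ∈ R, Set.Icc (r - N * c) (r + N * c) := by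
    intro t ht
    have ht' : |eval (Function.update x l t) Q| <
      c * |eval (Function.update x l t) (pderiv l Q)| := ht
    obtain ⟨r, hr, hr'⟩ := h t (by
      intro h0; rw [h0] at ht'; simp at ht'; exact absurd ht' (not_lt.2 (abs_nonneg _))) ht'.le
    refine Set.mem_biUnion hr ?_
    rw [abs_le] at hr'
    exact ⟨by linarith, by linarith⟩
  refine (measure_mono hsub).trans ((measure_biUnion_finset_le _ _).trans ?_)
  have hv : ∀ r ∈ R, volume (Set.Icc (r - N * c) (r + N * c)) = ENNReal.ofReal (2 * (N * c)) :=
    fun r _ => by rw [Real.volume_Icc]; congr 1; ring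
  rw [Finset.sum_congr rfl hv, Finset.sum_const, nsmul_eq_mul, ← ENNReal.ofReal_natCast,
    ← ENNReal.ofReal_mul (by positivity)]
  refine ENNReal.ofReal_le_ofReal ?_
  have : (R.card : ℝ) ≤ N := by exact_mod_cast hR
  calc (R.card : ℝ) * (2 * (N * c)) ≤ N * (2 * (N * c)) := by gcongr
    _ = _ := by ring

lemma lintegral_towerSet_le {N : ℕ} {c : ℝ} (hc : 0 ≤ c)
    {τ : List (MvPolynomial (Fin n) ℝ × Fin n)} {J : Finset (Fin n)} (hτ : IsTower N τ J)
    {f : (Fin n → ℝ) → ENNReal} (hf : Measurable f)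
    (hfJ : ∀ l ∉ J, ∀ x t, f (Function.update x l t) = f x) (x : Fin n → ℝ) :
    ∫⁻ y, (towerSet c τ).indicator f y ≤
      ENNReal.ofReal (2 * N ^ 2 * c) ^ τ.length * lmarginal (fun _ => volume) J f x := by
  classical
  induction τ generalizing J f with
  | nil =>
    rw [IsTower] at hτ
    have : towerSet c ([] : List (MvPolynomial (Fin n) ℝ × Fin n)) = Set.univ := by
      ext; simp [towerSet]
    rw [this, Set.indicator_univ, hτ, volume_pi, lintegral_eq_lmarginal_univ x]
    simp
  | cons e τ ih =>
    obtain ⟨J', h1, h2, rfl, h3, h4⟩ := hτ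
    set A : Set (Fin n → ℝ) := {x | |eval x e.1| < c * |eval x (pderiv e.2 e.1)|} with hA
    have hAm : MeasurableSet A :=
      measurableSet_lt ((measurable_eval _).abs) (((measurable_eval _).abs).const_mul c)
    have hset : towerSet c (e :: τ) = towerSet c τ ∩ A := by
      ext x; simp [towerSet, hA, and_comm]
    have hmemA : ∀ x, x ∈ A ↔ |eval x e.1| < c * |eval x (pderiv e.2 e.1)| := fun x => Iff.rfl
    rw [hset, ← Set.indicator_indicator]
    refine (ih h1 (hf.indicator hAm) (fun l hl x t => ?_)).trans ?_
    · have hl1 : l ∉ e.1.vars := fun h => hl (h3 h)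
      have hl2 : l ∉ (pderiv e.2 e.1).vars := fun h => hl1 (vars_pderiv_subset _ _ h)
      have h5 := hfJ l (fun h => hl (Finset.mem_of_mem_erase h)) x t
      simp only [Set.indicator, hmemA, eval_update_of_notMem hl1, eval_update_of_notMem hl2, h5]
    · rw [List.length_cons, pow_succ (ENNReal.ofReal (2 * N ^ 2 * c)), mul_assoc (_ ^ _)]
      refine mul_le_mul_right ?_ _
      rw [lmarginal_erase' _ (hf.indicator hAm) h2]
      have hle : (fun x => ∫⁻ t, A.indicator f (Function.update x e.2 t)) ≤
          fun x => ENNReal.ofReal (2 * N ^ 2 * c) * f x := by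
        intro x
        have h5 : ∀ t, A.indicator f (Function.update x e.2 t) =
            {t : ℝ | |eval (Function.update x e.2 t) e.1| <
              c * |eval (Function.update x e.2 t) (pderiv e.2 e.1)|}.indicator
              (fun _ => f x) t := by
          intro t
          have h6 := hfJ e.2 (Finset.notMem_erase _ _) x t
          by_cases h7 : Function.update x e.2 t ∈ A
          · rw [Set.indicator_of_mem h7, Set.indicator_of_mem (show t ∈ _ from h7), h6]
          · rw [Set.indicator_of_notMem h7, Set.indicator_of_notMem (show t ∉ _ from h7)]
        simp only [h5]
        refine (lintegral_indicator_const_le _ _).trans ?_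
        rw [mul_comm]
        gcongr
        exact volume_fiber_le hc h4 _ _
      refine (lmarginal_mono hle x).trans ?_
      simp only [lmarginal]
      rw [lintegral_const_mul]
      exact hf.comp (measurable_updateFinset)

/-- The volume of the neighbourhood of a tower inside a cube. -/
lemma volume_towerSet_le {N : ℕ} {c : ℝ} (hc : 0 ≤ c)
    {τ : List (MvPolynomial (Fin n) ℝ × Fin n)} {J : Finset (Fin n)} (hτ : IsTower N τ J)
    (o : Fin n → ℝ) {r : ℝ} (hr : 0 ≤ r) :
    volume (towerSet c τ ∩ Metric.closedBall o r) ≤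
      ENNReal.ofReal ((2 * N ^ 2 * c) ^ τ.length * (2 * r) ^ J.card) := by
  classical
  set A : Set (Fin n → ℝ) := {x | ∀ j ∈ J, x j ∈ Set.Icc (o j - r) (o j + r)} with hA
  have hAm : MeasurableSet A := by
    have : A = ⋂ j ∈ J, {x | x j ∈ Set.Icc (o j - r) (o j + r)} := by ext; simp [hA]
    rw [this]
    exact J.measurableSet_biInter fun j _ => (measurable_pi_apply j) measurableSet_Icc
  have hsub : towerSet c τ ∩ Metric.closedBall o r ⊆ towerSet c τ ∩ A := by
    rintro x ⟨h1, h2⟩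
    refine ⟨h1, fun j _ => ?_⟩
    have := (dist_pi_le_iff hr).1 (Metric.mem_closedBall.1 h2) j
    rw [Real.dist_eq, abs_le] at this
    exact ⟨by linarith, by linarith⟩
  refine (measure_mono hsub).trans ?_
  have h1 : volume (towerSet c τ ∩ A) =
      ∫⁻ y, (towerSet c τ).indicator (A.indicator fun _ => 1) y := by
    rw [Set.indicator_indicator, lintegral_indicator_const ((measurableSet_towerSet c τ).inter hAm),
      one_mul]
  rw [h1]
  refine (lintegral_towerSet_le hc hτ (measurable_const.indicator hAm)
      (fun l hl x t => ?_) o).trans ?_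
  · have : Function.update x l t ∈ A ↔ x ∈ A := by
      simp only [hA, Set.mem_ofPred_eq]
      refine forall₂_congr fun j hj => ?_
      rw [Function.update_of_ne (by rintro rfl; exact hl hj)]
    simp only [Set.indicator, this]
  · rw [ENNReal.ofReal_mul (p := (2 * N ^ 2 * c) ^ τ.length) (by positivity),
      ENNReal.ofReal_pow (p := 2 * N ^ 2 * c) (by positivity)]
    gcongr
    rw [lmarginal]
    have h2 : ∀ y : (∀ i : J, ℝ), A.indicator (fun _ => (1 : ENNReal)) (Function.updateFinset o J y)
        ≤ (Set.Icc (fun i : J => o i - r) (fun i : J => o i + r)).indicator (fun _ => 1) y := by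
      intro y
      by_cases hy : Function.updateFinset o J y ∈ A
      · rw [Set.indicator_of_mem hy, Set.indicator_of_mem]
        refine ⟨fun i => ?_, fun i => ?_⟩
        · have := (hy i i.2).1
          simpa [Function.updateFinset] using this
        · have := (hy i i.2).2
          simpa [Function.updateFinset] using this
      · rw [Set.indicator_of_notMem hy]; exact zero_le
    refine (lintegral_mono h2).trans ?_
    rw [lintegral_indicator_const measurableSet_Icc, one_mul]
    have h3 := Real.volume_Icc_pi (a := fun i : J => o i - r) (b := fun i : J => o i + r)
    rw [volume_pi] at h3
    rw [h3]
    have h4 : ∀ i : J, ENNReal.ofReal (o i + r - (o i - r)) = ENNReal.ofReal (2 * r) :=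
      fun i => by congr 1; ring
    rw [Finset.prod_congr rfl (fun i _ => h4 i), Finset.prod_const, Finset.card_univ,
      Fintype.card_coe, ENNReal.ofReal_pow (by positivity)]

end PolyCalc

end

section

open MeasureTheory

namespace PolyCalc

open MvPolynomial

section Bezout

variable {σ : Type*} [Fintype σ] [DecidableEq σ]

/-- The Jacobian matrix of a polynomial map. -/
noncomputable def jac (F : σ → MvPolynomial σ ℝ) (x : σ → ℝ) : Matrix σ σ ℝ :=
  Matrix.of fun i j => eval x (pderiv j (F i))

/-- The derivative of a polynomial map. -/
noncomputable def jacL (F : σ → MvPolynomial σ ℝ) (x : σ → ℝ) : (σ → ℝ) →L[ℝ] (σ → ℝ) :=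
  ContinuousLinearMap.pi fun i =>
    ∑ j, eval x (pderiv j (F i)) • (ContinuousLinearMap.proj j : (σ → ℝ) →L[ℝ] ℝ)

lemma det_jacL (F : σ → MvPolynomial σ ℝ) (x : σ → ℝ) : (jacL F x).det = (jac F x).det := by
  rw [← LinearMap.det_toLin', ContinuousLinearMap.det]
  congr 1
  ext v i
  simp [jacL, jac, Matrix.mulVec, dotProduct]

lemma hasStrictFDerivAt_jacL (F : σ → MvPolynomial σ ℝ) (x : σ → ℝ) :
    HasStrictFDerivAt (fun y i => eval y (F i)) (jacL F x) x :=
  hasStrictFDerivAt_pi.2 fun i => hasStrictFDerivAt_eval (F i) x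

lemma continuous_det_jac (F : σ → MvPolynomial σ ℝ) : Continuous fun x => (jac F x).det :=
  Continuous.matrix_det (continuous_matrix fun _ _ => MvPolynomial.continuous_eval _)

lemma hasStrictFDerivAt_equiv {F : σ → MvPolynomial σ ℝ} {x : σ → ℝ} (hx : (jac F x).det ≠ 0) :
    HasStrictFDerivAt (fun y i => eval y (F i))
      (((jacL F x).toContinuousLinearEquivOfDetNeZero (by rwa [det_jacL]) :
        (σ → ℝ) ≃L[ℝ] (σ → ℝ)) : (σ → ℝ) →L[ℝ] (σ → ℝ)) x :=
  (hasStrictFDerivAt_jacL F x).congr_fderiv (by ext; simp)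

/-- Any `card σ + 1` polynomials in `card σ` variables are algebraically dependent, with a
quantitative bound for the degrees. -/
lemma exists_algebraic_relation (F : σ → MvPolynomial σ ℝ) (h : MvPolynomial σ ℝ) {D K : ℕ}
    (hF : ∀ i, (F i).totalDegree ≤ D) (hh : h.totalDegree ≤ 1)
    (hK : (Fintype.card σ * D + 1) ^ Fintype.card σ ≤ K) :
    ∃ c : (σ → Fin (K + 1)) × Fin (K + 1) → ℝ, c ≠ 0 ∧
      ∑ a, c a • ((∏ i, F i ^ (a.1 i : ℕ)) * h ^ (a.2 : ℕ)) = 0 := by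
  set N := Fintype.card σ
  set E := (N * D + 1) * K with hE
  let Φ : ((σ → Fin (K + 1)) × Fin (K + 1) → ℝ) →ₗ[ℝ] MvPolynomial σ ℝ :=
    Fintype.linearCombination ℝ fun a => (∏ i, F i ^ (a.1 i : ℕ)) * h ^ (a.2 : ℕ)
  let Ψ : MvPolynomial σ ℝ →ₗ[ℝ] ((σ → Fin (E + 1)) → ℝ) :=
    LinearMap.pi fun β => lcoeff ℝ (Finsupp.equivFunOnFinite.symm fun i => (β i : ℕ))
  have hker : LinearMap.ker (Ψ ∘ₗ Φ) ≠ ⊥ := by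
    refine LinearMap.ker_ne_bot_of_finrank_lt ?_
    simp only [Module.finrank_fintype_fun_eq_card, Fintype.card_prod, Fintype.card_fun,
      Fintype.card_fin]
    calc (E + 1) ^ N ≤ ((N * D + 1) * (K + 1)) ^ N := by
          gcongr; rw [hE]; nlinarith
      _ = (N * D + 1) ^ N * (K + 1) ^ N := mul_pow _ _ _
      _ ≤ K * (K + 1) ^ N := by gcongr
      _ < (K + 1) ^ N * (K + 1) := by
          have : 0 < (K + 1) ^ N := by positivity
          nlinarith
  obtain ⟨c, hc, hc0⟩ := Submodule.exists_mem_ne_zero_of_ne_bot hker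
  refine ⟨c, hc0, ?_⟩
  have hdeg : (Φ c).totalDegree ≤ E := by
    simp only [Φ, Fintype.linearCombination_apply]
    refine totalDegree_finsetSum_le fun a _ => ?_
    refine (totalDegree_smul_le _ _).trans ((totalDegree_mul _ _).trans ?_)
    have h1 : (∏ i, F i ^ (a.1 i : ℕ)).totalDegree ≤ N * (K * D) := by
      refine (totalDegree_finsetProd _ _).trans ?_
      refine (Finset.sum_le_card_nsmul _ _ (K * D) fun i _ => ?_).trans
        (by simp [N, Finset.card_univ])
      exact (totalDegree_pow _ _).trans (Nat.mul_le_mul (by have := (a.1 i).2; omega) (hF i))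
    have h2 : (h ^ (a.2 : ℕ)).totalDegree ≤ K * 1 :=
      (totalDegree_pow _ _).trans (Nat.mul_le_mul (by have := a.2.2; omega) hh)
    rw [hE]
    nlinarith
  have hzero : Φ c = 0 := by
    ext m
    rw [coeff_zero]
    by_contra hm
    have hm' := mem_support_iff.2 hm
    have hle : ∀ i, m i < E + 1 := by
      intro i
      have h1 : m i ≤ (Φ c).totalDegree := (monomial_le_degreeOf i hm').trans
        (degreeOf_le_totalDegree _ _)
      omega
    have h2 := congrFun (LinearMap.mem_ker.1 hc) (fun i => ⟨m i, hle i⟩)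
    apply hm
    simp only [Ψ, LinearMap.comp_apply, LinearMap.pi_apply, lcoeff_apply, Pi.zero_apply] at h2
    rwa [show (Finsupp.equivFunOnFinite.symm fun i => m i) = m from by ext; simp] at h2
  simpa [Φ, Fintype.linearCombination_apply] using hzero

lemma exists_separating_form (X : Finset (σ → ℝ)) :
    ∃ h : MvPolynomial σ ℝ, h.totalDegree ≤ 1 ∧
      ∀ x ∈ X, ∀ x' ∈ X, x ≠ x' → eval x h ≠ eval x' h := by
  classical
  let L : (σ → ℝ) × (σ → ℝ) → MvPolynomial σ ℝ := fun z => ∑ i, C (z.1 i - z.2 i) * MvPolynomial.X i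
  have hL : ∀ z ∈ X.offDiag, L z ≠ 0 := by
    intro z hz h0
    apply (Finset.mem_offDiag.1 hz).2.2
    funext i
    have := congrArg (eval (Pi.single i 1)) h0
    simp only [L, map_sum, map_mul, eval_C, eval_X, map_zero] at this
    rw [Finset.sum_eq_single i (by intro b _ hb; simp [hb]) (by simp)] at this
    simp at this
    linarith
  have hne : ∏ z ∈ X.offDiag, L z ≠ 0 := Finset.prod_ne_zero_iff.2 hL
  obtain ⟨w, hw⟩ : ∃ w, eval w (∏ z ∈ X.offDiag, L z) ≠ 0 := by
    by_contra! hcon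
    exact hne (MvPolynomial.funext fun w => by simpa using hcon w)
  refine ⟨∑ i, C (w i) * MvPolynomial.X i, ?_, fun x hx x' hx' hxx' heq => ?_⟩
  · refine totalDegree_finsetSum_le fun i _ => ?_
    exact (totalDegree_mul _ _).trans (by simp)
  · rw [map_prod] at hw
    refine Finset.prod_ne_zero_iff.1 hw (x, x') (Finset.mem_offDiag.2 ⟨hx, hx', hxx'⟩) ?_
    simp only [map_sum, map_mul, eval_C, eval_X, L] at heq ⊢
    rw [← sub_eq_zero, ← Finset.sum_sub_distrib] at heq
    rw [← heq]
    exact Finset.sum_congr rfl fun i _ => by ring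

lemma exists_eval_ne_zero_of_mem_nhds {A : MvPolynomial σ ℝ} (hA : A ≠ 0) {y : σ → ℝ}
    {U : Set (σ → ℝ)} (hU : U ∈ nhds y) : ∃ z ∈ U, eval z A ≠ 0 := by
  by_contra! hcon
  obtain ⟨ρ, hρ, hball⟩ := Metric.mem_nhds_iff.1 hU
  apply hA
  refine MvPolynomial.funext_set (fun i => Metric.ball (y i) ρ)
    (fun i => (Real.ball_eq_Ioo (y i) ρ ▸ Set.Ioo_infinite (by linarith))) fun z hz => ?_
  rw [map_zero]
  refine hcon z (hball ?_)
  rw [ball_pi _ hρ]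
  exact hz

/-- A weak form of Bezout's theorem: the number of nondegenerate zeros of a square polynomial
system is bounded in terms of the degrees. -/
theorem card_nondegenerate_le (F : σ → MvPolynomial σ ℝ) {D : ℕ}
    (hF : ∀ i, (F i).totalDegree ≤ D) (y : σ → ℝ) (X : Finset (σ → ℝ))
    (hX : ∀ x ∈ X, (fun i => eval x (F i)) = y ∧ (jac F x).det ≠ 0) :
    X.card ≤ (Fintype.card σ * D + 1) ^ Fintype.card σ := by
  classical
  obtain ⟨h, hh, hsep⟩ := exists_separating_form X
  set K := (Fintype.card σ * D + 1) ^ Fintype.card σ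
  obtain ⟨c, hc, hrel⟩ := exists_algebraic_relation F h hF hh (le_refl K)
  obtain ⟨⟨a₀, k₀⟩, hk₀⟩ := Function.ne_iff.1 hc
  let A : MvPolynomial σ ℝ :=
    ∑ a : σ → Fin (K + 1), monomial (Finsupp.equivFunOnFinite.symm fun i => (a i : ℕ)) (c (a, k₀))
  have hA : A ≠ 0 := by
    intro h0
    have := congrArg (coeff (Finsupp.equivFunOnFinite.symm fun i => (a₀ i : ℕ))) h0
    simp only [A, coeff_sum, coeff_monomial, coeff_zero] at this
    rw [Finset.sum_eq_single a₀] at this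
    · simp at this; exact hk₀ this
    · intro b _ hb
      rw [if_neg]
      intro h1
      apply hb
      funext i
      have := congrFun (Finsupp.equivFunOnFinite.symm.injective h1) i
      exact Fin.ext this
    · simp
  obtain ⟨U, hU⟩ : ∃ U : (σ → ℝ) → Set ℝ, (∀ x ∈ X, U x ∈ nhds (eval x h)) ∧
      (∀ x ∈ X, ∀ x' ∈ X, x ≠ x' → Disjoint (U x) (U x')) := by
    obtain ⟨V, hV1, hV2⟩ := (X.image fun x => eval x h).finite_toSet.t2_separation
    refine ⟨fun x => V (eval x h), fun x _ => (hV1 _).2.mem_nhds (hV1 _).1,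
      fun x hx x' hx' hxx' => hV2 ?_ ?_ (hsep x hx x' hx' hxx')⟩
    · simpa using ⟨x, hx, rfl⟩
    · simpa using ⟨x', hx', rfl⟩
  have hnhds : (⋂ x ∈ X, (fun z i => eval z (F i)) '' {z | eval z h ∈ U x}) ∈ nhds y := by
    refine (Filter.biInter_finset_mem X).2 fun x hx => ?_
    have h1 := (hasStrictFDerivAt_equiv (hX x hx).2).map_nhds_eq_of_equiv
    rw [(hX x hx).1] at h1
    rw [← h1]
    refine Filter.image_mem_map ?_
    exact (MvPolynomial.continuous_eval h).continuousAt.preimage_mem_nhds (hU.1 x hx)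
  obtain ⟨y', hy', hAy'⟩ := exists_eval_ne_zero_of_mem_nhds hA hnhds
  rw [Set.mem_iInter₂] at hy'
  choose! g hg1 hg2 using hy'
  let R : Polynomial ℝ := ∑ k : Fin (K + 1), Polynomial.C
    (∑ a : σ → Fin (K + 1), c (a, k) * ∏ i, y' i ^ (a i : ℕ)) * Polynomial.X ^ (k : ℕ)
  have hRcoeff : R.coeff k₀ = eval y' A := by
    simp only [R, Polynomial.finsetSum_coeff, Polynomial.coeff_C_mul_X_pow]
    rw [Finset.sum_eq_single k₀]
    · simp [A, eval_monomial, Finsupp.prod_fintype]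
    · intro b _ hb; rw [if_neg]; intro h1; exact hb (Fin.ext h1.symm)
    · simp
  have hR : R ≠ 0 := by
    intro h0; rw [h0] at hRcoeff; exact hAy' (by simpa using hRcoeff.symm)
  have hroot : ∀ x ∈ X, eval (g x) h ∈ R.roots.toFinset := by
    intro x hx
    rw [Multiset.mem_toFinset, Polynomial.mem_roots hR, Polynomial.IsRoot]
    have h1 := congrArg (eval (g x)) hrel
    have h2 : ∀ i, eval (g x) (F i) = y' i := fun i => congrFun (hg2 x hx) i
    simp only [map_sum, smul_eval, map_mul, map_prod, map_pow, h2, map_zero] at h1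
    rw [← h1, Fintype.sum_prod_type_right]
    simp only [R, Polynomial.eval_finsetSum, Polynomial.eval_mul, Polynomial.eval_C,
      Polynomial.eval_pow, Polynomial.eval_X, Finset.sum_mul, mul_assoc]
  have hinj : Set.InjOn (fun x => eval (g x) h) X := by
    intro x hx x' hx' heq
    by_contra hne
    exact Set.disjoint_left.1 (hU.2 x hx x' hx' hne) (hg1 x hx) (by
      have := hg1 x' hx'
      rw [Set.mem_ofPred_eq] at this
      simpa [heq] using this)
  calc X.card ≤ R.roots.toFinset.card := Finset.card_le_card_of_injOn _ hroot hinj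
    _ ≤ R.natDegree := (Multiset.toFinset_card_le _).trans (Polynomial.card_roots' R)
    _ ≤ K := by
      refine Polynomial.natDegree_sum_le_of_forall_le _ _ fun k _ => ?_
      exact (Polynomial.natDegree_C_mul_X_pow_le _ _).trans (by have := k.2; omega)

/-- Change of variables inequality for polynomial maps, using the bound on the multiplicity. -/
theorem lintegral_abs_det_jac_le (F : σ → MvPolynomial σ ℝ) {D : ℕ}
    (hF : ∀ i, (F i).totalDegree ≤ D) {A S : Set (σ → ℝ)} (hA : MeasurableSet A)
    (hS : MeasurableSet S) (hAS : ∀ x ∈ A, (fun i => eval x (F i)) ∈ S) :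
    ∫⁻ x in A, ENNReal.ofReal |(jac F x).det| ≤
      ((Fintype.card σ * D + 1) ^ Fintype.card σ : ℕ) * volume S := by
  classical
  set K := (Fintype.card σ * D + 1) ^ Fintype.card σ
  set f : (σ → ℝ) → σ → ℝ := fun x i => eval x (F i) with hf
  set A' : Set (σ → ℝ) := A ∩ {x | (jac F x).det ≠ 0} with hA'
  have hdm : MeasurableSet {x | (jac F x).det ≠ 0} :=
    (isOpen_ne_fun (continuous_det_jac F) continuous_const).measurableSet
  have hA'm : MeasurableSet A' := hA.inter hdm
  have h1 : ∫⁻ x in A, ENNReal.ofReal |(jac F x).det| =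
      ∫⁻ x in A', ENNReal.ofReal |(jac F x).det| := by
    rw [← lintegral_indicator hA, ← lintegral_indicator hA'm]
    refine lintegral_congr fun x => ?_
    by_cases hx : (jac F x).det = 0
    · simp [Set.indicator, hx]
    · have : x ∈ A' ↔ x ∈ A := ⟨fun h => h.1, fun h => ⟨h, hx⟩⟩
      simp only [Set.indicator, this]
  have hloc : ∀ x ∈ A', ∃ U, IsOpen U ∧ x ∈ U ∧ Set.InjOn f U := by
    intro x hx
    let e := (hasStrictFDerivAt_equiv hx.2).toOpenPartialHomeomorph f
    exact ⟨e.source, e.open_source,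
      (hasStrictFDerivAt_equiv hx.2).mem_toOpenPartialHomeomorph_source, e.injOn⟩
  choose! U hUo hUx hUi using hloc
  obtain ⟨t, htA, htc, ht⟩ := TopologicalSpace.countable_cover_nhdsWithin
    (fun x hx => mem_nhdsWithin_of_mem_nhds ((hUo x hx).mem_nhds (hUx x hx)))
  rcases t.eq_empty_or_nonempty with rfl | hne
  · have : A' = ∅ := by simpa using ht
    rw [h1, this]; simp
  obtain ⟨g, rfl⟩ := htc.exists_eq_range hne
  have hgA : ∀ k, g k ∈ A' := fun k => htA ⟨k, rfl⟩
  set B : ℕ → Set (σ → ℝ) := fun k => A' ∩ disjointed (fun k => U (g k)) k with hB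
  have hBm : ∀ k, MeasurableSet (B k) := fun k =>
    hA'm.inter (MeasurableSet.disjointed (fun k => (hUo _ (hgA k)).measurableSet) k)
  have hBd : Pairwise (Function.onFun Disjoint B) := fun i j hij =>
    (disjoint_disjointed (fun k => U (g k)) hij).mono Set.inter_subset_right Set.inter_subset_right
  have hBU : A' = ⋃ k, B k := by
    rw [hB, ← Set.inter_iUnion, iUnion_disjointed, eq_comm, Set.inter_eq_left]
    simpa using ht
  have hBi : ∀ k, Set.InjOn f (B k) := fun k =>
    (hUi _ (hgA k)).mono (Set.inter_subset_right.trans (disjointed_subset _ _))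
  have hder : ∀ k, ∀ x ∈ B k, HasFDerivWithinAt f (jacL F x) (B k) x := fun k x _ =>
    (hasStrictFDerivAt_jacL F x).hasFDerivAt.hasFDerivWithinAt
  have himm : ∀ k, MeasurableSet (f '' B k) := fun k =>
    measurable_image_of_fderivWithin (hBm k) (hder k) (hBi k)
  have h2 : ∀ k, ∫⁻ x in B k, ENNReal.ofReal |(jac F x).det| = volume (f '' B k) := by
    intro k
    have := lintegral_image_eq_lintegral_abs_det_fderiv_mul volume (hBm k) (hder k) (hBi k)
      (fun _ => 1)
    simp only [lintegral_one, mul_one, det_jacL, Measure.restrict_apply_univ] at this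
    exact this.symm
  rw [h1, hBU, lintegral_iUnion hBm hBd]
  simp only [h2]
  have h3 : ∀ k, volume (f '' B k) = ∫⁻ y, (f '' B k).indicator 1 y := fun k => by
    rw [lintegral_indicator_one (himm k)]
  simp only [h3]
  rw [← lintegral_tsum fun k => (measurable_one.indicator (himm k)).aemeasurable]
  calc ∫⁻ y, ∑' k, (f '' B k).indicator 1 y ≤ ∫⁻ y, S.indicator (fun _ => (K : ENNReal)) y := by
        refine lintegral_mono fun y => ?_
        by_cases hy : y ∈ S
        · rw [Set.indicator_of_mem hy]
          refine ENNReal.summable.tsum_le_of_sum_le fun s => ?_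
          set s' := s.filter fun k => y ∈ f '' B k
          have h4 : ∀ k ∈ s', ∃ x ∈ B k, f x = y := fun k hk => (Finset.mem_filter.1 hk).2
          choose! x hx hxy using h4
          have h5 : (s'.image x).card ≤ K := by
            refine card_nondegenerate_le F hF y _ fun z hz => ?_
            obtain ⟨k, hk, rfl⟩ := Finset.mem_image.1 hz
            exact ⟨hxy k hk, (hx k hk).1.2⟩
          rw [Finset.card_image_of_injOn] at h5
          · calc ∑ k ∈ s, (f '' B k).indicator (1 : (σ → ℝ) → ENNReal) y = ∑ k ∈ s', 1 := by
                  simp only [Set.indicator, Pi.one_apply, Finset.sum_ite, Finset.sum_const_zero,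
                    add_zero, s']
              _ = (s'.card : ENNReal) := by simp
              _ ≤ K := by exact_mod_cast h5
          · intro i hi j hj hij
            by_contra hne
            exact Set.disjoint_left.1 (hBd hne) (hx i hi) (by rw [hij]; exact hx j hj)
        · rw [Set.indicator_of_notMem hy, nonpos_iff_eq_zero, ENNReal.tsum_eq_zero]
          intro k
          rw [Set.indicator_of_notMem]
          rintro ⟨x, hx, rfl⟩
          exact hy (hAS x hx.1.1)
    _ = K * volume S := lintegral_indicator_const hS _

end Bezout

end PolyCalc

end

section

open MeasureTheory

namespace PolyCalc

open MvPolynomial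

section Wolff

lemma totalDegree_aeval_le {σ τ : Type*} (f : σ → MvPolynomial τ ℝ)
    (hf : ∀ j, (f j).totalDegree ≤ 1) (P : MvPolynomial σ ℝ) :
    (aeval f P).totalDegree ≤ P.totalDegree := by
  rw [aeval_def, eval₂_eq]
  refine totalDegree_finsetSum_le fun m hm => ?_
  refine (totalDegree_mul _ _).trans ?_
  rw [show (algebraMap ℝ (MvPolynomial τ ℝ)) (coeff m P) = C (coeff m P) from rfl,
    totalDegree_C, zero_add]
  refine (totalDegree_finsetProd _ _).trans ?_
  refine le_trans (Finset.sum_le_sum fun j _ => ?_) (le_totalDegree hm)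
  exact (totalDegree_pow _ _).trans ((Nat.mul_le_mul_left _ (hf j)).trans (mul_one _).le)

lemma abs_det_le_sum {m : Type*} [Fintype m] [DecidableEq m] (A H : Matrix m m ℝ)
    {t : Fin (Fintype.card m + 1) → ℝ} (ht : Function.Injective t) :
    |H.det| ≤ ∑ i, (∏ j ∈ Finset.univ.erase i, |t i - t j|)⁻¹ * |(A - t i • H).det| := by
  set P : Polynomial ℝ := Matrix.det ((Polynomial.X : Polynomial ℝ) • (-H).map Polynomial.C +
    A.map Polynomial.C) with hP
  have hdeg : P.degree < (Finset.univ : Finset (Fin (Fintype.card m + 1))).card := by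
    rw [Finset.card_fin]
    refine lt_of_le_of_lt Polynomial.degree_le_natDegree ?_
    exact_mod_cast Nat.lt_succ_of_le (Polynomial.natDegree_det_X_add_C_le (-H) A)
  have h1 := Lagrange.coeff_eq_sum (s := Finset.univ) ht.injOn hdeg
  rw [Finset.card_fin, Nat.add_sub_cancel, hP, Polynomial.coeff_det_X_add_C_card, ← hP] at h1
  have heval : ∀ s : ℝ, P.eval s = (A - s • H).det := by
    intro s
    rw [hP, ← Polynomial.coe_evalRingHom, RingHom.map_det]
    congr 1
    ext i j
    simp [Matrix.map_apply]
    ring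
  calc |H.det| = |(-H).det| := by rw [Matrix.det_neg]; simp [abs_mul]
    _ ≤ ∑ i, |P.eval (t i) / ∏ j ∈ Finset.univ.erase i, (t i - t j)| := by
        rw [h1]; exact Finset.abs_sum_le_sum_abs _ _
    _ = _ := by
        refine Finset.sum_congr rfl fun i _ => ?_
        rw [abs_div, Finset.abs_prod, heval, div_eq_inv_mul]

variable {d : ℕ}

/-- Substitution of the point at height `s` of the line with slope `X (inl ·)` and base point
`X (inr ·)`. -/
noncomputable def lineSub (s : ℝ) (P : MvPolynomial (Fin (d + 1)) ℝ) :
    MvPolynomial (Fin d ⊕ Fin d) ℝ :=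
  aeval (Fin.cons (C s) fun j => X (Sum.inr j) + C s * X (Sum.inl j)) P

lemma eval_lineSub (s : ℝ) (P : MvPolynomial (Fin (d + 1)) ℝ) (v a : Fin d → ℝ) :
    eval (Sum.elim v a) (lineSub s P) = eval (Fin.cons s (a + s • v)) P := by
  have h : (aeval (R := ℝ) (Sum.elim v a)).comp
      (aeval (R := ℝ) (Fin.cons (C s) fun j => X (Sum.inr j) + C s * X (Sum.inl j) :
        Fin (d + 1) → MvPolynomial (Fin d ⊕ Fin d) ℝ))
      = aeval (R := ℝ) (Fin.cons s (a + s • v) : Fin (d + 1) → ℝ) := by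
    ext j
    refine Fin.cases ?_ (fun j => ?_) j
    · simp
    · simp
  have := DFunLike.congr_fun h P
  rw [AlgHom.comp_apply, aeval_eq_eval, aeval_eq_eval] at this
  exact this

lemma totalDegree_lineSub_le (s : ℝ) (P : MvPolynomial (Fin (d + 1)) ℝ) :
    (lineSub s P).totalDegree ≤ P.totalDegree := by
  refine totalDegree_aeval_le _ (fun j => ?_) P
  refine Fin.cases ?_ (fun j => ?_) j
  · simp
  · simp only [Fin.cons_succ]
    refine (totalDegree_add _ _).trans (max_le (by simp) ?_)
    exact (totalDegree_mul _ _).trans (by simp)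

lemma hasFDerivAt_eval_elim (P : MvPolynomial (Fin d ⊕ Fin d) ℝ) (v a : Fin d → ℝ) :
    HasFDerivAt (fun a => eval (Sum.elim v a) P)
      (∑ j, eval (Sum.elim v a) (pderiv (Sum.inr j) P) •
        (ContinuousLinearMap.proj j : (Fin d → ℝ) →L[ℝ] ℝ)) a := by
  have h1 : HasFDerivAt (fun a : Fin d → ℝ => (Sum.elim v a : Fin d ⊕ Fin d → ℝ))
      (ContinuousLinearMap.pi (Sum.elim (fun _ => (0 : (Fin d → ℝ) →L[ℝ] ℝ))
        fun j => (ContinuousLinearMap.proj j : (Fin d → ℝ) →L[ℝ] ℝ))) a := by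
    rw [hasFDerivAt_pi]
    rintro (j | j)
    · exact hasFDerivAt_const _ _
    · exact (ContinuousLinearMap.proj j : (Fin d → ℝ) →L[ℝ] ℝ).hasFDerivAt
  refine ((hasFDerivAt_eval P (Sum.elim v a)).comp a h1).congr_fderiv ?_
  ext w
  simp [Fintype.sum_sum_type]

/-- The system cutting out the points of a critical section above a slice. -/
noncomputable def sliceSystem (s : ℝ) (G : MvPolynomial (Fin d ⊕ Fin d) ℝ) :
    Fin d ⊕ Fin d → MvPolynomial (Fin d ⊕ Fin d) ℝ :=
  Sum.elim (fun j => X (Sum.inr j) + C s * X (Sum.inl j)) fun j => pderiv (Sum.inr j) G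

/-- The partial Hessian of `G` in the last variables. -/
noncomputable def hess (G : MvPolynomial (Fin d ⊕ Fin d) ℝ) (x : Fin d ⊕ Fin d → ℝ) :
    Matrix (Fin d) (Fin d) ℝ :=
  Matrix.of fun i j => eval x (pderiv (Sum.inr j) (pderiv (Sum.inr i) G))

/-- The mixed second derivatives of `G`. -/
noncomputable def mixedHess (G : MvPolynomial (Fin d ⊕ Fin d) ℝ) (x : Fin d ⊕ Fin d → ℝ) :
    Matrix (Fin d) (Fin d) ℝ :=
  Matrix.of fun i j => eval x (pderiv (Sum.inl j) (pderiv (Sum.inr i) G))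

lemma abs_det_jac_sliceSystem (s : ℝ) (G : MvPolynomial (Fin d ⊕ Fin d) ℝ)
    (x : Fin d ⊕ Fin d → ℝ) :
    |(jac (sliceSystem s G) x).det| = |(mixedHess G x - s • hess G x).det| := by
  have h : (jac (sliceSystem s G) x).submatrix (Equiv.refl _) (Equiv.sumComm (Fin d) (Fin d)) =
      Matrix.fromBlocks 1 (s • (1 : Matrix (Fin d) (Fin d) ℝ)) (hess G x) (mixedHess G x) := by
    ext (i | i) (j | j)
    · simp [jac, sliceSystem, pderiv_X, Matrix.one_apply, Pi.single_apply]
    · simp [jac, sliceSystem, pderiv_X, Matrix.one_apply, Pi.single_apply]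
      split_ifs <;> simp
    · simp [jac, sliceSystem, hess]
    · simp [jac, sliceSystem, mixedHess]
  rw [← Matrix.abs_det_submatrix_equiv_equiv (Equiv.refl _) (Equiv.sumComm (Fin d) (Fin d)), h,
    Matrix.det_fromBlocks_one₁₁]
  simp

lemma totalDegree_sliceSystem_le (s : ℝ) (G : MvPolynomial (Fin d ⊕ Fin d) ℝ)
    (i : Fin d ⊕ Fin d) : (sliceSystem s G i).totalDegree ≤ G.totalDegree + 1 := by
  rcases i with j | j
  · refine le_trans ((totalDegree_add _ _).trans (max_le (by simp) ?_)) (Nat.le_add_left 1 _)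
    exact (totalDegree_mul _ _).trans (by simp)
  · exact (totalDegree_pderiv_le _ _).trans (by omega)

lemma volume_sum_inter_le (A : Set (Fin d → ℝ)) {ρ : ℝ} (hρ : 0 < ρ) :
    volume {w : Fin d ⊕ Fin d → ℝ | (fun j => w (Sum.inl j)) ∈ A ∧ ∀ j, |w (Sum.inr j)| < ρ} =
      volume A * ENNReal.ofReal (2 * ρ) ^ d := by
  have h := volume_measurePreserving_sumPiEquivProdPi (fun _ : Fin d ⊕ Fin d => ℝ)
  have hset : {w : Fin d ⊕ Fin d → ℝ | (fun j => w (Sum.inl j)) ∈ A ∧ ∀ j, |w (Sum.inr j)| < ρ} =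
      MeasurableEquiv.sumPiEquivProdPi (fun _ : Fin d ⊕ Fin d => ℝ) ⁻¹'
        (A ×ˢ Metric.ball (0 : Fin d → ℝ) ρ) := by
    ext w
    rw [Set.mem_preimage, Set.mem_prod, mem_ball_zero_iff, pi_norm_lt_iff hρ]
    rfl
  rw [hset, h.measure_preimage_equiv, Measure.volume_eq_prod, Measure.prod_prod,
    Real.volume_pi_ball _ hρ]
  rw [Fintype.card_fin, ENNReal.ofReal_pow (by positivity)]

/-- Small values are taken by the gradient of a polynomial that is positive on a bounded domain
and vanishes at the boundary. -/
lemma exists_gradient_eq {κ : Type*} [Fintype κ] (f : κ → MvPolynomial (Fin d ⊕ Fin d) ℝ)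
    (v : Fin d → ℝ) (hne : ∃ a, ∀ k, 0 < eval (Sum.elim v a) (f k))
    (hb : Bornology.IsBounded {a : Fin d → ℝ | ∀ k, 0 < eval (Sum.elim v a) (f k)}) :
    ∃ ρ > 0, ∀ c : Fin d → ℝ, (∀ j, |c j| < ρ) → ∃ a, (∀ k, 0 < eval (Sum.elim v a) (f k)) ∧
      ∀ j, eval (Sum.elim v a) (pderiv (Sum.inr j) (∏ k, f k)) = c j := by
  set Ω : Set (Fin d → ℝ) := {a | ∀ k, 0 < eval (Sum.elim v a) (f k)} with hΩ
  have hcont : ∀ P : MvPolynomial (Fin d ⊕ Fin d) ℝ, Continuous fun a => eval (Sum.elim v a) P :=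
    fun P => continuous_iff_continuousAt.2 fun a => (hasFDerivAt_eval_elim P v a).continuousAt
  have hopen : IsOpen Ω := by
    have : Ω = ⋂ k, {a | 0 < eval (Sum.elim v a) (f k)} := by ext; simp [hΩ]
    rw [this]
    exact isOpen_iInter_of_finite fun k => isOpen_lt continuous_const (hcont _)
  have hcomp : IsCompact (closure Ω) := hb.isCompact_closure
  have hclos : ∀ a ∈ closure Ω, ∀ k, 0 ≤ eval (Sum.elim v a) (f k) := by
    intro a ha k
    have : closure Ω ⊆ {a | 0 ≤ eval (Sum.elim v a) (f k)} :=
      closure_minimal (fun a ha => (ha k).le) (isClosed_le continuous_const (hcont _))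
    exact this ha
  obtain ⟨a₀, ha₀⟩ := hne
  set G := ∏ k, f k with hG
  have hGpos : 0 < eval (Sum.elim v a₀) G := by
    rw [hG, map_prod]; exact Finset.prod_pos fun k _ => ha₀ k
  obtain ⟨R, hRpos, hR⟩ : ∃ R > 0, ∀ a ∈ closure Ω, ‖a‖ ≤ R := by
    obtain ⟨R, hR⟩ := hcomp.isBounded.exists_norm_le
    exact ⟨max R 1, by positivity, fun a ha => (hR a ha).trans (le_max_left _ _)⟩
  set m := eval (Sum.elim v a₀) G
  refine ⟨m / (2 * d * R + 1) / 2, by positivity, fun c hc => ?_⟩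
  set ρ := m / (2 * d * R + 1) / 2 with hρ
  have hin : ∀ a ∈ closure Ω, |∑ j, c j * a j| ≤ d * (ρ * R) := by
    intro a ha
    refine (Finset.abs_sum_le_sum_abs _ _).trans ?_
    refine (Finset.sum_le_card_nsmul _ _ (ρ * R) fun j _ => ?_).trans (by simp)
    rw [abs_mul]
    have h1 : |a j| ≤ R := (norm_le_pi_norm a j).trans (hR a ha)
    have := (hc j).le
    gcongr
  have hsmall : 2 * (d * (ρ * R)) < m := by
    have hpos : 0 < 2 * d * R + 1 := by positivity
    have h2 : ρ * (2 * d * R + 1) = m / 2 := by rw [hρ]; field_simp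
    have h3 : 0 < ρ := by positivity
    nlinarith
  obtain ⟨a, ha, hmax⟩ := hcomp.exists_isMaxOn ⟨a₀, subset_closure ha₀⟩
    (f := fun a => eval (Sum.elim v a) G - ∑ j, c j * a j)
    ((hcont G).sub (by fun_prop)).continuousOn
  have hmem : a ∈ Ω := by
    by_contra hnot
    obtain ⟨k, hk⟩ : ∃ k, eval (Sum.elim v a) (f k) ≤ 0 := by
      by_contra! hcon; exact hnot hcon
    have h0 : eval (Sum.elim v a) G = 0 := by
      rw [hG, map_prod]
      exact Finset.prod_eq_zero (Finset.mem_univ k) (le_antisymm hk (hclos a ha k))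
    have h1 := hmax (subset_closure ha₀ : a₀ ∈ closure Ω)
    simp only [Set.mem_ofPred_eq, h0] at h1
    have h2 := abs_le.1 (hin a ha)
    have h3 := abs_le.1 (hin a₀ (subset_closure ha₀))
    linarith [h2.1, h3.2]
  refine ⟨a, hmem, fun j => ?_⟩
  have hloc : IsLocalMax (fun a => eval (Sum.elim v a) G - ∑ j, c j * a j) a :=
    hmax.isLocalMax (Filter.mem_of_superset (hopen.mem_nhds hmem) subset_closure)
  have hd : HasFDerivAt (fun a : Fin d → ℝ => ∑ j, c j * a j)
      (∑ j, c j • (ContinuousLinearMap.proj j : (Fin d → ℝ) →L[ℝ] ℝ)) a :=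
    HasFDerivAt.fun_sum fun j _ =>
      ((ContinuousLinearMap.proj j : (Fin d → ℝ) →L[ℝ] ℝ).hasFDerivAt).const_mul (c j)
  have hz := hloc.hasFDerivAt_eq_zero ((hasFDerivAt_eval_elim G v a).sub hd)
  have := DFunLike.congr_fun hz (Pi.single j 1)
  simp only [sub_apply, sum_apply, smul_apply, ContinuousLinearMap.proj_apply, smul_eq_mul,
    zero_apply] at this
  rw [Finset.sum_eq_single j (by intro b _ hb; simp [hb]) (by simp),
    Finset.sum_eq_single j (by intro b _ hb; simp [hb]) (by simp)] at this
  simp at this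
  linarith

lemma hasFDerivAt_gradient (G : MvPolynomial (Fin d ⊕ Fin d) ℝ) (v a : Fin d → ℝ) :
    HasFDerivAt (fun a => fun i => eval (Sum.elim v a) (pderiv (Sum.inr i) G))
      (LinearMap.toContinuousLinearMap (Matrix.toLin' (hess G (Sum.elim v a)))) a := by
  rw [hasFDerivAt_pi']
  intro i
  refine (hasFDerivAt_eval_elim (pderiv (Sum.inr i) G) v a).congr_fderiv ?_
  ext w
  simp [hess, Matrix.toLin'_apply, Matrix.mulVec, dotProduct, sum_apply]

/-- If all small vectors are values of the gradient in the domain, the integral of the Hessian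
determinant is bounded below. -/
lemma le_lintegral_abs_det_hess (G : MvPolynomial (Fin d ⊕ Fin d) ℝ) (v : Fin d → ℝ)
    {A : Set (Fin d → ℝ)} (hA : MeasurableSet A) {ρ : ℝ} (hρ : 0 < ρ)
    (h : ∀ c : Fin d → ℝ, (∀ j, |c j| < ρ) → ∃ a ∈ A,
      ∀ j, eval (Sum.elim v a) (pderiv (Sum.inr j) G) = c j) :
    ENNReal.ofReal (2 * ρ) ^ d ≤
      ∫⁻ a in A, ENNReal.ofReal |(hess G (Sum.elim v a)).det| := by
  have h1 := addHaar_image_le_lintegral_abs_det_fderiv volume hA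
    (f := fun a => fun i => eval (Sum.elim v a) (pderiv (Sum.inr i) G))
    (fun a _ => (hasFDerivAt_gradient G v a).hasFDerivWithinAt)
  have h2 : Metric.ball (0 : Fin d → ℝ) ρ ⊆
      (fun a => fun i => eval (Sum.elim v a) (pderiv (Sum.inr i) G)) '' A := by
    intro c hc
    rw [mem_ball_zero_iff, pi_norm_lt_iff hρ] at hc
    obtain ⟨a, ha, hac⟩ := h c hc
    exact ⟨a, ha, funext hac⟩
  refine le_trans ?_ (h1.trans (le_of_eq ?_))
  · refine le_trans (le_of_eq ?_) (measure_mono h2)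
    rw [Real.volume_pi_ball _ hρ, Fintype.card_fin, ENNReal.ofReal_pow (by positivity)]
  · refine lintegral_congr fun a => ?_
    rw [ContinuousLinearMap.det]
    simp [LinearMap.det_toLin']

/-- Lines contained in a semialgebraic set at finitely many heights: the measure of the set of
slopes is controlled by the measures of the slices. -/
theorem volume_slopes_le {ι : Type*} [Fintype ι] {D : ℕ}
    (g : ι → MvPolynomial (Fin (d + 1)) ℝ) (hg : ∀ j, (g j).totalDegree ≤ D)
    (hb : Bornology.IsBounded {x : Fin (d + 1) → ℝ | ∀ j, 0 < eval x (g j)})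
    {t : Fin (d + 1) → ℝ} (ht : Function.Injective t) :
    volume {v : Fin d → ℝ | ∃ a : Fin d → ℝ, ∀ i j, 0 < eval (Fin.cons (t i) (a + t i • v)) (g j)} ≤
      ((2 * d * ((d + 1) * Fintype.card ι * D + 1) + 1) ^ (2 * d) : ℕ) *
        ∑ i, ENNReal.ofReal (∏ j ∈ Finset.univ.erase i, |t i - t j|)⁻¹ *
          volume {y : Fin d → ℝ | ∀ j, 0 < eval (Fin.cons (t i) y) (g j)} := by
  classical
  set f : Fin (d + 1) × ι → MvPolynomial (Fin d ⊕ Fin d) ℝ := fun q => lineSub (t q.1) (g q.2)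
    with hf
  set G := ∏ q, f q with hG
  have hGdeg : G.totalDegree ≤ (d + 1) * Fintype.card ι * D := by
    refine (totalDegree_finsetProd _ _).trans ?_
    refine (Finset.sum_le_card_nsmul _ _ D fun q _ =>
      (totalDegree_lineSub_le _ _).trans (hg _)).trans ?_
    simp
  have hcont : ∀ P : MvPolynomial (Fin d ⊕ Fin d) ℝ, Continuous fun x => eval x P :=
    fun P => P.continuous_eval
  have hfv : ∀ v a : Fin d → ℝ, (∀ q, 0 < eval (Sum.elim v a) (f q)) ↔
      ∀ i j, 0 < eval (Fin.cons (t i) (a + t i • v)) (g j) := by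
    intro v a
    simp only [hf, eval_lineSub, Prod.forall]
  set slice : Fin (d + 1) → Set (Fin d → ℝ) :=
    fun i => {y | ∀ j, 0 < eval (Fin.cons (t i) y) (g j)} with hslice
  have hsliceM : ∀ i, MeasurableSet (slice i) := by
    intro i
    have : slice i = ⋂ j, {y | 0 < eval (Fin.cons (t i) y) (g j)} := by ext; simp [hslice]
    rw [this]
    refine MeasurableSet.iInter fun j => (isOpen_lt continuous_const ?_).measurableSet
    exact (g j).continuous_eval.comp (by fun_prop)
  set Ω : ℝ → Set (Fin d ⊕ Fin d → ℝ) := fun ρ =>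
    {x | (∀ q, 0 < eval x (f q)) ∧ ∀ j, |eval x (pderiv (Sum.inr j) G)| < ρ} with hΩ
  have hΩM : ∀ ρ, MeasurableSet (Ω ρ) := by
    intro ρ
    have : Ω ρ = (⋂ q, {x | 0 < eval x (f q)}) ∩
        ⋂ j, {x | |eval x (pderiv (Sum.inr j) G)| < ρ} := by ext; simp [hΩ]
    rw [this]
    refine (MeasurableSet.iInter fun q => (isOpen_lt continuous_const
        (hcont _)).measurableSet).inter
      (MeasurableSet.iInter fun j => (isOpen_lt (hcont _).abs continuous_const).measurableSet)
  set K : ℕ := (2 * d * ((d + 1) * Fintype.card ι * D + 1) + 1) ^ (2 * d) with hK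
  set weight : Fin (d + 1) → ENNReal := fun i =>
    ENNReal.ofReal (∏ j ∈ Finset.univ.erase i, |t i - t j|)⁻¹ with hweight
  have upper : ∀ ρ > 0, ∫⁻ x in Ω ρ, ENNReal.ofReal |(hess G x).det| ≤
      (K * ∑ i, weight i * volume (slice i)) * ENNReal.ofReal (2 * ρ) ^ d := by
    intro ρ hρ
    have hpt : ∀ x, ENNReal.ofReal |(hess G x).det| ≤
        ∑ i, weight i * ENNReal.ofReal |(jac (sliceSystem (t i) G) x).det| := by
      intro x
      have hcard : Fintype.card (Fin d) + 1 = d + 1 := by simp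
      have h := abs_det_le_sum (m := Fin d) (mixedHess G x) (hess G x)
        (t := fun i => t (finCongr hcard i)) (ht.comp (finCongr hcard).injective)
      have h' : |(hess G x).det| ≤ ∑ i : Fin (d + 1), (∏ j ∈ Finset.univ.erase i, |t i - t j|)⁻¹ *
          |(jac (sliceSystem (t i) G) x).det| := by
        refine h.trans (le_of_eq ?_)
        refine Fintype.sum_equiv (finCongr hcard) _ _ fun i => ?_
        rw [abs_det_jac_sliceSystem]
        congr 2
        refine Finset.prod_equiv (finCongr hcard) (fun j => ?_) (fun j _ => rfl)
        simp
      refine (ENNReal.ofReal_le_ofReal h').trans (le_of_eq ?_)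
      rw [ENNReal.ofReal_sum_of_nonneg (fun i _ => by positivity)]
      refine Finset.sum_congr rfl fun i _ => ?_
      rw [ENNReal.ofReal_mul (by positivity)]
    have hmeas : ∀ i, Measurable fun x =>
        ENNReal.ofReal |(jac (sliceSystem (t i) G) x).det| := fun i =>
      ENNReal.measurable_ofReal.comp (continuous_det_jac _).abs.measurable
    calc _ ≤ ∫⁻ x in Ω ρ, ∑ i, weight i * ENNReal.ofReal |(jac (sliceSystem (t i) G) x).det| :=
          lintegral_mono hpt
      _ = ∑ i, weight i * ∫⁻ x in Ω ρ, ENNReal.ofReal |(jac (sliceSystem (t i) G) x).det| := by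
          rw [lintegral_finsetSum _ fun i _ => (hmeas i).const_mul _]
          exact Finset.sum_congr rfl fun i _ => lintegral_const_mul _ (hmeas i)
      _ ≤ ∑ i, weight i * (K * (volume (slice i) * ENNReal.ofReal (2 * ρ) ^ d)) := by
          refine Finset.sum_le_sum fun i _ => mul_le_mul_right ?_ _
          rw [← volume_sum_inter_le _ hρ]
          have h := lintegral_abs_det_jac_le (sliceSystem (t i) G)
            (D := (d + 1) * Fintype.card ι * D + 1)
            (fun j => (totalDegree_sliceSystem_le _ _ _).trans (by omega)) (hΩM ρ)
            (S := {w : Fin d ⊕ Fin d → ℝ | (fun j => w (Sum.inl j)) ∈ slice i ∧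
              ∀ j, |w (Sum.inr j)| < ρ}) ?_ ?_
          · refine h.trans (le_of_eq ?_)
            rw [hK]
            congr 2
            simp [two_mul]
          · have : {w : Fin d ⊕ Fin d → ℝ | (fun j => w (Sum.inl j)) ∈ slice i ∧
                ∀ j, |w (Sum.inr j)| < ρ} = ((fun w j => w (Sum.inl j)) ⁻¹' slice i) ∩
                ⋂ j, {w | |w (Sum.inr j)| < ρ} := by ext; simp
            rw [this]
            exact ((hsliceM i).preimage (by fun_prop)).inter (MeasurableSet.iInter fun j =>
                (isOpen_lt (by fun_prop) continuous_const).measurableSet)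
          · intro x hx
            obtain ⟨hx1, hx2⟩ := hx
            refine ⟨?_, fun j => by simpa [sliceSystem] using hx2 j⟩
            have hxe : x = Sum.elim (fun j => x (Sum.inl j)) (fun j => x (Sum.inr j)) := by
              ext (j | j) <;> rfl
            rw [hxe, hfv] at hx1
            intro j
            convert hx1 i j using 3
            ext l
            simp [sliceSystem]
            rfl
      _ = _ := by
          rw [Finset.mul_sum, Finset.sum_mul]
          exact Finset.sum_congr rfl fun i _ => by ring
  have hne : ∀ v, (∃ a : Fin d → ℝ, ∀ i j, 0 < eval (Fin.cons (t i) (a + t i • v)) (g j)) →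
      ∃ ρ > 0, ∀ c : Fin d → ℝ, (∀ j, |c j| < ρ) → ∃ a, (∀ q, 0 < eval (Sum.elim v a) (f q)) ∧
      ∀ j, eval (Sum.elim v a) (pderiv (Sum.inr j) G) = c j := by
    intro v hv
    refine exists_gradient_eq f v ?_ ?_
    · obtain ⟨a, ha⟩ := hv
      exact ⟨a, (hfv v a).2 ha⟩
    · obtain ⟨R, hR⟩ := hb.exists_norm_le
      refine (Metric.isBounded_closedBall (x := - (t 0 • v)) (r := max R 0)).subset fun a ha => ?_
      have h1 := hR _ (fun j => (hfv v a).1 ha 0 j)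
      rw [Metric.mem_closedBall, dist_eq_norm, sub_neg_eq_add]
      rw [pi_norm_le_iff_of_nonneg (le_max_right _ _)]
      intro l
      refine le_trans ?_ (h1.trans (le_max_left _ _))
      have := norm_le_pi_norm (Fin.cons (t 0) (a + t 0 • v) : Fin (d + 1) → ℝ) l.succ
      simpa using this
  set V : ℕ → Set (Fin d → ℝ) := fun k =>
    {v | ENNReal.ofReal (2 * (1 / ((k : ℝ) + 1))) ^ d ≤
      ∫⁻ a, (Ω (1 / ((k : ℝ) + 1))).indicator (fun x => ENNReal.ofReal |(hess G x).det|)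
        (Sum.elim v a)} with hV
  set I : ℝ → (Fin d ⊕ Fin d → ℝ) → ENNReal := fun ρ =>
    (Ω ρ).indicator (fun x => ENNReal.ofReal |(hess G x).det|) with hI
  have hIM : ∀ ρ, Measurable (I ρ) := by
    intro ρ
    refine Measurable.indicator ?_ (hΩM ρ)
    refine ENNReal.measurable_ofReal.comp (Continuous.measurable ?_)
    refine Continuous.abs (Continuous.matrix_det ?_)
    exact continuous_matrix fun i j => hcont _
  have hmp := volume_measurePreserving_sumPiEquivProdPi_symm (fun _ : Fin d ⊕ Fin d => ℝ)
  have hsym : ∀ q : (Fin d → ℝ) × (Fin d → ℝ),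
      (MeasurableEquiv.sumPiEquivProdPi (fun _ : Fin d ⊕ Fin d => ℝ)).symm q =
        Sum.elim q.1 q.2 := by
    intro q
    ext (j | j) <;> rfl
  have hIM2 : ∀ ρ, Measurable fun q : (Fin d → ℝ) × (Fin d → ℝ) => I ρ (Sum.elim q.1 q.2) := by
    intro ρ
    have h : (fun q : (Fin d → ℝ) × (Fin d → ℝ) => I ρ (Sum.elim q.1 q.2)) =
        I ρ ∘ (MeasurableEquiv.sumPiEquivProdPi (fun _ : Fin d ⊕ Fin d => ℝ)).symm :=
      funext fun q => by simp only [Function.comp, hsym]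
    rw [h]
    exact (hIM ρ).comp hmp.measurable
  have hfub : ∀ ρ, ∫⁻ v, ∫⁻ a, I ρ (Sum.elim v a) =
      ∫⁻ x in Ω ρ, ENNReal.ofReal |(hess G x).det| := by
    intro ρ
    rw [← lintegral_indicator (hΩM ρ), ← hmp.lintegral_comp (hIM ρ), Measure.volume_eq_prod,
      lintegral_prod _ (by exact ((hIM ρ).comp hmp.measurable).aemeasurable)]
    simp only [hsym]
  have hVk : ∀ k, volume (V k) ≤ K * ∑ i, weight i * volume (slice i) := by
    intro k
    have hk : (0 : ℝ) < 1 / ((k : ℝ) + 1) := by positivity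
    have h1 := mul_meas_ge_le_lintegral (μ := (volume : Measure (Fin d → ℝ)))
      (Measurable.lintegral_prod_right' (ν := (volume : Measure (Fin d → ℝ)))
        (hIM2 (1 / ((k : ℝ) + 1))))
      (ENNReal.ofReal (2 * (1 / ((k : ℝ) + 1))) ^ d)
    have h2 := h1.trans ((hfub _).le.trans (upper _ hk))
    rw [mul_comm] at h2
    refine (ENNReal.mul_le_mul_iff_left ?_ ?_).1 h2
    · exact pow_ne_zero _ (by rw [Ne, ENNReal.ofReal_eq_zero]; push Not; positivity)
    · exact ENNReal.pow_ne_top ENNReal.ofReal_ne_top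
  set W : ℕ → Set (Fin d → ℝ) := fun k => {v | ∀ c : Fin d → ℝ, (∀ j, |c j| < 1 / ((k : ℝ) + 1)) →
      ∃ a, (∀ q, 0 < eval (Sum.elim v a) (f q)) ∧
      ∀ j, eval (Sum.elim v a) (pderiv (Sum.inr j) G) = c j} with hW
  have hWV : ∀ k, W k ⊆ V k := by
    intro k v hv
    have hk : (0 : ℝ) < 1 / ((k : ℝ) + 1) := by positivity
    have hmv : Measurable fun a : Fin d → ℝ => (Sum.elim v a : Fin d ⊕ Fin d → ℝ) := by
      refine measurable_pi_iff.2 ?_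
      rintro (j | j)
      · exact measurable_const
      · exact measurable_pi_apply j
    have h := le_lintegral_abs_det_hess G v
      (A := (fun a => Sum.elim v a) ⁻¹' Ω (1 / ((k : ℝ) + 1))) ((hΩM _).preimage hmv) hk ?_
    · refine h.trans (le_of_eq ?_)
      rw [← lintegral_indicator ((hΩM _).preimage hmv)]
      rfl
    · intro c hc
      obtain ⟨a, ha1, ha2⟩ := hv c hc
      exact ⟨a, ⟨ha1, fun j => by rw [ha2]; exact hc j⟩, ha2⟩
  have hmono : Monotone W := by
    intro k l hkl v hv c hc
    refine hv c fun j => (hc j).trans_le ?_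
    gcongr
  calc _ ≤ volume (⋃ k, W k) := by
        refine measure_mono fun v hv => ?_
        obtain ⟨ρ, hρ, h⟩ := hne v hv
        obtain ⟨k, hk⟩ := exists_nat_one_div_lt hρ
        exact Set.mem_iUnion.2 ⟨k, fun c hc => h c fun j => (hc j).trans hk⟩
    _ = ⨆ k, volume (W k) := hmono.measure_iUnion
    _ ≤ _ := iSup_le fun k => (measure_mono (hWV k)).trans (hVk k)

end Wolff

end PolyCalc

end

section

open MeasureTheory
open scoped ENNReal

namespace Kakeya

section Broad

variable {ι γ : Type*} [DecidableEq γ]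

/-- The number of elements of `X` outside the best choice of at most `A` caps. -/
noncomputable def broad (cap : ι → γ) (A : ℕ) (X : Finset ι) : ℕ :=
  sInf {m | ∃ V : Finset γ, V.card ≤ A ∧ (X.filter fun i => cap i ∉ V).card = m}

variable {cap : ι → γ} {A B : ℕ} {X X' : Finset ι}

lemma broad_le {V : Finset γ} (hV : V.card ≤ A) :
    broad cap A X ≤ (X.filter fun i => cap i ∉ V).card :=
  Nat.sInf_le ⟨V, hV, rfl⟩

lemma exists_broad_eq (cap : ι → γ) (A : ℕ) (X : Finset ι) :
    ∃ V : Finset γ, V.card ≤ A ∧ (X.filter fun i => cap i ∉ V).card = broad cap A X :=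
  Nat.sInf_mem (s := {m | ∃ V : Finset γ, V.card ≤ A ∧ (X.filter fun i => cap i ∉ V).card = m})
    ⟨_, ∅, by simp, rfl⟩

lemma broad_le_card : broad cap A X ≤ X.card :=
  (broad_le (V := ∅) (by simp)).trans (Finset.card_filter_le _ _)

lemma broad_anti (h : A ≤ B) : broad cap B X ≤ broad cap A X := by
  obtain ⟨V, hV, hX⟩ := exists_broad_eq cap A X
  exact hX ▸ broad_le (hV.trans h)

lemma broad_mono (h : X ⊆ X') : broad cap A X ≤ broad cap A X' := by
  obtain ⟨V, hV, hX⟩ := exists_broad_eq cap A X'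
  exact hX ▸ (broad_le hV).trans (Finset.card_le_card (Finset.filter_subset_filter _ h))

lemma broad_union_le [DecidableEq ι] :
    broad cap (A + B) (X ∪ X') ≤ broad cap A X + broad cap B X' := by
  obtain ⟨V, hV, hX⟩ := exists_broad_eq cap A X
  obtain ⟨V', hV', hX'⟩ := exists_broad_eq cap B X'
  rw [← hX, ← hX']
  refine (broad_le (V := V ∪ V') ((Finset.card_union_le _ _).trans (by omega))).trans ?_
  refine le_trans (Finset.card_le_card ?_) (Finset.card_union_le _ _)
  intro i
  simp only [Finset.mem_filter, Finset.mem_union]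
  tauto

lemma broad_eq_zero (h : (X.image cap).card ≤ A) : broad cap A X = 0 := by
  refine Nat.le_zero.1 ((broad_le h).trans (Nat.le_zero.2 ?_))
  rw [Finset.card_eq_zero, Finset.filter_eq_empty_iff]
  intro i hi
  simpa using ⟨i, hi, rfl⟩

@[simp] lemma broad_empty : broad cap A (∅ : Finset ι) = 0 := broad_eq_zero (by simp)

end Broad

section Energy

variable {ι γ E : Type*} [Fintype ι] [DecidableEq γ]

open Classical in
/-- The indices of the sets containing `x`. -/
noncomputable def mult (Y : ι → Set E) (x : E) : Finset ι := Finset.univ.filter fun i => x ∈ Y i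

open Classical in
/-- The indices of the nonempty sets. -/
noncomputable def active (Y : ι → Set E) : Finset ι := Finset.univ.filter fun i => (Y i).Nonempty

@[simp] lemma mem_mult {Y : ι → Set E} {x : E} {i : ι} : i ∈ mult Y x ↔ x ∈ Y i := by
  simp [mult]

@[simp] lemma mem_active {Y : ι → Set E} {i : ι} : i ∈ active Y ↔ (Y i).Nonempty := by
  simp [active]

lemma mult_subset_active (Y : ι → Set E) (x : E) : mult Y x ⊆ active Y := fun _ hi =>
  mem_active.2 ⟨x, mem_mult.1 hi⟩

lemma active_mono {Y Y' : ι → Set E} (h : ∀ i, Y i ⊆ Y' i) : active Y ⊆ active Y' := fun i hi =>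
  mem_active.2 ((mem_active.1 hi).mono (h i))

lemma mult_mono {Y Y' : ι → Set E} (h : ∀ i, Y i ⊆ Y' i) (x : E) : mult Y x ⊆ mult Y' x :=
  fun i hi => mem_mult.2 (h i (mem_mult.1 hi))

variable [MeasureSpace E]

/-- The `p`-th power of the `L^p` norm of the broad multiplicity. -/
noncomputable def energy (cap : ι → γ) (p : ℝ) (A : ℕ) (Y : ι → Set E) : ℝ≥0∞ :=
  ∫⁻ x, (broad cap A (mult Y x) : ℝ≥0∞) ^ p

variable {cap : ι → γ} {p : ℝ} {A B : ℕ} {Y Y' Y'' : ι → Set E}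

lemma measurable_comp_mult (hY : ∀ i, MeasurableSet (Y i)) (F : Finset ι → ℝ≥0∞) :
    Measurable fun x => F (mult Y x) := by
  classical
  have h : (fun x => F (mult Y x)) = fun x => ∑ s : Finset ι,
      (if ∀ i, x ∈ Y i ↔ i ∈ s then F s else 0) := by
    funext x
    rw [Finset.sum_eq_single (mult Y x)]
    · rw [if_pos fun i => mem_mult.symm]
    · intro s _ hs
      rw [if_neg]
      intro hcon
      exact hs (Finset.ext fun i => by rw [mem_mult, hcon i])
    · simp
  rw [h]
  refine Finset.measurable_sum _ fun s _ => Measurable.ite ?_ measurable_const measurable_const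
  have : {x | ∀ i, x ∈ Y i ↔ i ∈ s} = ⋂ i, {x | x ∈ Y i ↔ i ∈ s} := by ext; simp
  rw [this]
  refine MeasurableSet.iInter fun i => ?_
  by_cases hi : i ∈ s
  · have : {x | x ∈ Y i ↔ i ∈ s} = Y i := by ext; simp [hi]
    rw [this]; exact hY i
  · have : {x | x ∈ Y i ↔ i ∈ s} = (Y i)ᶜ := by ext; simp [hi]
    rw [this]; exact (hY i).compl

lemma energy_mono (hp : 0 ≤ p) (h : ∀ i, Y i ⊆ Y' i) : energy cap p A Y ≤ energy cap p A Y' :=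
  lintegral_mono fun x => ENNReal.rpow_le_rpow (by exact_mod_cast broad_mono (mult_mono h x)) hp

lemma energy_anti (hp : 0 ≤ p) (h : A ≤ B) : energy cap p B Y ≤ energy cap p A Y :=
  lintegral_mono fun x => ENNReal.rpow_le_rpow (by exact_mod_cast broad_anti h) hp

lemma energy_le_volume (hp : 1 ≤ p) (hY : ∀ i, MeasurableSet (Y i)) :
    energy cap p A Y ≤ ((active Y).card : ℝ≥0∞) ^ (p - 1) * ∑ i, volume (Y i) := by
  classical
  have h : ∀ x, (broad cap A (mult Y x) : ℝ≥0∞) ^ p ≤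
      ((active Y).card : ℝ≥0∞) ^ (p - 1) * ∑ i, (Y i).indicator 1 x := by
    intro x
    have h1 : (broad cap A (mult Y x) : ℝ≥0∞) ≤ ((mult Y x).card : ℝ≥0∞) := by
      exact_mod_cast broad_le_card
    have h2 : ((mult Y x).card : ℝ≥0∞) ≤ ((active Y).card : ℝ≥0∞) := by
      exact_mod_cast Finset.card_le_card (mult_subset_active Y x)
    have h3 : ((mult Y x).card : ℝ≥0∞) = ∑ i, (Y i).indicator 1 x := by
      rw [mult, Finset.card_filter, Nat.cast_sum]
      exact Finset.sum_congr rfl fun i _ => by by_cases hx : x ∈ Y i <;> simp [hx]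
    calc (broad cap A (mult Y x) : ℝ≥0∞) ^ p ≤ ((mult Y x).card : ℝ≥0∞) ^ p :=
          ENNReal.rpow_le_rpow h1 (by linarith)
      _ = ((mult Y x).card : ℝ≥0∞) ^ (p - 1) * ((mult Y x).card : ℝ≥0∞) := by
          conv_lhs => rw [show p = (p - 1) + 1 by ring]
          rw [ENNReal.rpow_add_of_nonneg _ _ (by linarith) zero_le_one, ENNReal.rpow_one]
      _ ≤ _ := by
          rw [← h3]
          exact mul_le_mul_left (ENNReal.rpow_le_rpow h2 (by linarith)) _
  refine (lintegral_mono h).trans ?_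
  have hm : ∀ i, Measurable ((Y i).indicator (1 : E → ℝ≥0∞)) := fun i =>
    measurable_one.indicator (hY i)
  rw [lintegral_const_mul _ (Finset.measurable_sum _ fun i _ => hm i),
    lintegral_finsetSum _ fun i _ => hm i]
  simp [lintegral_indicator_one (hY _)]

lemma energy_inter (hp : 0 < p) {O : Set E} (hO : MeasurableSet O) :
    energy cap p A (fun i => Y i ∩ O) = ∫⁻ x in O, (broad cap A (mult Y x) : ℝ≥0∞) ^ p := by
  classical
  rw [energy, ← lintegral_indicator hO]
  refine lintegral_congr fun x => ?_
  by_cases hx : x ∈ O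
  · rw [Set.indicator_of_mem hx]
    congr 3
    ext i
    simp [hx]
  · rw [Set.indicator_of_notMem hx]
    have : mult (fun i => Y i ∩ O) x = ∅ := by ext i; simp [hx]
    simp [this, hp]

lemma energy_le_sum (hp : 0 < p) {κ : Type*} (s : Finset κ) (O : κ → Set E)
    (hO : ∀ o ∈ s, MeasurableSet (O o)) (hcov : ∀ i, Y i ⊆ ⋃ o ∈ s, O o) :
    energy cap p A Y ≤ ∑ o ∈ s, energy cap p A fun i => Y i ∩ O o := by
  classical
  have h1 : energy cap p A Y ≤ ∫⁻ x in ⋃ o ∈ s, O o, (broad cap A (mult Y x) : ℝ≥0∞) ^ p := by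
    rw [← energy_inter hp (Finset.measurableSet_biUnion s hO)]
    exact energy_mono hp.le fun i x hx => ⟨hx, hcov i hx⟩
  have hU : (⋃ o ∈ s, O o) = ⋃ o : s, O o := by ext; simp
  rw [hU] at h1
  refine h1.trans ((lintegral_iUnion_le _ _).trans (le_of_eq ?_))
  rw [tsum_fintype]
  rw [← Finset.sum_coe_sort s]
  exact Finset.sum_congr rfl fun o _ => (energy_inter hp (hO o o.2)).symm

lemma energy_union_le (hp : 0 ≤ p) (hY' : ∀ i, MeasurableSet (Y' i))
    (hcov : ∀ i, Y i ⊆ Y' i ∪ Y'' i) :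
    energy cap p (A + B) Y ≤ 2 ^ p * (energy cap p A Y' + energy cap p B Y'') := by
  classical
  rw [energy, energy, energy, ← lintegral_add_left
    (measurable_comp_mult hY' fun s => (broad cap A s : ℝ≥0∞) ^ p),
    ← lintegral_const_mul' _ _ (by simp)]
  refine lintegral_mono fun x => ?_
  have h1 : broad cap (A + B) (mult Y x) ≤ broad cap A (mult Y' x) + broad cap B (mult Y'' x) := by
    refine le_trans (broad_mono fun i hi => ?_) broad_union_le
    simpa using hcov i (mem_mult.1 hi)
  set b := (broad cap A (mult Y' x) : ℝ≥0∞)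
  set c := (broad cap B (mult Y'' x) : ℝ≥0∞)
  have h2 : (broad cap (A + B) (mult Y x) : ℝ≥0∞) ≤ 2 * max b c := by
    calc (broad cap (A + B) (mult Y x) : ℝ≥0∞) ≤ b + c := by
          rw [← Nat.cast_add]; exact Nat.cast_le.2 h1
      _ ≤ max b c + max b c := add_le_add (le_max_left _ _) (le_max_right _ _)
      _ = _ := (two_mul _).symm
  refine (ENNReal.rpow_le_rpow h2 hp).trans ?_
  rw [ENNReal.mul_rpow_of_nonneg _ _ hp]
  refine mul_le_mul_right ?_ _
  rcases le_total b c with h | h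
  · rw [max_eq_right h]; exact le_add_self
  · rw [max_eq_left h]; exact le_self_add

end Energy

end Kakeya

end

section

open MeasureTheory
open scoped ENNReal

namespace Kakeya

open MvPolynomial PolyCalc PolyPartition

section Pieces

variable {ι γ E κ : Type*} [Fintype ι] [DecidableEq γ]

lemma sum_card_active_le {Y : ι → Set E} (s : Finset κ) (O : κ → Set E) {C : ℕ}
    (hC : ∀ i, ∀ s' ⊆ s, (∀ o ∈ s', (Y i ∩ O o).Nonempty) → s'.card ≤ C) :
    ∑ o ∈ s, (active fun i => Y i ∩ O o).card ≤ C * (active Y).card := by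
  classical
  calc ∑ o ∈ s, (active fun i => Y i ∩ O o).card
      = ∑ o ∈ s, ∑ i ∈ active Y, if (Y i ∩ O o).Nonempty then 1 else 0 := by
        refine Finset.sum_congr rfl fun o _ => ?_
        rw [← Finset.card_filter]
        congr 1
        ext i
        simp only [mem_active, Finset.mem_filter]
        exact ⟨fun h => ⟨h.mono Set.inter_subset_left, h⟩, fun h => h.2⟩
    _ = ∑ i ∈ active Y, (s.filter fun o => (Y i ∩ O o).Nonempty).card := by
        rw [Finset.sum_comm]
        simp only [Finset.card_filter]
    _ ≤ ∑ i ∈ active Y, C := Finset.sum_le_sum fun i _ =>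
        hC i _ (Finset.filter_subset _ _) fun o ho => (Finset.mem_filter.1 ho).2
    _ = _ := by simp [mul_comm]

lemma sum_rpow_le (s : Finset κ) (N : κ → ℝ) (hN : ∀ o ∈ s, 0 ≤ N o) {u : ℝ} (hu : 0 ≤ u) :
    ∑ o ∈ s, N o ^ (1 + u) ≤ (∑ o ∈ s, N o) ^ (1 + u) := by
  set T := ∑ o ∈ s, N o with hT
  have hT0 : 0 ≤ T := Finset.sum_nonneg hN
  calc ∑ o ∈ s, N o ^ (1 + u) ≤ ∑ o ∈ s, N o * T ^ u := by
        refine Finset.sum_le_sum fun o ho => ?_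
        rw [Real.rpow_add_of_nonneg (hN o ho) zero_le_one hu, Real.rpow_one]
        exact mul_le_mul_of_nonneg_left (Real.rpow_le_rpow (hN o ho)
          (Finset.single_le_sum hN ho) hu) (hN o ho)
    _ = T * T ^ u := by rw [← Finset.sum_mul]
    _ = T ^ (1 + u) := by rw [Real.rpow_add_of_nonneg hT0 zero_le_one hu, Real.rpow_one]

/-- Hölder's inequality in the form used for summing over cells. -/
lemma le_of_cells (s : Finset κ) (m N : κ → ℝ) (hm : ∀ o ∈ s, 0 ≤ m o) (hN : ∀ o ∈ s, 0 ≤ N o)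
    {M u G lam T : ℝ} (hM : 0 ≤ M) (hu : 0 ≤ u) (hG : 0 ≤ G) (hlam : 0 ≤ lam)
    (h1 : M ≤ 2 * ∑ o ∈ s, m o) (h2 : ∀ o ∈ s, m o ≤ lam * M)
    (h3 : ∀ o ∈ s, m o ≤ G * N o ^ (1 + u)) (h4 : ∑ o ∈ s, N o ≤ T) :
    M ≤ 2 ^ (1 + u) * lam ^ u * G * T ^ (1 + u) := by
  have hu1 : 0 < 1 + u := by linarith
  have hT : 0 ≤ T := (Finset.sum_nonneg hN).trans h4
  rcases hM.eq_or_lt with h0 | hMpos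
  · rw [← h0]; positivity
  set α := u / (1 + u) with hα
  set β := 1 / (1 + u) with hβ
  have hαβ : α + β = 1 := by rw [hα, hβ]; field_simp; ring
  have hα0 : 0 ≤ α := by positivity
  have hβ0 : 0 < β := by positivity
  have key : ∀ o ∈ s, m o ≤ (lam * M) ^ α * G ^ β * N o := by
    intro o ho
    have e1 : m o = m o ^ α * m o ^ β := by
      rw [← Real.rpow_add_of_nonneg (hm o ho) hα0 hβ0.le, hαβ, Real.rpow_one]
    rw [e1, mul_assoc]
    refine mul_le_mul (Real.rpow_le_rpow (hm o ho) (h2 o ho) hα0) ?_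
      (Real.rpow_nonneg (hm o ho) _) (by positivity)
    refine (Real.rpow_le_rpow (hm o ho) (h3 o ho) hβ0.le).trans (le_of_eq ?_)
    rw [Real.mul_rpow hG (Real.rpow_nonneg (hN o ho) _), ← Real.rpow_mul (hN o ho), hβ,
      mul_one_div_cancel hu1.ne', Real.rpow_one]
  have h5 : M ≤ 2 * ((lam * M) ^ α * G ^ β * T) := by
    refine h1.trans ?_
    gcongr
    refine (Finset.sum_le_sum key).trans ?_
    rw [← Finset.mul_sum]
    gcongr
  have h6 := Real.rpow_le_rpow hM h5 hu1.le
  have e2 : (2 * ((lam * M) ^ α * G ^ β * T)) ^ (1 + u) =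
      2 ^ (1 + u) * lam ^ u * G * T ^ (1 + u) * M ^ u := by
    rw [Real.mul_rpow (by norm_num) (by positivity), Real.mul_rpow (by positivity) hT,
      Real.mul_rpow (by positivity) (by positivity), ← Real.rpow_mul (by positivity),
      ← Real.rpow_mul hG, hα, hβ, div_mul_cancel₀ _ hu1.ne', div_mul_cancel₀ _ hu1.ne',
      Real.rpow_one, Real.mul_rpow hlam hM]
    ring
  rw [e2, Real.rpow_add_of_nonneg hM zero_le_one hu, Real.rpow_one] at h6
  exact le_of_mul_le_mul_right h6 (Real.rpow_pos_of_pos hMpos u)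

variable [MeasureSpace E] {cap : ι → γ} {p : ℝ} {A : ℕ} {Y : ι → Set E}

lemma energy_le_of_pieces (hp : 0 < p) (s : Finset κ) (O : κ → Set E)
    (hO : ∀ o ∈ s, MeasurableSet (O o)) (hcov : ∀ i, Y i ⊆ ⋃ o ∈ s, O o) {C : ℕ}
    (hC : ∀ i, ∀ s' ⊆ s, (∀ o ∈ s', (Y i ∩ O o).Nonempty) → s'.card ≤ C)
    {G u : ℝ} (hG : 0 ≤ G) (hu : 0 ≤ u)
    (hE : ∀ o ∈ s, energy cap p A (fun i => Y i ∩ O o) ≤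
      ENNReal.ofReal (G * ((active fun i => Y i ∩ O o).card : ℝ) ^ (1 + u))) :
    energy cap p A Y ≤ ENNReal.ofReal (G * (C * (active Y).card : ℝ) ^ (1 + u)) := by
  refine (energy_le_sum hp s O hO hcov).trans ((Finset.sum_le_sum hE).trans ?_)
  rw [← ENNReal.ofReal_sum_of_nonneg fun o _ => by positivity]
  refine ENNReal.ofReal_le_ofReal ?_
  rw [← Finset.mul_sum]
  refine mul_le_mul_of_nonneg_left ?_ hG
  refine (sum_rpow_le s _ (fun o _ => by positivity) hu).trans ?_
  refine Real.rpow_le_rpow (by positivity) ?_ (by linarith)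
  exact_mod_cast sum_card_active_le s O hC

lemma energy_le_of_cells (hp : 0 < p) (s : Finset κ) (O : κ → Set E) (W : Set E)
    (hO : ∀ o ∈ s, MeasurableSet (O o)) (hW : MeasurableSet W)
    (hcov : ∀ i, Y i ⊆ W ∪ ⋃ o ∈ s, O o) {C : ℕ}
    (hC : ∀ i, ∀ s' ⊆ s, (∀ o ∈ s', (Y i ∩ O o).Nonempty) → s'.card ≤ C)
    (hfin : energy cap p A Y ≠ ∞)
    {G u lam : ℝ} (hG : 0 ≤ G) (hu : 0 ≤ u) (hlam : 0 ≤ lam)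
    (hl : ∀ o ∈ s, energy cap p A (fun i => Y i ∩ O o) ≤
      ENNReal.ofReal lam * energy cap p A Y)
    (hE : ∀ o ∈ s, energy cap p A (fun i => Y i ∩ O o) ≤
      ENNReal.ofReal (G * ((active fun i => Y i ∩ O o).card : ℝ) ^ (1 + u))) :
    energy cap p A Y ≤ 2 * energy cap p A (fun i => Y i ∩ W) ∨
    energy cap p A Y ≤ ENNReal.ofReal
      (2 ^ (1 + u) * lam ^ u * G * (C * (active Y).card : ℝ) ^ (1 + u)) := by
  classical
  rw [or_iff_not_imp_left]
  intro hlarge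
  push Not at hlarge
  set M := energy cap p A Y with hM
  have hsub : ∀ O' : Set E, energy cap p A (fun i => Y i ∩ O') ≤ M := fun O' =>
    energy_mono hp.le fun i => Set.inter_subset_left
  have hsubt : ∀ O' : Set E, energy cap p A (fun i => Y i ∩ O') ≠ ∞ := fun O' =>
    ne_top_of_le_ne_top hfin (hsub O')
  have h1 : M ≤ energy cap p A (fun i => Y i ∩ W) +
      ∑ o ∈ s, energy cap p A fun i => Y i ∩ O o := by
    have h := energy_le_sum (cap := cap) (A := A) (Y := Y) hp (Finset.insertNone s)
      (fun o => o.elim W O) ?_ ?_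
    · rw [Finset.sum_insertNone] at h
      exact h
    · intro o ho
      cases o with
      | none => exact hW
      | some o => exact hO o (by simpa using ho)
    · intro i x hx
      rcases hcov i hx with h | h
      · exact Set.mem_biUnion (x := none) (by simp) h
      · obtain ⟨o, ho, hxo⟩ := Set.mem_iUnion₂.1 h
        exact Set.mem_biUnion (x := some o) (by simpa using ho) hxo
  have h2 : M.toReal ≤ (energy cap p A (fun i => Y i ∩ W)).toReal +
      ∑ o ∈ s, (energy cap p A fun i => Y i ∩ O o).toReal := by
    rw [← ENNReal.toReal_sum fun o _ => hsubt _, ← ENNReal.toReal_add (hsubt _)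
      (ENNReal.sum_ne_top.2 fun o _ => hsubt _)]
    exact ENNReal.toReal_mono (ENNReal.add_ne_top.2 ⟨hsubt _,
      ENNReal.sum_ne_top.2 fun o _ => hsubt _⟩) h1
  have h3 : 2 * (energy cap p A (fun i => Y i ∩ W)).toReal ≤ M.toReal := by
    have := ENNReal.toReal_mono hfin hlarge.le
    simpa using this
  rw [← ENNReal.ofReal_toReal hfin]
  refine ENNReal.ofReal_le_ofReal ?_
  refine le_of_cells s (fun o => (energy cap p A fun i => Y i ∩ O o).toReal)
    (fun o => ((active fun i => Y i ∩ O o).card : ℝ)) (fun o _ => ENNReal.toReal_nonneg)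
    (fun o _ => by positivity) ENNReal.toReal_nonneg hu hG hlam (by linarith) (fun o ho => ?_)
    (fun o ho => ?_) (by exact_mod_cast sum_card_active_le s O hC)
  · have := ENNReal.toReal_mono (ENNReal.mul_ne_top ENNReal.ofReal_ne_top hfin) (hl o ho)
    rwa [ENNReal.toReal_mul, ENNReal.toReal_ofReal hlam] at this
  · have := ENNReal.toReal_mono ENNReal.ofReal_ne_top (hE o ho)
    rwa [ENNReal.toReal_ofReal (by positivity)] at this

end Pieces

end Kakeya

end

section

open MeasureTheory
open scoped ENNReal

namespace Kakeya

open MvPolynomial PolyCalc PolyPartition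

section Tubes

variable {d : ℕ}

/-- The direction of the line with slope `v`. -/
def dirVec (v : Fin d → ℝ) : Fin (d + 1) → ℝ := Fin.cons 1 v

/-- The point at height `t` of the line with base point `a` and slope `v`. -/
def corePt (a v : Fin d → ℝ) (t : ℝ) : Fin (d + 1) → ℝ := Fin.cons t (a + t • v)

/-- The infinite tube of radius `δ` (in the supremum norm of slices) around a line. -/
def gtube (δ : ℝ) (a v : Fin d → ℝ) : Set (Fin (d + 1) → ℝ) :=
  {x | ∀ j : Fin d, |x j.succ - (a j + x 0 * v j)| ≤ δ}

lemma corePt_eq (a v : Fin d → ℝ) (t : ℝ) :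
    corePt a v t = Fin.cons 0 a + t • dirVec v := by
  ext j
  refine Fin.cases ?_ (fun j => ?_) j <;> simp [corePt, dirVec]

@[simp] lemma corePt_zero_apply (a v : Fin d → ℝ) (t : ℝ) : corePt a v t 0 = t := rfl

@[simp] lemma corePt_succ_apply (a v : Fin d → ℝ) (t : ℝ) (j : Fin d) :
    corePt a v t j.succ = a j + t * v j := by simp [corePt]

lemma norm_corePt_sub_le {δ : ℝ} (hδ : 0 ≤ δ) {a v : Fin d → ℝ} {x : Fin (d + 1) → ℝ}
    (hx : x ∈ gtube δ a v) : ‖corePt a v (x 0) - x‖ ≤ δ := by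
  rw [pi_norm_le_iff_of_nonneg hδ]
  intro j
  refine Fin.cases ?_ (fun j => ?_) j
  · simpa using hδ
  · rw [Pi.sub_apply, corePt_succ_apply, Real.norm_eq_abs, abs_sub_comm]
    exact hx j

lemma measurableSet_gtube (δ : ℝ) (a v : Fin d → ℝ) : MeasurableSet (gtube δ a v) := by
  rw [gtube, Set.ofPred_forall]
  refine MeasurableSet.iInter fun j => (isClosed_le (by fun_prop) continuous_const).measurableSet

lemma volume_gtube_inter_le {δ : ℝ} (hδ : 0 ≤ δ) (a v : Fin d → ℝ) {I : Set ℝ}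
    (hI : MeasurableSet I) :
    volume (gtube δ a v ∩ {x | x 0 ∈ I}) ≤ volume I * ENNReal.ofReal ((2 * δ) ^ d) := by
  have hmp := volume_preserving_piFinSuccAbove (fun _ : Fin (d + 1) => ℝ) 0
  set S : Set (ℝ × (Fin d → ℝ)) := {q | q.1 ∈ I ∧ ∀ j, |q.2 j - (a j + q.1 * v j)| ≤ δ} with hS
  have hSM : MeasurableSet S := by
    refine (measurable_fst hI).inter ?_
    have : (Set.ofPred fun q : ℝ × (Fin d → ℝ) => ∀ j, |q.2 j - (a j + q.1 * v j)| ≤ δ) =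
      ⋂ j, {q | |q.2 j - (a j + q.1 * v j)| ≤ δ} := by ext; simp
    change MeasurableSet (Set.ofPred _)
    rw [this]
    exact MeasurableSet.iInter fun j => (isClosed_le (by fun_prop) continuous_const).measurableSet
  have hpre : gtube δ a v ∩ {x | x 0 ∈ I} =
      MeasurableEquiv.piFinSuccAbove (fun _ : Fin (d + 1) => ℝ) 0 ⁻¹' S := by
    ext x
    simp [gtube, hS, MeasurableEquiv.piFinSuccAbove, Fin.insertNthEquiv, and_comm]
    exact fun _ => Iff.rfl
  rw [hpre, hmp.measure_preimage_equiv, Measure.volume_eq_prod, Measure.prod_apply hSM]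
  calc ∫⁻ t, volume (Prod.mk t ⁻¹' S) ≤ ∫⁻ t in I, ENNReal.ofReal ((2 * δ) ^ d) := by
        rw [← lintegral_indicator hI]
        refine lintegral_mono fun t => ?_
        by_cases ht : t ∈ I
        · rw [Set.indicator_of_mem ht]
          refine (measure_mono (t := Metric.closedBall (a + t • v) δ) fun y hy => ?_).trans
            (le_of_eq ?_)
          · rw [Metric.mem_closedBall, dist_eq_norm, pi_norm_le_iff_of_nonneg hδ]
            exact fun j => by simpa using hy.2 j
          · rw [Real.volume_pi_closedBall _ hδ, Fintype.card_fin]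
        · have : Prod.mk t ⁻¹' S = ∅ := by ext y; simp [hS, ht]
          simp [this]
    _ = _ := by rw [setLIntegral_const, mul_comm]

/-- The restriction of a polynomial to a line. -/
noncomputable def coreRes (a v : Fin d → ℝ) (P : MvPolynomial (Fin (d + 1)) ℝ) : Polynomial ℝ :=
  lineRes P (Fin.cons 0 a) (dirVec v)

lemma eval_coreRes (a v : Fin d → ℝ) (P : MvPolynomial (Fin (d + 1)) ℝ) (t : ℝ) :
    (coreRes a v P).eval t = eval (corePt a v t) P := by
  rw [coreRes, eval_lineRes, corePt_eq]

lemma natDegree_coreRes_le (a v : Fin d → ℝ) (P : MvPolynomial (Fin (d + 1)) ℝ) :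
    (coreRes a v P).natDegree ≤ P.totalDegree := natDegree_lineRes_le _ _ _

lemma eval_derivative_coreRes (a v : Fin d → ℝ) (P : MvPolynomial (Fin (d + 1)) ℝ) (t : ℝ) :
    (Polynomial.derivative (coreRes a v P)).eval t =
      ∑ j, dirVec v j * eval (corePt a v t) (pderiv j P) := by
  rw [coreRes, derivative_lineRes, Polynomial.eval_finsetSum]
  refine Finset.sum_congr rfl fun j _ => ?_
  rw [Polynomial.eval_mul, Polynomial.eval_C, eval_lineRes, corePt_eq]

/-- A polynomial without zeros in an interval keeps its sign. -/
lemma polynomial_pos_of_forall_ne {q : Polynomial ℝ} {t t' : ℝ}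
    (h0 : ∀ r ∈ Set.uIcc t t', q.eval r ≠ 0) (h : 0 < q.eval t) : 0 < q.eval t' := by
  by_contra hcon
  push Not at hcon
  have hc : ContinuousOn (fun r => q.eval r) (Set.uIcc t' t) := q.continuous.continuousOn
  obtain ⟨r, hr, hr0⟩ := intermediate_value_uIcc hc
    (show (0 : ℝ) ∈ Set.uIcc (q.eval t') (q.eval t) from Set.mem_uIcc.2 (Or.inl ⟨hcon, h.le⟩))
  exact h0 r (Set.uIcc_comm t t' ▸ hr) hr0

lemma mem_signCell_of_ball {n T : ℕ} {P : Fin T → MvPolynomial (Fin n) ℝ} {σ : Fin T → Bool}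
    {y z : Fin n → ℝ} {ρ : ℝ} (h0 : ∀ x ∈ Metric.ball y ρ, eval x (∏ i, P i) ≠ 0)
    (hz : z ∈ Metric.ball y ρ) (hy : y ∈ signCell P σ) : z ∈ signCell P σ := by
  have hyy : y ∈ Metric.ball y ρ := Metric.mem_ball_self (dist_nonneg.trans_lt hz)
  have hpre : IsPreconnected (Metric.ball y ρ) := (convex_ball y ρ).isPreconnected
  have hne : ∀ i, ∀ x ∈ Metric.ball y ρ, eval x (P i) ≠ 0 := by
    intro i x hx h
    refine h0 x hx ?_
    rw [map_prod]
    exact Finset.prod_eq_zero (Finset.mem_univ i) h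
  intro i
  have hc : ContinuousOn (fun x => eval x (P i)) (Metric.ball y ρ) :=
    (P i).continuous_eval.continuousOn
  have hi := hy i
  cases hσ : σ i
  · simp only [hσ, Bool.false_eq_true, if_false] at hi ⊢
    by_contra hcon
    push Not at hcon
    obtain ⟨x, hx, hx0⟩ := hpre.intermediate_value hyy hz hc ⟨hi.le, hcon⟩
    exact hne i x hx hx0
  · simp only [hσ, if_true] at hi ⊢
    by_contra hcon
    push Not at hcon
    obtain ⟨x, hx, hx0⟩ := hpre.intermediate_value hz hyy hc ⟨hcon, hi.le⟩
    exact hne i x hx hx0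

/-- A line meets few products of a sign cell and a slab. -/
lemma card_cells_le {T B N : ℕ} (P : Fin T → MvPolynomial (Fin (d + 1)) ℝ)
    (hN : (∏ i, P i).totalDegree ≤ N) (a v : Fin d → ℝ) {h ℓ : ℝ}
    (s : Finset ((Fin T → Bool) × ℕ))
    (hs : ∀ o ∈ s, o.2 ≤ B ∧ ∃ t, h + o.2 * ℓ ≤ t ∧ t < h + (o.2 + 1) * ℓ ∧
      corePt a v t ∈ signCell P o.1) : s.card ≤ B + N + 1 := by
  classical
  set q := coreRes a v (∏ i, P i) with hq
  choose! hB t ht1 ht2 ht3 using hs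
  have hqi : ∀ r, q.eval r = ∏ i, (coreRes a v (P i)).eval r := by
    intro r
    rw [hq, eval_coreRes, map_prod]
    exact Finset.prod_congr rfl fun i _ => (eval_coreRes _ _ _ _).symm
  have hcell : ∀ o ∈ s, q.eval (t o) ≠ 0 := by
    intro o ho
    rw [hqi, Finset.prod_ne_zero_iff]
    intro i _
    have := ht3 o ho i
    rw [eval_coreRes]
    split_ifs at this
    · exact this.ne'
    · exact this.ne
  set cnt : (Fin T → Bool) × ℕ → ℕ := fun o =>
    o.2 + (q.roots.toFinset.filter fun r => r < t o).card with hcnt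
  have hmaps : ∀ o ∈ s, cnt o ∈ Finset.range (B + N + 1) := by
    intro o ho
    have h1 : (q.roots.toFinset.filter fun r => r < t o).card ≤ N :=
      (Finset.card_filter_le _ _).trans ((Multiset.toFinset_card_le _).trans
        ((Polynomial.card_roots' _).trans ((natDegree_coreRes_le _ _ _).trans hN)))
    have h2 := hB o ho
    simp only [hcnt, Finset.mem_range]
    omega
  have key : ∀ o ∈ s, ∀ o' ∈ s, t o ≤ t o' → cnt o = cnt o' → o = o' := by
    intro o ho o' ho' htt hc
    have hsub : (q.roots.toFinset.filter fun r => r < t o) ⊆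
        q.roots.toFinset.filter fun r => r < t o' :=
      Finset.monotone_filter_right _ fun r _ hr => lt_of_lt_of_le hr htt
    have hcard := Finset.card_le_card hsub
    have hℓ : 0 < ℓ := by nlinarith [ht1 o ho, ht2 o ho]
    have hb : o.2 ≤ o'.2 := by
      have h1 : (o.2 : ℝ) * ℓ < (o'.2 + 1) * ℓ := by linarith [ht1 o ho, ht2 o' ho']
      have h2 : (o.2 : ℝ) < o'.2 + 1 := lt_of_mul_lt_mul_right h1 hℓ.le
      exact Nat.lt_succ_iff.1 (by exact_mod_cast h2)
    simp only [hcnt] at hc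
    have hb' : o.2 = o'.2 := by omega
    have heq := Finset.eq_of_subset_of_card_le hsub (by omega)
    have hno : ∀ r ∈ Set.uIcc (t o) (t o'), q.eval r ≠ 0 := by
      intro r hr hr0
      rw [Set.uIcc_of_le htt] at hr
      rcases hr.2.eq_or_lt with h | h
      · exact hcell o' ho' (h ▸ hr0)
      · have hq0 : q ≠ 0 := fun h => hcell o ho (by simp [h])
        have : r ∈ q.roots.toFinset.filter fun r => r < t o' := by
          simp [Polynomial.mem_roots hq0, hr0, h]
        rw [← heq] at this
        exact absurd (Finset.mem_filter.1 this).2 (not_lt.2 hr.1)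
    refine Prod.ext (funext fun i => ?_) hb'
    have hnoi : ∀ r ∈ Set.uIcc (t o) (t o'), (coreRes a v (P i)).eval r ≠ 0 := by
      intro r hr h0
      exact hno r hr (by rw [hqi]; exact Finset.prod_eq_zero (Finset.mem_univ i) h0)
    have h1 := ht3 o ho i
    have h2 := ht3 o' ho' i
    simp only [← eval_coreRes] at h1 h2
    cases hσ : o.1 i <;> cases hσ' : o'.1 i <;> simp only [hσ, hσ', Bool.false_eq_true, if_false,
      if_true] at h1 h2 <;> try rfl
    · rw [Set.uIcc_comm] at hnoi
      exact absurd (polynomial_pos_of_forall_ne hnoi h2) (not_lt.2 h1.le)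
    · exact absurd (polynomial_pos_of_forall_ne hnoi h1) (not_lt.2 h2.le)
  have := Finset.card_le_card_of_injOn cnt hmaps (fun o ho o' ho' hc => by
    rcases le_total (t o) (t o') with h | h
    · exact key o ho o' ho' h hc
    · exact (key o' ho' o ho h hc.symm).symm)
  simpa using this

/-- Few slabs come close to a finite set of heights. -/
lemma card_slabs_le {h ℓ : ℝ} (hℓ : 0 < ℓ) (R : Finset ℝ) {N : ℕ} (hR : R.card ≤ N)
    (s : Finset ℕ)
    (hs : ∀ b ∈ s, ∃ t, h + b * ℓ ≤ t ∧ t < h + (b + 1) * ℓ ∧ ∃ r ∈ R, |t - r| ≤ ℓ) :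
    s.card ≤ 3 * N := by
  classical
  have hsub : s.image (fun b : ℕ => (b : ℤ)) ⊆
      R.biUnion fun r => Finset.Icc (⌊(r - h) / ℓ⌋ - 1) (⌊(r - h) / ℓ⌋ + 1) := by
    intro b hb
    obtain ⟨b, hbs, rfl⟩ := Finset.mem_image.1 hb
    obtain ⟨t, h1, h2, r, hr, htr⟩ := hs b hbs
    refine Finset.mem_biUnion.2 ⟨r, hr, ?_⟩
    have hb' : (b : ℤ) = ⌊(t - h) / ℓ⌋ := by
      symm
      rw [Int.floor_eq_iff]
      constructor
      · rw [le_div_iff₀ hℓ]; push_cast; linarith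
      · rw [div_lt_iff₀ hℓ]; push_cast; linarith
    rw [hb', Finset.mem_Icc]
    rw [abs_le] at htr
    constructor
    · rw [← Int.floor_sub_one]
      refine Int.floor_le_floor ?_
      rw [← sub_nonneg]
      have : (t - h) / ℓ - ((r - h) / ℓ - 1) = (t - r + ℓ) / ℓ := by field_simp; ring
      rw [this]
      exact div_nonneg (by linarith) hℓ.le
    · rw [← Int.floor_add_one]
      refine Int.floor_le_floor ?_
      rw [← sub_nonneg]
      have : (r - h) / ℓ + 1 - (t - h) / ℓ = (r - t + ℓ) / ℓ := by field_simp; ring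
      rw [this]
      exact div_nonneg (by linarith) hℓ.le
  have h1 := Finset.card_le_card hsub
  rw [Finset.card_image_of_injective _ Nat.cast_injective] at h1
  refine h1.trans (Finset.card_biUnion_le.trans ?_)
  refine (Finset.sum_le_card_nsmul _ _ 3 fun r _ => ?_).trans ?_
  · rw [Int.card_Icc]; omega
  · rw [smul_eq_mul]; omega

end Tubes

end Kakeya

end

section

open MeasureTheory
open scoped ENNReal

namespace Kakeya

open MvPolynomial PolyCalc

section Tangent

variable {n d : ℕ}

lemma pderiv_eq_zero_of_vars {P : MvPolynomial (Fin n) ℝ} {J : Finset (Fin n)} (h : P.vars ⊆ J)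
    {j : Fin n} (hj : j ∉ J) : pderiv j P = 0 :=
  pderiv_eq_zero_of_notMem_vars fun hcon => hj (h hcon)

/-- The vectors nearly annihilated by the gradients of a tower are nearly determined by their
coordinates in the remaining variables. -/
lemma exists_tower_coeff {N : ℕ} {τ : List (MvPolynomial (Fin n) ℝ × Fin n)}
    {J : Finset (Fin n)} (hτ : IsTower N τ J) {y : Fin n → ℝ}
    (hy : ∀ e ∈ τ, eval y (pderiv e.2 e.1) ≠ 0 ∧
      ∀ j, |eval y (pderiv j e.1)| ≤ |eval y (pderiv e.2 e.1)|) :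
    ∃ c : Fin n → Fin n → ℝ, (∀ l j, |c l j| ≤ 2 ^ τ.length) ∧
      ∀ (u : Fin n → ℝ) (θ : ℝ), 0 ≤ θ → (∀ e ∈ τ, |∑ j, u j * eval y (pderiv j e.1)| ≤
        θ * |eval y (pderiv e.2 e.1)|) → ∀ l, |u l - ∑ j ∈ J, c l j * u j| ≤ 2 ^ τ.length * θ := by
  classical
  induction τ generalizing J with
  | nil =>
    obtain rfl : J = Finset.univ := hτ
    refine ⟨fun l j => if l = j then 1 else 0, fun l j => ?_, fun u θ hθ _ l => ?_⟩
    · dsimp only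
      split_ifs <;> simp
    · simpa using hθ
  | cons e τ ih =>
    obtain ⟨J', h1, h2, rfl, h3, h4⟩ := hτ
    obtain ⟨c, hc, hu⟩ := ih h1 fun e' he' => hy e' (List.mem_cons_of_mem _ he')
    obtain ⟨he0, hej⟩ := hy e List.mem_cons_self
    set g : Fin n → ℝ := fun j => eval y (pderiv j e.1) / eval y (pderiv e.2 e.1) with hg
    have hg1 : ∀ j, |g j| ≤ 1 := fun j => by
      rw [hg, abs_div]; exact div_le_one_of_le₀ (hej j) (abs_nonneg _)
    refine ⟨fun x j => c x j - c x e.2 * g j, fun x j => ?_, fun u θ hθ h x => ?_⟩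
    · calc |c x j - c x e.2 * g j| ≤ |c x j| + |c x e.2| * |g j| := by
            rw [← abs_mul]; exact abs_sub _ _
        _ ≤ 2 ^ τ.length + 2 ^ τ.length * 1 := by
            gcongr
            · exact hc _ _
            · exact hc _ _
            · exact hg1 j
        _ = _ := by rw [List.length_cons]; ring
    · have hx := hu u θ hθ (fun e' he' => h e' (List.mem_cons_of_mem _ he')) x
      have hl := h e List.mem_cons_self
      have hsum : ∑ j, u j * eval y (pderiv j e.1) =
          eval y (pderiv e.2 e.1) * (u e.2 + ∑ j ∈ J'.erase e.2, g j * u j) := by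
        have e1 : ∑ j, u j * eval y (pderiv j e.1) = ∑ j ∈ J', u j * eval y (pderiv j e.1) := by
          symm
          refine Finset.sum_subset (Finset.subset_univ _) fun j _ hj => ?_
          rw [pderiv_eq_zero_of_vars h3 hj]; simp
        rw [e1, ← Finset.add_sum_erase _ _ h2, mul_add, Finset.mul_sum]
        congr 1
        · ring
        · refine Finset.sum_congr rfl fun j _ => ?_
          rw [hg]; field_simp
      rw [hsum, abs_mul, mul_comm] at hl
      have hl' := le_of_mul_le_mul_right hl (abs_pos.2 he0)
      rw [← Finset.add_sum_erase _ _ h2] at hx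
      have hid : u x - ∑ j ∈ J'.erase e.2, (c x j - c x e.2 * g j) * u j =
          (u x - (c x e.2 * u e.2 + ∑ j ∈ J'.erase e.2, c x j * u j)) +
            c x e.2 * (u e.2 + ∑ j ∈ J'.erase e.2, g j * u j) := by
        rw [mul_add, Finset.mul_sum]
        have : ∑ j ∈ J'.erase e.2, (c x j - c x e.2 * g j) * u j =
            ∑ j ∈ J'.erase e.2, c x j * u j - ∑ j ∈ J'.erase e.2, c x e.2 * (g j * u j) := by
          rw [← Finset.sum_sub_distrib]
          exact Finset.sum_congr rfl fun j _ => by ring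
        rw [this]; ring
      rw [hid]
      calc _ ≤ 2 ^ τ.length * θ + 2 ^ τ.length * θ := by
            refine (abs_add_le _ _).trans (add_le_add hx ?_)
            rw [abs_mul]
            exact mul_le_mul (hc _ _) hl' (abs_nonneg _) (by positivity)
        _ = _ := by rw [List.length_cons]; ring

/-- The constant relating angular separation to the tangency parameter. -/
def tangentConst (n : ℕ) : ℝ := (2 * n ^ 2 + 5 * n + 2) * 4 ^ n

lemma abs_floor_sub_floor_le {x y : ℝ} (h : |x - y| ≤ 1) : |⌊x⌋ - ⌊y⌋| ≤ 1 := by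
  rw [abs_le] at h ⊢
  constructor
  · have : ⌊y - 1⌋ ≤ ⌊x⌋ := Int.floor_le_floor (by linarith [h.1])
    rw [Int.floor_sub_one] at this; omega
  · have : ⌊x⌋ ≤ ⌊y + 1⌋ := Int.floor_le_floor (by linarith [h.2])
    rw [Int.floor_add_one] at this; omega

lemma abs_sub_le_of_floor_eq {x y θ : ℝ} (hθ : 0 < θ) (h : ⌊x / θ⌋ = ⌊y / θ⌋) : |x - y| ≤ θ := by
  have := Int.abs_sub_lt_one_of_floor_eq_floor h
  rw [← sub_div, abs_div, abs_of_pos hθ, div_lt_one hθ] at this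
  exact this.le

/-- Slopes tangent to a tower at a point lie in few caps. -/
lemma card_image_cap_le {ι : Type*} {N : ℕ} {τ : List (MvPolynomial (Fin (d + 1)) ℝ × Fin (d + 1))}
    {J : Finset (Fin (d + 1))} (hτ : IsTower N τ J) {y : Fin (d + 1) → ℝ}
    (hy : ∀ e ∈ τ, eval y (pderiv e.2 e.1) ≠ 0 ∧
      ∀ j, |eval y (pderiv j e.1)| ≤ |eval y (pderiv e.2 e.1)|)
    {v : ι → Fin d → ℝ} (X : Finset ι) (hv : ∀ i ∈ X, ∀ j, |v i j| ≤ 1) {θ η : ℝ} (hθ : 0 < θ)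
    (hη : 0 < η) (hη1 : η ≤ 1) (hθη : tangentConst (d + 1) * θ ≤ η)
    (ht : ∀ i ∈ X, ∀ e ∈ τ, |∑ j, dirVec (v i) j * eval y (pderiv j e.1)| ≤
        θ * |eval y (pderiv e.2 e.1)|) :
    (X.image fun i => fun j => ⌊v i j / η⌋).card ≤ (2 * ⌈1 / θ⌉₊ + 1) ^ (J.card - 1) * 3 ^ d := by
  classical
  obtain ⟨c, hc, hu⟩ := exists_tower_coeff hτ hy
  rcases X.eq_empty_or_nonempty with rfl | ⟨i₀, hi₀⟩
  · simp
  have hlen : τ.length ≤ d + 1 := by have := hτ.card; omega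
  set E : ℝ := 2 ^ (d + 1) with hE
  have hE1 : 1 ≤ E := one_le_pow₀ (by norm_num)
  have hEl : (2 : ℝ) ^ τ.length ≤ E := pow_le_pow_right₀ (by norm_num) hlen
  set n : ℝ := ((d + 1 : ℕ) : ℝ) with hn
  have hn1 : 1 ≤ n := by rw [hn]; exact_mod_cast Nat.le_add_left 1 d
  have hJn : (J.card : ℝ) ≤ n := by
    rw [hn]; exact_mod_cast (Finset.card_le_univ J).trans (by simp)
  have hCn : tangentConst (d + 1) = (2 * n ^ 2 + 5 * n + 2) * E ^ 2 := by
    have h4 : (4 : ℝ) ^ (d + 1) = E ^ 2 := by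
      rw [hE, ← pow_mul, mul_comm (d + 1) 2, pow_mul]; norm_num
    rw [tangentConst, h4, hn]
  rw [hCn] at hθη
  have hE2 : E ≤ E ^ 2 := by nlinarith
  have hω : ∀ i ∈ X, ∀ j, |dirVec (v i) j| ≤ 1 := by
    intro i hi j
    refine Fin.cases (by simp [dirVec]) (fun j => ?_) j
    simpa [dirVec] using hv i hi j
  have hEθ : E * θ ≤ 1 / 2 := by
    have h1 : 2 * (E * θ) ≤ (2 * n ^ 2 + 5 * n + 2) * E ^ 2 * θ := by
      have : 2 * E ≤ (2 * n ^ 2 + 5 * n + 2) * E ^ 2 := by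
        have : 2 ≤ 2 * n ^ 2 + 5 * n + 2 := by nlinarith
        calc 2 * E ≤ 2 * E ^ 2 := by linarith
          _ ≤ _ := by gcongr
      nlinarith
    linarith
  obtain ⟨l, hlJ, hl⟩ : ∃ l ∈ J, 1 / (2 * n) ≤ |c 0 l| := by
    by_contra! hcon
    have h0 := hu (dirVec (v i₀)) θ hθ.le (ht i₀ hi₀) 0
    have h1 : |∑ j ∈ J, c 0 j * dirVec (v i₀) j| ≤ ∑ j ∈ J, |c 0 j| :=
      (Finset.abs_sum_le_sum_abs _ _).trans (Finset.sum_le_sum fun j _ => by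
        rw [abs_mul]
        exact mul_le_of_le_one_right (abs_nonneg _) (hω i₀ hi₀ j))
    have h2 : |dirVec (v i₀) 0 - ∑ j ∈ J, c 0 j * dirVec (v i₀) j| ≤ 1 / 2 :=
      h0.trans ((mul_le_mul_of_nonneg_right hEl hθ.le).trans hEθ)
    have h3 : dirVec (v i₀) 0 = 1 := rfl
    rw [h3] at h2
    have h4 : 1 / 2 ≤ ∑ j ∈ J, |c 0 j| := by
      have := (abs_le.1 h2).2
      have := (abs_le.1 h1).2
      linarith
    rcases J.eq_empty_or_nonempty with hJ | hJ
    · rw [hJ] at h4; norm_num at h4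
    · have h5 : ∑ j ∈ J, |c 0 j| < ∑ j ∈ J, 1 / (2 * n) :=
        Finset.sum_lt_sum_of_nonempty hJ fun j hj => hcon j hj
      rw [Finset.sum_const, nsmul_eq_mul] at h5
      have h6 : (J.card : ℝ) * (1 / (2 * n)) ≤ n * (1 / (2 * n)) := by gcongr
      have h7 : n * (1 / (2 * n)) = 1 / 2 := by field_simp
      linarith
  have hclose : ∀ i ∈ X, ∀ i' ∈ X,
      (∀ j ∈ J.erase l, ⌊dirVec (v i) j / θ⌋ = ⌊dirVec (v i') j / θ⌋) →
      ∀ x, |dirVec (v i) x - dirVec (v i') x| ≤ η := by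
    intro i hi i' hi' hkey x
    set u : Fin (d + 1) → ℝ := fun j => dirVec (v i) j - dirVec (v i') j with hudef
    have hsmall : ∀ j ∈ J.erase l, |u j| ≤ θ := fun j hj => abs_sub_le_of_floor_eq hθ (hkey j hj)
    have htan : ∀ e ∈ τ, |∑ j, u j * eval y (pderiv j e.1)| ≤
        2 * θ * |eval y (pderiv e.2 e.1)| := by
      intro e he
      have : ∑ j, u j * eval y (pderiv j e.1) = ∑ j, dirVec (v i) j * eval y (pderiv j e.1) -
          ∑ j, dirVec (v i') j * eval y (pderiv j e.1) := by
        rw [← Finset.sum_sub_distrib]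
        exact Finset.sum_congr rfl fun j _ => by rw [hudef]; ring
      rw [this]
      refine (abs_sub _ _).trans ?_
      linarith [ht i hi e he, ht i' hi' e he]
    have hux : ∀ x, |u x - (c x l * u l + ∑ j ∈ J.erase l, c x j * u j)| ≤ E * (2 * θ) := by
      intro x
      rw [Finset.add_sum_erase J (fun j => c x j * u j) hlJ]
      exact (hu u (2 * θ) (by positivity) htan x).trans (by gcongr)
    have hrest : ∀ x, |∑ j ∈ J.erase l, c x j * u j| ≤ n * (E * θ) := by
      intro x
      refine (Finset.abs_sum_le_sum_abs _ _).trans ?_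
      refine (Finset.sum_le_card_nsmul _ _ (E * θ) fun j hj => ?_).trans ?_
      · rw [abs_mul]
        exact mul_le_mul ((hc _ _).trans hEl) (hsmall j hj) (abs_nonneg _) (by positivity)
      · rw [nsmul_eq_mul]
        have : ((J.erase l).card : ℝ) ≤ n :=
          le_trans (by exact_mod_cast Finset.card_erase_le) hJn
        gcongr
    have hul : |u l| ≤ 2 * n * ((n + 2) * (E * θ)) := by
      have h0 := hux 0
      have hu0 : u 0 = 0 := by simp [hudef, dirVec]
      rw [hu0, zero_sub, abs_neg] at h0
      have h1 : |c 0 l * u l| ≤ (n + 2) * (E * θ) := by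
        have h2 := hrest 0
        have : c 0 l * u l = (c 0 l * u l + ∑ j ∈ J.erase l, c 0 j * u j) -
          ∑ j ∈ J.erase l, c 0 j * u j := by ring
        rw [this]
        refine (abs_sub _ _).trans ?_
        linarith
      rw [abs_mul] at h1
      have h2 : 1 / (2 * n) * |u l| ≤ (n + 2) * (E * θ) :=
        (mul_le_mul_of_nonneg_right hl (abs_nonneg _)).trans h1
      have h3 : |u l| = 2 * n * (1 / (2 * n) * |u l|) := by field_simp
      rw [h3]
      gcongr
    have hfin : |u x| ≤ (2 * n ^ 2 + 5 * n + 2) * E ^ 2 * θ := by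
      have h1 : |c x l * u l| ≤ E * (2 * n * ((n + 2) * (E * θ))) := by
        rw [abs_mul]
        exact mul_le_mul ((hc _ _).trans hEl) hul (abs_nonneg _) (by positivity)
      have h2 := hrest x
      have h3 := hux x
      have h4 : |u x| ≤ E * (2 * θ) + (E * (2 * n * ((n + 2) * (E * θ))) + n * (E * θ)) := by
        have : u x = (u x - (c x l * u l + ∑ j ∈ J.erase l, c x j * u j)) +
          (c x l * u l + ∑ j ∈ J.erase l, c x j * u j) := by ring
        rw [this]
        refine (abs_add_le _ _).trans (add_le_add h3 ((abs_add_le _ _).trans (add_le_add h1 h2)))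
      have h5 : (2 + n) * (E * θ) ≤ (2 + n) * (E ^ 2 * θ) := by gcongr
      nlinarith
    exact hfin.trans hθη
  have hcover : (X.image fun i => fun j => ⌊v i j / η⌋) ⊆
      (X.image fun i => fun j : (J.erase l : Finset _) => ⌊dirVec (v i) j / θ⌋).biUnion fun key =>
        (X.filter fun i => (fun j : (J.erase l : Finset _) => ⌊dirVec (v i) j / θ⌋) = key).image
          fun i => fun j => ⌊v i j / η⌋ := by
    intro w hw
    obtain ⟨i, hi, rfl⟩ := Finset.mem_image.1 hw
    refine Finset.mem_biUnion.2 ⟨_, Finset.mem_image_of_mem _ hi, ?_⟩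
    exact Finset.mem_image_of_mem _ (Finset.mem_filter.2 ⟨hi, rfl⟩)
  refine (Finset.card_le_card hcover).trans
    ((Finset.card_biUnion_le_card_mul _ _ (3 ^ d) fun key hkey => ?_).trans ?_)
  · obtain ⟨i', hi', rfl⟩ := Finset.mem_image.1 hkey
    have hsub : ((X.filter fun i => (fun j : (J.erase l : Finset _) => ⌊dirVec (v i) j / θ⌋) =
        fun j : (J.erase l : Finset _) => ⌊dirVec (v i') j / θ⌋).image
          fun i => fun j => ⌊v i j / η⌋) ⊆
        Fintype.piFinset fun j => Finset.Icc (⌊v i' j / η⌋ - 1) (⌊v i' j / η⌋ + 1) := by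
      intro w hw
      obtain ⟨i, hi, rfl⟩ := Finset.mem_image.1 hw
      obtain ⟨hiX, hik⟩ := Finset.mem_filter.1 hi
      refine Fintype.mem_piFinset.2 fun j => ?_
      have h1 := hclose i hiX i' hi' (fun j hj => congrFun hik ⟨j, hj⟩) j.succ
      have h2 : |v i j / η - v i' j / η| ≤ 1 := by
        rw [← sub_div, abs_div, abs_of_pos hη, div_le_one hη]
        simpa [dirVec] using h1
      have h3 := abs_le.1 (abs_floor_sub_floor_le h2)
      rw [Finset.mem_Icc]
      omega
    refine (Finset.card_le_card hsub).trans (le_of_eq ?_)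
    rw [Fintype.card_piFinset]
    have : ∀ j : Fin d, (Finset.Icc (⌊v i' j / η⌋ - 1) (⌊v i' j / η⌋ + 1)).card = 3 := by
      intro j; rw [Int.card_Icc]; omega
    simp [this]
  · gcongr
    have hsub : (X.image fun i => fun j : (J.erase l : Finset _) => ⌊dirVec (v i) j / θ⌋) ⊆
        Fintype.piFinset fun _ => Finset.Icc (-(⌈1 / θ⌉₊ : ℤ)) ⌈1 / θ⌉₊ := by
      intro w hw
      obtain ⟨i, hi, rfl⟩ := Finset.mem_image.1 hw
      refine Fintype.mem_piFinset.2 fun j => ?_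
      have h1 := abs_le.1 (hω i hi j)
      have h2 : 1 / θ ≤ ⌈1 / θ⌉₊ := Nat.le_ceil _
      have h3 : dirVec (v i) j / θ ≤ 1 / θ := by gcongr; exact h1.2
      have h4 : -(1 / θ) ≤ dirVec (v i) j / θ := by
        rw [← neg_div]; gcongr; exact h1.1
      rw [Finset.mem_Icc]
      constructor
      · rw [Int.le_floor]; push_cast; linarith
      · have : (⌊dirVec (v i) j / θ⌋ : ℝ) ≤ (⌈1 / θ⌉₊ : ℝ) :=
          (Int.floor_le _).trans (h3.trans h2)
        exact_mod_cast this
    refine (Finset.card_le_card hsub).trans (le_of_eq ?_)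
    rw [Fintype.card_piFinset, Finset.prod_const, Finset.card_univ, Int.card_Icc,
      Fintype.card_coe, Finset.card_erase_of_mem hlJ]
    congr 1
    omega

end Tangent

end Kakeya

end

section

open MeasureTheory
open scoped ENNReal

namespace Kakeya

open MvPolynomial PolyCalc

section Volume

variable {ι γ E : Type*} [Fintype ι] [DecidableEq γ] [MeasureSpace E] {cap : ι → γ} {p : ℝ} {A : ℕ}
  {Y : ι → Set E}

lemma energy_le_of_volume_le (hp : 1 ≤ p) (hY : ∀ i, MeasurableSet (Y i)) {V : ℝ}
    (hV : ∀ i, volume (Y i) ≤ ENNReal.ofReal V) :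
    energy cap p A Y ≤ ENNReal.ofReal (V * ((active Y).card : ℝ) ^ p) := by
  classical
  refine (energy_le_volume hp hY).trans ?_
  have h1 : ∑ i, volume (Y i) ≤ ENNReal.ofReal ((active Y).card * V) := by
    rw [← Finset.sum_subset (Finset.subset_univ (active Y)) fun i _ hi => ?_]
    · refine (Finset.sum_le_card_nsmul _ _ _ fun i _ => hV i).trans (le_of_eq ?_)
      rw [nsmul_eq_mul, ENNReal.ofReal_mul (by positivity), ENNReal.ofReal_natCast]
    · rw [mem_active, Set.not_nonempty_iff_eq_empty] at hi
      rw [hi, measure_empty]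
  refine (mul_le_mul_right h1 _).trans (le_of_eq ?_)
  rw [← ENNReal.ofReal_natCast, ENNReal.ofReal_rpow_of_nonneg (by positivity) (by linarith),
    ← ENNReal.ofReal_mul (by positivity)]
  congr 1
  rcases (Nat.cast_nonneg (α := ℝ) (active Y).card).eq_or_lt with h0 | h0
  · rw [← h0, Real.zero_rpow (by linarith : p ≠ 0)]; ring
  · rw [Real.rpow_sub_one h0.ne']; field_simp

end Volume

section Reg

variable {n d : ℕ}

/-- The points that are regular for every member of a tower. -/
def regSet (s B : ℝ) (τ : List (MvPolynomial (Fin n) ℝ × Fin n)) : Set (Fin n → ℝ) :=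
  {y | ∀ e ∈ τ, y ∈ Reg s B Finset.univ e.2 e.1}

lemma iterD_eq_zero_of_vars {J : Finset (Fin n)} {Q : MvPolynomial (Fin n) ℝ} (hQ : Q.vars ⊆ J)
    {L : List (Fin n)} (hL : ¬ ∀ l ∈ L, l ∈ J) : iterD L Q = 0 := by
  induction L with
  | nil => simp at hL
  | cons l L ih =>
    rw [iterD_cons]
    by_cases hl : l ∈ J
    · rw [ih fun h => hL fun l' hl' => by
        rcases List.mem_cons.1 hl' with rfl | h'
        · exact hl
        · exact h _ h', map_zero]
    · exact pderiv_eq_zero_of_vars ((vars_iterD_subset L Q).trans hQ) hl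

lemma Reg_subset_univ {s B : ℝ} (hs : 0 ≤ s) (hB : 0 ≤ B) {J : Finset (Fin n)} {l : Fin n}
    {Q : MvPolynomial (Fin n) ℝ}
    (hQ : Q.vars ⊆ J) : Reg s B J l Q ⊆ Reg s B Finset.univ l Q := by
  intro y hy
  refine ⟨hy.1, fun L _ => ?_⟩
  by_cases hL : ∀ l ∈ L, l ∈ J
  · exact hy.2 L hL
  · rw [iterD_eq_zero_of_vars hQ hL, map_zero, abs_zero, mul_zero]
    positivity

lemma regSet_fatten {s B : ℝ} (hs : 0 < s) (hB : 1 ≤ B)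
    {τ : List (MvPolynomial (Fin n) ℝ × Fin n)} {y z : Fin n → ℝ}
    (hy : y ∈ regSet s B τ) (hz : n * ‖z - y‖ / s ≤ 1 / (8 * B)) : z ∈ regSet s (4 * B) τ :=
  fun e he => (Reg.fatten hs hB (Finset.subset_univ _) (hy e he) hz).1

/-- Shadings contained in a neighbourhood of a low-dimensional tower have small broad energy. -/
lemma energy_le_of_subset_regSet {ι : Type*} [Fintype ι] {N K : ℕ}
    {τ : List (MvPolynomial (Fin (d + 1)) ℝ × Fin (d + 1))} {J : Finset (Fin (d + 1))}
    (hτ : IsTower N τ J) {a v : ι → Fin d → ℝ} (hv : ∀ i j, |v i j| ≤ 1) {δ Lam θ η p : ℝ}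
    (hδ : 0 < δ) (hLam : 8 * ((d + 1 : ℕ) : ℝ) ≤ Lam) (hθ : 0 < θ)
    (hLam' : 6 * ((d + 1 : ℕ) : ℝ) ^ 2 ≤ θ * Lam)
    (hη : 0 < η) (hη1 : η ≤ 1) (hθη : tangentConst (d + 1) * θ ≤ η)
    (hK : (2 * ⌈1 / θ⌉₊ + 1) ^ (J.card - 1) * 3 ^ d ≤ K) (hp : 1 ≤ p)
    {Y : ι → Set (Fin (d + 1) → ℝ)} (hY : ∀ i, MeasurableSet (Y i))
    (hYτ : ∀ i, Y i ⊆ regSet (Lam * δ) 1 τ) (hYT : ∀ i, Y i ⊆ gtube δ (a i) (v i)) :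
    energy (fun i j => ⌊v i j / η⌋) p K Y ≤ ENNReal.ofReal
      (2 ^ p * (16 * (d + 1) * N ^ 2 * Lam / θ * 2 ^ d) * δ ^ (d + 1) *
        ((active Y).card : ℝ) ^ p) := by
  classical
  have hn0 : (0 : ℝ) < ((d + 1 : ℕ) : ℝ) := by positivity
  have hLam0 : 0 < Lam := lt_of_lt_of_le (by positivity) hLam
  set s := Lam * δ with hs
  have hs0 : 0 < s := by positivity
  set c : ℝ := 8 * s / θ with hc
  have hc0 : 0 ≤ c := by positivity
  have hdeg : ∀ i, ∀ e ∈ τ, (coreRes (a i) (v i) e.1).natDegree ≤ N := fun i e he =>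
    (natDegree_coreRes_le _ _ _).trans (hτ.totalDegree_le e he)
  have hR : ∀ i, ∀ e : MvPolynomial (Fin (d + 1)) ℝ × Fin (d + 1), ∃ R : Finset ℝ, e ∈ τ →
      R.card ≤ N ∧ ∀ t, (coreRes (a i) (v i) e.1).derivative.eval t ≠ 0 →
        |(coreRes (a i) (v i) e.1).eval t| ≤ c * |(coreRes (a i) (v i) e.1).derivative.eval t| →
        ∃ r ∈ R, |t - r| ≤ N * c := by
    intro i e
    by_cases he : e ∈ τ
    · obtain ⟨R, h1, h2⟩ := exists_centers_of_abs_eval_le _ (hdeg i e he) hc0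
      exact ⟨R, fun _ => ⟨h1, h2⟩⟩
    · exact ⟨∅, fun h => absurd h he⟩
  choose R hR using hR
  set I : ι → Set ℝ := fun i => ⋃ e ∈ τ.toFinset, ⋃ r ∈ R i e, Metric.closedBall r (N * c) with hI
  have hIm : ∀ i, MeasurableSet (I i) := fun i =>
    Finset.measurableSet_biUnion _ fun e _ => Finset.measurableSet_biUnion _ fun r _ =>
      Metric.isClosed_closedBall.measurableSet
  have hIm' : ∀ i, MeasurableSet {x : Fin (d + 1) → ℝ | x 0 ∈ I i} := fun i =>
    (measurable_pi_apply 0) (hIm i)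
  have hlen : τ.length ≤ d + 1 := by have := hτ.card; omega
  have hIv : ∀ i, volume (I i) ≤ ENNReal.ofReal ((d + 1) * (N * (2 * (N * c)))) := by
    intro i
    calc volume (I i) ≤ ∑ e ∈ τ.toFinset, ∑ r ∈ R i e, volume (Metric.closedBall r (N * c)) :=
          (measure_biUnion_finset_le _ _).trans (Finset.sum_le_sum fun e _ =>
            measure_biUnion_finset_le _ _)
      _ ≤ ∑ e ∈ τ.toFinset, ENNReal.ofReal (N * (2 * (N * c))) := by
          refine Finset.sum_le_sum fun e he => ?_
          simp only [Real.volume_closedBall, Finset.sum_const, nsmul_eq_mul]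
          rw [← ENNReal.ofReal_natCast, ← ENNReal.ofReal_mul (by positivity)]
          refine ENNReal.ofReal_le_ofReal ?_
          gcongr
          exact (hR i e (List.mem_toFinset.1 he)).1
      _ ≤ _ := by
          rw [Finset.sum_const, nsmul_eq_mul, ← ENNReal.ofReal_natCast,
            ← ENNReal.ofReal_mul (by positivity)]
          refine ENNReal.ofReal_le_ofReal ?_
          gcongr
          exact_mod_cast (List.toFinset_card_le τ).trans hlen
  set Y' : ι → Set (Fin (d + 1) → ℝ) := fun i => Y i ∩ {x | x 0 ∈ I i} with hY'
  set Y'' : ι → Set (Fin (d + 1) → ℝ) := fun i => Y i \ {x | x 0 ∈ I i} with hY''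
  have hY'm : ∀ i, MeasurableSet (Y' i) := fun i => (hY i).inter (hIm' i)
  have hcov : ∀ i, Y i ⊆ Y' i ∪ Y'' i := fun i => (Set.inter_union_sdiff _ _).ge
  have hE1 : energy (fun i j => ⌊v i j / η⌋) p 0 Y' ≤ ENNReal.ofReal
      ((16 * (d + 1) * N ^ 2 * Lam / θ * 2 ^ d) * δ ^ (d + 1) * ((active Y).card : ℝ) ^ p) := by
    refine (energy_le_of_volume_le hp hY'm
      (V := (16 * (d + 1) * N ^ 2 * Lam / θ * 2 ^ d) * δ ^ (d + 1))
      fun i => ?_).trans ?_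
    · refine (measure_mono (Set.inter_subset_inter_left _ (hYT i))).trans
        ((volume_gtube_inter_le hδ.le _ _ (hIm i)).trans ?_)
      refine (mul_le_mul_left (hIv i) _).trans (le_of_eq ?_)
      rw [← ENNReal.ofReal_mul (by positivity)]
      congr 1
      rw [hc, hs]; ring
    · refine ENNReal.ofReal_le_ofReal ?_
      gcongr
      exact active_mono fun i => Set.inter_subset_left
  have hE2 : energy (fun i j => ⌊v i j / η⌋) p K Y'' = 0 := by
    rw [energy]
    refine (lintegral_congr fun x => ?_).trans lintegral_zero
    have h0 : broad (fun i j => ⌊v i j / η⌋) K (mult Y'' x) = 0 := by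
      refine broad_eq_zero ?_
      rcases (mult Y'' x).eq_empty_or_nonempty with hemp | ⟨i₀, hi₀⟩
      · rw [hemp]; simp
      have hx : x ∈ regSet s 1 τ := hYτ i₀ (mem_mult.1 hi₀).1
      refine (card_image_cap_le hτ (y := x) (fun e he => ⟨(hx e he).1, fun j => ?_⟩) _
        (fun i _ => hv i) hθ hη hη1 hθη fun i hi e he => ?_).trans hK
      · have := (hx e he).2 [j] (by simp)
        rw [iterD_cons, iterD_nil, List.length_singleton, pow_one, one_mul] at this
        exact le_of_mul_le_mul_left this hs0
      · obtain ⟨hxY, hxI⟩ := mem_mult.1 hi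
        set z := corePt (a i) (v i) (x 0) with hz
        have hzx : ‖z - x‖ ≤ δ := norm_corePt_sub_le hδ.le (hYT i hxY)
        have hratio : ((d + 1 : ℕ) : ℝ) * ‖z - x‖ / s ≤ ((d + 1 : ℕ) : ℝ) / Lam := by
          rw [div_le_div_iff₀ hs0 hLam0, hs]
          have : ((d + 1 : ℕ) : ℝ) * ‖z - x‖ * Lam ≤ ((d + 1 : ℕ) : ℝ) * δ * Lam := by gcongr
          linarith
        have hr8 : ((d + 1 : ℕ) : ℝ) / Lam ≤ 1 / 8 := by
          rw [div_le_div_iff₀ hLam0 (by norm_num)]; linarith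
        obtain ⟨hz4, hg1, hg2⟩ := Reg.fatten hs0 le_rfl (Finset.subset_univ _) (hx e he)
          (z := z) (by rw [mul_one]; exact hratio.trans hr8)
        have hdq : (coreRes (a i) (v i) e.1).derivative.eval (x 0) =
            ∑ j, dirVec (v i) j * eval z (pderiv j e.1) := eval_derivative_coreRes _ _ _ _
        have hqle : |(coreRes (a i) (v i) e.1).eval (x 0)| ≤
            4 * (s * |eval z (pderiv e.2 e.1)|) := by
          rw [eval_coreRes]
          have := hz4.2 [] (by simp)
          rwa [iterD_nil, List.length_nil, pow_zero, one_mul, mul_one] at this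
        have htan : |∑ j, dirVec (v i) j * eval z (pderiv j e.1)| ≤
            θ / 2 * |eval z (pderiv e.2 e.1)| := by
          by_contra! hcon
          rw [← hdq] at hcon
          have hpos : 0 < |eval z (pderiv e.2 e.1)| := abs_pos.2 hz4.1
          have h1 : (coreRes (a i) (v i) e.1).derivative.eval (x 0) ≠ 0 := by
            intro h
            rw [h, abs_zero] at hcon
            exact absurd hcon (not_lt.2 (by positivity))
          obtain ⟨r, hr, hxr⟩ := (hR i e he).2 (x 0) h1 (by
            refine hqle.trans ?_
            have : c * (θ / 2 * |eval z (pderiv e.2 e.1)|) =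
                4 * (s * |eval z (pderiv e.2 e.1)|) := by
              rw [hc]; field_simp; ring
            rw [← this]
            gcongr)
          refine hxI ?_
          show x 0 ∈ I i
          rw [hI]
          simp only [Set.mem_iUnion]
          exact ⟨e, List.mem_toFinset.2 he, r, hr, by rwa [Metric.mem_closedBall, Real.dist_eq]⟩
        have hdiff : |∑ j, dirVec (v i) j * eval z (pderiv j e.1) -
            ∑ j, dirVec (v i) j * eval x (pderiv j e.1)| ≤
            ((d + 1 : ℕ) : ℝ) * (2 * (((d + 1 : ℕ) : ℝ) / Lam) * |eval x (pderiv e.2 e.1)|) := by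
          rw [← Finset.sum_sub_distrib]
          refine (Finset.abs_sum_le_sum_abs _ _).trans ?_
          refine (Finset.sum_le_card_nsmul _ _ (2 * (((d + 1 : ℕ) : ℝ) / Lam) *
            |eval x (pderiv e.2 e.1)|) fun j _ => ?_).trans (by simp)
          rw [← mul_sub, abs_mul]
          have h1 : |dirVec (v i) j| ≤ 1 := by
            refine Fin.cases (by simp [dirVec]) (fun j => ?_) j
            simpa [dirVec] using hv i j
          have h2 := Reg.abs_pderiv_sub_le hs0 (Finset.subset_univ _) (hx e he) (z := z)
            (hratio.trans (hr8.trans (by norm_num))) j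
          rw [one_mul] at h2
          calc _ ≤ 1 * |eval z (pderiv j e.1) - eval x (pderiv j e.1)| := by gcongr
            _ ≤ _ := by
              rw [one_mul]
              refine h2.trans ?_
              gcongr
        have hLam'' : ((d + 1 : ℕ) : ℝ) * (2 * (((d + 1 : ℕ) : ℝ) / Lam)) ≤ θ / 3 := by
          have : ((d + 1 : ℕ) : ℝ) * (2 * (((d + 1 : ℕ) : ℝ) / Lam)) =
              2 * ((d + 1 : ℕ) : ℝ) ^ 2 / Lam := by ring
          rw [this, div_le_div_iff₀ hLam0 (by norm_num)]
          linarith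
        have hfin : |∑ j, dirVec (v i) j * eval x (pderiv j e.1)| ≤
            |∑ j, dirVec (v i) j * eval z (pderiv j e.1)| +
            |∑ j, dirVec (v i) j * eval z (pderiv j e.1) -
            ∑ j, dirVec (v i) j * eval x (pderiv j e.1)| := by
          have := abs_sub (∑ j, dirVec (v i) j * eval z (pderiv j e.1))
            (∑ j, dirVec (v i) j * eval z (pderiv j e.1) -
            ∑ j, dirVec (v i) j * eval x (pderiv j e.1))
          rwa [sub_sub_cancel] at this
        refine hfin.trans ((add_le_add htan hdiff).trans ?_)
        have h3 : θ / 2 * |eval z (pderiv e.2 e.1)| ≤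
            θ / 2 * (4 / 3 * |eval x (pderiv e.2 e.1)|) := by
          gcongr
        have h4 := mul_le_mul_of_nonneg_right hLam'' (abs_nonneg (eval x (pderiv e.2 e.1)))
        nlinarith
    rw [h0, Nat.cast_zero, ENNReal.zero_rpow_of_pos (by linarith)]
  have := energy_union_le (cap := fun i j => ⌊v i j / η⌋) (A := 0) (B := K) (p := p)
    (by linarith) hY'm hcov
  rw [hE2, add_zero, zero_add] at this
  refine this.trans ((mul_le_mul_right hE1 _).trans (le_of_eq ?_))
  rw [← ENNReal.ofReal_ofNat, ENNReal.ofReal_rpow_of_nonneg (by norm_num) (by linarith),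
    ← ENNReal.ofReal_mul (by positivity)]
  congr 1
  ring

end Reg

end Kakeya

end

section

open MeasureTheory
open scoped ENNReal

namespace Kakeya

open MvPolynomial PolyCalc

section Breakpoints

variable {n d : ℕ}

/-- Lists of bounded length over `Fin n`. -/
noncomputable def boundedLists (n N : ℕ) : Finset (List (Fin n)) :=
  (List.finite_length_le (Fin n) N).toFinset

lemma mem_boundedLists {N : ℕ} {L : List (Fin n)} : L ∈ boundedLists n N ↔ L.length ≤ N := by
  simp [boundedLists]

/-- The polynomial whose positivity expresses one of the regularity inequalities. -/
noncomputable def gapPoly (b s : ℝ) (l : Fin n) (L : List (Fin n)) (Q : MvPolynomial (Fin n) ℝ) :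
    MvPolynomial (Fin n) ℝ :=
  (C (b * s) * pderiv l Q) ^ 2 - (C (s ^ L.length) * iterD L Q) ^ 2

lemma eval_gapPoly (b s : ℝ) (l : Fin n) (L : List (Fin n)) (Q : MvPolynomial (Fin n) ℝ)
    (y : Fin n → ℝ) : eval y (gapPoly b s l L Q) =
      (b * s * eval y (pderiv l Q)) ^ 2 - (s ^ L.length * eval y (iterD L Q)) ^ 2 := by
  simp [gapPoly]

lemma totalDegree_gapPoly_le (b s : ℝ) (l : Fin n) (L : List (Fin n))
    (Q : MvPolynomial (Fin n) ℝ) : (gapPoly b s l L Q).totalDegree ≤ 2 * Q.totalDegree := by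
  refine (totalDegree_sub _ _).trans (max_le ?_ ?_)
  · refine (totalDegree_pow _ _).trans (Nat.mul_le_mul_left _ ((totalDegree_mul _ _).trans ?_))
    rw [totalDegree_C, zero_add]
    exact (totalDegree_pderiv_le l Q).trans (Nat.sub_le _ _)
  · refine (totalDegree_pow _ _).trans (Nat.mul_le_mul_left _ ((totalDegree_mul _ _).trans ?_))
    rw [totalDegree_C, zero_add]
    exact (totalDegree_iterD_le L Q).trans (Nat.sub_le _ _)

lemma eval_gapPoly_pos {b s : ℝ} (hb : 0 < b) (hs : 0 < s) {l : Fin n} {L : List (Fin n)}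
    {Q : MvPolynomial (Fin n) ℝ} {y : Fin n → ℝ} (h0 : eval y (pderiv l Q) ≠ 0) {B : ℝ} (hB : B < b)
    (h : s ^ L.length * |eval y (iterD L Q)| ≤ B * (s * |eval y (pderiv l Q)|)) :
    0 < eval y (gapPoly b s l L Q) := by
  rw [eval_gapPoly, sub_pos]
  refine sq_lt_sq.2 ?_
  rw [abs_mul, abs_mul, abs_of_pos (pow_pos hs _), abs_of_pos (mul_pos hb hs)]
  refine h.trans_lt ?_
  rw [mul_assoc]
  exact mul_lt_mul_of_pos_right hB (mul_pos hs (abs_pos.2 h0))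

lemma mem_Reg_of_eval_gapPoly_pos {b s : ℝ} (hb : 0 < b) (hs : 0 < s) {l : Fin n}
    {Q : MvPolynomial (Fin n) ℝ} {N : ℕ} (hQ : Q.totalDegree ≤ N) {y : Fin n → ℝ}
    (h : ∀ L ∈ boundedLists n N, 0 < eval y (gapPoly b s l L Q)) :
    y ∈ Reg s b Finset.univ l Q := by
  have hle : ∀ L ∈ boundedLists n N,
      s ^ L.length * |eval y (iterD L Q)| < b * (s * |eval y (pderiv l Q)|) := by
    intro L hL
    have := h L hL
    rw [eval_gapPoly, sub_pos] at this
    have := sq_lt_sq.1 this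
    rwa [abs_mul, abs_mul, abs_of_pos (pow_pos hs _), abs_of_pos (mul_pos hb hs), mul_assoc] at this
  refine ⟨fun h0 => ?_, fun L _ => ?_⟩
  · have := hle [] (mem_boundedLists.2 (Nat.zero_le _))
    rw [h0, abs_zero, mul_zero, mul_zero] at this
    exact absurd this (not_lt.2 (by positivity))
  · by_cases hL : L.length ≤ N
    · exact (hle L (mem_boundedLists.2 hL)).le
    · rw [iterD_eq_zero (by omega), map_zero, abs_zero, mul_zero]
      positivity

/-- The heights that lie in an interval of length `ℓ` along which the line stays regular. -/
def longSet (s ℓ : ℝ) (τ : List (MvPolynomial (Fin (d + 1)) ℝ × Fin (d + 1)))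
    (a v : Fin d → ℝ) : Set ℝ :=
  {t | ∃ c, t ∈ Set.Ioo c (c + ℓ) ∧ ∀ t' ∈ Set.Ioo c (c + ℓ), corePt a v t' ∈ regSet s 8 τ}

lemma isOpen_longSet (s ℓ : ℝ) (τ : List (MvPolynomial (Fin (d + 1)) ℝ × Fin (d + 1)))
    (a v : Fin d → ℝ) : IsOpen (longSet s ℓ τ a v) := by
  refine isOpen_iff_forall_mem_open.2 fun t ⟨c, hc, h⟩ => ⟨Set.Ioo c (c + ℓ), ?_, isOpen_Ioo, hc⟩
  exact fun t' ht' => ⟨c, ht', h⟩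

/-- The number of breakpoints of a line relative to a tower of degree at most `N`. -/
noncomputable def breakCount (d N : ℕ) : ℕ := (d + 1) * ((boundedLists (d + 1) N).card * (2 * N))

lemma exists_breakpoints {N : ℕ} {τ : List (MvPolynomial (Fin (d + 1)) ℝ × Fin (d + 1))}
    {J : Finset (Fin (d + 1))} (hτ : IsTower N τ J) (a v : Fin d → ℝ) {s ℓ : ℝ} (hs : 0 < s)
    (hℓ : 0 < ℓ) :
    ∃ R : Finset ℝ, R.card ≤ breakCount d N ∧ ∀ t, corePt a v t ∈ regSet s 4 τ →
      t ∉ longSet s ℓ τ a v → ∃ r ∈ R, |t - r| ≤ ℓ := by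
  classical
  have hlen : τ.length ≤ d + 1 := by have := hτ.card; omega
  set G : MvPolynomial (Fin (d + 1)) ℝ × Fin (d + 1) → List (Fin (d + 1)) → Polynomial ℝ :=
    fun e L => coreRes a v (gapPoly 8 s e.2 L e.1) with hG
  refine ⟨τ.toFinset.biUnion fun e => (boundedLists (d + 1) N).biUnion fun L =>
    (G e L).roots.toFinset, ?_, fun t ht htL => ?_⟩
  · refine (Finset.card_biUnion_le_card_mul _ _ ((boundedLists (d + 1) N).card * (2 * N))
      fun e he => Finset.card_biUnion_le_card_mul _ _ _ fun L hL => ?_).trans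
      (Nat.mul_le_mul_right _ ((List.toFinset_card_le τ).trans hlen))
    refine (Multiset.toFinset_card_le _).trans ((Polynomial.card_roots' _).trans ?_)
    refine (natDegree_coreRes_le _ _ _).trans ((totalDegree_gapPoly_le _ _ _ _ _).trans ?_)
    exact Nat.mul_le_mul_left _ (hτ.totalDegree_le e (List.mem_toFinset.1 he))
  · by_contra! hcon
    have hpos : ∀ e ∈ τ, ∀ L, 0 < (G e L).eval t := by
      intro e he L
      rw [hG, eval_coreRes]
      exact eval_gapPoly_pos (by norm_num) hs (ht e he).1 (by norm_num)
        ((ht e he).2 L fun _ _ => Finset.mem_univ _)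
    refine htL ⟨t - ℓ / 2, ⟨by linarith, by linarith⟩, fun t' ht' e he => ?_⟩
    refine mem_Reg_of_eval_gapPoly_pos (by norm_num) hs (hτ.totalDegree_le e he) fun L hL => ?_
    have : 0 < (G e L).eval t' := by
      refine polynomial_pos_of_forall_ne (fun r hr h0 => ?_) (hpos e he L)
      have hne : G e L ≠ 0 := fun h => by
        have := hpos e he L
        rw [h, Polynomial.eval_zero] at this
        exact lt_irrefl _ this
      have hmem : r ∈ τ.toFinset.biUnion fun e => (boundedLists (d + 1) N).biUnion fun L =>
          (G e L).roots.toFinset := by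
        refine Finset.mem_biUnion.2 ⟨e, List.mem_toFinset.2 he, Finset.mem_biUnion.2 ⟨L, hL, ?_⟩⟩
        rw [Multiset.mem_toFinset]
        exact (Polynomial.mem_roots hne).2 h0
      have h1 := hcon r hmem
      have h2 : |t - r| ≤ |t - t'| := by
        rcases Set.mem_uIcc.1 hr with h | h
        · rw [abs_le]; constructor <;> cases abs_cases (t - t') <;> linarith [h.1, h.2]
        · rw [abs_le]; constructor <;> cases abs_cases (t - t') <;> linarith [h.1, h.2]
      have h3 : |t - t'| ≤ ℓ := by
        rw [abs_le]; constructor <;> linarith [ht'.1, ht'.2]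
      linarith
    rwa [hG, eval_coreRes] at this

end Breakpoints

section Slices

variable {d : ℕ}

lemma exists_slice_le {S : Set (Fin (d + 1) → ℝ)} (hS : MeasurableSet S) {α β : ℝ} (h : α < β) :
    ∃ t ∈ Set.Ioo α β, volume {y : Fin d → ℝ | (Fin.cons t y : Fin (d + 1) → ℝ) ∈ S} ≤
      volume S / ENNReal.ofReal (β - α) := by
  have hmp := volume_preserving_piFinSuccAbove (fun _ : Fin (d + 1) => ℝ) 0
  set e := MeasurableEquiv.piFinSuccAbove (fun _ : Fin (d + 1) => ℝ) 0 with he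
  set S' : Set (ℝ × (Fin d → ℝ)) := e.symm ⁻¹' S with hS'
  have hS'm : MeasurableSet S' := e.symm.measurable hS
  have hsl : ∀ t, {y : Fin d → ℝ | (Fin.cons t y : Fin (d + 1) → ℝ) ∈ S} = Prod.mk t ⁻¹' S' := by
    intro t; ext y
    simp [hS', he, MeasurableEquiv.piFinSuccAbove, Fin.insertNthEquiv]
  have hvol : volume S = ∫⁻ t, volume (Prod.mk t ⁻¹' S') := by
    rw [← Measure.prod_apply hS'm, ← Measure.volume_eq_prod, ← hmp.measure_preimage_equiv]
    congr 1
    ext x; simp [hS', he]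
  have hI : volume (Set.Ioo α β) = ENNReal.ofReal (β - α) := Real.volume_Ioo
  obtain ⟨t, ht, hle⟩ := exists_le_setLAverage (μ := volume) (s := Set.Ioo α β)
    (f := fun t => volume (Prod.mk t ⁻¹' S'))
    (by rw [hI]; simpa using h) (by rw [hI]; exact ENNReal.ofReal_ne_top)
    (measurable_measure_prodMk_left hS'm).aemeasurable
  refine ⟨t, ht, ?_⟩
  rw [hsl]
  refine hle.trans ?_
  rw [setLAverage_eq, hI]
  exact ENNReal.div_le_div_right ((setLIntegral_le_lintegral _ _).trans hvol.ge) _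

end Slices

end Kakeya

end

section

open MeasureTheory
open scoped ENNReal

namespace Kakeya

open MvPolynomial PolyCalc

variable {d : ℕ}

/-- The polynomials cutting out a neighbourhood of a tower inside a cube. -/
noncomputable def nbhdPoly (s ρ : ℝ) (o : Fin (d + 1) → ℝ)
    (τ : List (MvPolynomial (Fin (d + 1)) ℝ × Fin (d + 1))) :
    Fin τ.length ⊕ Fin (d + 1) → MvPolynomial (Fin (d + 1)) ℝ :=
  Sum.elim (fun k => gapPoly 64 s (τ.get k).2 [] (τ.get k).1) fun j =>
    C (ρ ^ 2) - (X j - C (o j)) ^ 2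

lemma totalDegree_nbhdPoly_le (s ρ : ℝ) (o : Fin (d + 1) → ℝ) {N : ℕ}
    {τ : List (MvPolynomial (Fin (d + 1)) ℝ × Fin (d + 1))}
    (hτ : ∀ e ∈ τ, e.1.totalDegree ≤ N) (k : Fin τ.length ⊕ Fin (d + 1)) :
    (nbhdPoly s ρ o τ k).totalDegree ≤ 2 * N + 2 := by
  rcases k with k | j
  · refine (totalDegree_gapPoly_le _ _ _ _ _).trans ?_
    have := hτ _ (τ.get_mem k)
    omega
  · refine (totalDegree_sub _ _).trans (max_le (by rw [totalDegree_C]; omega) ?_)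
    refine (totalDegree_pow _ _).trans ?_
    have : (X j - C (o j) : MvPolynomial (Fin (d + 1)) ℝ).totalDegree ≤ 1 :=
      (totalDegree_sub _ _).trans (max_le (totalDegree_X _).le (by simp))
    omega

lemma nbhd_subset {s ρ : ℝ} (hs : 0 < s) (hρ : 0 ≤ ρ) (o : Fin (d + 1) → ℝ)
    (τ : List (MvPolynomial (Fin (d + 1)) ℝ × Fin (d + 1))) :
    {x | ∀ k, 0 < eval x (nbhdPoly s ρ o τ k)} ⊆ towerSet (64 * s) τ ∩ Metric.closedBall o ρ := by
  intro x hx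
  refine ⟨fun e he => ?_, ?_⟩
  · obtain ⟨k, hk⟩ := List.get_of_mem he
    have h := hx (Sum.inl k)
    simp only [nbhdPoly, Sum.elim_inl, eval_gapPoly, sub_pos, hk] at h
    have h := sq_lt_sq.1 h
    simpa [abs_mul, abs_of_pos hs] using h
  · rw [Metric.mem_closedBall, dist_eq_norm, pi_norm_le_iff_of_nonneg hρ]
    intro j
    have h := hx (Sum.inr j)
    simp only [nbhdPoly, Sum.elim_inr, map_sub, map_pow, eval_C, eval_X, sub_pos] at h
    have h := sq_lt_sq.1 h
    rw [abs_of_nonneg hρ] at h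
    exact h.le

lemma mem_nbhd {s ρ : ℝ} (hs : 0 < s) {o : Fin (d + 1) → ℝ}
    {τ : List (MvPolynomial (Fin (d + 1)) ℝ × Fin (d + 1))} {x : Fin (d + 1) → ℝ}
    (hx : x ∈ regSet s 32 τ) (hxo : ‖x - o‖ < ρ) (k) : 0 < eval x (nbhdPoly s ρ o τ k) := by
  rcases k with k | j
  · have h := hx _ (τ.get_mem k)
    exact eval_gapPoly_pos (by norm_num) hs h.1 (by norm_num) (h.2 [] (by simp))
  · simp only [nbhdPoly, Sum.elim_inr, map_sub, map_pow, eval_C, eval_X, sub_pos]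
    refine sq_lt_sq.2 ?_
    have := (norm_le_pi_norm (x - o) j).trans_lt hxo
    exact this.trans_le (le_abs_self _)

/-- The constant in the polynomial Wolff estimate. -/
noncomputable def wolffConst (d N : ℕ) : ℝ :=
  (d + 1) * ((2 * d * ((d + 1) * (2 * (d + 1)) * (2 * N + 2) + 1) + 1) ^ (2 * d) : ℕ)

/-- The polynomial Wolff estimate for lines regular over a common interval of heights. -/
lemma card_le_of_common_interval {ι : Type*} {N : ℕ}
    {τ : List (MvPolynomial (Fin (d + 1)) ℝ × Fin (d + 1))} {J : Finset (Fin (d + 1))}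
    (hτ : IsTower N τ J) {a v : ι → Fin d → ℝ} {δ Lam c₀ r ℓ g : ℝ} (hδ : 0 < δ) (hδr : δ ≤ r)
    (hLam : 64 * ((d + 1 : ℕ) : ℝ) ≤ Lam) (hc₀ : 0 < c₀) (hc₀1 : c₀ ≤ 1) (hℓ : 0 < ℓ)
    (hℓ2 : ℓ ≤ 2) (X : Finset ι) (hsep : ∀ i ∈ X, ∀ j ∈ X, i ≠ j → c₀ * δ ≤ ‖v i - v j‖)
    (o : Fin (d + 1) → ℝ)
    (hX : ∀ i ∈ X, ∀ t ∈ Set.Ioo g (g + ℓ), corePt (a i) (v i) t ∈ regSet (Lam * δ) 8 τ ∧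
      ‖corePt (a i) (v i) t - o‖ ≤ 5 * r) :
    X.card * (c₀ * δ) ^ d ≤ wolffConst d N *
      ((128 * N ^ 2 * (Lam * δ)) ^ τ.length * (14 * r) ^ J.card) *
        (2 * (d + 1) / ℓ) ^ (d + 1) := by
  classical
  have hr : 0 < r := hδ.trans_le hδr
  have hLam0 : 0 < Lam := lt_of_lt_of_le (by positivity) hLam
  set s := Lam * δ with hs
  have hs0 : 0 < s := by positivity
  set S : Set (Fin (d + 1) → ℝ) := {x | ∀ k, 0 < eval x (nbhdPoly s (7 * r) o τ k)} with hS
  have hSm : MeasurableSet S := by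
    have : S = ⋂ k, {x | 0 < eval x (nbhdPoly s (7 * r) o τ k)} := by ext; simp [hS]
    rw [this]
    exact MeasurableSet.iInter fun k => measurableSet_lt measurable_const (measurable_eval _)
  have hSsub := nbhd_subset hs0 (by positivity : 0 ≤ 7 * r) o τ
  set V : ℝ := (128 * N ^ 2 * (Lam * δ)) ^ τ.length * (14 * r) ^ J.card with hV
  have hV0 : 0 ≤ V := by positivity
  have hSV : volume S ≤ ENNReal.ofReal V := by
    refine (measure_mono hSsub).trans ((volume_towerSet_le (by positivity) hτ o
      (by positivity)).trans (le_of_eq ?_))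
    rw [hV, hs]; congr 1; ring
  set ρ : ℝ := ℓ / (2 * (d + 1)) with hρ
  have hρ0 : 0 < ρ := by positivity
  have hex : ∀ k : Fin (d + 1), ∃ t ∈ Set.Ioo (g + 2 * (k : ℝ) * ρ) (g + (2 * (k : ℝ) + 1) * ρ),
      volume {y : Fin d → ℝ | (Fin.cons t y : Fin (d + 1) → ℝ) ∈ S} ≤ ENNReal.ofReal (V / ρ) := by
    intro k
    obtain ⟨t, ht, hle⟩ := exists_slice_le hSm
      (show g + 2 * (k : ℝ) * ρ < g + (2 * (k : ℝ) + 1) * ρ by linarith)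
    refine ⟨t, ht, hle.trans ?_⟩
    rw [ENNReal.ofReal_div_of_pos hρ0]
    refine (ENNReal.div_le_div_right hSV _).trans (le_of_eq ?_)
    congr 2; ring
  choose t ht hts using hex
  have htsep : ∀ k k', k ≠ k' → ρ ≤ |t k - t k'| := by
    have key : ∀ k k' : Fin (d + 1), k < k' → ρ ≤ |t k - t k'| := by
      intro k k' hk
      have h1 : (k : ℝ) + 1 ≤ k' := by exact_mod_cast hk
      have h2 := (ht k).2
      have h3 := (ht k').1
      rw [abs_sub_comm]
      refine le_trans ?_ (le_abs_self _)
      nlinarith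
    intro k k' hne
    rcases lt_or_gt_of_ne hne with h | h
    · exact key _ _ h
    · rw [abs_sub_comm]; exact key _ _ h
  have htinj : Function.Injective t := by
    intro k k' h
    by_contra hne
    have := htsep k k' hne
    rw [h, sub_self, abs_zero] at this
    linarith
  have htmem : ∀ k, t k ∈ Set.Ioo g (g + ℓ) := by
    intro k
    have h1 : (k : ℝ) + 1 ≤ d + 1 := by exact_mod_cast k.2
    have h2 : (0 : ℝ) ≤ k := Nat.cast_nonneg _
    have h3 : ℓ = 2 * (d + 1) * ρ := by rw [hρ]; field_simp
    refine ⟨lt_of_le_of_lt ?_ (ht k).1, lt_of_lt_of_le (ht k).2 ?_⟩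
    · nlinarith
    · rw [h3]; nlinarith
  have hW := volume_slopes_le (nbhdPoly s (7 * r) o τ)
    (totalDegree_nbhdPoly_le s (7 * r) o hτ.totalDegree_le)
    ((Metric.isBounded_closedBall.subset Set.inter_subset_right).subset hSsub) htinj
  set Vs : Set (Fin d → ℝ) := {v : Fin d → ℝ | ∃ a : Fin d → ℝ, ∀ i k,
    0 < eval (Fin.cons (t i) (a + t i • v)) (nbhdPoly s (7 * r) o τ k)} with hVs
  have hballs : ∀ i ∈ X, Metric.ball (v i) (c₀ * δ / 2) ⊆ Vs := by
    intro i hi w hw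
    refine ⟨a i + g • (v i - w), fun k => ?_⟩
    rw [Metric.mem_ball, dist_eq_norm] at hw
    obtain ⟨h1, h2⟩ := hX i hi (t k) (htmem k)
    set z : Fin (d + 1) → ℝ := Fin.cons (t k) (a i + g • (v i - w) + t k • w) with hz
    have hzle : ‖z - corePt (a i) (v i) (t k)‖ ≤ δ := by
      rw [pi_norm_le_iff_of_nonneg hδ.le]
      intro j
      refine Fin.cases ?_ (fun j => ?_) j
      · simpa [hz] using hδ.le
      · have hj : |w j - v i j| ≤ c₀ * δ / 2 := (norm_le_pi_norm (w - v i) j).trans hw.le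
        have : (z - corePt (a i) (v i) (t k)) j.succ = (t k - g) * (w j - v i j) := by
          simp [hz]; ring
        rw [this, Real.norm_eq_abs, abs_mul]
        have h3 : |t k - g| ≤ 2 := by
          rw [abs_le]; constructor <;> linarith [(htmem k).1, (htmem k).2]
        calc |t k - g| * |w j - v i j| ≤ 2 * (c₀ * δ / 2) := by gcongr
          _ ≤ δ := by nlinarith
    refine mem_nbhd hs0 ?_ ?_
    · have := regSet_fatten hs0 (by norm_num : (1 : ℝ) ≤ 8) h1 (z := z) (by
        rw [div_le_div_iff₀ hs0 (by norm_num)]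
        calc ((d + 1 : ℕ) : ℝ) * ‖z - corePt (a i) (v i) (t k)‖ * (8 * 8) ≤
            ((d + 1 : ℕ) : ℝ) * δ * (8 * 8) := by gcongr
          _ = 64 * ((d + 1 : ℕ) : ℝ) * δ := by ring
          _ ≤ Lam * δ := by gcongr
          _ = 1 * s := by rw [hs, one_mul])
      norm_num at this
      exact this
    · calc ‖z - o‖ = ‖(z - corePt (a i) (v i) (t k)) + (corePt (a i) (v i) (t k) - o)‖ := by
            congr 1; abel
        _ ≤ δ + 5 * r := (norm_add_le _ _).trans (add_le_add hzle h2)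
        _ < 7 * r := by linarith
  have hlow : ENNReal.ofReal (X.card * (c₀ * δ) ^ d) ≤ volume Vs := by
    refine le_trans ?_ (measure_mono (Set.iUnion₂_subset hballs))
    rw [measure_biUnion_finset ?_ fun i _ => Metric.isOpen_ball.measurableSet]
    · simp only [Real.volume_pi_ball _ (by positivity : 0 < c₀ * δ / 2), Fintype.card_fin,
        Finset.sum_const, nsmul_eq_mul]
      rw [ENNReal.ofReal_mul (by positivity), ENNReal.ofReal_natCast]
      refine le_of_eq ?_
      congr 3; ring
    · intro i hi j hj hij
      refine Metric.ball_disjoint_ball ?_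
      rw [dist_eq_norm]
      have := hsep i hi j hj hij
      linarith
  have hlen : τ.length ≤ d + 1 := by have := hτ.card; omega
  have hup : volume Vs ≤ ENNReal.ofReal (wolffConst d N * V * (2 * (d + 1) / ℓ) ^ (d + 1)) := by
    refine hW.trans ?_
    have h1 : ∀ i, ENNReal.ofReal (∏ j ∈ Finset.univ.erase i, |t i - t j|)⁻¹ *
        volume {y : Fin d → ℝ | ∀ k, 0 < eval (Fin.cons (t i) y) (nbhdPoly s (7 * r) o τ k)} ≤
        ENNReal.ofReal ((ρ⁻¹) ^ (d + 1) * V) := by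
      intro i
      have h2 : (∏ j ∈ Finset.univ.erase i, |t i - t j|)⁻¹ ≤ (ρ⁻¹) ^ d := by
        rw [inv_pow]
        refine inv_anti₀ (by positivity) ?_
        have : ρ ^ d = ∏ j ∈ Finset.univ.erase i, ρ := by
          rw [Finset.prod_const, Finset.card_erase_of_mem (Finset.mem_univ _), Finset.card_univ,
            Fintype.card_fin, Nat.add_sub_cancel]
        rw [this]
        exact Finset.prod_le_prod (fun _ _ => hρ0.le) fun j hj =>
          htsep i j (Finset.ne_of_mem_erase hj).symm
      calc _ ≤ ENNReal.ofReal ((ρ⁻¹) ^ d) * ENNReal.ofReal (V / ρ) :=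
            mul_le_mul' (ENNReal.ofReal_le_ofReal h2) (hts i)
        _ = _ := by
            rw [← ENNReal.ofReal_mul (by positivity)]
            congr 1; rw [pow_succ]; field_simp
    refine (mul_le_mul_right (Finset.sum_le_card_nsmul _ _ _ fun i _ => h1 i) _).trans ?_
    rw [Finset.card_univ, Fintype.card_fin, nsmul_eq_mul, ← ENNReal.ofReal_natCast,
      ← ENNReal.ofReal_natCast, ← ENNReal.ofReal_mul (by positivity),
      ← ENNReal.ofReal_mul (by positivity)]
    refine ENNReal.ofReal_le_ofReal ?_
    have h3 : (((2 * d * ((d + 1) * Fintype.card (Fin τ.length ⊕ Fin (d + 1)) *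
        (2 * N + 2) + 1) + 1)
        ^ (2 * d) : ℕ) : ℝ) ≤
        ((2 * d * ((d + 1) * (2 * (d + 1)) * (2 * N + 2) + 1) + 1) ^ (2 * d) : ℕ) := by
      have : Fintype.card (Fin τ.length ⊕ Fin (d + 1)) ≤ 2 * (d + 1) := by simp; omega
      exact_mod_cast Nat.pow_le_pow_left (by gcongr) _
    have h4 : ρ⁻¹ = 2 * (d + 1) / ℓ := by rw [hρ, inv_div]
    rw [← h4, wolffConst]
    calc _ ≤ ((2 * d * ((d + 1) * (2 * (d + 1)) * (2 * N + 2) + 1) + 1) ^ (2 * d) : ℕ) *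
          (((d + 1 : ℕ) : ℝ) * (ρ⁻¹ ^ (d + 1) * V)) := by gcongr
      _ = _ := by push_cast; ring
  have hnn : 0 ≤ wolffConst d N * V * (2 * (d + 1) / ℓ) ^ (d + 1) := by
    rw [wolffConst]; positivity
  exact (ENNReal.ofReal_le_ofReal_iff hnn).1 (hlow.trans hup)

/-- The polynomial Wolff estimate for lines regular over long intervals inside a cube. -/
lemma card_long_le {ι : Type*} {N : ℕ}
    {τ : List (MvPolynomial (Fin (d + 1)) ℝ × Fin (d + 1))} {J : Finset (Fin (d + 1))}
    (hτ : IsTower N τ J) {a v : ι → Fin d → ℝ} {δ Lam c₀ r κ : ℝ} (hδ : 0 < δ) (hδr : δ ≤ r)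
    (hr2 : r ≤ 2) (hLam : 64 * ((d + 1 : ℕ) : ℝ) ≤ Lam) (hc₀ : 0 < c₀) (hc₀1 : c₀ ≤ 1) (hκ : 0 < κ)
    (hκ1 : κ ≤ 1) (X : Finset ι) (hsep : ∀ i ∈ X, ∀ j ∈ X, i ≠ j → c₀ * δ ≤ ‖v i - v j‖)
    (o : Fin (d + 1) → ℝ)
    (hX : ∀ i ∈ X, ∃ c, ∀ t ∈ Set.Ioo c (c + κ * r),
      corePt (a i) (v i) t ∈ regSet (Lam * δ) 8 τ ∧ ‖corePt (a i) (v i) t - o‖ ≤ 5 * r) :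
    X.card * (c₀ * δ) ^ d ≤ 21 / κ * (wolffConst d N *
      ((128 * N ^ 2 * (Lam * δ)) ^ τ.length * (14 * r) ^ J.card) *
        (4 * (d + 1) / (κ * r)) ^ (d + 1)) := by
  classical
  have hr : 0 < r := hδ.trans_le hδr
  choose! c hc using hX
  set B : ℝ := wolffConst d N * ((128 * N ^ 2 * (Lam * δ)) ^ τ.length * (14 * r) ^ J.card) *
        (4 * (d + 1) / (κ * r)) ^ (d + 1) with hB
  set ℓ : ℝ := κ * r / 2 with hℓ
  have hℓ0 : 0 < ℓ := by positivity
  have hκr : κ * r = 2 * ℓ := by rw [hℓ]; ring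
  have hheight : ∀ i ∈ X, ∀ t ∈ Set.Ioo (c i) (c i + κ * r), |t - o 0| ≤ 5 * r := fun i hi t ht =>
    (norm_le_pi_norm (corePt (a i) (v i) t - o) 0).trans (hc i hi t ht).2
  have hclow : ∀ i ∈ X, o 0 - 5 * r ≤ c i := by
    intro i hi
    refine le_of_forall_gt_imp_ge_of_dense fun t ht => ?_
    have h1 := hheight i hi (min t (c i + ℓ)) ⟨lt_min ht (by linarith), by
      have := min_le_right t (c i + ℓ); linarith⟩
    have h2 := (abs_le.1 h1).1
    have h3 := min_le_left t (c i + ℓ)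
    linarith
  have hchigh : ∀ i ∈ X, c i ≤ o 0 + 5 * r := by
    intro i hi
    have h1 := hheight i hi (c i + ℓ) ⟨by linarith, by linarith⟩
    linarith [(abs_le.1 h1).2]
  set f : ι → ℕ := fun i => ⌊(c i - (o 0 - 5 * r)) / ℓ⌋₊ with hf
  have hfmem : ∀ i ∈ X, f i ∈ Finset.range (⌊20 / κ⌋₊ + 1) := by
    intro i hi
    rw [Finset.mem_range, Nat.lt_succ_iff]
    refine Nat.floor_le_floor ?_
    rw [div_le_div_iff₀ hℓ0 hκ]
    nlinarith [hchigh i hi]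
  have hcard : (X.card : ℝ) = ∑ b ∈ Finset.range (⌊20 / κ⌋₊ + 1),
      ((X.filter fun i => f i = b).card : ℝ) := by
    exact_mod_cast Finset.card_eq_sum_card_fiberwise hfmem
  have hone : ∀ b ∈ Finset.range (⌊20 / κ⌋₊ + 1),
      ((X.filter fun i => f i = b).card : ℝ) * (c₀ * δ) ^ d ≤ B := by
    intro b _
    have h := card_le_of_common_interval hτ (a := a) (v := v) (g := o 0 - 5 * r + (b + 1) * ℓ)
      hδ hδr hLam hc₀ hc₀1 hℓ0
      (by nlinarith) (X.filter fun i => f i = b)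
      (fun i hi j hj => hsep i (Finset.mem_filter.1 hi).1 j (Finset.mem_filter.1 hj).1) o
      (fun i hi t ht => by
        obtain ⟨hiX, hib⟩ := Finset.mem_filter.1 hi
        have h0 : 0 ≤ (c i - (o 0 - 5 * r)) / ℓ := div_nonneg (by linarith [hclow i hiX]) hℓ0.le
        have h1 := Nat.floor_le h0
        have h2 := Nat.lt_floor_add_one ((c i - (o 0 - 5 * r)) / ℓ)
        have h3 : ⌊(c i - (o 0 - 5 * r)) / ℓ⌋₊ = b := hib
        rw [h3, le_div_iff₀ hℓ0] at h1
        rw [h3, div_lt_iff₀ hℓ0] at h2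
        exact hc i hiX t ⟨by linarith [ht.1], by linarith [ht.2]⟩)
    refine h.trans (le_of_eq ?_)
    rw [hB, hκr]
    congr 2
    field_simp
    ring
  have hLam0 : 0 ≤ Lam := le_trans (by positivity) hLam
  have hB0 : 0 ≤ B := by rw [hB, wolffConst]; positivity
  rw [hcard, Finset.sum_mul]
  refine (Finset.sum_le_card_nsmul _ _ B hone).trans ?_
  rw [Finset.card_range, nsmul_eq_mul]
  refine mul_le_mul_of_nonneg_right ?_ hB0
  have h1 : (⌊20 / κ⌋₊ : ℝ) ≤ 20 / κ := Nat.floor_le (by positivity)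
  have h2 : 1 ≤ 1 / κ := by rw [le_div_iff₀ hκ]; linarith
  push_cast
  have h3 : 21 / κ = 20 / κ + 1 / κ := by ring
  linarith

end Kakeya

end

section

open MeasureTheory
open scoped ENNReal

namespace Kakeya

open MvPolynomial PolyCalc PolyPartition

variable {d : ℕ} {ι : Type*}

/-- The cap of side `η` containing a slope. -/
noncomputable def slopeCap (η : ℝ) (v : ι → Fin d → ℝ) (i : ι) : Fin d → ℤ := fun j => ⌊v i j / η⌋

/-- Measurable shadings of tubes inside a set and inside a slab of heights. -/
structure Shaded (a v : ι → Fin d → ℝ) (δ : ℝ) (S : Set (Fin (d + 1) → ℝ)) (h r : ℝ)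
    (Y : ι → Set (Fin (d + 1) → ℝ)) : Prop where
  measurableSet : ∀ i, MeasurableSet (Y i)
  subset : ∀ i, Y i ⊆ S
  subset_gtube : ∀ i, Y i ⊆ gtube δ (a i) (v i)
  height : ∀ i, ∀ x ∈ Y i, x 0 ∈ Set.Icc h (h + r)

namespace Shaded

variable {a v : ι → Fin d → ℝ} {δ : ℝ} {S S' : Set (Fin (d + 1) → ℝ)} {h r h' r' : ℝ}
  {Y Y' : ι → Set (Fin (d + 1) → ℝ)}

lemma mono (H : Shaded a v δ S h r Y) (hm : ∀ i, MeasurableSet (Y' i)) (hsub : ∀ i, Y' i ⊆ Y i)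
    (hS : ∀ i, Y' i ⊆ S') (hh : ∀ i, ∀ x ∈ Y' i, x 0 ∈ Set.Icc h' (h' + r')) :
    Shaded a v δ S' h' r' Y' :=
  ⟨hm, hS, fun i => (hsub i).trans (H.subset_gtube i), hh⟩

lemma volume_le (H : Shaded a v δ S h r Y) (hδ : 0 < δ) (hr : 0 ≤ r) (i : ι) :
    volume (Y i) ≤ ENNReal.ofReal (r / δ * (2 ^ d * δ ^ (d + 1))) := by
  refine (measure_mono (t := gtube δ (a i) (v i) ∩ {x | x 0 ∈ Set.Icc h (h + r)}) fun x hx =>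
    ⟨H.subset_gtube i hx, H.height i x hx⟩).trans
    ((volume_gtube_inter_le hδ.le _ _ measurableSet_Icc).trans (le_of_eq ?_))
  rw [Real.volume_Icc, ← ENNReal.ofReal_mul (by linarith)]
  congr 1
  field_simp
  ring

end Shaded

lemma measurableSet_Reg {n : ℕ} (s B : ℝ) (J : Finset (Fin n)) (l : Fin n)
    (Q : MvPolynomial (Fin n) ℝ) : MeasurableSet (Reg s B J l Q) := by
  have h : Reg s B J l Q = {y | eval y (pderiv l Q) ≠ 0} ∩ ⋂ L : List (Fin n),
      ⋂ (_ : ∀ l ∈ L, l ∈ J),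
        {y | s ^ L.length * |eval y (iterD L Q)| ≤ B * (s * |eval y (pderiv l Q)|)} := by
    ext y
    simp [Reg]
  rw [h]
  have hm := fun R : MvPolynomial (Fin n) ℝ => measurable_eval (P := R)
  refine MeasurableSet.inter ?_ (MeasurableSet.iInter fun L => MeasurableSet.iInter fun _ => ?_)
  · exact (measurableSet_singleton (0 : ℝ)).compl.preimage (hm (pderiv l Q))
  · exact measurableSet_le (((hm _).abs).const_mul _) ((((hm _).abs).const_mul _).const_mul _)

variable [Fintype ι]

/-- The contribution of the neighbourhood of the zero set of `P` is controlled by the regular parts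
of the iterated derivatives of `P`. -/
lemma energy_inter_thickening_le {γ : Type*} [DecidableEq γ] {cap : ι → γ} {p : ℝ} {A N : ℕ}
    {Y : ι → Set (Fin (d + 1) → ℝ)} (hp : 0 < p) {δ Lam : ℝ} (hδ : 0 < δ)
    (hLam : 8 * ((d + 1 : ℕ) : ℝ) ≤ Lam) {J : Finset (Fin (d + 1))}
    {P : MvPolynomial (Fin (d + 1)) ℝ} (hP : P ≠ 0) (hv : P.vars ⊆ J) (hN : P.totalDegree ≤ N) :
    energy cap p A (fun i => Y i ∩ Metric.thickening (2 * δ) {x | eval x P = 0}) ≤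
      ∑ o ∈ boundedLists (d + 1) N ×ˢ J,
        energy cap p A fun i => Y i ∩ Reg (Lam * δ) 1 Finset.univ o.2 (iterD o.1 P) := by
  have hLam0 : 0 < Lam := lt_of_lt_of_le (by positivity) hLam
  refine (energy_le_sum hp (boundedLists (d + 1) N ×ˢ J)
    (fun o => Reg (Lam * δ) 1 Finset.univ o.2 (iterD o.1 P))
        (fun o _ => measurableSet_Reg _ _ _ _ _)
    ?_).trans (Finset.sum_le_sum fun o _ => energy_mono hp.le fun i =>
      Set.inter_subset_inter_left _ Set.inter_subset_left)
  rintro i x ⟨-, hx⟩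
  obtain ⟨z, hz, hxz⟩ := Metric.mem_thickening_iff.1 hx
  have hclose : ((d + 1 : ℕ) : ℝ) * ‖z - x‖ / (Lam * δ) ≤ 1 / 4 := by
    rw [← dist_eq_norm, dist_comm, div_le_div_iff₀ (by positivity) (by norm_num)]
    have h1 : ((d + 1 : ℕ) : ℝ) * dist x z ≤ ((d + 1 : ℕ) : ℝ) * (2 * δ) := by gcongr
    nlinarith [mul_le_mul_of_nonneg_right hLam hδ.le]
  obtain ⟨L, l, hL, hLJ, hl, hreg⟩ := exists_mem_Reg (s := Lam * δ) (by positivity) hP hv hclose hz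
  refine Set.mem_biUnion (x := (L, l)) ?_ (Reg_subset_univ (by positivity) zero_le_one
    ((vars_iterD_subset L P).trans hv) hreg)
  simp only [Finset.coe_product, Set.mem_prod, Finset.mem_coe]
  exact ⟨mem_boundedLists.2 (hL.trans hN), hl⟩

/-- One step of polynomial partitioning: either the cells dominate, and the bound at the smaller
scale can be used, or the neighbourhood of a zero set dominates. -/
lemma energy_le_or_exists_wall {γ : Type*} [DecidableEq γ] {cap : ι → γ} {p : ℝ} {A N b : ℕ}
    {a v : ι → Fin d → ℝ} {δ h r : ℝ} {S : Set (Fin (d + 1) → ℝ)}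
    {Y : ι → Set (Fin (d + 1) → ℝ)} (H : Shaded a v δ S h r Y) (hp : 1 ≤ p)
    (hδ : 0 < δ) (hr : 0 < r)
    (hN : 2 * (d + 1) ^ 2 * 2 ^ b ≤ N) (J : Finset (Fin (d + 1))) (hJ : J.Nonempty)
    {Lam : ℝ} (hLam : 8 * ((d + 1 : ℕ) : ℝ) ≤ Lam) {G u : ℝ} (hG : 0 ≤ G) (hu : 0 ≤ u)
    (hcell : ∀ Y' h', Shaded a v δ S h' (r / 2 ^ b) Y' →
      energy cap p A Y' ≤ ENNReal.ofReal (G * ((active Y').card : ℝ) ^ (1 + u))) :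
    (∃ P : MvPolynomial (Fin (d + 1)) ℝ, P ≠ 0 ∧ P.vars ⊆ J ∧ P.totalDegree ≤ N ∧
      energy cap p A Y ≤ 2 * ∑ o ∈ boundedLists (d + 1) N ×ˢ J,
        energy cap p A fun i => Y i ∩ Reg (Lam * δ) 1 Finset.univ o.2 (iterD o.1 P)) ∨
    energy cap p A Y ≤ ENNReal.ofReal (2 ^ (1 + u) * (((2 ^ b) ^ J.card : ℝ)⁻¹) ^ u * G *
      (((2 ^ b + N + 1 : ℕ) : ℝ) * (active Y).card) ^ (1 + u)) := by
  classical
  have hp0 : 0 < p := by linarith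
  have hfin : energy cap p A Y ≠ ∞ := ne_top_of_le_ne_top ENNReal.ofReal_ne_top
    (energy_le_of_volume_le hp H.measurableSet (H.volume_le hδ hr.le))
  set f : (Fin (d + 1) → ℝ) → ℝ≥0∞ := fun x => (broad cap A (mult Y x) : ℝ≥0∞) ^ p with hf
  set μ : Measure (Fin (d + 1) → ℝ) := volume.withDensity f with hμ
  have hμu : μ Set.univ = energy cap p A Y := by
    rw [hμ, withDensity_apply _ MeasurableSet.univ, Measure.restrict_univ]; rfl
  have : IsFiniteMeasure μ := ⟨by rw [hμu]; exact hfin.lt_top⟩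
  obtain ⟨T, P, hP0, hPv, hPd, hPc⟩ := exists_partition J hJ μ
      (withDensity_absolutelyContinuous _ _) b
  have hJc : J.card ≤ d + 1 := by simpa using Finset.card_le_univ J
  have hPN : (∏ i, P i).totalDegree ≤ N := by
    refine hPd.trans (le_trans ?_ hN)
    gcongr
  have hPne : ∏ i, P i ≠ 0 := Finset.prod_ne_zero_iff.2 fun i _ => hP0 i
  set W : Set (Fin (d + 1) → ℝ) := Metric.thickening (2 * δ) {x | eval x (∏ i, P i) = 0} with hW
  set ℓ : ℝ := r / 2 ^ b with hℓ
  have hℓ0 : 0 < ℓ := by positivity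
  set s : Finset ((Fin T → Bool) × ℕ) := Finset.univ ×ˢ Finset.range (2 ^ b + 1) with hs
  set O : (Fin T → Bool) × ℕ → Set (Fin (d + 1) → ℝ) := fun o =>
    (signCell P o.1 ∩ {x | x 0 ∈ Set.Ico (h + o.2 * ℓ) (h + (o.2 + 1) * ℓ)}) \ W with hO
  have hWm : MeasurableSet W := Metric.isOpen_thickening.measurableSet
  have hOm : ∀ o, MeasurableSet (O o) := fun o =>
    ((measurableSet_signCell P o.1).inter (measurable_pi_apply 0 measurableSet_Ico)).diff hWm
  have hzero : ∀ x, x ∉ W → ∀ z ∈ Metric.ball x (2 * δ), eval z (∏ i, P i) ≠ 0 := by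
    intro x hx z hz h0
    refine hx (Metric.mem_thickening_iff.2 ⟨z, h0, ?_⟩)
    rw [dist_comm]; exact hz
  have hcov : ∀ i, Y i ⊆ W ∪ ⋃ o ∈ s, O o := by
    intro i x hx
    by_cases hxW : x ∈ W
    · exact Or.inl hxW
    refine Or.inr ?_
    obtain ⟨hx1, hx2⟩ := H.height i x hx
    set c := ⌊(x 0 - h) / ℓ⌋₊ with hc
    have hq0 : 0 ≤ (x 0 - h) / ℓ := div_nonneg (by linarith) hℓ0.le
    have hc1 : (c : ℝ) * ℓ ≤ x 0 - h := (le_div_iff₀ hℓ0).1 (Nat.floor_le hq0)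
    have hc2 : x 0 - h < (c + 1) * ℓ := (div_lt_iff₀ hℓ0).1 (Nat.lt_floor_add_one _)
    have hc3 : c ≤ 2 ^ b := by
      have : (x 0 - h) / ℓ ≤ ((2 ^ b : ℕ) : ℝ) := by
        rw [div_le_iff₀ hℓ0, hℓ]
        push_cast
        rw [mul_div_cancel₀ _ (by positivity)]
        linarith
      exact Nat.floor_le_of_le this
    refine Set.mem_biUnion (x := (fun i => decide (0 < eval x (P i)), c)) ?_ ⟨⟨?_, ?_⟩, hxW⟩
    · simp [hs, Nat.lt_succ_of_le hc3]
    · intro i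
      have hne : eval x (P i) ≠ 0 := by
        intro h0
        refine hzero x hxW x (Metric.mem_ball_self (by positivity)) ?_
        rw [map_prod]
        exact Finset.prod_eq_zero (Finset.mem_univ i) h0
      by_cases hpos : 0 < eval x (P i)
      · simp [hpos]
      · simpa [hpos] using lt_of_le_of_ne (not_lt.1 hpos) hne
    · exact ⟨by linarith, by linarith⟩
  have hC : ∀ i, ∀ s' ⊆ s, (∀ o ∈ s', (Y i ∩ O o).Nonempty) → s'.card ≤ 2 ^ b + N + 1 := by
    intro i s' hs' hne
    refine card_cells_le P hPN (a i) (v i) (h := h) (ℓ := ℓ) s' fun o ho => ⟨?_, ?_⟩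
    · have := hs' ho
      simp only [hs, Finset.mem_product, Finset.mem_range] at this
      exact Nat.lt_succ_iff.1 this.2
    · obtain ⟨x, hxY, ⟨hxσ, hxh⟩, hxW⟩ := hne o ho
      refine ⟨x 0, hxh.1, hxh.2, mem_signCell_of_ball (hzero x hxW) ?_ hxσ⟩
      rw [Metric.mem_ball, dist_eq_norm]
      exact (norm_corePt_sub_le hδ.le (H.subset_gtube i hxY)).trans_lt (by linarith)
  have hl : ∀ o ∈ s, energy cap p A (fun i => Y i ∩ O o) ≤
      ENNReal.ofReal ((2 ^ b) ^ J.card : ℝ)⁻¹ * energy cap p A Y := by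
    intro o _
    have h2 : energy cap p A (fun i => Y i ∩ O o) ≤ μ (signCell P o.1) := by
      rw [hμ, withDensity_apply _ (measurableSet_signCell P o.1),
        ← energy_inter hp0 (measurableSet_signCell P o.1)]
      exact energy_mono hp0.le fun i => Set.inter_subset_inter_right _ fun x hx => hx.1.1
    refine h2.trans ?_
    have h3 := hPc o.1
    rw [hμu] at h3
    rw [ENNReal.ofReal_inv_of_pos (by positivity), mul_comm, ← div_eq_mul_inv,
      ENNReal.le_div_iff_mul_le (by simp) (by simp), mul_comm]
    convert h3 using 2
    rw [ENNReal.ofReal_pow (by positivity), ENNReal.ofReal_pow (by positivity)]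
    simp
  have hE : ∀ o ∈ s, energy cap p A (fun i => Y i ∩ O o) ≤
      ENNReal.ofReal (G * ((active fun i => Y i ∩ O o).card : ℝ) ^ (1 + u)) := by
    intro o _
    refine hcell _ (h + o.2 * ℓ) (H.mono (fun i => (H.measurableSet i).inter (hOm o))
      (fun i => Set.inter_subset_left) (fun i => Set.inter_subset_left.trans (H.subset i)) ?_)
    rintro i x ⟨-, ⟨-, hx⟩, -⟩
    exact ⟨hx.1, by have := hx.2; linarith⟩
  rcases energy_le_of_cells (cap := cap) (A := A) (Y := Y) hp0 s O W (fun o _ => hOm o) hWm hcov hC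
    hfin hG hu (by positivity) hl hE with h1 | h1
  · refine Or.inl ⟨∏ i, P i, hPne, hPv, hPN, h1.trans ?_⟩
    exact mul_le_mul_right (energy_inter_thickening_le hp0 hδ hLam hPne hPv hPN) _
  · exact Or.inr h1

/-- The broad estimate at level `m`, for shadings inside neighbourhoods of towers that leave `m`
free variables. -/
def LevelBound (a v : ι → Fin d → ℝ) (δ κ η Lam p : ℝ) (N K m : ℕ) (B e u : ℝ) : Prop :=
  ∀ (s : ℕ) (τ : List (MvPolynomial (Fin (d + 1)) ℝ × Fin (d + 1))) (J : Finset (Fin (d + 1))),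
    IsTower N τ J → J.card = m → ∀ (Y : ι → Set (Fin (d + 1) → ℝ)) (h r : ℝ),
    Shaded a v δ (regSet (Lam * δ) 1 τ) h r Y → δ ≤ r → r ≤ 2 → r * κ ^ s ≤ δ →
    energy (slopeCap η v) p (2 ^ (s + m) * K) Y ≤
      ENNReal.ofReal (B * (r / δ) ^ e * ((active Y).card : ℝ) ^ (1 + u))

/-- The estimate needed when the neighbourhood of a zero set dominates. -/
def WallBound (a v : ι → Fin d → ℝ) (δ κ η Lam p : ℝ) (N K m : ℕ) (B e u : ℝ) : Prop :=
  ∀ (s : ℕ) (E : MvPolynomial (Fin (d + 1)) ℝ × Fin (d + 1))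
    (τ : List (MvPolynomial (Fin (d + 1)) ℝ × Fin (d + 1))) (J : Finset (Fin (d + 1))),
    IsTower N (E :: τ) J → J.card + 1 = m → ∀ (Y : ι → Set (Fin (d + 1) → ℝ)) (h r : ℝ),
    Shaded a v δ (regSet (Lam * δ) 1 (E :: τ)) h r Y → δ ≤ κ * r → r ≤ 2 → r * κ ^ (s + 1) ≤ δ →
    (∀ (Y' : ι → Set (Fin (d + 1) → ℝ)) (h' : ℝ),
      Shaded a v δ (regSet (Lam * δ) 1 τ) h' (κ * r) Y' →
      energy (slopeCap η v) p (2 ^ (s + m) * K) Y' ≤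
        ENNReal.ofReal (B * (κ * r / δ) ^ e * ((active Y').card : ℝ) ^ (1 + u))) →
    energy (slopeCap η v) p (2 ^ (s + 1 + m) * K) Y ≤
      ENNReal.ofReal (B * (r / δ) ^ e * ((active Y).card : ℝ) ^ (1 + u) /
        (2 * ((boundedLists (d + 1) N).card * (d + 1))))

lemma energy_le_of_short {γ : Type*} [DecidableEq γ] {cap : ι → γ} {A : ℕ}
    {a v : ι → Fin d → ℝ} {δ κ p : ℝ} {B e u M h r : ℝ} {S : Set (Fin (d + 1) → ℝ)}
    {Y : ι → Set (Fin (d + 1) → ℝ)} (H : Shaded a v δ S h r Y) (hp : 1 ≤ p) (hδ : 0 < δ)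
    (hδr : δ ≤ r) (he : 0 ≤ e) (hup : 1 + u ≤ p)
    (hu : 0 ≤ u) (hM : (Fintype.card ι : ℝ) ≤ M)
    (hterm : κ⁻¹ * (2 ^ d * δ ^ (d + 1)) * M ^ (p - (1 + u)) ≤ B) (hr : r / δ ≤ κ⁻¹) :
    energy cap p A Y ≤ ENNReal.ofReal (B * (r / δ) ^ e * ((active Y).card : ℝ) ^ (1 + u)) := by
  refine (energy_le_of_volume_le hp H.measurableSet (H.volume_le hδ (hδ.le.trans hδr))).trans
    (ENNReal.ofReal_le_ofReal ?_)
  have h1 : (1 : ℝ) ≤ (r / δ) ^ e := Real.one_le_rpow ((one_le_div hδ).2 hδr) he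
  have hN : ((active Y).card : ℝ) ≤ M := le_trans (by exact_mod_cast Finset.card_le_univ _) hM
  have hM0 : 0 ≤ M := le_trans (by positivity) hM
  have h2 : ((active Y).card : ℝ) ^ p ≤ M ^ (p - (1 + u)) * ((active Y).card : ℝ) ^ (1 + u) := by
    rw [show p = (p - (1 + u)) + (1 + u) by ring,
      Real.rpow_add_of_nonneg (by positivity) (by linarith) (by linarith), add_sub_cancel_right]
    gcongr
  have hB : 0 ≤ κ⁻¹ * (2 ^ d * δ ^ (d + 1)) * M ^ (p - (1 + u)) := by
    have : 0 ≤ κ⁻¹ := le_trans (by have := hδ.le.trans hδr; positivity) hr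
    positivity
  calc r / δ * (2 ^ d * δ ^ (d + 1)) * ((active Y).card : ℝ) ^ p
      ≤ κ⁻¹ * (2 ^ d * δ ^ (d + 1)) * (M ^ (p - (1 + u)) * ((active Y).card : ℝ) ^ (1 + u)) := by
        have : 0 ≤ κ⁻¹ := le_trans (by have := hδ.le.trans hδr; positivity) hr
        gcongr
    _ = κ⁻¹ * (2 ^ d * δ ^ (d + 1)) * M ^ (p - (1 + u)) * 1 * ((active Y).card : ℝ) ^ (1 + u) := by
        ring
    _ ≤ _ := by gcongr; exact hB.trans hterm

lemma levelBound_of_wallBound {a v : ι → Fin d → ℝ} {δ κ η Lam p : ℝ} {N K m b : ℕ} {B e u M : ℝ}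
    (hp : 1 ≤ p) (hδ : 0 < δ) (hLam : 8 * ((d + 1 : ℕ) : ℝ) ≤ Lam) (hκ : 0 < κ) (hb : 1 ≤ b)
    (hκb : κ * 2 ^ b ≤ 1) (hN : 2 * (d + 1) ^ 2 * 2 ^ b ≤ N) (hm : 1 ≤ m) (he : 0 ≤ e) (hB : 0 ≤ B)
    (hu : 0 ≤ u) (hup : 1 + u ≤ p) (hM : (Fintype.card ι : ℝ) ≤ M)
    (hterm : κ⁻¹ * (2 ^ d * δ ^ (d + 1)) * M ^ (p - (1 + u)) ≤ B)
    (hclose : 2 ^ (1 + u) * (((2 ^ b) ^ m : ℝ)⁻¹) ^ u * ((2 ^ b : ℝ) ^ e)⁻¹ *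
      ((2 ^ b + N + 1 : ℕ) : ℝ) ^ (1 + u) ≤ 1)
    (hwall : WallBound a v δ κ η Lam p N K m B e u) :
    LevelBound a v δ κ η Lam p N K m B e u := by
  have hκ1 : κ ≤ 1 := le_trans (by
    nlinarith [one_le_pow₀ (M₀ := ℝ) (n := b) (a := 2) (by norm_num)]) hκb
  suffices hmain : ∀ j s : ℕ,
      ∀ (τ : List (MvPolynomial (Fin (d + 1)) ℝ × Fin (d + 1))) (J : Finset (Fin (d + 1))),
      IsTower N τ J → J.card = m → ∀ (Y : ι → Set (Fin (d + 1) → ℝ)) (h r : ℝ),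
      Shaded a v δ (regSet (Lam * δ) 1 τ) h r Y → δ ≤ r → r ≤ 2 → r * κ ^ s ≤ δ →
      r ≤ (2 ^ b) ^ j * δ →
      energy (slopeCap η v) p (2 ^ (s + m) * K) Y ≤
        ENNReal.ofReal (B * (r / δ) ^ e * ((active Y).card : ℝ) ^ (1 + u)) by
    intro s τ J hτ hJ Y h r H h1 h2 h3
    obtain ⟨j, hj⟩ := pow_unbounded_of_one_lt (r / δ)
      (one_lt_pow₀ (M₀ := ℝ) (a := 2) (n := b) (by norm_num) (by omega))
    exact hmain j s τ J hτ hJ Y h r H h1 h2 h3 ((div_le_iff₀ hδ).1 hj.le)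
  intro j
  induction j with
  | zero =>
    intro s τ J hτ hJ Y h r H h1 h2 h3 h4
    refine energy_le_of_short H hp hδ h1 he hup hu hM hterm ?_
    rw [pow_zero, one_mul] at h4
    exact ((div_le_one hδ).2 h4).trans ((one_le_inv₀ hκ).2 hκ1)
  | succ j ih =>
    intro s τ J hτ hJ Y h r H h1 h2 h3 h4
    by_cases hrκ : r / δ ≤ κ⁻¹
    · exact energy_le_of_short H hp hδ h1 he hup hu hM hterm hrκ
    push Not at hrκ
    have hδκ : δ ≤ κ * r := by
      rw [lt_div_iff₀ hδ, inv_mul_lt_iff₀ hκ] at hrκ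
      exact hrκ.le
    have hr0 : 0 < r := hδ.trans_le h1
    obtain ⟨s, rfl⟩ : ∃ s', s = s' + 1 := by
      rcases s with _ | s
      · rw [pow_zero, mul_one] at h3
        exact absurd hrκ (not_lt.2 (((div_le_one hδ).2 h3).trans ((one_le_inv₀ hκ).2 hκ1)))
      · exact ⟨s, rfl⟩
    have hD : (0 : ℝ) < 2 ^ b := by positivity
    have hκr : κ * r ≤ r / 2 ^ b := by
      rw [le_div_iff₀ hD]
      nlinarith
    have hrj : r / 2 ^ b ≤ (2 ^ b) ^ j * δ := by
      rw [div_le_iff₀ hD]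
      calc r ≤ _ := h4
        _ = _ := by ring
    have hr2 : r / 2 ^ b ≤ r := div_le_self hr0.le (one_le_pow₀ (by norm_num))
    rcases energy_le_or_exists_wall (cap := slopeCap η v) (A := 2 ^ (s + 1 + m) * K)
        (b := b) H hp hδ
      hr0 hN J (Finset.card_pos.1 (by omega)) hLam (G := B * (r / 2 ^ b / δ) ^ e) (by positivity) hu
      (fun Y' h' H' => ih (s + 1) τ J hτ hJ Y' h' _ H' (hδκ.trans hκr) (hr2.trans h2)
        (le_trans (by gcongr) h3) hrj) with ⟨P, hP0, hPv, hPd, hle⟩ | hle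
    · refine hle.trans ?_
      set Cw : ℝ := (boundedLists (d + 1) N).card * (d + 1) with hCw
      have hCw0 : 0 < Cw := by
        have : 0 < (boundedLists (d + 1) N).card :=
          Finset.card_pos.2 ⟨[], mem_boundedLists.2 (by simp)⟩
        positivity
      have hX : 0 ≤ B * (r / δ) ^ e * ((active Y).card : ℝ) ^ (1 + u) := by positivity
      have hpart : ∀ o ∈ boundedLists (d + 1) N ×ˢ J,
          energy (slopeCap η v) p (2 ^ (s + 1 + m) * K)
            (fun i => Y i ∩ Reg (Lam * δ) 1 Finset.univ o.2 (iterD o.1 P)) ≤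
          ENNReal.ofReal (B * (r / δ) ^ e * ((active Y).card : ℝ) ^ (1 + u) / (2 * Cw)) := by
        intro o ho
        obtain ⟨-, hoJ⟩ := Finset.mem_product.1 ho
        refine (hwall s (iterD o.1 P, o.2) τ (J.erase o.2) ⟨J, hτ, hoJ, rfl,
          (vars_iterD_subset _ _).trans hPv, (totalDegree_iterD_le _ _).trans
            ((Nat.sub_le _ _).trans hPd)⟩ ?_ _ h r (H.mono (fun i => (H.measurableSet i).inter
              (measurableSet_Reg _ _ _ _ _)) (fun i => Set.inter_subset_left) ?_ ?_) hδκ h2 h3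
            fun Y' h' H' => ih s τ J hτ hJ Y' h' _ H' hδκ (hκr.trans (hr2.trans h2)) ?_
              (hκr.trans hrj)).trans ?_
        · rw [Finset.card_erase_of_mem hoJ, hJ]; omega
        · rintro i x ⟨hx, hx'⟩ E hE
          rcases List.mem_cons.1 hE with rfl | hE
          · exact hx'
          · exact H.subset i hx E hE
        · exact fun i x hx => H.height i x hx.1
        · rw [pow_succ] at h3
          linarith
        · refine ENNReal.ofReal_le_ofReal ?_
          have := active_mono (Y := fun i => Y i ∩ Reg (Lam * δ) 1 Finset.univ o.2 (iterD o.1 P))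
            (Y' := Y) fun i => Set.inter_subset_left
          gcongr
      refine (mul_le_mul_right (Finset.sum_le_card_nsmul _ _ _ hpart) _).trans ?_
      rw [nsmul_eq_mul, ← mul_assoc, ← ENNReal.ofReal_natCast, show (2 : ℝ≥0∞) = ENNReal.ofReal 2 by
        simp, ← ENNReal.ofReal_mul (by norm_num), ← ENNReal.ofReal_mul (by positivity)]
      refine ENNReal.ofReal_le_ofReal ?_
      have hcard : (((boundedLists (d + 1) N) ×ˢ J).card : ℝ) ≤ Cw := by
        rw [Finset.card_product, hCw]
        push_cast
        have : (J.card : ℝ) ≤ d + 1 := by exact_mod_cast (by simpa using Finset.card_le_univ J)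
        gcongr
      rw [mul_div_assoc', div_le_iff₀ (by positivity)]
      nlinarith [mul_le_mul_of_nonneg_right hcard hX]
    · refine hle.trans (ENNReal.ofReal_le_ofReal ?_)
      rw [hJ, div_right_comm, Real.div_rpow (by positivity) hD.le,
        Real.mul_rpow (by positivity) (by positivity)]
      calc _ = (2 ^ (1 + u) * (((2 ^ b) ^ m : ℝ)⁻¹) ^ u * ((2 ^ b : ℝ) ^ e)⁻¹ *
            ((2 ^ b + N + 1 : ℕ) : ℝ) ^ (1 + u)) *
              (B * (r / δ) ^ e * ((active Y).card : ℝ) ^ (1 + u)) := by ring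
        _ ≤ 1 * (B * (r / δ) ^ e * ((active Y).card : ℝ) ^ (1 + u)) := by gcongr
        _ = _ := one_mul _

end Kakeya

end

section

open MeasureTheory
open scoped ENNReal

namespace Kakeya

open MvPolynomial PolyCalc PolyPartition

variable {d : ℕ} {ι : Type*} [Fintype ι]

/-- Near a tower with `k - 1` free variables the broad estimate is trivial up to constants. -/
lemma wallBound_of_tangent {a v : ι → Fin d → ℝ} (hv : ∀ i j, |v i j| ≤ 1) {δ κ η Lam p θ : ℝ}
    {N K k : ℕ} {B e u : ℝ} (hp : 1 ≤ p) (hδ : 0 < δ) (hLam : 8 * ((d + 1 : ℕ) : ℝ) ≤ Lam)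
    (hκ : 0 < κ) (hκ1 : κ ≤ 1) (he : 0 ≤ e) (hpu : p = 1 + u) (hθ : 0 < θ)
    (hLam' : 6 * ((d + 1 : ℕ) : ℝ) ^ 2 ≤ θ * Lam) (hη : 0 < η) (hη1 : η ≤ 1)
    (hθη : tangentConst (d + 1) * θ ≤ η) (hK : (2 * ⌈1 / θ⌉₊ + 1) ^ (k - 2) * 3 ^ d ≤ K)
    (hB : 2 ^ p * (16 * (d + 1) * N ^ 2 * Lam / θ * 2 ^ d) * δ ^ (d + 1) *
      (2 * ((boundedLists (d + 1) N).card * (d + 1))) ≤ B) :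
    WallBound a v δ κ η Lam p N K k B e u := by
  intro s E τ J hτ hJ Y h r H hδr _ _ _
  have hp0 : 0 ≤ p := by linarith
  have hr : 0 < r := (mul_pos_iff_of_pos_left hκ).1 (hδ.trans_le hδr)
  have hδr' : δ ≤ r := hδr.trans (mul_le_of_le_one_left hr.le hκ1)
  have hCw0 : (0 : ℝ) < 2 * ((boundedLists (d + 1) N).card * (d + 1)) := by
    have : 0 < (boundedLists (d + 1) N).card :=
      Finset.card_pos.2 ⟨[], mem_boundedLists.2 (by simp)⟩
    positivity
  refine (energy_anti hp0 (Nat.le_mul_of_pos_left K (by positivity))).trans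
    ((energy_le_of_subset_regSet hτ hv hδ hLam hθ hLam' hη hη1 hθη ?_ hp H.measurableSet H.subset
      H.subset_gtube).trans (ENNReal.ofReal_le_ofReal ?_))
  · rw [show J.card - 1 = k - 2 by omega]; exact hK
  · rw [le_div_iff₀ hCw0, ← hpu]
    have h1 : (1 : ℝ) ≤ (r / δ) ^ e := Real.one_le_rpow ((one_le_div hδ).2 hδr') he
    have hLam0 : 0 < Lam := lt_of_lt_of_le (by positivity) hLam
    have hB0 : 0 ≤ B := le_trans (by positivity) hB
    calc _ = 2 ^ p * (16 * (d + 1) * N ^ 2 * Lam / θ * 2 ^ d) * δ ^ (d + 1) *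
          (2 * ((boundedLists (d + 1) N).card * (d + 1))) * 1 * ((active Y).card : ℝ) ^ p := by ring
      _ ≤ _ := by gcongr

/-- The part of a shading over short intervals of regularity. -/
lemma energy_short_le {γ : Type*} [DecidableEq γ] {cap : ι → γ} {A N : ℕ}
    {a v : ι → Fin d → ℝ} {δ κ Lam p G u h r : ℝ}
    {τ : List (MvPolynomial (Fin (d + 1)) ℝ × Fin (d + 1))} {J : Finset (Fin (d + 1))}
    (hτ : IsTower N τ J) {Y : ι → Set (Fin (d + 1) → ℝ)}
    (H : Shaded a v δ (regSet (Lam * δ) 1 τ) h r Y) (hp : 0 < p) (hδ : 0 < δ)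
    (hLam : 8 * ((d + 1 : ℕ) : ℝ) ≤ Lam) (hκ : 0 < κ) (hr : 0 < r) (hu : 0 ≤ u) (hG : 0 ≤ G)
    (hE : ∀ (Y' : ι → Set (Fin (d + 1) → ℝ)) (h' : ℝ),
      Shaded a v δ (regSet (Lam * δ) 1 τ) h' (κ * r) Y' →
      energy cap p A Y' ≤ ENNReal.ofReal (G * ((active Y').card : ℝ) ^ (1 + u))) :
    energy cap p A (fun i => Y i ∩ {x | x 0 ∉ longSet (Lam * δ) (κ * r) τ (a i) (v i)}) ≤
      ENNReal.ofReal (G * (((3 * breakCount d N : ℕ) : ℝ) * (active Y).card) ^ (1 + u)) := by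
  classical
  have hLam0 : 0 < Lam := lt_of_lt_of_le (by positivity) hLam
  set ℓ := κ * r with hℓ
  have hℓ0 : 0 < ℓ := by positivity
  set Z : ι → Set (Fin (d + 1) → ℝ) :=
    fun i => Y i ∩ {x | x 0 ∉ longSet (Lam * δ) ℓ τ (a i) (v i)} with hZ
  have hlm : ∀ i, MeasurableSet {x : Fin (d + 1) → ℝ | x 0 ∈ longSet (Lam * δ) ℓ τ (a i) (v i)} :=
    fun i => measurableSet_preimage (measurable_pi_apply 0)
      (isOpen_longSet (Lam * δ) ℓ τ (a i) (v i)).measurableSet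
  have hZm : ∀ i, MeasurableSet (Z i) := fun i => (H.measurableSet i).inter (hlm i).compl
  set O : ℕ → Set (Fin (d + 1) → ℝ) :=
    fun c => {x | x 0 ∈ Set.Ico (h + c * ℓ) (h + (c + 1) * ℓ)} with hO
  have hOm : ∀ c, MeasurableSet (O c) := fun c => measurable_pi_apply 0 measurableSet_Ico
  have hZO : ∀ c : ℕ, Shaded a v δ (regSet (Lam * δ) 1 τ) (h + c * ℓ) ℓ fun i => Z i ∩ O c :=
    fun c => H.mono (fun i => (hZm i).inter (hOm c))
      (fun i => Set.inter_subset_left.trans Set.inter_subset_left)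
      (fun i => (Set.inter_subset_left.trans Set.inter_subset_left).trans (H.subset i))
      (fun i x hx => ⟨hx.2.1, by have := hx.2.2; linarith⟩)
  refine (energy_le_of_pieces (C := 3 * breakCount d N) hp (Finset.range (⌊r / ℓ⌋₊ + 1)) O
    (fun c _ => hOm c) ?_ ?_ hG hu fun c _ => hE _ _ (hZO c)).trans (ENNReal.ofReal_le_ofReal ?_)
  · rintro i x ⟨hx, -⟩
    obtain ⟨hx1, hx2⟩ := H.height i x hx
    have hq0 : 0 ≤ (x 0 - h) / ℓ := div_nonneg (by linarith) hℓ0.le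
    have hc1 : (⌊(x 0 - h) / ℓ⌋₊ : ℝ) * ℓ ≤ x 0 - h := (le_div_iff₀ hℓ0).1 (Nat.floor_le hq0)
    have hc2 : x 0 - h < (⌊(x 0 - h) / ℓ⌋₊ + 1) * ℓ :=
      (div_lt_iff₀ hℓ0).1 (Nat.lt_floor_add_one _)
    refine Set.mem_biUnion (x := ⌊(x 0 - h) / ℓ⌋₊) ?_ ⟨by linarith, by linarith⟩
    rw [Finset.mem_coe, Finset.mem_range, Nat.lt_succ_iff]
    exact Nat.floor_le_floor (div_le_div_of_nonneg_right (by linarith) hℓ0.le)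
  · intro i s' _ hne
    obtain ⟨R, hR, hbreak⟩ := exists_breakpoints hτ (a i) (v i) (s := Lam * δ) (by positivity) hℓ0
    refine card_slabs_le (h := h) hℓ0 R hR s' fun c hc => ?_
    obtain ⟨x, ⟨hx, hxl⟩, hxc⟩ := hne c hc
    refine ⟨x 0, hxc.1, hxc.2, hbreak _ ?_ hxl⟩
    rw [show (4 : ℝ) = 4 * 1 by norm_num]
    refine regSet_fatten (by positivity) le_rfl (H.subset i hx) ?_
    rw [div_le_div_iff₀ (by positivity) (by norm_num)]
    have h1 := norm_corePt_sub_le hδ.le (H.subset_gtube i hx)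
    have h2 : ((d + 1 : ℕ) : ℝ) * ‖corePt (a i) (v i) (x 0) - x‖ ≤ ((d + 1 : ℕ) : ℝ) * δ := by
      gcongr
    nlinarith [mul_le_mul_of_nonneg_right hLam hδ.le]
  · have := active_mono (Y := Z) (Y' := Y) fun i => Set.inter_subset_left
    gcongr

/-- Localization of shadings to lateral cubes whose side is the height of the slab. -/
lemma energy_le_of_cubes {γ : Type*} [DecidableEq γ] {cap : ι → γ} {A : ℕ}
    {a v : ι → Fin d → ℝ} (hv : ∀ i j, |v i j| ≤ 1) {δ p G u h r : ℝ} {S : Set (Fin (d + 1) → ℝ)}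
    {Y : ι → Set (Fin (d + 1) → ℝ)} (H : Shaded a v δ S h r Y) (hp : 0 < p) (hδ : 0 < δ)
    (hδr : δ ≤ r) (hu : 0 ≤ u) (hG : 0 ≤ G)
    (hE : ∀ β : Fin d → ℤ, energy cap p A (fun i => Y i ∩ {x | ∀ j, ⌊x j.succ / r⌋ = β j}) ≤
      ENNReal.ofReal (G * ((active fun i => Y i ∩ {x | ∀ j, ⌊x j.succ / r⌋ = β j}).card : ℝ) ^
        (1 + u))) :
    energy cap p A Y ≤ ENNReal.ofReal (G * (((9 ^ d : ℕ) : ℝ) * (active Y).card) ^ (1 + u)) := by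
  classical
  have hr : 0 < r := hδ.trans_le hδr
  set key : (Fin (d + 1) → ℝ) → Fin d → ℤ := fun x j => ⌊x j.succ / r⌋ with hkey
  set O : (Fin d → ℤ) → Set (Fin (d + 1) → ℝ) := fun β => {x | ∀ j, ⌊x j.succ / r⌋ = β j} with hO
  have hOm : ∀ β, MeasurableSet (O β) := by
    intro β
    simp only [hO, Set.ofPred_forall]
    refine MeasurableSet.iInter fun j => ?_
    have hm : Measurable fun x : Fin (d + 1) → ℝ => ⌊x j.succ / r⌋ :=
      Int.measurable_floor.comp ((measurable_pi_apply _).div_const _)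
    exact hm (measurableSet_singleton _)
  have hclose : ∀ i, ∀ x ∈ Y i, ∀ y ∈ Y i, ∀ j : Fin d, |⌊x j.succ / r⌋ - ⌊y j.succ / r⌋| ≤ 4 := by
    intro i x hx y hy j
    have h1 := abs_le.1 (H.subset_gtube i hx j)
    have h2 := abs_le.1 (H.subset_gtube i hy j)
    obtain ⟨h3, h3'⟩ := H.height i x hx
    obtain ⟨h4, h4'⟩ := H.height i y hy
    have h5 : |(x 0 - y 0) * v i j| ≤ r := by
      rw [abs_mul]
      calc _ ≤ r * 1 := mul_le_mul (abs_le.2 ⟨by linarith, by linarith⟩) (hv i j)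
            (abs_nonneg _) hr.le
        _ = r := mul_one r
    have h5' := abs_le.1 h5
    have h6 : x j.succ / r ≤ y j.succ / r + 3 := by
      rw [div_add' _ _ _ hr.ne', div_le_div_iff_of_pos_right hr]; linarith
    have h7 : y j.succ / r ≤ x j.succ / r + 3 := by
      rw [div_add' _ _ _ hr.ne', div_le_div_iff_of_pos_right hr]; linarith
    have h8 : ⌊x j.succ / r⌋ ≤ ⌊y j.succ / r⌋ + 3 := by
      have := Int.floor_le_floor h6
      rwa [show (3 : ℝ) = ((3 : ℤ) : ℝ) by norm_num, Int.floor_add_intCast] at this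
    have h9 : ⌊y j.succ / r⌋ ≤ ⌊x j.succ / r⌋ + 3 := by
      have := Int.floor_le_floor h7
      rwa [show (3 : ℝ) = ((3 : ℤ) : ℝ) by norm_num, Int.floor_add_intCast] at this
    rw [abs_le]
    omega
  set box : (Fin d → ℤ) → Finset (Fin d → ℤ) := fun β =>
    Fintype.piFinset fun j => Finset.Icc (β j - 4) (β j + 4) with hbox
  have hboxc : ∀ β, (box β).card = 9 ^ d := by
    intro β
    rw [hbox, Fintype.card_piFinset]
    have h9 : ∀ z : ℤ, z + 4 + 1 - (z - 4) = 9 := fun z => by ring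
    simp [Int.card_Icc, h9]
  have hex : ∀ i, ∃ β : Fin d → ℤ, ∀ x ∈ Y i, key x ∈ box β := by
    intro i
    rcases (Y i).eq_empty_or_nonempty with h0 | ⟨y, hy⟩
    · exact ⟨0, by simp [h0]⟩
    · refine ⟨key y, fun x hx => Fintype.mem_piFinset.2 fun j => Finset.mem_Icc.2 ?_⟩
      have := abs_le.1 (hclose i x hx y hy j)
      simp only [hkey]
      omega
  choose β hβ using hex
  refine energy_le_of_pieces (C := 9 ^ d) hp (Finset.univ.biUnion fun i => box (β i)) O
    (fun c _ => hOm c) ?_ ?_ hG hu fun c _ => hE c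
  · intro i x hx
    refine Set.mem_biUnion (x := key x) ?_ fun j => rfl
    exact Finset.mem_coe.2 (Finset.mem_biUnion.2 ⟨i, Finset.mem_univ _, hβ i x hx⟩)
  · intro i s' _ hne
    rw [← hboxc (β i)]
    refine Finset.card_le_card fun o ho => ?_
    obtain ⟨x, hx, hxo⟩ := hne o ho
    have : key x = o := funext hxo
    exact this ▸ hβ i x hx

/-- The number of tubes with a long regular piece in a cube. -/
noncomputable def longConst (d N : ℕ) (Lam c₀ : ℝ) : ℝ :=
  21 * (wolffConst d N * ((128 * N ^ 2 * Lam + 1) ^ (d + 1) * 14 ^ (d + 1))) *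
    (4 * (d + 1)) ^ (d + 1) / c₀ ^ d

lemma longConst_nonneg {N : ℕ} {Lam c₀ : ℝ} (hLam : 0 ≤ Lam) (hc₀ : 0 < c₀) :
    0 ≤ longConst d N Lam c₀ := by
  have : 0 ≤ wolffConst d N := by unfold wolffConst; positivity
  unfold longConst
  positivity

lemma card_active_long_le {a v : ι → Fin d → ℝ} (hv : ∀ i j, |v i j| ≤ 1)
    {δ κ Lam c₀ h r : ℝ} {N : ℕ}
    {τ : List (MvPolynomial (Fin (d + 1)) ℝ × Fin (d + 1))} {J : Finset (Fin (d + 1))}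
    (hτ : IsTower N τ J) {Y : ι → Set (Fin (d + 1) → ℝ)} {S : Set (Fin (d + 1) → ℝ)}
    (H : Shaded a v δ S h r Y) (hδ : 0 < δ) (hδr : δ ≤ r) (hr2 : r ≤ 2)
    (hLam : 64 * ((d + 1 : ℕ) : ℝ) ≤ Lam) (hc₀ : 0 < c₀) (hc₀1 : c₀ ≤ 1) (hκ : 0 < κ) (hκ1 : κ ≤ 1)
    (hsep : ∀ i j, i ≠ j → c₀ * δ ≤ ‖v i - v j‖) (β : Fin d → ℤ)
    (hlong : ∀ i, ∀ x ∈ Y i, x 0 ∈ longSet (Lam * δ) (κ * r) τ (a i) (v i))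
    (hβ : ∀ i, ∀ x ∈ Y i, ∀ j : Fin d, ⌊x j.succ / r⌋ = β j) :
    ((active Y).card : ℝ) ≤
      longConst d N Lam c₀ * κ⁻¹ ^ (d + 2) * δ⁻¹ ^ d * ((r / δ) ^ τ.length)⁻¹ := by
  have hr : 0 < r := hδ.trans_le hδr
  have hLam0 : 0 < Lam := lt_of_lt_of_le (by positivity) hLam
  have hW : 0 ≤ wolffConst d N := by unfold wolffConst; positivity
  have hlen := hτ.card
  have h1 := card_long_le hτ hδ hδr hr2 hLam hc₀ hc₀1 hκ hκ1 (active Y)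
    (fun i _ j _ hij => hsep i j hij) (a := a) (Fin.cons h fun j => β j * r) ?_
  · have h2 : (128 * (N : ℝ) ^ 2 * (Lam * δ)) ^ τ.length * (14 * r) ^ J.card ≤
        (128 * N ^ 2 * Lam + 1) ^ (d + 1) * 14 ^ (d + 1) * (δ ^ τ.length * r ^ J.card) := by
      rw [← mul_assoc (128 * (N : ℝ) ^ 2), mul_pow, mul_pow 14]
      have h3 : (128 * (N : ℝ) ^ 2 * Lam) ^ τ.length ≤ (128 * N ^ 2 * Lam + 1) ^ (d + 1) :=
        (pow_le_pow_left₀ (by positivity) (by linarith) _).trans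
          (pow_le_pow_right₀ (le_add_of_nonneg_left (by positivity)) (by omega))
      have h4 : (14 : ℝ) ^ J.card ≤ 14 ^ (d + 1) := pow_le_pow_right₀ (by norm_num) (by omega)
      calc _ = (128 * (N : ℝ) ^ 2 * Lam) ^ τ.length * 14 ^ J.card *
          (δ ^ τ.length * r ^ J.card) := by
            ring
        _ ≤ _ := by gcongr
    have h5 : δ ^ τ.length * r ^ J.card * (1 / r) ^ (d + 1) = ((r / δ) ^ τ.length)⁻¹ := by
      have h51 : r ^ (d + 1) = r ^ J.card * r ^ τ.length := by rw [← pow_add, hlen]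
      rw [div_pow, div_pow, h51]
      field_simp
      simp
    have h6 : ((active Y).card : ℝ) * (c₀ * δ) ^ d ≤ 21 / κ * (wolffConst d N *
        ((128 * N ^ 2 * Lam + 1) ^ (d + 1) * 14 ^ (d + 1) * (δ ^ τ.length * r ^ J.card)) *
          (4 * (d + 1) / (κ * r)) ^ (d + 1)) := h1.trans (by gcongr)
    rw [← le_div_iff₀ (by positivity)] at h6
    refine h6.trans (le_of_eq ?_)
    rw [← h5, longConst, mul_pow c₀, div_pow, mul_pow κ, inv_pow, inv_pow, div_pow, one_pow,
      show d + 2 = d + 1 + 1 by ring, pow_succ κ (d + 1)]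
    field_simp
  · intro i hi
    obtain ⟨x, hx⟩ := mem_active.1 hi
    obtain ⟨c, hc, hreg⟩ := hlong i x hx
    refine ⟨c, fun t ht => ⟨hreg t ht, ?_⟩⟩
    obtain ⟨hx1, hx2⟩ := H.height i x hx
    have hκr : κ * r ≤ r := mul_le_of_le_one_left hr.le hκ1
    have htx : |t - x 0| ≤ r := abs_le.2 ⟨by linarith [ht.1, ht.2, hc.1, hc.2],
      by linarith [ht.1, ht.2, hc.1, hc.2]⟩
    rw [pi_norm_le_iff_of_nonneg (by positivity)]
    intro j
    refine Fin.cases ?_ (fun j => ?_) j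
    · rw [Pi.sub_apply, corePt_zero_apply, Fin.cons_zero, Real.norm_eq_abs]
      have := abs_le.1 htx
      exact abs_le.2 ⟨by linarith, by linarith⟩
    · rw [Pi.sub_apply, corePt_succ_apply, Fin.cons_succ, Real.norm_eq_abs]
      have h1 := abs_le.1 (H.subset_gtube i hx j)
      have h5 : |(t - x 0) * v i j| ≤ r := by
        rw [abs_mul]
        calc _ ≤ r * 1 := mul_le_mul htx (hv i j) (abs_nonneg _) hr.le
          _ = r := mul_one r
      have h5' := abs_le.1 h5
      have h6 : (β j : ℝ) * r ≤ x j.succ := by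
        rw [← le_div_iff₀ hr, ← hβ i x hx j]; exact Int.floor_le _
      have h7 : x j.succ < (β j + 1) * r := by
        rw [← div_lt_iff₀ hr, ← hβ i x hx j]; exact Int.lt_floor_add_one _
      exact abs_le.2 ⟨by linarith, by linarith⟩

lemma wallBound_of_levelBound {a v : ι → Fin d → ℝ} (hv : ∀ i j, |v i j| ≤ 1)
    {δ κ η Lam p c₀ : ℝ} {N K m : ℕ} {B B' e e' u w : ℝ}
    (hp : 1 ≤ p) (hδ : 0 < δ) (hLam : 64 * ((d + 1 : ℕ) : ℝ) ≤ Lam)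
    (hc₀ : 0 < c₀) (hc₀1 : c₀ ≤ 1) (hκ : 0 < κ) (hκ1 : κ ≤ 1) (hm : m ≤ d)
    (hsep : ∀ i j, i ≠ j → c₀ * δ ≤ ‖v i - v j‖) (hB : 0 ≤ B) (hB' : 0 ≤ B') (hu : 0 ≤ u)
    (hw : 0 ≤ w)
    (he' : e' = e + w * ((d + 1 - m : ℕ) : ℝ))
    (hlevel : LevelBound a v δ κ η Lam p N K m B' e' (u + w))
    (hshort : 2 ^ p * κ ^ e * ((3 * breakCount d N : ℕ) : ℝ) ^ (1 + u) *
      (4 * ((boundedLists (d + 1) N).card * (d + 1))) ≤ 1)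
    (hlong : 2 ^ p * ((9 ^ d : ℕ) : ℝ) ^ (1 + u) * B' *
      (longConst d N Lam c₀ * κ⁻¹ ^ (d + 2) * δ⁻¹ ^ d) ^ w *
      (4 * ((boundedLists (d + 1) N).card * (d + 1))) ≤ B) :
    WallBound a v δ κ η Lam p N K (m + 1) B e u := by
  classical
  intro s E τ J hτ hJ Y h r H hδr hr2 hs hIH
  have hJm : J.card = m := by omega
  have hp0 : 0 < p := by linarith
  have hr : 0 < r := (mul_pos_iff_of_pos_left hκ).1 (hδ.trans_le hδr)
  have hδr' : δ ≤ r := hδr.trans (mul_le_of_le_one_left hr.le hκ1)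
  have hLam0 : 0 < Lam := lt_of_lt_of_le (by positivity) hLam
  have hLam8 : 8 * ((d + 1 : ℕ) : ℝ) ≤ Lam := le_trans (by gcongr; norm_num) hLam
  set Cw : ℝ := (boundedLists (d + 1) N).card * (d + 1) with hCw
  have hCw0 : 0 < Cw := by
    have : 0 < (boundedLists (d + 1) N).card :=
      Finset.card_pos.2 ⟨[], mem_boundedLists.2 (by simp)⟩
    positivity
  set lng : ι → Set (Fin (d + 1) → ℝ) :=
    fun i => {x | x 0 ∈ longSet (Lam * δ) (κ * r) (E :: τ) (a i) (v i)} with hlng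
  have hlm : ∀ i, MeasurableSet (lng i) := fun i => measurableSet_preimage (measurable_pi_apply 0)
      (isOpen_longSet (Lam * δ) (κ * r) (E :: τ) (a i) (v i)).measurableSet
  have hsub : regSet (Lam * δ) 1 (E :: τ) ⊆ regSet (Lam * δ) 1 τ :=
    fun x hx e he => hx e (List.mem_cons_of_mem _ he)
  set X : ℝ := (r / δ) ^ e * ((active Y).card : ℝ) ^ (1 + u) with hX
  have hX0 : 0 ≤ X := by positivity
  have hS := energy_short_le (cap := slopeCap η v) (A := 2 ^ (s + (m + 1)) * K) (u := u)
    (G := B * (κ * r / δ) ^ e) hτ H hp0 hδ hLam8 hκ hr hu (by positivity) fun Y' h' H' =>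
      hIH Y' h' ⟨H'.measurableSet, fun i => (H'.subset i).trans hsub, H'.subset_gtube, H'.height⟩
  have hLS : Shaded a v δ (regSet (Lam * δ) 1 (E :: τ)) h r fun i => Y i ∩ lng i :=
    H.mono (fun i => (H.measurableSet i).inter (hlm i)) (fun i => Set.inter_subset_left)
      (fun i => Set.inter_subset_left.trans (H.subset i)) fun i x hx => H.height i x hx.1
  set Hc : ℝ := longConst d N Lam c₀ * κ⁻¹ ^ (d + 2) * δ⁻¹ ^ d with hHc
  have hHc0 : 0 ≤ Hc := by have := longConst_nonneg (d := d) (N := N) hLam0.le hc₀; positivity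
  have hlen : (E :: τ).length = d + 1 - m := by have := hτ.card; omega
  have hL := energy_le_of_cubes (cap := slopeCap η v) (A := 2 ^ (s + (m + 1)) * K)
      hv hLS hp0 hδ hδr'
    (u := u) (G := B' * (r / δ) ^ e * Hc ^ w) hu (by positivity) ?_
  · rw [show 2 ^ (s + 1 + (m + 1)) * K = 2 ^ (s + (m + 1)) * K + 2 ^ (s + (m + 1)) * K by ring]
    refine (energy_union_le hp0.le (Y' := fun i => Y i ∩ lng i) hLS.measurableSet
      (fun i x hx => ?_)).trans ((mul_le_mul_right (add_le_add hL hS) _).trans ?_)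
    · by_cases hxl : x ∈ lng i
      · exact Or.inl ⟨hx, hxl⟩
      · exact Or.inr ⟨hx, hxl⟩
    have hact : ((active fun i => Y i ∩ lng i).card : ℝ) ≤ (active Y).card := by
      have := active_mono (Y := fun i => Y i ∩ lng i) (Y' := Y) fun i => Set.inter_subset_left
      exact_mod_cast Finset.card_le_card this
    rw [← ENNReal.ofReal_add (by positivity) (by positivity),
      show (2 : ℝ≥0∞) = ENNReal.ofReal 2 by simp, ENNReal.ofReal_rpow_of_pos (by norm_num),
      ← ENNReal.ofReal_mul (by positivity)]
    refine ENNReal.ofReal_le_ofReal ?_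
    have hL1 : B' * (r / δ) ^ e * Hc ^ w *
        (((9 ^ d : ℕ) : ℝ) * (active fun i => Y i ∩ lng i).card) ^ (1 + u) ≤
        ((9 ^ d : ℕ) : ℝ) ^ (1 + u) * B' * Hc ^ w * X := by
      calc _ ≤ B' * (r / δ) ^ e * Hc ^ w * (((9 ^ d : ℕ) : ℝ) * (active Y).card) ^ (1 + u) := by
            gcongr
        _ = _ := by
            rw [Real.mul_rpow (x := ((9 ^ d : ℕ) : ℝ)) (y := ((active Y).card : ℝ))
              (by positivity) (by positivity), hX]
            ring
    have hS1 : B * (κ * r / δ) ^ e * (((3 * breakCount d N : ℕ) : ℝ) * (active Y).card) ^ (1 + u) =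
        κ ^ e * ((3 * breakCount d N : ℕ) : ℝ) ^ (1 + u) * B * X := by
      rw [Real.mul_rpow (by positivity) (by positivity), mul_div_assoc,
        Real.mul_rpow hκ.le (by positivity)]
      ring
    have e1 : B * (r / δ) ^ e * ((active Y).card : ℝ) ^ (1 + u) = B * X := by rw [hX]; ring
    rw [hS1, e1, le_div_iff₀ (by positivity)]
    have h1 := mul_le_mul_of_nonneg_right hlong hX0
    have h2 := mul_le_mul_of_nonneg_right hshort (mul_nonneg hB hX0)
    have h3 := mul_le_mul_of_nonneg_left hL1
      (show (0 : ℝ) ≤ 2 ^ p * (4 * Cw) by positivity)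
    nlinarith [h1, h2, h3]
  · intro β
    set Z : ι → Set (Fin (d + 1) → ℝ) :=
      fun i => Y i ∩ lng i ∩ {x | ∀ j : Fin d, ⌊x j.succ / r⌋ = β j} with hZ
    have hZS : Shaded a v δ (regSet (Lam * δ) 1 (E :: τ)) h r Z := by
      refine hLS.mono (fun i => (hLS.measurableSet i).inter ?_) (fun i => Set.inter_subset_left)
        (fun i => Set.inter_subset_left.trans (hLS.subset i)) fun i x hx => hLS.height i x hx.1
      simp only [Set.ofPred_forall]
      refine MeasurableSet.iInter fun j => ?_
      have hm : Measurable fun x : Fin (d + 1) → ℝ => ⌊x j.succ / r⌋ :=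
        Int.measurable_floor.comp ((measurable_pi_apply _).div_const _)
      exact hm (measurableSet_singleton _)
    have h1 := hlevel (s + 1) (E :: τ) J hτ hJm Z h r hZS hδr' hr2 hs
    rw [show s + 1 + m = s + (m + 1) by ring] at h1
    refine h1.trans (ENNReal.ofReal_le_ofReal ?_)
    have hc := card_active_long_le hv hτ hZS hδ hδr' hr2 hLam hc₀ hc₀1 hκ hκ1 hsep β
      (fun i x hx => hx.1.2) (fun i x hx => hx.2)
    have hrδ : 0 < r / δ := by positivity
    have hcw : ((active Z).card : ℝ) ^ w ≤ Hc ^ w * ((r / δ) ^ (w * ((d + 1 - m : ℕ) : ℝ)))⁻¹ := by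
      refine (Real.rpow_le_rpow (by positivity) hc hw).trans (le_of_eq ?_)
      rw [Real.mul_rpow hHc0 (by positivity), hlen, Real.inv_rpow (by positivity), mul_comm w,
        Real.rpow_mul hrδ.le, Real.rpow_natCast]
    rw [he', Real.rpow_add hrδ, ← add_assoc, Real.rpow_add_of_nonneg (by positivity)
        (by linarith) hw]
    calc B' * ((r / δ) ^ e * (r / δ) ^ (w * ((d + 1 - m : ℕ) : ℝ))) *
          (((active Z).card : ℝ) ^ (1 + u) * ((active Z).card : ℝ) ^ w)
        ≤ B' * ((r / δ) ^ e * (r / δ) ^ (w * ((d + 1 - m : ℕ) : ℝ))) *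
          (((active Z).card : ℝ) ^ (1 + u) *
            (Hc ^ w * ((r / δ) ^ (w * ((d + 1 - m : ℕ) : ℝ)))⁻¹)) := by gcongr
      _ = B' * (r / δ) ^ e * Hc ^ w * ((active Z).card : ℝ) ^ (1 + u) *
          ((r / δ) ^ (w * ((d + 1 - m : ℕ) : ℝ)) * ((r / δ) ^ (w * ((d + 1 - m : ℕ) : ℝ)))⁻¹) := by
          ring
      _ = _ := by rw [mul_inv_cancel₀ (by positivity), mul_one]

end Kakeya

end

section

open MeasureTheory
open scoped ENNReal

namespace Kakeya

open MvPolynomial PolyCalc PolyPartition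

/-- The exponents of the number of tubes in the broad estimate inside `m`-dimensional pieces. -/
noncomputable def levelExp (d m : ℕ) : ℝ := 1 / d * (((d : ℝ) + 1) / d) ^ (d + 1 - m)

section Exponents

variable {d m : ℕ}

lemma levelExp_pos (hd : 1 ≤ d) : 0 < levelExp d m := by
  have : (0 : ℝ) < d := by exact_mod_cast hd
  unfold levelExp
  positivity

lemma levelExp_top : levelExp d (d + 1) = 1 / d := by simp [levelExp]

lemma levelExp_eq (hd : 1 ≤ d) (hm : m ≤ d) :
    levelExp d m = levelExp d (m + 1) + levelExp d (m + 1) / d := by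
  have : (0 : ℝ) < d := by exact_mod_cast hd
  unfold levelExp
  rw [show d + 1 - m = (d + 1 - (m + 1)) + 1 by omega, pow_succ]
  field_simp

lemma levelExp_anti (hd : 1 ≤ d) {m m' : ℕ} (h : m ≤ m') : levelExp d m' ≤ levelExp d m := by
  have hd0 : (0 : ℝ) < d := by exact_mod_cast hd
  unfold levelExp
  gcongr
  · rw [le_div_iff₀ hd0]; linarith

/-- The exponents of the scale in the broad estimate inside `m`-dimensional pieces. -/
noncomputable def scaleExp (d m : ℕ) (ε : ℝ) : ℝ := 1 - levelExp d m * ((m : ℝ) - 1) + ε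

lemma scaleExp_top (hd : 1 ≤ d) (ε : ℝ) : scaleExp d (d + 1) ε = ε := by
  have hd0 : (0 : ℝ) < d := by exact_mod_cast hd
  unfold scaleExp
  rw [levelExp_top]
  push_cast
  field_simp
  ring

lemma scaleExp_eq (hd : 1 ≤ d) (hm : m ≤ d) (ε : ℝ) : scaleExp d m ε =
    scaleExp d (m + 1) ε + levelExp d (m + 1) / d * ((d + 1 - m : ℕ) : ℝ) := by
  have hd0 : (0 : ℝ) < d := by exact_mod_cast hd
  unfold scaleExp
  rw [levelExp_eq hd hm, Nat.cast_sub (by omega)]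
  push_cast
  field_simp
  ring

lemma le_scaleExp (hd : 1 ≤ d) (ε : ℝ) (hm : m ≤ d + 1) : ε ≤ scaleExp d m ε := by
  induction hm using Nat.decreasingInduction with
  | self => exact (scaleExp_top hd ε).ge
  | of_succ m hm ih =>
    rw [scaleExp_eq hd (by omega)]
    have := levelExp_pos (m := m + 1) hd
    have : 0 ≤ levelExp d (m + 1) / d * ((d + 1 - m : ℕ) : ℝ) := by positivity
    linarith

end Exponents

lemma exists_forall_mul_rpow_le_one {C e : ℝ} (hC : 0 ≤ C) (he : 0 < e) :
    ∃ κ₀ : ℝ, 0 < κ₀ ∧ κ₀ ≤ 1 ∧ ∀ κ, 0 < κ → κ ≤ κ₀ → C * κ ^ e ≤ 1 := by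
  have h1 : (1 : ℝ) ≤ C + 1 := by linarith
  refine ⟨(C + 1) ^ (-(1 / e)), by positivity,
    Real.rpow_le_one_of_one_le_of_nonpos h1 (neg_nonpos.2 (by positivity)), fun κ hκ h => ?_⟩
  have : κ ^ e ≤ (C + 1)⁻¹ := by
    refine (Real.rpow_le_rpow hκ.le h he.le).trans (le_of_eq ?_)
    rw [← Real.rpow_mul (by positivity), show -(1 / e) * e = -1 by field_simp, Real.rpow_neg_one]
  calc C * κ ^ e ≤ C * (C + 1)⁻¹ := by gcongr
    _ ≤ 1 := by rw [mul_inv_le_iff₀ (by positivity)]; linarith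

/-- The broad estimate at level `m`, uniformly over all separated families of tubes. -/
def UniformLevel (d k N K m : ℕ) (η Lam c₀ M₀ ε : ℝ) : Prop :=
  ∃ F κ₀ : ℝ, 0 < F ∧ 0 < κ₀ ∧ κ₀ ≤ 1 ∧
    ∀ (ι : Type) [Fintype ι] (a v : ι → Fin d → ℝ) (δ κ : ℝ), (∀ i j, |v i j| ≤ 1) → 0 < δ →
      0 < κ → κ ≤ κ₀ → (∀ i j, i ≠ j → c₀ * δ ≤ ‖v i - v j‖) →
      (Fintype.card ι : ℝ) ≤ M₀ * δ⁻¹ ^ d →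
      LevelBound a v δ κ η Lam (1 + levelExp d k) N K m
        (F * κ⁻¹ ^ (1 + (d + 2) * (levelExp d k - levelExp d m)) * δ ^ (d + 1) *
          (δ⁻¹ ^ d) ^ (levelExp d k - levelExp d m)) (scaleExp d m ε) (levelExp d m)

variable {d : ℕ}

lemma term_le {κ δ M₀ q z w F : ℝ} (hκ : 0 < κ) (hκ1 : κ ≤ 1) (hδ : 0 < δ) (hM₀ : 1 ≤ M₀)
    (hwq : w ≤ q) (hz : 0 ≤ z) (hF : 2 ^ d * M₀ ^ q ≤ F) :
    κ⁻¹ * (2 ^ d * δ ^ (d + 1)) * (M₀ * δ⁻¹ ^ d) ^ w ≤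
      F * κ⁻¹ ^ (1 + z) * δ ^ (d + 1) * (δ⁻¹ ^ d) ^ w := by
  have h1 : (1 : ℝ) ≤ κ⁻¹ := (one_le_inv₀ hκ).2 hκ1
  have h2 : κ⁻¹ ≤ κ⁻¹ ^ (1 + z) := by
    conv_lhs => rw [← Real.rpow_one κ⁻¹]
    exact Real.rpow_le_rpow_of_exponent_le h1 (by linarith)
  have h3 : M₀ ^ w ≤ M₀ ^ q := Real.rpow_le_rpow_of_exponent_le hM₀ hwq
  rw [Real.mul_rpow (by positivity) (by positivity)]
  calc _ = (2 ^ d * M₀ ^ w) * κ⁻¹ * δ ^ (d + 1) * (δ⁻¹ ^ d) ^ w := by ring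
    _ ≤ (2 ^ d * M₀ ^ q) * κ⁻¹ ^ (1 + z) * δ ^ (d + 1) * (δ⁻¹ ^ d) ^ w := by gcongr
    _ ≤ _ := by gcongr

lemma close_le (hd : 1 ≤ d) {k m b : ℕ} {ε : ℝ} (hkm : k ≤ m)
    (hb : (2 * (2 * ((d : ℝ) + 1) ^ 2 + 2)) ^ (1 + levelExp d k) ≤ (2 ^ b : ℝ) ^ ε) :
    2 ^ (1 + levelExp d m) * (((2 ^ b) ^ m : ℝ)⁻¹) ^ levelExp d m *
      ((2 ^ b : ℝ) ^ scaleExp d m ε)⁻¹ *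
      ((2 ^ b + 2 * (d + 1) ^ 2 * 2 ^ b + 1 : ℕ) : ℝ) ^ (1 + levelExp d m) ≤ 1 := by
  set u := levelExp d m with hu
  have hu0 : 0 < u := levelExp_pos hd
  set D : ℝ := 2 ^ b with hD
  have hD1 : 1 ≤ D := one_le_pow₀ (by norm_num)
  have hD0 : 0 < D := by linarith
  set c : ℝ := 2 * ((d : ℝ) + 1) ^ 2 + 2 with hc
  have hc1 : 1 ≤ 2 * c := by nlinarith [sq_nonneg ((d : ℝ) + 1)]
  have hc0 : 0 < c := by linarith
  have h1 : ((2 ^ b + 2 * (d + 1) ^ 2 * 2 ^ b + 1 : ℕ) : ℝ) ≤ c * D := by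
    push_cast
    rw [← hD, hc]
    nlinarith
  have h2 : ((D ^ m)⁻¹) ^ u = D ^ (-(m * u)) := by
    rw [← Real.rpow_natCast, ← Real.rpow_neg hD0.le, ← Real.rpow_mul hD0.le]; ring_nf
  rw [h2, ← Real.rpow_neg hD0.le]
  calc _ ≤ 2 ^ (1 + u) * D ^ (-(m * u)) * D ^ (-scaleExp d m ε) * (c * D) ^ (1 + u) := by gcongr
    _ = (2 * c) ^ (1 + u) * (D ^ (-(m * u)) * D ^ (-scaleExp d m ε) * D ^ (1 + u)) := by
      rw [Real.mul_rpow hc0.le hD0.le, Real.mul_rpow (by norm_num) hc0.le]; ring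
    _ = (2 * c) ^ (1 + u) * D ^ (-ε) := by
      rw [← Real.rpow_add hD0, ← Real.rpow_add hD0]
      congr 2
      rw [scaleExp, ← hu]
      ring
    _ ≤ (2 * c) ^ (1 + levelExp d k) * D ^ (-ε) := by
      have := levelExp_anti hd hkm
      gcongr
    _ ≤ D ^ ε * D ^ (-ε) := by gcongr
    _ = 1 := by rw [← Real.rpow_add hD0]; simp

lemma uniformLevel_base (hd : 1 ≤ d) {k K b : ℕ} {η θ Lam c₀ M₀ ε : ℝ} (hk : 2 ≤ k)
    (hk' : k ≤ d + 1) (hb1 : 1 ≤ b) (hε : 0 < ε) (hM₀ : 1 ≤ M₀)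
    (hb : (2 * (2 * ((d : ℝ) + 1) ^ 2 + 2)) ^ (1 + levelExp d k) ≤ (2 ^ b : ℝ) ^ ε)
    (hLam : 64 * ((d + 1 : ℕ) : ℝ) ≤ Lam) (hθ : 0 < θ)
    (hLam' : 6 * ((d + 1 : ℕ) : ℝ) ^ 2 ≤ θ * Lam) (hη : 0 < η) (hη1 : η ≤ 1)
    (hθη : tangentConst (d + 1) * θ ≤ η) (hK : (2 * ⌈1 / θ⌉₊ + 1) ^ (k - 2) * 3 ^ d ≤ K) :
    UniformLevel d k (2 * (d + 1) ^ 2 * 2 ^ b) K k η Lam c₀ M₀ ε := by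
  have hq : 0 < levelExp d k := levelExp_pos hd
  set N := 2 * (d + 1) ^ 2 * 2 ^ b with hN
  set G : ℝ := 2 ^ (1 + levelExp d k) * (16 * (d + 1) * N ^ 2 * Lam / θ * 2 ^ d) *
    (2 * ((boundedLists (d + 1) N).card * (d + 1))) with hG
  have hLam0 : 0 < Lam := lt_of_lt_of_le (by positivity) hLam
  have hLam8 : 8 * ((d + 1 : ℕ) : ℝ) ≤ Lam := le_trans (by gcongr; norm_num) hLam
  have hG0 : 0 ≤ G := by positivity
  refine ⟨2 ^ d * M₀ ^ levelExp d k + G, (2 ^ b)⁻¹, by positivity, by positivity,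
    inv_le_one_of_one_le₀ (one_le_pow₀ (by norm_num)), ?_⟩
  intro ι _ a v δ κ hv hδ hκ hκ₀ hsep hcard
  have hκ1 : κ ≤ 1 := hκ₀.trans (inv_le_one_of_one_le₀ (one_le_pow₀ (by norm_num)))
  have hκb : κ * 2 ^ b ≤ 1 := by
    rwa [← le_div_iff₀ (by positivity), one_div]
  have he : 0 ≤ scaleExp d k ε := hε.le.trans (le_scaleExp hd ε hk')
  refine levelBound_of_wallBound (b := b) (by linarith) hδ hLam8 hκ hb1 hκb le_rfl (by omega) he
    (by positivity) hq.le le_rfl hcard ?_ (close_le hd le_rfl hb) ?_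
  · have := term_le (d := d) (z := (d + 2) * (levelExp d k - levelExp d k))
        (q := levelExp d k) hκ hκ1 hδ hM₀
      (w := levelExp d k - levelExp d k) (by rw [sub_self]; exact hq.le) (by simp)
      (le_add_of_nonneg_right hG0)
    rwa [show (1 : ℝ) + levelExp d k - (1 + levelExp d k) = levelExp d k - levelExp d k by ring]
  · refine wallBound_of_tangent hv (by linarith) hδ hLam8 hκ hκ1 he rfl hθ hLam' hη hη1 hθη hK ?_
    rw [sub_self, mul_zero, add_zero, Real.rpow_one, Real.rpow_zero, mul_one]
    have h1 : (1 : ℝ) ≤ κ⁻¹ := (one_le_inv₀ hκ).2 hκ1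
    calc _ = G * 1 * δ ^ (d + 1) := by rw [hG]; ring
      _ ≤ _ := by
        gcongr
        exact le_add_of_nonneg_left (by positivity)

lemma uniformLevel_succ (hd : 1 ≤ d) {k K b m : ℕ} {η Lam c₀ M₀ ε : ℝ} (hkm : k ≤ m)
    (hm : m ≤ d) (hb1 : 1 ≤ b) (hε : 0 < ε) (hM₀ : 1 ≤ M₀) (hc₀ : 0 < c₀) (hc₀1 : c₀ ≤ 1)
    (hb : (2 * (2 * ((d : ℝ) + 1) ^ 2 + 2)) ^ (1 + levelExp d k) ≤ (2 ^ b : ℝ) ^ ε)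
    (hLam : 64 * ((d + 1 : ℕ) : ℝ) ≤ Lam)
    (H : UniformLevel d k (2 * (d + 1) ^ 2 * 2 ^ b) K m η Lam c₀ M₀ ε) :
    UniformLevel d k (2 * (d + 1) ^ 2 * 2 ^ b) K (m + 1) η Lam c₀ M₀ ε := by
  set N := 2 * (d + 1) ^ 2 * 2 ^ b with hN
  set q := levelExp d k with hq
  set u := levelExp d (m + 1) with hu
  set w := u / d with hw
  have hd0 : (0 : ℝ) < d := by exact_mod_cast hd
  have hq0 : 0 < q := levelExp_pos hd
  have hu0 : 0 < u := levelExp_pos hd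
  have hw0 : 0 < w := by positivity
  have huw : levelExp d m = u + w := levelExp_eq hd hm
  have huq : u + w ≤ q := huw ▸ levelExp_anti hd hkm
  have hLam0 : 0 < Lam := lt_of_lt_of_le (by positivity) hLam
  have hLam8 : 8 * ((d + 1 : ℕ) : ℝ) ≤ Lam := le_trans (by gcongr; norm_num) hLam
  have hee : ε ≤ scaleExp d (m + 1) ε := le_scaleExp hd ε (by omega)
  have he : 0 < scaleExp d (m + 1) ε := hε.trans_le hee
  obtain ⟨F, κ₀, hF, hκ₀, hκ₀1, HF⟩ := H
  obtain ⟨κ₁, hκ₁, hκ₁1, Hκ⟩ := exists_forall_mul_rpow_le_one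
    (C := 2 ^ (1 + q) * ((3 * breakCount d N : ℕ) : ℝ) ^ (1 + u) *
      (4 * ((boundedLists (d + 1) N).card * (d + 1)))) (by positivity) he
  have hL0 : 0 ≤ longConst d N Lam c₀ := longConst_nonneg hLam0.le hc₀
  set G : ℝ := 2 ^ (1 + q) * ((9 ^ d : ℕ) : ℝ) ^ (1 + u) * F * longConst d N Lam c₀ ^ w *
    (4 * ((boundedLists (d + 1) N).card * (d + 1))) with hG
  have hG0 : 0 ≤ G := by positivity
  refine ⟨2 ^ d * M₀ ^ q + G, min (min κ₀ κ₁) (2 ^ b)⁻¹, by positivity, by positivity,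
    (min_le_left _ _).trans ((min_le_left _ _).trans hκ₀1), ?_⟩
  intro ι _ a v δ κ hv hδ hκ hκm hsep hcard
  obtain ⟨hκm', hκb'⟩ := le_min_iff.1 hκm
  obtain ⟨hκ0, hκ1⟩ := le_min_iff.1 hκm'
  have hκ_one : κ ≤ 1 := hκ0.trans hκ₀1
  have hκb : κ * 2 ^ b ≤ 1 := by
    rwa [← le_div_iff₀ (by positivity), one_div]
  have hlev := HF ι a v δ κ hv hδ hκ hκ0 hsep hcard
  rw [huw] at hlev
  refine levelBound_of_wallBound (b := b) (by linarith) hδ hLam8 hκ hb1 hκb le_rfl (by omega) he.le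
    (by positivity) hu0.le (by linarith) hcard ?_ (close_le hd (by omega) hb) ?_
  · have := term_le (d := d) (z := (d + 2) * (q - u)) (w := q - u) (q := q) hκ hκ_one hδ hM₀
      (by linarith) (mul_nonneg (by positivity) (by linarith))
      (le_add_of_nonneg_right hG0)
    rwa [show (1 : ℝ) + q - (1 + u) = q - u by ring]
  · refine wallBound_of_levelBound hv (by linarith) hδ hLam hc₀ hc₀1 hκ hκ_one hm hsep
      (by positivity) (by positivity) hu0.le hw0.le (scaleExp_eq hd hm ε) hlev ?_ ?_
    · refine le_trans (le_of_eq ?_) (Hκ κ hκ hκ1)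
      ring
    · have hκi : 0 < κ⁻¹ := by positivity
      have hδi : 0 < δ⁻¹ ^ d := by positivity
      have e1 : κ⁻¹ ^ (1 + (d + 2) * (q - (u + w))) * (κ⁻¹ ^ (d + 2)) ^ w =
          κ⁻¹ ^ (1 + (d + 2) * (q - u)) := by
        rw [← Real.rpow_natCast, ← Real.rpow_mul hκi.le, ← Real.rpow_add hκi]
        congr 1
        push_cast
        ring
      have e2 : (δ⁻¹ ^ d) ^ (q - (u + w)) * (δ⁻¹ ^ d) ^ w = (δ⁻¹ ^ d) ^ (q - u) := by
        rw [← Real.rpow_add hδi]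
        congr 1
        ring
      rw [Real.mul_rpow (by positivity) hδi.le, Real.mul_rpow hL0 (by positivity), ← e1, ← e2]
      calc _ = G * (κ⁻¹ ^ (1 + (d + 2) * (q - (u + w))) * (κ⁻¹ ^ (d + 2)) ^ w) * δ ^ (d + 1) *
            ((δ⁻¹ ^ d) ^ (q - (u + w)) * (δ⁻¹ ^ d) ^ w) := by rw [hG]; ring
        _ ≤ _ := by
          gcongr
          exact le_add_of_nonneg_left (by positivity)

lemma uniformLevel_top (hd : 1 ≤ d) {k K b : ℕ} {η θ Lam c₀ M₀ ε : ℝ} (hk : 2 ≤ k)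
    (hk' : k ≤ d + 1) (hb1 : 1 ≤ b) (hε : 0 < ε) (hM₀ : 1 ≤ M₀) (hc₀ : 0 < c₀) (hc₀1 : c₀ ≤ 1)
    (hb : (2 * (2 * ((d : ℝ) + 1) ^ 2 + 2)) ^ (1 + levelExp d k) ≤ (2 ^ b : ℝ) ^ ε)
    (hLam : 64 * ((d + 1 : ℕ) : ℝ) ≤ Lam) (hθ : 0 < θ)
    (hLam' : 6 * ((d + 1 : ℕ) : ℝ) ^ 2 ≤ θ * Lam) (hη : 0 < η) (hη1 : η ≤ 1)
    (hθη : tangentConst (d + 1) * θ ≤ η) (hK : (2 * ⌈1 / θ⌉₊ + 1) ^ (k - 2) * 3 ^ d ≤ K) :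
    UniformLevel d k (2 * (d + 1) ^ 2 * 2 ^ b) K (d + 1) η Lam c₀ M₀ ε := by
  have H : ∀ m, k ≤ m → m ≤ d + 1 →
      UniformLevel d k (2 * (d + 1) ^ 2 * 2 ^ b) K m η Lam c₀ M₀ ε := by
    intro m hkm
    induction m, hkm using Nat.le_induction with
    | base => exact fun _ =>
        uniformLevel_base hd hk hk' hb1 hε hM₀ hb hLam hθ hLam' hη hη1 hθη hK
    | succ m hkm ih => exact fun hm =>
        uniformLevel_succ hd hkm (by omega) hb1 hε hM₀ hc₀ hc₀1 hb hLam (ih (by omega))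
  exact H _ hk' le_rfl

end Kakeya

end

section

open MeasureTheory
open scoped ENNReal

namespace Kakeya

open MvPolynomial PolyCalc PolyPartition

variable {d : ℕ} {ι : Type*} [Fintype ι]

lemma card_le_of_separated {v : ι → Fin d → ℝ} (hv : ∀ i j, |v i j| ≤ 1) {s : ℝ}
    (hs : 0 < s) (hs1 : s ≤ 1) (hsep : ∀ i j, i ≠ j → s ≤ ‖v i - v j‖) :
    (Fintype.card ι : ℝ) ≤ (5 / s) ^ d := by
  classical
  set m := ⌈1 / s⌉₊ with hm
  have hm1 : 1 / s ≤ m := Nat.le_ceil _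
  have hmem : ∀ i, slopeCap s v i ∈ Fintype.piFinset fun _ : Fin d => Finset.Icc (-(m : ℤ)) m := by
    intro i
    refine Fintype.mem_piFinset.2 fun j => Finset.mem_Icc.2 ⟨?_, ?_⟩
    · refine Int.le_floor.2 ?_
      have h1 := (abs_le.1 (hv i j)).1
      have : -(1 / s) ≤ v i j / s := by rw [← neg_div]; gcongr
      push_cast
      linarith
    · have h1 := (abs_le.1 (hv i j)).2
      have h2 : v i j / s ≤ 1 / s := by gcongr
      have h3 : ((⌊v i j / s⌋ : ℤ) : ℝ) ≤ (m : ℤ) := by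
        push_cast
        exact (Int.floor_le _).trans (h2.trans hm1)
      exact_mod_cast h3
  have hinj : Function.Injective (slopeCap s v) := by
    intro i j hij
    by_contra hne
    have h1 : ‖v i - v j‖ < s := by
      refine (pi_norm_lt_iff hs).2 fun l => ?_
      have h2 : ⌊v i l / s⌋ = ⌊v j l / s⌋ := congrFun hij l
      have h3 := Int.abs_sub_lt_one_of_floor_eq_floor h2
      rw [← sub_div, abs_div, abs_of_pos hs, div_lt_one hs] at h3
      exact h3
    exact absurd (hsep i j hne) (not_le.2 h1)
  have hcard := Finset.card_le_card_of_injOn (s := Finset.univ) (slopeCap s v) (fun i _ => hmem i)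
    hinj.injOn
  rw [Fintype.card_piFinset_const, Finset.card_univ, Int.card_Icc,
    show ((m : ℤ) + 1 - -(m : ℤ)).toNat = 2 * m + 1 by omega] at hcard
  have h5 : ((2 * m + 1 : ℕ) : ℝ) ≤ 5 / s := by
    have h1 : (m : ℝ) < 1 / s + 1 := Nat.ceil_lt_add_one (by positivity)
    have h2 : 1 ≤ 1 / s := (one_le_div hs).2 hs1
    have h3 : 5 / s = 5 * (1 / s) := by ring
    push_cast
    rw [h3]
    linarith
  calc (Fintype.card ι : ℝ) ≤ ((2 * m + 1 : ℕ) : ℝ) ^ d := by exact_mod_cast hcard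
    _ ≤ _ := by gcongr

/-- The number of caps of size `η` met by slopes tangent to a `(k - 1)`-dimensional plane. -/
noncomputable def capBudget (d k : ℕ) (η : ℝ) : ℕ :=
  (2 * ⌈tangentConst (d + 1) / η⌉₊ + 1) ^ (k - 2) * 3 ^ d

lemma one_le_tangentConst (n : ℕ) : 1 ≤ tangentConst n := by
  unfold tangentConst
  have : (1 : ℝ) ≤ 4 ^ n := one_le_pow₀ (by norm_num)
  have h2 : (1 : ℝ) ≤ 2 * (n : ℝ) ^ 2 + 5 * n + 2 := by
    have : (0 : ℝ) ≤ 2 * (n : ℝ) ^ 2 + 5 * n := by positivity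
    linarith
  exact one_le_mul_of_one_le_of_one_le h2 this

lemma capBudget_le {k : ℕ} {η : ℝ} (hη : 0 < η) (hη1 : η ≤ 1) :
    (capBudget d k η : ℝ) ≤ (5 * tangentConst (d + 1)) ^ (k - 2) * 3 ^ d * (η⁻¹) ^ (k - 2) := by
  have ht := one_le_tangentConst (d + 1)
  have h1 : 1 ≤ tangentConst (d + 1) / η := by rw [one_le_div hη]; linarith
  have h2 := Nat.ceil_lt_add_one (show 0 ≤ tangentConst (d + 1) / η by positivity)
  unfold capBudget
  push_cast
  calc _ ≤ (5 * (tangentConst (d + 1) / η)) ^ (k - 2) * 3 ^ d := by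
        gcongr
        linarith
    _ = _ := by rw [div_eq_mul_inv, ← mul_assoc, mul_pow]; ring

/-- The broad estimate for separated families of tubes. -/
theorem exists_energy_le (hd : 1 ≤ d) {k : ℕ} (hk : 2 ≤ k) (hk' : k ≤ d + 1) {c₀ ε : ℝ}
    (hc₀ : 0 < c₀) (hc₀1 : c₀ ≤ 1) (hε : 0 < ε) :
    ∃ A : ℕ, 0 < A ∧ ∀ η : ℝ, 0 < η → η ≤ 1 → ∃ F δ₀ : ℝ, 0 < F ∧ 0 < δ₀ ∧ δ₀ ≤ 1 ∧
      ∀ (ι : Type) [Fintype ι] (a v : ι → Fin d → ℝ) (δ : ℝ), (∀ i j, |v i j| ≤ 1) → 0 < δ →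
        δ ≤ δ₀ → (∀ i j, i ≠ j → c₀ * δ ≤ ‖v i - v j‖) →
        ∀ (Y : ι → Set (Fin (d + 1) → ℝ)) (h : ℝ), Shaded a v δ Set.univ h 2 Y →
          energy (slopeCap η v) (1 + levelExp d k) (A * capBudget d k η) Y ≤
            ENNReal.ofReal (F * δ ^ (d + 1 - d * levelExp d k - ε) * Fintype.card ι) := by
  set q := levelExp d k with hq
  have hd0 : (0 : ℝ) < d := by exact_mod_cast hd
  have hq0 : 0 < q := levelExp_pos hd
  have hqd : 1 / (d : ℝ) ≤ q := by rw [← levelExp_top]; exact levelExp_anti hd hk'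
  set Z : ℝ := 1 + (d + 2) * (q - 1 / d) with hZ
  have hZ1 : 1 ≤ Z := le_add_of_nonneg_right (mul_nonneg (by positivity) (by linarith))
  have hZ0 : 0 < Z := by linarith
  set ε₂ := ε / 2 / Z with hε₂
  have hε₂0 : 0 < ε₂ := by positivity
  set s := ⌈2 / ε₂⌉₊ with hs
  have hsε : 2 ≤ ε₂ * s := by
    have := Nat.le_ceil (2 / ε₂)
    rw [div_le_iff₀ hε₂0] at this
    linarith
  refine ⟨2 ^ (s + (d + 1)), by positivity, fun η hη hη1 => ?_⟩
  have ht := one_le_tangentConst (d + 1)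
  have ht0 : 0 < tangentConst (d + 1) := by linarith
  set θ := η / tangentConst (d + 1) with hθ
  have hθ0 : 0 < θ := by positivity
  set Lam : ℝ := max (64 * ((d + 1 : ℕ) : ℝ)) (6 * ((d + 1 : ℕ) : ℝ) ^ 2 / θ) with hLam
  have hLam' : 6 * ((d + 1 : ℕ) : ℝ) ^ 2 ≤ θ * Lam := by
    rw [mul_comm θ, ← div_le_iff₀ hθ0]
    exact le_max_right _ _
  obtain ⟨b₀, hb₀⟩ := pow_unbounded_of_one_lt
    ((2 * (2 * ((d : ℝ) + 1) ^ 2 + 2)) ^ (1 + q)) (Real.one_lt_rpow (x := 2) one_lt_two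
        (half_pos hε))
  have hb : (2 * (2 * ((d : ℝ) + 1) ^ 2 + 2)) ^ (1 + q) ≤ (2 ^ (b₀ + 1) : ℝ) ^ (ε / 2) := by
    refine hb₀.le.trans ?_
    rw [← Real.rpow_natCast, ← Real.rpow_natCast, ← Real.rpow_mul zero_le_two,
      ← Real.rpow_mul zero_le_two]
    refine Real.rpow_le_rpow_of_exponent_le one_le_two ?_
    push_cast
    nlinarith
  set M₀ : ℝ := (5 / c₀) ^ d with hM₀
  have hM₀1 : 1 ≤ M₀ := one_le_pow₀ (by rw [one_le_div hc₀]; linarith)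
  obtain ⟨F, κ₀, hF, hκ₀, hκ₀1, H⟩ := uniformLevel_top hd (K := capBudget d k η) hk hk'
    (Nat.le_add_left 1 b₀) (half_pos hε) hM₀1 hc₀ hc₀1 hb (le_max_left _ _) hθ0 hLam' hη hη1
    (by rw [hθ]; field_simp; rfl) (by rw [hθ, one_div_div]; rfl)
  refine ⟨F * 2 ^ (ε / 2) * M₀ ^ (1 / (d : ℝ)), min (1 / 2) (κ₀ ^ (1 / ε₂)), by positivity,
    by positivity, (min_le_left _ _).trans (by norm_num), ?_⟩
  intro ι _ a v δ hv hδ hδ₀ hsep Y h HY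
  obtain ⟨hδ2, hδκ⟩ := le_min_iff.1 hδ₀
  have hδ1 : δ ≤ 1 := by linarith
  set κ := δ ^ ε₂ with hκ
  have hκ0 : 0 < κ := by positivity
  have hκκ : κ ≤ κ₀ := by
    calc κ ≤ (κ₀ ^ (1 / ε₂)) ^ ε₂ := by rw [hκ]; gcongr
      _ = κ₀ := by rw [← Real.rpow_mul hκ₀.le, one_div, inv_mul_cancel₀ hε₂0.ne', Real.rpow_one]
  have hcard : (Fintype.card ι : ℝ) ≤ M₀ * δ⁻¹ ^ d := by
    refine (card_le_of_separated hv (by positivity)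
      (mul_le_one₀ hc₀1 hδ.le hδ1) hsep).trans (le_of_eq ?_)
    rw [hM₀, ← mul_pow]
    congr 1
    field_simp
  have hκs : 2 * κ ^ s ≤ δ := by
    have : κ ^ s ≤ δ ^ (2 : ℝ) := by
      rw [hκ, ← Real.rpow_natCast, ← Real.rpow_mul hδ.le]
      exact Real.rpow_le_rpow_of_exponent_ge hδ hδ1 hsε
    rw [Real.rpow_two] at this
    nlinarith
  have key := H ι a v δ κ hv hδ hκ0 hκκ hsep hcard s [] Finset.univ rfl (by simp) Y h 2
    (by convert HY using 1; simp [regSet]) (by linarith) le_rfl hκs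
  refine key.trans (ENNReal.ofReal_le_ofReal ?_)
  rw [scaleExp_top hd, levelExp_top]
  have hact : ((active Y).card : ℝ) ≤ Fintype.card ι := by exact_mod_cast Finset.card_le_univ _
  have h1 : ((active Y).card : ℝ) ^ (1 + 1 / (d : ℝ)) ≤
      Fintype.card ι * (M₀ ^ (1 / (d : ℝ)) * δ⁻¹) := by
    rw [Real.rpow_add_of_nonneg (by positivity) zero_le_one (by positivity), Real.rpow_one]
    gcongr
    calc ((active Y).card : ℝ) ^ (1 / (d : ℝ)) ≤ (M₀ * δ⁻¹ ^ d) ^ (1 / (d : ℝ)) := by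
          gcongr
          exact hact.trans hcard
      _ = _ := by
          rw [Real.mul_rpow (by positivity) (by positivity), one_div,
            Real.pow_rpow_inv_natCast (x := δ⁻¹) (by positivity) (by omega)]
  have e1 : κ⁻¹ ^ Z = δ ^ (-(ε / 2)) := by
    rw [hκ, ← Real.rpow_neg hδ.le, ← Real.rpow_mul hδ.le, hε₂]
    congr 1
    field_simp
  have e2 : (δ⁻¹ ^ d) ^ (q - 1 / d) = δ ^ (1 - d * q) := by
    rw [← Real.rpow_natCast, ← Real.rpow_neg_one, ← Real.rpow_mul hδ.le, ← Real.rpow_mul hδ.le]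
    congr 1
    field_simp
    ring
  have e3 : (2 / δ) ^ (ε / 2) = 2 ^ (ε / 2) * δ ^ (-(ε / 2)) := by
    rw [Real.div_rpow (by norm_num) hδ.le, Real.rpow_neg hδ.le, div_eq_mul_inv]
  rw [e1, e2, e3]
  calc _ ≤ F * δ ^ (-(ε / 2)) * δ ^ (d + 1) * δ ^ (1 - d * q) *
        (2 ^ (ε / 2) * δ ^ (-(ε / 2))) * (Fintype.card ι * (M₀ ^ (1 / (d : ℝ)) * δ⁻¹)) := by gcongr
    _ = F * 2 ^ (ε / 2) * M₀ ^ (1 / (d : ℝ)) * (δ ^ (-(ε / 2)) * δ ^ ((d + 1 : ℕ) : ℝ) *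
        δ ^ (1 - d * q) * δ ^ (-(ε / 2)) * δ ^ (-1 : ℝ)) * Fintype.card ι := by
      rw [Real.rpow_natCast, Real.rpow_neg_one]
      ring
    _ = _ := by
      rw [← Real.rpow_add hδ, ← Real.rpow_add hδ, ← Real.rpow_add hδ, ← Real.rpow_add hδ]
      congr 3
      push_cast
      ring

end Kakeya

end

section

open MeasureTheory
open scoped ENNReal

namespace Kakeya

section Linear

lemma card_mult_subtype {ι E : Type*} [Fintype ι] (Y : ι → Set E) (P : ι → Prop) [DecidablePred P]
    (x : E) : (mult (fun i : {i // P i} => Y i) x).card = ((mult Y x).filter P).card := by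
  classical
  rw [← Finset.card_map (Function.Embedding.subtype P)]
  congr 1
  ext i
  simp

variable {ι : Type*} [Fintype ι] {E : Type*} [MeasureSpace E] {γ : Type*} [DecidableEq γ]

/-- The `p`-th power of the `L^p` norm of the multiplicity. -/
noncomputable def lpEnergy (p : ℝ) (Y : ι → Set E) : ℝ≥0∞ :=
  ∫⁻ x, ((mult Y x).card : ℝ≥0∞) ^ p

lemma lpEnergy_eq (cap : ι → γ) (p : ℝ) (Y : ι → Set E) : lpEnergy p Y = energy cap p 0 Y := by
  unfold lpEnergy energy
  refine lintegral_congr fun x => ?_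
  congr 2
  obtain ⟨V, hV, h⟩ := exists_broad_eq cap 0 (mult Y x)
  rw [← h, Finset.card_eq_zero.1 (Nat.le_zero.1 hV)]
  simp

/-- The multiplicity is controlled by its broad part and the multiplicities of single caps. -/
lemma card_rpow_le_broad (cap : ι → γ) {p : ℝ} (hp : 1 ≤ p) (A : ℕ) (X : Finset ι) :
    (X.card : ℝ≥0∞) ^ p ≤ 2 ^ (p - 1) * ((broad cap A X : ℝ≥0∞) ^ p + (A : ℝ≥0∞) ^ (p - 1) *
      ∑ c ∈ Finset.univ.image cap, ((X.filter fun i => cap i = c).card : ℝ≥0∞) ^ p) := by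
  classical
  obtain ⟨V, hV, hX⟩ := exists_broad_eq cap A X
  set W := V ∩ Finset.univ.image cap with hW
  have h1 : (X.card : ℝ≥0∞) = (broad cap A X : ℝ≥0∞) +
      ∑ c ∈ W, ((X.filter fun i => cap i = c).card : ℝ≥0∞) := by
    rw [← hX, ← Finset.card_filter_add_card_filter_not (s := X) fun i => cap i ∉ V]
    push_cast
    congr 1
    rw [← Nat.cast_sum]
    congr 1
    rw [Finset.card_eq_sum_card_fiberwise (f := cap) (t := W) fun i hi => ?_]
    · refine Finset.sum_congr rfl fun c hc => ?_
      congr 1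
      ext i
      have hcV : c ∈ V := (Finset.mem_inter.1 hc).1
      simp only [Finset.mem_filter, not_not]
      constructor
      · rintro ⟨⟨h, -⟩, h'⟩
        exact ⟨h, h'⟩
      · rintro ⟨h, rfl⟩
        exact ⟨⟨h, hcV⟩, rfl⟩
    · simp only [Finset.coe_filter, not_not] at hi
      exact Finset.mem_inter.2 ⟨hi.2, Finset.mem_image_of_mem _ (Finset.mem_univ _)⟩
  rw [h1]
  refine (ENNReal.rpow_add_le_mul_rpow_add_rpow _ _ hp).trans ?_
  refine mul_le_mul_right (add_le_add le_rfl ?_) _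
  refine (ENNReal.rpow_sum_le_const_mul_sum_rpow _ _ hp).trans ?_
  refine mul_le_mul' (ENNReal.rpow_le_rpow ?_ (by linarith))
    (Finset.sum_le_sum_of_subset Finset.inter_subset_right)
  exact_mod_cast (Finset.card_le_card Finset.inter_subset_left).trans hV

lemma lpEnergy_le_broad (cap : ι → γ) {p : ℝ} (hp : 1 ≤ p) (A : ℕ) {Y : ι → Set E}
    (hY : ∀ i, MeasurableSet (Y i)) :
    lpEnergy p Y ≤ 2 ^ (p - 1) * (energy cap p A Y + (A : ℝ≥0∞) ^ (p - 1) *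
      ∑ c ∈ Finset.univ.image cap, lpEnergy p fun i : {i // cap i = c} => Y i) := by
  have hm1 : Measurable fun x => (broad cap A (mult Y x) : ℝ≥0∞) ^ p :=
    measurable_comp_mult hY fun X => (broad cap A X : ℝ≥0∞) ^ p
  have hm2 : ∀ c, Measurable fun x => (((mult Y x).filter fun i => cap i = c).card : ℝ≥0∞) ^ p :=
    fun c => measurable_comp_mult hY fun X => ((X.filter fun i => cap i = c).card : ℝ≥0∞) ^ p
  calc lpEnergy p Y ≤ ∫⁻ x, 2 ^ (p - 1) * ((broad cap A (mult Y x) : ℝ≥0∞) ^ p +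
        (A : ℝ≥0∞) ^ (p - 1) * ∑ c ∈ Finset.univ.image cap,
          (((mult Y x).filter fun i => cap i = c).card : ℝ≥0∞) ^ p) :=
        lintegral_mono fun x => card_rpow_le_broad cap hp A _
    _ = _ := by
      have hm3 := Finset.measurable_sum (Finset.univ.image cap) fun c _ => hm2 c
      have hm4 : Measurable fun x => (broad cap A (mult Y x) : ℝ≥0∞) ^ p + (A : ℝ≥0∞) ^ (p - 1) *
          ∑ c ∈ Finset.univ.image cap, (((mult Y x).filter fun i => cap i = c).card : ℝ≥0∞) ^ p :=
        hm1.add (hm3.const_mul _)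
      rw [lintegral_const_mul _ hm4, lintegral_add_left hm1,
        lintegral_const_mul _ hm3, lintegral_finsetSum _ fun c _ => hm2 c]
      simp only [energy, lpEnergy, card_mult_subtype]

end Linear

variable {d : ℕ} {ι : Type*}

/-- The part of a tube over an interval of heights of length two. -/
def slabTube (δ h : ℝ) (a v : Fin d → ℝ) : Set (Fin (d + 1) → ℝ) :=
  gtube δ a v ∩ {x | x 0 ∈ Set.Icc h (h + 2)}

lemma measurableSet_slabTube (δ h : ℝ) (a v : Fin d → ℝ) : MeasurableSet (slabTube δ h a v) :=
  (measurableSet_gtube δ a v).inter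
    (measurableSet_preimage (measurable_pi_apply (0 : Fin (d + 1))) measurableSet_Icc)

lemma shaded_slabTube (a v : ι → Fin d → ℝ) (δ h : ℝ) :
    Shaded a v δ Set.univ h 2 fun i => slabTube δ h (a i) (v i) :=
  ⟨fun _ => measurableSet_slabTube _ _ _ _, fun _ => Set.subset_univ _,
    fun _ => Set.inter_subset_left, fun _ _ hx => hx.2⟩

variable [Fintype ι]

/-- The matrix of the map `(t, y) ↦ (t, (y - t b) / η)`. -/
noncomputable def shearMatrix (η : ℝ) (b : Fin d → ℝ) : Matrix (Fin (d + 1)) (Fin (d + 1)) ℝ :=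
  Matrix.of (Fin.cons (Pi.single 0 1) fun j => Fin.cons (-(b j / η)) (Pi.single j η⁻¹))

lemma shearMatrix_mulVec_zero (η : ℝ) (b : Fin d → ℝ) (x : Fin (d + 1) → ℝ) :
    (shearMatrix η b).toLin' x 0 = x 0 := by
  simp [shearMatrix, Matrix.mulVec, dotProduct, Fin.sum_univ_succ]

lemma shearMatrix_mulVec_succ (η : ℝ) (b : Fin d → ℝ) (x : Fin (d + 1) → ℝ) (j : Fin d) :
    (shearMatrix η b).toLin' x j.succ = (x j.succ - x 0 * b j) / η := by
  simp [shearMatrix, Matrix.mulVec, dotProduct, Fin.sum_univ_succ, Pi.single_apply]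
  ring

lemma det_shearMatrix (η : ℝ) (b : Fin d → ℝ) : (shearMatrix η b).det = η⁻¹ ^ d := by
  rw [Matrix.det_of_isLowerTriangular]
  · rw [Fin.prod_univ_succ]
    simp [shearMatrix]
  · intro i j hij
    have hij' : i < j := hij
    cases i using Fin.cases with
    | zero => simp [shearMatrix, (Fin.pos_iff_ne_zero.1 hij')]
    | succ i =>
      cases j using Fin.cases with
      | zero => exact absurd hij' (by simp)
      | succ j =>
        have : i ≠ j := (Fin.succ_lt_succ_iff.1 hij').ne
        simp [shearMatrix, this.symm]

lemma lpEnergy_slabTube_eq {η : ℝ} (hη : 0 < η) (b : Fin d → ℝ) (a w : ι → Fin d → ℝ) (δ h p : ℝ) :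
    lpEnergy p (fun i => slabTube δ h (a i) fun j => b j + η * w i j) =
      ENNReal.ofReal (η ^ d) *
        lpEnergy p fun i => slabTube (δ / η) h (fun j => a i j / η) (w i) := by
  set Y : ι → Set (Fin (d + 1) → ℝ) :=
    fun i => slabTube (δ / η) h (fun j => a i j / η) (w i) with hY
  have hYm : ∀ i, MeasurableSet (Y i) := fun i => measurableSet_slabTube _ _ _ _
  set L := (shearMatrix η b).toLin' with hL
  have hdet : (shearMatrix η b).det ≠ 0 := by rw [det_shearMatrix]; positivity
  have hmap := Real.map_matrix_volume_pi_eq_smul_volume_pi hdet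
  have hmem : ∀ x i, L x ∈ Y i ↔ x ∈ slabTube δ h (a i) fun j => b j + η * w i j := by
    intro x i
    have h0 : L x 0 = x 0 := shearMatrix_mulVec_zero η b x
    have h1 : ∀ j : Fin d, L x j.succ = (x j.succ - x 0 * b j) / η := shearMatrix_mulVec_succ η b x
    have h2 : ∀ j : Fin d, |L x j.succ - (a i j / η + L x 0 * w i j)| ≤ δ / η ↔
        |x j.succ - (a i j + x 0 * (b j + η * w i j))| ≤ δ := by
      intro j
      rw [h0, h1, le_div_iff₀ hη]
      have h3 : ∀ z : ℝ, |z| * η = |z * η| := fun z => by rw [abs_mul, abs_of_pos hη]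
      rw [h3]
      congr! 2
      field_simp
      ring
    have h4 : L x 0 ∈ Set.Icc h (h + 2) ↔ x 0 ∈ Set.Icc h (h + 2) := by rw [h0]
    exact and_congr (forall_congr' h2) h4
  have hm : Measurable fun x => ((mult Y x).card : ℝ≥0∞) ^ p :=
    measurable_comp_mult hYm fun X => (X.card : ℝ≥0∞) ^ p
  have hLm : Measurable L := L.continuous_of_finiteDimensional.measurable
  have h1 : lpEnergy p (fun i => slabTube δ h (a i) fun j => b j + η * w i j) =
      ∫⁻ x, ((mult Y (L x)).card : ℝ≥0∞) ^ p := by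
    refine lintegral_congr fun x => ?_
    congr 2
    refine congrArg Finset.card (Finset.ext fun i => ?_)
    rw [mem_mult, mem_mult, hmem]
  rw [h1, ← lintegral_map hm hLm, hmap, lintegral_smul_measure, det_shearMatrix, lpEnergy,
    smul_eq_mul]
  congr 2
  rw [inv_pow, inv_inv, abs_of_pos (by positivity)]

lemma energy_le_rpow_mul_energy {γ : Type*} [DecidableEq γ] {cap : ι → γ} {A : ℕ}
    {Y : ι → Set (Fin (d + 1) → ℝ)} (hY : ∀ i, MeasurableSet (Y i)) {p p' M : ℝ} (hp' : 0 ≤ p')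
    (hpp : p' ≤ p) (hM : (Fintype.card ι : ℝ) ≤ M) :
    energy cap p A Y ≤ ENNReal.ofReal (M ^ (p - p')) * energy cap p' A Y := by
  have hM0 : 0 ≤ M := le_trans (by positivity) hM
  have hm : Measurable fun x => (broad cap A (mult Y x) : ℝ≥0∞) ^ p' :=
    measurable_comp_mult hY fun X => (broad cap A X : ℝ≥0∞) ^ p'
  unfold energy
  rw [← lintegral_const_mul _ hm]
  refine lintegral_mono fun x => ?_
  have h1 : (broad cap A (mult Y x) : ℝ≥0∞) ≤ ENNReal.ofReal M := by
    rw [← ENNReal.ofReal_natCast]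
    refine ENNReal.ofReal_le_ofReal (le_trans ?_ hM)
    exact_mod_cast broad_le_card.trans (Finset.card_le_univ _)
  calc (broad cap A (mult Y x) : ℝ≥0∞) ^ p
      = (broad cap A (mult Y x) : ℝ≥0∞) ^ (p - p') * (broad cap A (mult Y x) : ℝ≥0∞) ^ p' := by
        rw [← ENNReal.rpow_add_of_nonneg _ _ (by linarith) hp']
        congr 1
        ring
    _ ≤ _ := by
        rw [← ENNReal.ofReal_rpow_of_nonneg hM0 (by linarith)]
        exact mul_le_mul_left (ENNReal.rpow_le_rpow h1 (by linarith)) _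

/-- The contributions of single caps are controlled by the estimate at a larger scale. -/
lemma lpEnergy_cap_le {p e C δ η c₀ h : ℝ} (hη : 0 < η) {ι : Type} [Fintype ι]
    {a v : ι → Fin d → ℝ} (hsep : ∀ i j, i ≠ j → c₀ * δ ≤ ‖v i - v j‖)
    (H : ∀ (ι : Type) [Fintype ι] (a v : ι → Fin d → ℝ), (∀ i j, |v i j| ≤ 1) →
      (∀ i j, i ≠ j → c₀ * (δ / η) ≤ ‖v i - v j‖) →
      lpEnergy p (fun i => slabTube (δ / η) h (a i) (v i)) ≤
        ENNReal.ofReal (C * (δ / η) ^ e * Fintype.card ι)) (c : Fin d → ℤ) :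
    lpEnergy p (fun i : {i // slopeCap η v i = c} => slabTube δ h (a i) (v i)) ≤
      ENNReal.ofReal (η ^ d * (C * (δ / η) ^ e) * Fintype.card {i // slopeCap η v i = c}) := by
  set b : Fin d → ℝ := fun j => η * c j with hb
  set w : {i // slopeCap η v i = c} → Fin d → ℝ := fun i j => v i j / η - c j with hw
  have hvw : ∀ i : {i // slopeCap η v i = c}, v i = fun j => b j + η * w i j := by
    intro i
    funext j
    simp only [hb, hw]
    field_simp
    ring
  have hfl : ∀ (i : {i // slopeCap η v i = c}) (j : Fin d), ⌊v i j / η⌋ = c j :=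
    fun i j => congrFun i.2 j
  have hw1 : ∀ i j, |w i j| ≤ 1 := by
    intro i j
    have h1 := Int.floor_le (v i j / η)
    have h2 := Int.lt_floor_add_one (v i j / η)
    rw [hfl] at h1 h2
    rw [abs_le]
    constructor <;> simp only [hw] <;> linarith
  have hwsep : ∀ i j, i ≠ j → c₀ * (δ / η) ≤ ‖w i - w j‖ := by
    intro i j hij
    have h1 : v i - v j = η • (w i - w j) := by
      funext l
      simp only [hw, Pi.sub_apply, Pi.smul_apply, smul_eq_mul]
      field_simp
      ring
    have h2 := hsep i j fun h => hij (Subtype.ext h)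
    rw [h1, norm_smul, Real.norm_of_nonneg hη.le] at h2
    rw [← mul_div_assoc, div_le_iff₀ hη]
    linarith
  have h1 : (fun i : {i // slopeCap η v i = c} => slabTube δ h (a i) (v i)) =
      fun i : {i // slopeCap η v i = c} => slabTube δ h (a i) fun j => b j + η * w i j := by
    funext i
    rw [← hvw]
  rw [h1, lpEnergy_slabTube_eq hη b (fun i : {i // slopeCap η v i = c} => a i) w,
    mul_assoc, ENNReal.ofReal_mul (by positivity)]
  exact mul_le_mul_right (H _ _ w hw1 hwsep) _

set_option maxHeartbeats 800000 in
/-- The linear estimate for separated families of tubes with bounded slopes. -/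
theorem exists_lpEnergy_le (hd : 1 ≤ d) {k : ℕ} (hk : 2 ≤ k) (hk' : k ≤ d + 1) {p c₀ ε : ℝ}
    (hp : 1 + levelExp d k ≤ p) (hp' : 1 ≤ ((d : ℝ) + 2 - k) * (p - 1)) (hc₀ : 0 < c₀)
    (hc₀1 : c₀ ≤ 1)
    (hε : 0 < ε) :
    ∃ C : ℝ, 0 < C ∧ ∀ (ι : Type) [Fintype ι] (a v : ι → Fin d → ℝ) (δ h : ℝ), 0 < δ → δ ≤ 1 →
      (∀ i j, |v i j| ≤ 1) → (∀ i j, i ≠ j → c₀ * δ ≤ ‖v i - v j‖) →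
      lpEnergy p (fun i => slabTube δ h (a i) (v i)) ≤
        ENNReal.ofReal (C * δ ^ (d + 1 - d * (p - 1) - ε) * Fintype.card ι) := by
  set q := levelExp d k with hq
  set e : ℝ := d + 1 - d * (p - 1) - ε with he
  have hq0 : 0 < q := levelExp_pos hd
  have hp1 : 1 ≤ p := by linarith
  obtain ⟨A, hA, HA⟩ := exists_energy_le hd hk hk' hc₀ hc₀1 hε
  have ht := one_le_tangentConst (d + 1)
  set C' : ℝ := (5 * tangentConst (d + 1)) ^ (k - 2) * 3 ^ d with hC'
  have hC'0 : 0 < C' := by positivity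
  obtain ⟨κ₀, hκ₀, hκ₀1, Hκ⟩ := exists_forall_mul_rpow_le_one
    (C := 2 * (2 ^ (p - 1) * (A * C') ^ (p - 1))) (by positivity) hε
  set η : ℝ := min κ₀ (1 / 2) with hη
  have hη0 : 0 < η := by positivity
  have hη1 : η ≤ 1 := (min_le_left _ _).trans hκ₀1
  have hη2 : η < 1 := (min_le_right _ _).trans_lt (by norm_num)
  have hηε := Hκ η hη0 (min_le_left _ _)
  obtain ⟨F, δ₁, hF, hδ₁, hδ₁1, HF⟩ := HA η hη0 hη1
  set δ₀ := min δ₁ η with hδ₀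
  have hδ₀0 : 0 < δ₀ := by positivity
  set M₀ : ℝ := (5 / c₀) ^ d with hM₀
  set G : ℝ := M₀ ^ (p - (1 + q)) * F with hG
  have hG0 : 0 < G := by positivity
  set T : ℝ := 2 / δ₀ * 2 ^ d * (M₀ * δ₀⁻¹ ^ d) ^ (p - 1) * (δ₀ ^ |e|)⁻¹ with hT
  have hT0 : 0 < T := by positivity
  set C : ℝ := 2 * 2 ^ (p - 1) * G + T with hC
  have hC0 : 0 < C := by positivity
  have hcard : ∀ (ι : Type) [Fintype ι] (v : ι → Fin d → ℝ) (δ : ℝ), 0 < δ → δ ≤ 1 →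
      (∀ i j, |v i j| ≤ 1) → (∀ i j, i ≠ j → c₀ * δ ≤ ‖v i - v j‖) →
      (Fintype.card ι : ℝ) ≤ M₀ * δ⁻¹ ^ d := by
    intro ι _ v δ hδ hδ1 hv hsep
    refine (card_le_of_separated hv (by positivity)
      (mul_le_one₀ hc₀1 hδ.le hδ1) hsep).trans (le_of_eq ?_)
    rw [hM₀, ← mul_pow]
    congr 1
    field_simp
  refine ⟨C, hC0, ?_⟩
  suffices H : ∀ (s : ℕ) (ι : Type) [Fintype ι] (a v : ι → Fin d → ℝ) (δ h : ℝ), η ^ s ≤ δ → δ ≤ 1 →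
      (∀ i j, |v i j| ≤ 1) → (∀ i j, i ≠ j → c₀ * δ ≤ ‖v i - v j‖) →
      lpEnergy p (fun i => slabTube δ h (a i) (v i)) ≤
        ENNReal.ofReal (C * δ ^ e * Fintype.card ι) by
    intro ι _ a v δ h hδ
    obtain ⟨s, hs⟩ := exists_pow_lt_of_lt_one hδ hη2
    exact H s ι a v δ h hs.le
  have large : ∀ (ι : Type) [Fintype ι] (a v : ι → Fin d → ℝ) (δ h : ℝ), δ₀ ≤ δ → δ ≤ 1 →
      (∀ i j, |v i j| ≤ 1) → (∀ i j, i ≠ j → c₀ * δ ≤ ‖v i - v j‖) →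
      lpEnergy p (fun i => slabTube δ h (a i) (v i)) ≤
        ENNReal.ofReal (C * δ ^ e * Fintype.card ι) := by
    intro ι _ a v δ h hδ₀δ hδ1 hv hsep
    have hδ : 0 < δ := hδ₀0.trans_le hδ₀δ
    have HS := shaded_slabTube a v δ h
    rw [lpEnergy_eq (slopeCap η v)]
    refine (energy_le_of_volume_le hp1 HS.measurableSet
      (HS.volume_le hδ zero_le_two)).trans (ENNReal.ofReal_le_ofReal ?_)
    have hact : ((active fun i => slabTube δ h (a i) (v i)).card : ℝ) ≤ Fintype.card ι := by
      exact_mod_cast Finset.card_le_univ _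
    have h1 : ((active fun i => slabTube δ h (a i) (v i)).card : ℝ) ^ p ≤
        Fintype.card ι * (M₀ * δ₀⁻¹ ^ d) ^ (p - 1) := by
      calc _ ≤ (Fintype.card ι : ℝ) ^ p := by gcongr
        _ = Fintype.card ι * (Fintype.card ι : ℝ) ^ (p - 1) := by
            conv_lhs => rw [show p = 1 + (p - 1) by ring,
              Real.rpow_add_of_nonneg (by positivity) zero_le_one (by linarith), Real.rpow_one]
        _ ≤ _ := by
            gcongr
            refine (hcard ι v δ hδ hδ1 hv hsep).trans ?_
            gcongr
    have h2 : δ₀ ^ |e| ≤ δ ^ e :=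
      (Real.rpow_le_rpow hδ₀0.le hδ₀δ (abs_nonneg e)).trans
        (Real.rpow_le_rpow_of_exponent_ge hδ hδ1 (le_abs_self e))
    have h3 : 2 / δ * (2 ^ d * δ ^ (d + 1)) ≤ 2 / δ₀ * 2 ^ d := by
      calc _ ≤ 2 / δ₀ * (2 ^ d * 1) := by
            gcongr
            exact pow_le_one₀ hδ.le hδ1
        _ = _ := by ring
    calc _ ≤ 2 / δ₀ * 2 ^ d * (Fintype.card ι * (M₀ * δ₀⁻¹ ^ d) ^ (p - 1)) := by gcongr
      _ = T * δ₀ ^ |e| * Fintype.card ι := by rw [hT]; field_simp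
      _ ≤ C * δ ^ e * Fintype.card ι := by
          gcongr
          exact le_add_of_nonneg_left (by positivity)
  intro s
  induction s with
  | zero =>
    intro ι _ a v δ h hs hδ1
    exact large ι a v δ h ((min_le_right _ _).trans (hη1.trans (by simpa using hs))) hδ1
  | succ s ih =>
    intro ι _ a v δ h hs hδ1 hv hsep
    rcases le_total δ₀ δ with hδδ | hδδ
    · exact large ι a v δ h hδδ hδ1 hv hsep
    have hδ : 0 < δ := lt_of_lt_of_le (by positivity) hs
    have hδη : δ / η ≤ 1 := (div_le_one hη0).2 (hδδ.trans (min_le_right _ _))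
    have hs' : η ^ s ≤ δ / η := by rwa [le_div_iff₀ hη0, ← pow_succ]
    have hcap := lpEnergy_cap_le (a := a) (h := h) hη0 hsep
      fun ι _ a v hv hsep => ih ι a v (δ / η) h hs' hδη hv hsep
    have HS := shaded_slabTube a v δ h
    have hc := hcard ι v δ hδ hδ1 hv hsep
    have hbroad : energy (slopeCap η v) p (A * capBudget d k η)
        (fun i => slabTube δ h (a i) (v i)) ≤ ENNReal.ofReal (G * δ ^ e * Fintype.card ι) := by
      refine (energy_le_rpow_mul_energy HS.measurableSet (p' := 1 + q) (by linarith) hp hc).trans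
        ((mul_le_mul_right (HF ι a v δ hv hδ (hδδ.trans (min_le_left _ _)) hsep _ h HS) _).trans
          (le_of_eq ?_))
      rw [← ENNReal.ofReal_mul (by positivity)]
      congr 1
      have e1 : (δ⁻¹ ^ d) ^ (p - (1 + q)) * δ ^ ((d : ℝ) + 1 - d * q - ε) = δ ^ e := by
        rw [← Real.rpow_natCast, ← Real.rpow_neg_one, ← Real.rpow_mul hδ.le, ← Real.rpow_mul hδ.le,
          ← Real.rpow_add hδ, he]
        congr 1
        ring
      rw [Real.mul_rpow (by positivity) (by positivity), ← e1, hG]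
      ring
    refine (lpEnergy_le_broad (slopeCap η v) hp1 (A * capBudget d k η) HS.measurableSet).trans ?_
    have hsum : ∑ c ∈ Finset.univ.image (slopeCap η v),
        (Fintype.card {i // slopeCap η v i = c} : ℝ) = Fintype.card ι := by
      have := Finset.card_eq_sum_card_fiberwise (s := (Finset.univ : Finset ι)) (f := slopeCap η v)
        (t := Finset.univ.image (slopeCap η v)) fun i hi => Finset.mem_image_of_mem _ hi
      rw [← Finset.card_univ, this]
      push_cast
      refine Finset.sum_congr rfl fun c _ => ?_
      rw [Fintype.card_subtype]
    have hnarrow : ∑ c ∈ Finset.univ.image (slopeCap η v),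
        lpEnergy p (fun i : {i // slopeCap η v i = c} => slabTube δ h (a i) (v i)) ≤
        ENNReal.ofReal (η ^ d * (C * (δ / η) ^ e) * Fintype.card ι) := by
      refine (Finset.sum_le_sum fun c _ => hcap c).trans (le_of_eq ?_)
      rw [← ENNReal.ofReal_sum_of_nonneg fun c _ => by positivity, ← Finset.mul_sum, hsum]
    refine (mul_le_mul_right (add_le_add hbroad (mul_le_mul_right hnarrow _)) _).trans ?_
    rw [← ENNReal.ofReal_natCast, ENNReal.ofReal_rpow_of_nonneg (by positivity) (by linarith),
      ← ENNReal.ofReal_mul (by positivity), ← ENNReal.ofReal_add (by positivity) (by positivity),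
      show (2 : ℝ≥0∞) = ENNReal.ofReal 2 by simp, ENNReal.ofReal_rpow_of_pos (by norm_num),
      ← ENNReal.ofReal_mul (by positivity)]
    refine ENNReal.ofReal_le_ofReal ?_
    have hAK : ((A * capBudget d k η : ℕ) : ℝ) ^ (p - 1) * (η ^ d * (δ / η) ^ e) ≤
        (A * C') ^ (p - 1) * η ^ ε * δ ^ e := by
      have h1 : ((A * capBudget d k η : ℕ) : ℝ) ≤ A * C' * η⁻¹ ^ (k - 2) := by
        push_cast
        rw [mul_assoc]
        gcongr
        exact capBudget_le hη0 hη1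
      have h2 : (η⁻¹ ^ (k - 2)) ^ (p - 1) * (η ^ d * (δ / η) ^ e) ≤ η ^ ε * δ ^ e := by
        have e1 : (η⁻¹ ^ (k - 2)) ^ (p - 1) = η ^ (-((k : ℝ) - 2) * (p - 1)) := by
          rw [← Real.rpow_natCast, ← Real.rpow_neg_one, ← Real.rpow_mul hη0.le,
            ← Real.rpow_mul hη0.le, Nat.cast_sub hk]
          congr 1
          push_cast
          ring
        rw [e1, Real.div_rpow hδ.le hη0.le, div_eq_mul_inv, ← Real.rpow_neg hη0.le,
          ← Real.rpow_natCast]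
        calc _ = (η ^ (-((k : ℝ) - 2) * (p - 1)) * η ^ (d : ℝ) * η ^ (-e)) * δ ^ e := by ring
          _ ≤ _ := by
            rw [← Real.rpow_add hη0, ← Real.rpow_add hη0]
            refine mul_le_mul_of_nonneg_right
              (Real.rpow_le_rpow_of_exponent_ge hη0 hη1 ?_) (by positivity)
            rw [he]
            nlinarith
      calc _ ≤ (A * C' * η⁻¹ ^ (k - 2)) ^ (p - 1) * (η ^ d * (δ / η) ^ e) := by gcongr
        _ = (A * C') ^ (p - 1) * ((η⁻¹ ^ (k - 2)) ^ (p - 1) * (η ^ d * (δ / η) ^ e)) := by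
            rw [Real.mul_rpow (by positivity) (by positivity)]; ring
        _ ≤ (A * C') ^ (p - 1) * (η ^ ε * δ ^ e) := by gcongr
        _ = _ := by ring
    set W : ℝ := δ ^ e * Fintype.card ι with hW
    have hW0 : 0 ≤ W := by positivity
    calc _ = 2 ^ (p - 1) * G * W + 2 ^ (p - 1) * C * (((A * capBudget d k η : ℕ) : ℝ) ^ (p - 1) *
          (η ^ d * (δ / η) ^ e)) * Fintype.card ι := by rw [hW]; ring
      _ ≤ 2 ^ (p - 1) * G * W + 2 ^ (p - 1) * C * ((A * C') ^ (p - 1) * η ^ ε * δ ^ e) *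
          Fintype.card ι := by gcongr
      _ = 2 ^ (p - 1) * G * W + C / 2 * W * (2 * (2 ^ (p - 1) * (A * C') ^ (p - 1)) * η ^ ε) := by
          rw [hW]; ring
      _ ≤ 2 ^ (p - 1) * G * W + C / 2 * W * 1 := by gcongr
      _ ≤ C * W := by
          have : 2 ^ (p - 1) * G ≤ C / 2 := by rw [hC]; linarith
          nlinarith
      _ = _ := by rw [hW]; ring

end Kakeya

end

section

open MeasureTheory
open scoped ENNReal

namespace Kakeya

section Energy

variable {ι E : Type*} [Fintype ι] [MeasureSpace E]

lemma lpEnergy_le_sum {κ : Type*} (S : Finset κ) {J : κ → Type*} [∀ k, Fintype (J k)] {p : ℝ}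
    {Y : ι → Set E} {Z : ∀ k, J k → Set E} (hZ : ∀ k j, MeasurableSet (Z k j)) (K : ℝ≥0∞)
    (h : ∀ x, ((mult Y x).card : ℝ≥0∞) ^ p ≤ K * ∑ k ∈ S, ((mult (Z k) x).card : ℝ≥0∞) ^ p) :
    lpEnergy p Y ≤ K * ∑ k ∈ S, lpEnergy p (Z k) := by
  have hm : ∀ k, Measurable fun x => ((mult (Z k) x).card : ℝ≥0∞) ^ p := fun k =>
    measurable_comp_mult (hZ k) fun X => (X.card : ℝ≥0∞) ^ p
  unfold lpEnergy
  rw [← lintegral_finsetSum _ fun k _ => hm k,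
    ← lintegral_const_mul _ (Finset.measurable_sum S fun k _ => hm k)]
  exact lintegral_mono h

lemma lpEnergy_le_card_mul_sum {κ : Type*} (S : Finset κ) {J : κ → Type*} [∀ k, Fintype (J k)]
    {p : ℝ} (hp : 1 ≤ p) {Y : ι → Set E} {Z : ∀ k, J k → Set E}
    (hZ : ∀ k j, MeasurableSet (Z k j))
    (h : ∀ x, (mult Y x).card ≤ ∑ k ∈ S, (mult (Z k) x).card) :
    lpEnergy p Y ≤ (S.card : ℝ≥0∞) ^ (p - 1) * ∑ k ∈ S, lpEnergy p (Z k) := by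
  refine lpEnergy_le_sum S hZ _ fun x => ?_
  refine le_trans ?_ (ENNReal.rpow_sum_le_const_mul_sum_rpow S _ hp)
  exact ENNReal.rpow_le_rpow (by exact_mod_cast h x) (by linarith)

lemma lpEnergy_mono {p : ℝ} (hp : 0 ≤ p) {Y Z : ι → Set E} (h : ∀ i, Y i ⊆ Z i) :
    lpEnergy p Y ≤ lpEnergy p Z := by
  refine lintegral_mono fun x => ENNReal.rpow_le_rpow ?_ hp
  refine Nat.cast_le.2 (Finset.card_le_card fun i hi => ?_)
  rw [mem_mult] at hi ⊢
  exact h i hi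

lemma lpEnergy_preimage {F : Type*} [MeasureSpace F] {p : ℝ} {f : E → F} (hf : MeasurePreserving f)
    {Y : ι → Set F} (hY : ∀ i, MeasurableSet (Y i)) :
    lpEnergy p (fun i => f ⁻¹' Y i) = lpEnergy p Y := by
  unfold lpEnergy
  rw [← hf.lintegral_comp (measurable_comp_mult hY fun X => (X.card : ℝ≥0∞) ^ p)]
  rfl

end Energy

variable {d : ℕ}

/-- An `L^p` bound for all families of tubes of radius `δ` with `s`-separated slopes over
intervals of heights of length two. -/
def SlabBound (d : ℕ) (p δ s K : ℝ) : Prop :=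
  ∀ (ι : Type) [Fintype ι] (a v : ι → Fin d → ℝ) (h : ℝ), (∀ i j, |v i j| ≤ 1) →
    (∀ i j, i ≠ j → s ≤ ‖v i - v j‖) →
    lpEnergy p (fun i => slabTube δ h (a i) (v i)) ≤ ENNReal.ofReal (K * Fintype.card ι)

/-- The part of a tube at heights within `3 / 2` of `t`. -/
def heightTube (δ t : ℝ) (a v : Fin d → ℝ) : Set (Fin (d + 1) → ℝ) :=
  gtube δ a v ∩ {x | |x 0 - t| ≤ 3 / 2}

lemma measurableSet_heightTube (δ t : ℝ) (a v : Fin d → ℝ) :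
    MeasurableSet (heightTube δ t a v) := by
  refine (measurableSet_gtube δ a v).inter ?_
  have : Measurable fun x : Fin (d + 1) → ℝ => |x 0 - t| :=
    Continuous.measurable (by fun_prop)
  exact measurableSet_le this measurable_const

lemma SlabBound.heightTube_le {p δ s K : ℝ} (H : SlabBound d p δ s K) (hp : 1 ≤ p) (hK : 0 ≤ K)
    {ι : Type} [Fintype ι] {a v : ι → Fin d → ℝ} (t : ι → ℝ) (hv : ∀ i j, |v i j| ≤ 1)
    (hs : ∀ i j, i ≠ j → s ≤ ‖v i - v j‖) :
    lpEnergy p (fun i => heightTube δ (t i) (a i) (v i)) ≤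
      ENNReal.ofReal (3 * K * Fintype.card ι) := by
  classical
  set J : ι → Finset ℤ := fun i => Finset.Icc (⌊t i / 2⌋ - 1) (⌊t i / 2⌋ + 1) with hJ
  set S : Finset ℤ := Finset.univ.biUnion J with hS
  have key : ∀ i (x : Fin (d + 1) → ℝ), |x 0 - t i| ≤ 3 / 2 → ⌊x 0 / 2⌋ ∈ J i := by
    intro i x hx
    rw [abs_le] at hx
    rw [hJ, Finset.mem_Icc]
    constructor
    · rw [Int.le_floor]
      push_cast
      linarith [Int.floor_le (t i / 2), hx.1]
    · rw [← Int.lt_add_one_iff, Int.floor_lt]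
      push_cast
      linarith [Int.lt_floor_add_one (t i / 2), hx.2]
  have h1 := lpEnergy_le_sum (p := p) (Y := fun i => heightTube δ (t i) (a i) (v i)) S
    (J := fun z => {i // z ∈ J i})
    (Z := fun z i => slabTube δ (2 * z) (a i) (v i)) (fun _ _ => measurableSet_slabTube _ _ _ _) 1
    fun x => by
      rw [one_mul]
      by_cases hx : ⌊x 0 / 2⌋ ∈ S
      · refine le_trans ?_ (Finset.single_le_sum (fun _ _ => zero_le) hx)
        refine ENNReal.rpow_le_rpow ?_ (by linarith)
        rw [Nat.cast_le]
        rw [card_mult_subtype (fun i => slabTube δ (2 * ⌊x 0 / 2⌋) (a i) (v i))]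
        refine Finset.card_le_card fun i hi => ?_
        rw [mem_mult] at hi
        rw [Finset.mem_filter, mem_mult]
        refine ⟨⟨hi.1, ?_⟩, key i x hi.2⟩
        constructor
        · linarith [Int.floor_le (x 0 / 2)]
        · linarith [Int.lt_floor_add_one (x 0 / 2)]
      · have : mult (fun i => heightTube δ (t i) (a i) (v i)) x = ∅ := by
          refine Finset.eq_empty_of_forall_notMem fun i hi => hx ?_
          rw [mem_mult] at hi
          exact Finset.mem_biUnion.2 ⟨i, Finset.mem_univ _, key i x hi.2⟩
        rw [this, Finset.card_empty, Nat.cast_zero, ENNReal.zero_rpow_of_pos (by linarith)]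
        exact zero_le
  rw [one_mul] at h1
  refine h1.trans ?_
  calc _ ≤ ∑ z ∈ S, ENNReal.ofReal (K * Fintype.card {i // z ∈ J i}) := by
        refine Finset.sum_le_sum fun z _ => H _ _ _ _ (fun i j => hv i j) fun i j hij => ?_
        exact hs i j fun h => hij (Subtype.ext h)
    _ = ENNReal.ofReal (∑ z ∈ S, K * Fintype.card {i // z ∈ J i}) := by
        rw [ENNReal.ofReal_sum_of_nonneg fun _ _ => by positivity]
    _ ≤ _ := by
        refine ENNReal.ofReal_le_ofReal ?_
        rw [← Finset.mul_sum]
        have : ∑ z ∈ S, Fintype.card {i // z ∈ J i} = 3 * Fintype.card ι := by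
          simp_rw [Fintype.card_subtype]
          have := Finset.sum_card_bipartiteAbove_eq_sum_card_bipartiteBelow (s := S)
            (t := (Finset.univ : Finset ι)) fun z i => z ∈ J i
          simp only [Finset.bipartiteAbove, Finset.bipartiteBelow] at this
          rw [this]
          have h3 : ∀ i, (S.filter fun z => z ∈ J i) = J i := fun i => by
            rw [Finset.filter_mem_eq_inter]
            exact Finset.inter_eq_right.2 (Finset.subset_biUnion_of_mem J (Finset.mem_univ i))
          simp only [h3]
          have h4 : ∀ i, (J i).card = 3 := fun i => by
            simp only [hJ, Int.card_Icc]
            omega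
          simp [h4, mul_comm]
        rw [← Nat.cast_sum, this]
        push_cast
        linarith

lemma SlabBound.heightTube_two_mul_le {p δ s K : ℝ} (H : SlabBound d p δ s K) (hp : 1 ≤ p)
    (hK : 0 ≤ K) {ι : Type} [Fintype ι] {a v : ι → Fin d → ℝ} (t : ι → ℝ)
    (hv : ∀ i j, |v i j| ≤ 1) (hs : ∀ i j, i ≠ j → s ≤ ‖v i - v j‖) :
    lpEnergy p (fun i => heightTube (2 * δ) (t i) (a i) (v i)) ≤
      ENNReal.ofReal (((2 : ℝ) ^ d) ^ p * (3 * K * Fintype.card ι)) := by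
  classical
  set b : (Fin d → Bool) → ι → Fin d → ℝ := fun σ i j => a i j + (if σ j then δ else -δ) with hb
  have h1 := lpEnergy_le_card_mul_sum (Y := fun i => heightTube (2 * δ) (t i) (a i) (v i))
    (Finset.univ : Finset (Fin d → Bool)) (J := fun _ => ι)
    (Z := fun σ i => heightTube δ (t i) (b σ i) (v i)) hp
    (fun _ _ => measurableSet_heightTube _ _ _ _) fun x => by
      refine le_trans (Finset.card_le_card ?_) Finset.card_biUnion_le
      intro i hi
      rw [mem_mult] at hi
      refine Finset.mem_biUnion.2 ⟨fun j => decide (0 ≤ x j.succ - (a i j + x 0 * v i j)),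
        Finset.mem_univ _, ?_⟩
      rw [mem_mult]
      refine ⟨fun j => ?_, hi.2⟩
      have h := abs_le.1 (hi.1 j)
      simp only [hb]
      by_cases hj : 0 ≤ x j.succ - (a i j + x 0 * v i j)
      · simp only [hj, decide_true, if_true]
        exact abs_le.2 ⟨by linarith, by linarith⟩
      · simp only [hj, decide_false, Bool.false_eq_true, if_false]
        rw [not_le] at hj
        exact abs_le.2 ⟨by linarith, by linarith⟩
  refine h1.trans ?_
  calc _ ≤ ((Finset.univ : Finset (Fin d → Bool)).card : ℝ≥0∞) ^ (p - 1) *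
        ∑ _σ : Fin d → Bool, ENNReal.ofReal (3 * K * Fintype.card ι) := by
        refine mul_le_mul_right (Finset.sum_le_sum fun σ _ => ?_) _
        exact H.heightTube_le hp hK t hv hs
    _ = _ := by
        have h2 : (Finset.univ : Finset (Fin d → Bool)).card = 2 ^ d := by simp
        rw [Finset.sum_const, h2, nsmul_eq_mul, ← mul_assoc]
        have h3 : ((2 ^ d : ℕ) : ℝ≥0∞) = ENNReal.ofReal (2 ^ d) := by
          rw [← ENNReal.ofReal_natCast]
          push_cast
          rfl
        rw [h3, ENNReal.ofReal_rpow_of_pos (by positivity), ← ENNReal.ofReal_mul (by positivity),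
          ← ENNReal.ofReal_mul (by positivity)]
        congr 2
        conv_rhs => rw [show p = (p - 1) + 1 by ring]
        rw [Real.rpow_add_one (by positivity)]

end Kakeya

end

section

namespace Kakeya

section Geometry

variable {n : ℕ}

lemma preimage_tube (L : Esp n ≃ₗᵢ[ℝ] Esp n) (δ : ℝ) (a v : Esp n) :
    L ⁻¹' tube n δ (L a) (L v) = tube n δ a v := by
  ext x
  have h : ∀ u w : Esp n, L u - L w = L (u - w) := fun u w => (map_sub L u w).symm
  change (|⟪L x - L a, L v⟫| ≤ 1 / 2 ∧ ‖(L x - L a) - ⟪L x - L a, L v⟫ • L v‖ ≤ δ) ↔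
    (|⟪x - a, v⟫| ≤ 1 / 2 ∧ ‖(x - a) - ⟪x - a, v⟫ • v‖ ≤ δ)
  rw [h, L.inner_map_map, ← map_smul, h, L.norm_map]

lemma norm_le_card_mul (x : Esp n) {r : ℝ} (hr : 0 ≤ r) (h : ∀ j, |x j| ≤ r) : ‖x‖ ≤ n * r := by
  rw [EuclideanSpace.norm_eq]
  refine Real.sqrt_le_iff.2 ⟨by positivity, ?_⟩
  calc ∑ j, ‖x j‖ ^ 2 ≤ ∑ _j : Fin n, r ^ 2 := by
        refine Finset.sum_le_sum fun j _ => ?_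
        rw [Real.norm_eq_abs]
        gcongr
        exact h j
    _ = n * r ^ 2 := by simp
    _ ≤ (n * r) ^ 2 := by
        rw [mul_pow]
        gcongr
        exact_mod_cast Nat.le_self_pow two_ne_zero n

lemma abs_apply_le_norm (x : Esp n) (j : Fin n) : |x j| ≤ ‖x‖ := by
  simpa using PiLp.norm_apply_le x j

/-- Dehomogenizing unit vectors with respect to a positive or negative multiple is bi-Lipschitz. -/
lemma norm_sub_le_two_mul {E : Type*} [NormedAddCommGroup E] [NormedSpace ℝ E] {v w : E}
    (hv : ‖v‖ = 1) (hw : ‖w‖ = 1) {s t : ℝ} (hs : s ≠ 0) (ht : t ≠ 0) (hst : 0 ≤ s ↔ 0 ≤ t)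
    (hs1 : |s| ≤ 1) : ‖v - w‖ ≤ 2 * ‖s⁻¹ • v - t⁻¹ • w‖ := by
  set V := s⁻¹ • v with hV
  set W := t⁻¹ • w with hW
  have hv' : v = s • V := by rw [hV, smul_inv_smul₀ hs]
  have hw' : w = t • W := by rw [hW, smul_inv_smul₀ ht]
  have hsV : |s| * ‖V‖ = 1 := by rw [← Real.norm_eq_abs, ← norm_smul, ← hv', hv]
  have htW : |t| * ‖W‖ = 1 := by rw [← Real.norm_eq_abs, ← norm_smul, ← hw', hw]
  have habs : |s - t| = |(|s| - |t|)| := by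
    by_cases h : 0 ≤ s
    · rw [abs_of_nonneg h, abs_of_nonneg (hst.1 h)]
    · have h' : ¬ 0 ≤ t := fun h'' => h (hst.2 h'')
      rw [abs_of_neg (not_le.1 h), abs_of_neg (not_le.1 h'), ← abs_neg]
      congr 1
      ring
  have h2 : |s - t| * ‖W‖ ≤ ‖V - W‖ := by
    have : |s - t| * ‖W‖ = |s| * |‖W‖ - ‖V‖| := by
      rw [habs, ← abs_of_nonneg (norm_nonneg W), ← abs_mul, ← abs_of_nonneg (abs_nonneg s),
        ← abs_mul, abs_of_nonneg (norm_nonneg W), abs_of_nonneg (abs_nonneg s)]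
      congr 1
      linarith
    rw [this]
    calc _ ≤ 1 * ‖V - W‖ := by
          gcongr
          rw [abs_sub_comm]
          exact abs_norm_sub_norm_le V W
      _ = _ := one_mul _
  calc ‖v - w‖ = ‖s • (V - W) + (s - t) • W‖ := by
        rw [hv', hw', smul_sub, sub_smul]
        congr 1
        abel
    _ ≤ |s| * ‖V - W‖ + |s - t| * ‖W‖ := by
        refine (norm_add_le _ _).trans ?_
        rw [norm_smul, norm_smul, Real.norm_eq_abs, Real.norm_eq_abs]
    _ ≤ 1 * ‖V - W‖ + ‖V - W‖ := by gcongr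
    _ = _ := by ring

end Geometry

variable {d : ℕ}

/-- The slope of a direction with respect to the first coordinate. -/
def slope (v : Esp (d + 1)) : Fin d → ℝ := fun j => v j.succ / v 0

/-- The position at height zero of a line. -/
def foot (a v : Esp (d + 1)) : Fin d → ℝ := fun j => a j.succ - a 0 * slope v j

lemma abs_slope_le {v : Esp (d + 1)} (hv : ∀ j, |v j| ≤ |v 0|) (j : Fin d) : |slope v j| ≤ 1 := by
  rw [slope, abs_div]
  exact div_le_one_of_le₀ (hv _) (abs_nonneg _)

lemma zero_ne_of_forall_abs_le {v : Esp (d + 1)} (h1 : ‖v‖ = 1) (hv : ∀ j, |v j| ≤ |v 0|) :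
    v 0 ≠ 0 := by
  intro h
  have : v = 0 := by
    ext j
    have := hv j
    rw [h, abs_zero] at this
    simpa using abs_nonpos_iff.1 this
  rw [this, norm_zero] at h1
  exact zero_ne_one h1

lemma le_norm_slope_sub {v w : Esp (d + 1)} (hv1 : ‖v‖ = 1) (hw1 : ‖w‖ = 1)
    (hv : ∀ j, |v j| ≤ |v 0|) (hw : ∀ j, |w j| ≤ |w 0|) (hvw : 0 ≤ v 0 ↔ 0 ≤ w 0) {δ : ℝ}
    (hδ : δ ≤ ‖v - w‖) : 1 / (2 * (d + 1)) * δ ≤ ‖slope v - slope w‖ := by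
  have hv0 := zero_ne_of_forall_abs_le hv1 hv
  have hw0 := zero_ne_of_forall_abs_le hw1 hw
  have h1 := norm_sub_le_two_mul hv1 hw1 hv0 hw0 hvw (hv1 ▸ abs_apply_le_norm v 0)
  have h2 : ‖(v 0)⁻¹ • v - (w 0)⁻¹ • w‖ ≤ ((d + 1 : ℕ) : ℝ) * ‖slope v - slope w‖ := by
    refine norm_le_card_mul _ (norm_nonneg _) fun j => ?_
    cases j using Fin.cases with
    | zero => simp [hv0, hw0]
    | succ j =>
      have := norm_le_pi_norm (slope v - slope w) j
      rw [Real.norm_eq_abs] at this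
      refine le_of_eq_of_le ?_ this
      simp [slope, div_eq_inv_mul]
  push_cast at h2
  rw [one_div, inv_mul_le_iff₀ (by positivity)]
  linarith

lemma tube_subset {v : Esp (d + 1)} (hv1 : ‖v‖ = 1) (hv : ∀ j, |v j| ≤ |v 0|) {δ : ℝ}
    (hδ1 : δ ≤ 1) (a : Esp (d + 1)) :
    tube (d + 1) δ a v ⊆ WithLp.ofLp ⁻¹' heightTube (2 * δ) (a 0) (foot a v) (slope v) := by
  rintro x ⟨h1, h2⟩
  have hv0 := zero_ne_of_forall_abs_le hv1 hv
  set c := ⟪x - a, v⟫ with hc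
  set u := (x - a) - c • v with hu
  have hx : ∀ j, x j = a j + c * v j + u j := fun j => by
    simp [hu]
  have hu' : ∀ j, |u j| ≤ δ := fun j => (abs_apply_le_norm u j).trans h2
  have hvle : ∀ j, |v j| ≤ 1 := fun j => hv1 ▸ abs_apply_le_norm v j
  refine ⟨fun j => ?_, ?_⟩
  · have : x j.succ - (foot a v j + x 0 * slope v j) = u j.succ - u 0 * slope v j := by
      rw [foot, hx, hx 0, slope]
      field_simp
      ring
    change |x j.succ - (foot a v j + x 0 * slope v j)| ≤ 2 * δ
    rw [this]
    calc _ ≤ |u j.succ| + |u 0| * |slope v j| := by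
          rw [← abs_mul]
          exact abs_sub _ _
      _ ≤ δ + δ * 1 := by
          have h0 := (abs_nonneg (u 0)).trans (hu' 0)
          gcongr
          exacts [hu' _, hu' _, abs_slope_le hv j]
      _ = _ := by ring
  · change |x 0 - a 0| ≤ 3 / 2
    have : x 0 - a 0 = c * v 0 + u 0 := by rw [hx 0]; ring
    rw [this]
    calc _ ≤ |c| * |v 0| + |u 0| := by
          rw [← abs_mul]
          exact abs_add_le _ _
      _ ≤ 1 / 2 * 1 + 1 := by
          gcongr
          exacts [hvle 0, (hu' 0).trans hδ1]
      _ = _ := by norm_num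

lemma measurableSet_tube (n : ℕ) (δ : ℝ) (a v : Esp n) : MeasurableSet (tube n δ a v) := by
  have h1 : Continuous fun x : Esp n => |⟪x - a, v⟫| := by fun_prop
  have h2 : Continuous fun x : Esp n => ‖(x - a) - ⟪x - a, v⟫ • v‖ := by fun_prop
  exact ((isClosed_le h1 continuous_const).inter (isClosed_le h2 continuous_const)).measurableSet

lemma le_volume_tube {v : Esp (d + 1)} (hv : ‖v‖ = 1) (a : Esp (d + 1)) {δ : ℝ} (hδ : 0 < δ) :
    ENNReal.ofReal ((1 / (d + 1)) ^ d * δ ^ d) ≤ volume (tube (d + 1) δ a v) := by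
  set e : Esp (d + 1) := EuclideanSpace.single 0 1 with he
  have he1 : ‖v‖ = ‖e‖ := by rw [hv, he]; simp
  set L : Esp (d + 1) ≃ₗᵢ[ℝ] Esp (d + 1) := (ℝ ∙ (v - e))ᗮ.reflection with hL
  have hLv : L v = e := Submodule.reflection_sub he1
  rw [← preimage_tube L, hLv, L.measurePreserving.measure_preimage
    (measurableSet_tube _ _ _ _).nullMeasurableSet]
  set b := L a
  set r : ℝ := δ / (d + 1) with hr
  have hr0 : 0 < r := by positivity
  set lo : Fin (d + 1) → ℝ := Fin.cons (b 0 - 1 / 2) fun j => b j.succ - r with hlo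
  set hi : Fin (d + 1) → ℝ := Fin.cons (b 0 + 1 / 2) fun j => b j.succ + r with hhi
  have hsub : WithLp.ofLp ⁻¹' Set.Icc lo hi ⊆ tube (d + 1) δ b e := by
    rintro x ⟨h1, h2⟩
    have hin : ⟪x - b, e⟫ = x 0 - b 0 := by
      rw [he, EuclideanSpace.inner_single_right]
      simp
    have h10 := h1 0
    have h20 := h2 0
    simp only [hlo, hhi, Fin.cons_zero] at h10 h20
    refine ⟨?_, ?_⟩
    · rw [hin]
      exact abs_le.2 ⟨by linarith, by linarith⟩
    · rw [hin]
      refine (norm_le_card_mul _ hr0.le fun j => ?_).trans_eq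
        (by rw [hr]; push_cast; field_simp)
      cases j using Fin.cases with
      | zero => simp [he, hr0.le]
      | succ j =>
        have h1j := h1 j.succ
        have h2j := h2 j.succ
        simp only [hlo, hhi, Fin.cons_succ] at h1j h2j
        simp only [he, PiLp.sub_apply, PiLp.smul_apply, PiLp.single_apply, smul_eq_mul]
        simp only [Fin.succ_ne_zero, if_false, mul_zero, sub_zero]
        exact abs_le.2 ⟨by linarith, by linarith⟩
  refine le_trans ?_ (measure_mono hsub)
  rw [(PiLp.volume_preserving_ofLp (Fin (d + 1))).measure_preimage
    measurableSet_Icc.nullMeasurableSet, Real.volume_Icc_pi, Fin.prod_univ_succ]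
  simp only [hlo, hhi, Fin.cons_zero, Fin.cons_succ]
  have e1 : ∀ j : Fin d, b j.succ + r - (b j.succ - r) = 2 * r := fun j => by ring
  have e2 : b 0 + 1 / 2 - (b 0 - 1 / 2) = 1 := by ring
  simp only [e1, e2, ENNReal.ofReal_one, one_mul, Finset.prod_const, Finset.card_univ,
    Fintype.card_fin]
  rw [← ENNReal.ofReal_pow (by positivity), ← mul_pow]
  refine ENNReal.ofReal_le_ofReal ?_
  refine pow_le_pow_left₀ (by positivity) ?_ _
  rw [one_div_mul_eq_div, ← hr]
  linarith

end Kakeya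

end

section

namespace Kakeya

variable {d : ℕ}

lemma SlabBound.tube_chart_le {p δ K : ℝ} (H : SlabBound d p δ (1 / (2 * (d + 1)) * δ) K)
    (hp : 1 ≤ p) (hK : 0 ≤ K) (hδ1 : δ ≤ 1) {ι : Type} [Fintype ι] {a v : ι → Esp (d + 1)}
    (hv1 : ∀ i, ‖v i‖ = 1) (hs : ∀ i j, i ≠ j → δ ≤ ‖v i - v j‖) (c : Fin (d + 1))
    (hc : ∀ i j, |v i j| ≤ |v i c|) (hsign : ∀ i j, 0 ≤ v i c ↔ 0 ≤ v j c) :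
    lpEnergy p (fun i => tube (d + 1) δ (a i) (v i)) ≤
      ENNReal.ofReal (((2 : ℝ) ^ d) ^ p * (3 * K * Fintype.card ι)) := by
  set L : Esp (d + 1) ≃ₗᵢ[ℝ] Esp (d + 1) :=
    LinearIsometryEquiv.piLpCongrLeft 2 ℝ ℝ (Equiv.swap 0 c) with hL
  have hLa : ∀ (u : Esp (d + 1)) j, L u j = u (Equiv.swap 0 c j) := fun u j => by
    simp [hL, LinearIsometryEquiv.piLpCongrLeft_apply, Equiv.piCongrLeft'_apply]
  have hL0 : ∀ u : Esp (d + 1), L u 0 = u c := fun u => by rw [hLa, Equiv.swap_apply_left]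
  have hw1 : ∀ i, ‖L (v i)‖ = 1 := fun i => by rw [L.norm_map, hv1]
  have hw : ∀ i j, |L (v i) j| ≤ |L (v i) 0| := fun i j => by
    rw [hL0, hLa]
    exact hc _ _
  have hmp : MeasurePreserving fun x : Esp (d + 1) => WithLp.ofLp (L x) :=
    (PiLp.volume_preserving_ofLp (Fin (d + 1))).comp L.measurePreserving
  calc _ ≤ lpEnergy p (fun i => (fun x : Esp (d + 1) => WithLp.ofLp (L x)) ⁻¹'
        heightTube (2 * δ) (L (a i) 0) (foot (L (a i)) (L (v i))) (slope (L (v i)))) := by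
        refine lpEnergy_mono (by linarith) fun i => ?_
        rw [← preimage_tube L]
        exact Set.preimage_mono (tube_subset (hw1 i) (hw i) hδ1 (L (a i)))
    _ = lpEnergy p (fun i =>
        heightTube (2 * δ) (L (a i) 0) (foot (L (a i)) (L (v i))) (slope (L (v i)))) :=
        lpEnergy_preimage hmp fun i => measurableSet_heightTube _ _ _ _
    _ ≤ _ := by
        refine H.heightTube_two_mul_le hp hK _ (fun i j => abs_slope_le (hw i) j) fun i j hij => ?_
        refine le_norm_slope_sub (hw1 i) (hw1 j) (hw i) (hw j) ?_ ?_
        · rw [hL0, hL0]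
          exact hsign i j
        · rw [← map_sub, L.norm_map]
          exact hs i j hij

lemma SlabBound.tube_le {p δ K : ℝ} (H : SlabBound d p δ (1 / (2 * (d + 1)) * δ) K)
    (hp : 1 ≤ p) (hK : 0 ≤ K) (hδ1 : δ ≤ 1) {ι : Type} [Fintype ι] {a v : ι → Esp (d + 1)}
    (hv1 : ∀ i, ‖v i‖ = 1) (hs : ∀ i j, i ≠ j → δ ≤ ‖v i - v j‖) :
    lpEnergy p (fun i => tube (d + 1) δ (a i) (v i)) ≤
      ENNReal.ofReal (((d + 1 : ℝ) * 2) ^ p * (((2 : ℝ) ^ d) ^ p * (3 * K * Fintype.card ι))) := by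
  classical
  have hmax : ∀ i, ∃ c, ∀ j, |v i j| ≤ |v i c| := fun i => by
    obtain ⟨c, -, hc⟩ := Finset.exists_max_image Finset.univ (fun j => |v i j|) Finset.univ_nonempty
    exact ⟨c, fun j => hc j (Finset.mem_univ j)⟩
  choose c hc using hmax
  set cls : ι → Fin (d + 1) × Bool := fun i => (c i, decide (0 ≤ v i (c i))) with hcls
  have h1 := lpEnergy_le_card_mul_sum (Y := fun i => tube (d + 1) δ (a i) (v i))
    (Finset.univ : Finset (Fin (d + 1) × Bool)) (J := fun κ => {i // cls i = κ})
    (Z := fun κ i => tube (d + 1) δ (a i) (v i)) hp (fun _ _ => measurableSet_tube _ _ _ _)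
    fun x => by
      rw [Finset.card_eq_sum_card_fiberwise (f := cls) fun _ _ => Finset.mem_univ _]
      refine Finset.sum_le_sum fun κ _ => ?_
      rw [card_mult_subtype fun i => tube (d + 1) δ (a i) (v i)]
  refine h1.trans ?_
  set B : ℝ := ((2 : ℝ) ^ d) ^ p * (3 * K * Fintype.card ι) with hB
  have hB0 : 0 ≤ B := by positivity
  calc _ ≤ ((Finset.univ : Finset (Fin (d + 1) × Bool)).card : ℝ≥0∞) ^ (p - 1) *
        ∑ _κ : Fin (d + 1) × Bool, ENNReal.ofReal B := by
        refine mul_le_mul_right (Finset.sum_le_sum fun κ _ => ?_) _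
        have hcκ : ∀ i : {i // cls i = κ}, c i = κ.1 := fun i => congrArg Prod.fst i.2
        have hbκ : ∀ i : {i // cls i = κ}, decide (0 ≤ v i (c i)) = κ.2 :=
          fun i => congrArg Prod.snd i.2
        have hmax : ∀ (i : {i // cls i = κ}) j, |v i j| ≤ |v i κ.1| := fun i j => by
          rw [← hcκ i]
          exact hc i j
        refine (H.tube_chart_le (a := fun i : {i // cls i = κ} => a i)
          (v := fun i : {i // cls i = κ} => v i) hp hK hδ1 (fun i => hv1 i) (fun i j hij =>
            hs i j fun h => hij (Subtype.ext h)) κ.1 hmax fun i j => ?_).trans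
          (ENNReal.ofReal_le_ofReal ?_)
        · have hi := hbκ i
          have hj := hbκ j
          rw [hcκ] at hi hj
          rw [← decide_eq_decide, hi, hj]
        · rw [hB]
          gcongr
          exact Fintype.card_subtype_le _
    _ = _ := by
        have h2 : (Finset.univ : Finset (Fin (d + 1) × Bool)).card = (d + 1) * 2 := by simp
        rw [Finset.sum_const, h2, nsmul_eq_mul, ← mul_assoc]
        have h3 : (((d + 1) * 2 : ℕ) : ℝ≥0∞) = ENNReal.ofReal ((d + 1) * 2) := by
          rw [← ENNReal.ofReal_natCast]
          push_cast
          rfl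
        rw [h3, ENNReal.ofReal_rpow_of_pos (by positivity), ← ENNReal.ofReal_mul (by positivity),
          ← ENNReal.ofReal_mul (by positivity)]
        congr 2
        conv_rhs => rw [show p = (p - 1) + 1 by ring]
        rw [Real.rpow_add_one (by positivity)]

lemma eLpNorm_sum_indicator {E ι : Type*} [MeasureSpace E] [Fintype ι] {p : ℝ} (hp : 0 < p)
    (Y : ι → Set E) :
    eLpNorm (fun x => ∑ i, Set.indicator (Y i) (fun _ => (1 : ℝ)) x) (ENNReal.ofReal p) volume =
      lpEnergy p Y ^ (1 / p) := by
  classical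
  rw [eLpNorm_eq_lintegral_rpow_enorm_toReal (by simpa using hp) ENNReal.ofReal_ne_top,
    ENNReal.toReal_ofReal hp.le]
  congr 1
  refine lintegral_congr fun x => ?_
  congr 1
  have : ∑ i, Set.indicator (Y i) (fun _ => (1 : ℝ)) x = ((mult Y x).card : ℝ) := by
    simp only [Set.indicator_apply]
    rw [Finset.sum_boole]
    congr 2
  rw [this, Real.enorm_eq_ofReal (by positivity), ENNReal.ofReal_natCast]

/-- Passing from an energy bound in terms of the number of tubes to one in terms of volumes. -/
lemma card_mul_le_sum_volume {δ B : ℝ} (hδ : 0 < δ) (hB : 0 ≤ B) {m : ℕ}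
    {a v : Fin m → Esp (d + 1)} (hv1 : ∀ i, ‖v i‖ = 1) :
    ENNReal.ofReal (B * m) ≤ ENNReal.ofReal (B * (d + 1) ^ d * δ ^ (-(d : ℝ))) *
      ∑ i, volume (tube (d + 1) δ (a i) (v i)) := by
  calc _ = ENNReal.ofReal (B * (d + 1) ^ d * δ ^ (-(d : ℝ))) *
        ∑ _i : Fin m, ENNReal.ofReal ((1 / (d + 1)) ^ d * δ ^ d) := by
        rw [Finset.sum_const, Finset.card_univ, Fintype.card_fin, nsmul_eq_mul,
          ← ENNReal.ofReal_natCast, ← ENNReal.ofReal_mul (by positivity),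
          ← ENNReal.ofReal_mul (by positivity)]
        congr 1
        rw [Real.rpow_neg hδ.le, Real.rpow_natCast, one_div, inv_pow]
        field_simp
    _ ≤ _ := by
        gcongr with i
        exact le_volume_tube (hv1 i) (a i) hδ

end Kakeya

end

/-- Theorem 1.5 (linear Kakeya maximal estimate): for `n ≥ 2` and `p ≥ p_n`, where
`p_n = 1 + (1/(n−1))·min_{2 ≤ k ≤ n} max{(n/(n−1))^{n−k}, (n−1)/(n−k+1)}`, for every
`ε > 0` there is `C > 0` such that for every `0 < δ < 1` and every direction-separated
family of δ-tubes, `‖Σ_T χ_T‖_{L^p} ≤ C δ^{−(n−1−n/p)−ε} (Σ_T |T|)^{1/p}`. -/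
theorem statement0 (n : ℕ) (hn : 2 ≤ n) (p : ℝ)
    (hp : 1 + 1 / ((n : ℝ) - 1) *
        (Finset.Icc 2 n).inf' (Finset.nonempty_Icc.mpr hn)
          (fun k => max (((n : ℝ) / ((n : ℝ) - 1)) ^ (n - k))
            (((n : ℝ) - 1) / ((n : ℝ) - (k : ℝ) + 1))) ≤ p)
    (ε : ℝ) (hε : 0 < ε) :
    ∃ C : ℝ, 0 < C ∧ ∀ (δ : ℝ), 0 < δ → δ < 1 →
      ∀ (m : ℕ) (a v : Fin m → Esp n),
        (∀ i, ‖v i‖ = 1) →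
        (∀ i j, i ≠ j → δ ≤ ‖v i - v j‖) →
        eLpNorm (fun x => ∑ i, Set.indicator (tube n δ (a i) (v i)) (fun _ => (1 : ℝ)) x)
            (ENNReal.ofReal p) volume ≤
          ENNReal.ofReal (C * δ ^ (-((n : ℝ) - 1 - (n : ℝ) / p) - ε)) *
            (∑ i, volume (tube n δ (a i) (v i))) ^ (1 / p) := by
  obtain ⟨k, hk, hkeq⟩ := Finset.exists_mem_eq_inf' (Finset.nonempty_Icc.mpr hn)
    (fun k : ℕ => max (((n : ℝ) / ((n : ℝ) - 1)) ^ (n - k))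
      (((n : ℝ) - 1) / ((n : ℝ) - (k : ℝ) + 1)))
  rw [hkeq] at hp
  obtain ⟨hk2, hkn⟩ := Finset.mem_Icc.1 hk
  obtain ⟨d, rfl⟩ : ∃ d, n = d + 1 := ⟨n - 1, by omega⟩
  have hd : 1 ≤ d := by omega
  have hd0 : (0 : ℝ) < d := by exact_mod_cast hd
  have hkd : (k : ℝ) ≤ d + 1 := by exact_mod_cast hkn
  push_cast at hp
  rw [add_sub_cancel_right] at hp
  have hp1 : 1 + Kakeya.levelExp d k ≤ p := by
    refine le_trans ?_ hp
    rw [Kakeya.levelExp]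
    gcongr
    exact le_max_left _ _
  have hp2 : 1 ≤ ((d : ℝ) + 2 - k) * (p - 1) := by
    have h1 : 1 / (d : ℝ) * (d / (d + 1 - k + 1)) ≤ p - 1 := by
      refine le_trans ?_ (le_sub_iff_add_le'.2 hp)
      gcongr
      exact le_max_right _ _
    have h2 : 1 / (d : ℝ) * (d / (d + 1 - k + 1)) = 1 / (d + 2 - k) := by
      rw [show (d : ℝ) + 1 - k + 1 = d + 2 - k by ring]
      field_simp
    rw [h2, div_le_iff₀ (by linarith)] at h1
    linarith
  have hp0 : 1 ≤ p := by linarith [Kakeya.levelExp_pos (m := k) hd]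
  obtain ⟨C, hC, hmain⟩ := Kakeya.exists_lpEnergy_le hd hk2 hkn hp1 hp2
    (c₀ := 1 / (2 * (d + 1))) (by positivity)
    (by rw [div_le_one (by positivity)]; linarith) (mul_pos hε (by linarith : 0 < p))
  set e : ℝ := (d : ℝ) + 1 - d * (p - 1) - ε * p with he
  set B : ℝ := ((d + 1 : ℝ) * 2) ^ p * (((2 : ℝ) ^ d) ^ p * (3 * C)) * (d + 1) ^ d with hB
  have hB0 : 0 < B := by positivity
  refine ⟨B ^ (1 / p), by positivity, fun δ hδ hδ1 m a v hv1 hs => ?_⟩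
  have H : Kakeya.SlabBound d p δ (1 / (2 * (d + 1)) * δ) (C * δ ^ e) :=
    fun ι _ a v h hv hs => hmain ι a v δ h hδ hδ1.le hv hs
  have h1 := H.tube_le hp0 (by positivity) hδ1.le (a := a) hv1 hs
  rw [Fintype.card_fin, ← mul_assoc (3 : ℝ), ← mul_assoc, ← mul_assoc] at h1
  have h2 := h1.trans (Kakeya.card_mul_le_sum_volume (a := a) hδ (by positivity) hv1)
  rw [Kakeya.eLpNorm_sum_indicator (by linarith)]
  refine (ENNReal.rpow_le_rpow h2 (by positivity)).trans_eq ?_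
  rw [ENNReal.mul_rpow_of_nonneg _ _ (by positivity)]
  congr 1
  rw [ENNReal.ofReal_rpow_of_pos (by positivity)]
  congr 1
  have h3 : ((d + 1 : ℝ) * 2) ^ p * ((2 : ℝ) ^ d) ^ p * (3 * C * δ ^ e) * (d + 1) ^ d *
      δ ^ (-(d : ℝ)) = B * δ ^ (e - d) := by
    rw [sub_eq_add_neg, Real.rpow_add hδ, hB]
    ring
  rw [h3, Real.mul_rpow hB0.le (by positivity), ← Real.rpow_mul hδ.le]
  congr 2
  rw [he]
  push_cast
  field_simp
  ring

end
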